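/- Assume (β, μ_h, σ_h²) ∈ A_{RS⁻}. Then for every k ≥ 0 and p ≥ 1 with 2k + p ≥ 2, there exists a constant C = C_{β,h} > 0 such that N^{−p} ∑_{j₁,…,j_p=1}^N 𝔼 m_{j₁…j_p;k}² ≤ C N^{−A_{2k+p}}, where A_m = m/2 if m ≤ 2 and A_m = m/2 + 1/2 if m ≥ 3. -/

import Mathlib

open MeasureTheory ProbabilityTheory Real Filter

noncomputable section

namespace SK

/-- The spin value `±1` encoded by a Boolean. -/
def spin (b : Bool) : ℝ := if b then 1 else -1

/-- SK Hamiltonian with coupling matrix `g`, inverse temperature `β` and external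
field vector `hv`:  `H(σ) = β ∑_{i<j} g_{ij} σ_i σ_j + ∑_i hv_i σ_i`. -/
def hamiltonian (N : ℕ) (β : ℝ) (g : Fin N → Fin N → ℝ) (hv : Fin N → ℝ)
    (σ : Fin N → ℝ) : ℝ :=
  β * ∑ i : Fin N, ∑ j : Fin N, (if i < j then g i j * σ i * σ j else 0)
    + ∑ i : Fin N, hv i * σ i

/-- Partition function `Z_N`. -/
def partitionZ (N : ℕ) (β : ℝ) (g : Fin N → Fin N → ℝ) (hv : Fin N → ℝ) : ℝ :=
  ∑ s : Fin N → Bool, Real.exp (hamiltonian N β g hv (fun i => spin (s i)))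

/-- Gibbs expectation `⟨f⟩`. -/
def gibbs (N : ℕ) (β : ℝ) (g : Fin N → Fin N → ℝ) (hv : Fin N → ℝ)
    (f : (Fin N → ℝ) → ℝ) : ℝ :=
  (∑ s : Fin N → Bool, f (fun i => spin (s i)) *
      Real.exp (hamiltonian N β g hv (fun i => spin (s i)))) / partitionZ N β g hv

/-- Magnetization `m_i = ⟨σ_i⟩`. -/
def mag (N : ℕ) (β : ℝ) (g : Fin N → Fin N → ℝ) (hv : Fin N → ℝ) (i : Fin N) : ℝ :=
  gibbs N β g hv (fun σ => σ i)

/-- Two point correlation `m_{ij} = ⟨σ_i σ_j⟩ - ⟨σ_i⟩⟨σ_j⟩`. -/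
def corr (N : ℕ) (β : ℝ) (g : Fin N → Fin N → ℝ) (hv : Fin N → ℝ) (i j : Fin N) : ℝ :=
  gibbs N β g hv (fun σ => σ i * σ j) - mag N β g hv i * mag N β g hv j

/-- Operator (ℓ²→ℓ²) norm of an `N×N` real matrix. -/
def opNorm (N : ℕ) (A : Fin N → Fin N → ℝ) : ℝ :=
  sSup {x : ℝ | ∃ u : Fin N → ℝ, (∑ i, u i ^ 2) = 1 ∧
    x = Real.sqrt (∑ i, (∑ j, A i j * u j) ^ 2)}

/-- `q ↦ E tanh²(h + β √q Z)`, `Z` standard Gaussian. -/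
def qtanh (β h q : ℝ) : ℝ :=
  ∫ z, Real.tanh (h + β * Real.sqrt q * z) ^ 2 ∂(gaussianReal 0 1)

/-- `q` is the (unique) solution in `(0,1)` of `q = E tanh²(h + β √q Z)`. -/
def isFixedq (β h q : ℝ) : Prop := 0 < q ∧ q < 1 ∧ q = qtanh β h q

/-- The de Almeida–Thouless condition `β² E sech⁴(h + β √q Z) < 1`. -/
def ATcond (β h q : ℝ) : Prop :=
  β ^ 2 * ∫ z, (Real.cosh (h + β * Real.sqrt q * z))⁻¹ ^ 4 ∂(gaussianReal 0 1) < 1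

/-- The functional `Φ(m, q')` from condition (AT+). -/
def Phi (β h q m q' : ℝ) : ℝ :=
  Real.log 2 + β ^ 2 / 4 * (1 - q') ^ 2 - β ^ 2 / 4 * m * (q' ^ 2 - q ^ 2)
    + (1 / m) * ∫ z, Real.log (∫ z', Real.cosh (h + β * Real.sqrt q * z
        + β * Real.sqrt (q' - q) * z') ^ m ∂(gaussianReal 0 1)) ∂(gaussianReal 0 1)

/-- Condition (AT+): `(∂_m Φ)(m, q')|_{m=1} < 0` for all `q < q' ≤ 1`. -/
def ATplus (β h q : ℝ) : Prop :=
  ∀ q' : ℝ, q < q' → q' ≤ 1 → deriv (fun m => Phi β h q m q') 1 < 0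

/-- `G` is a GOE random matrix: symmetric, zero diagonal, and the entries above the
diagonal are i.i.d. centered Gaussians of variance `1/N`. -/
def IsGOE (N : ℕ) {Ω : Type*} [MeasurableSpace Ω] (P : Measure Ω)
    (G : Ω → Fin N → Fin N → ℝ) : Prop :=
  (∀ ω i j, G ω i j = G ω j i) ∧ (∀ ω i, G ω i i = 0) ∧
  iIndepFun (m := fun _ : {p : Fin N × Fin N // p.1 < p.2} => (inferInstance : MeasurableSpace ℝ))
    (fun p ω => G ω p.1.1 p.1.2) P ∧
  ∀ p : {p : Fin N × Fin N // p.1 < p.2},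
    Measure.map (fun ω => G ω p.1.1 p.1.2) P = gaussianReal 0 (N : NNReal)⁻¹


/-! ### SK model with Gaussian external field and multi-point correlation functions -/

/-- `E tanh²(h + β √q Z)` with `h ∼ N(μ, v)` and `Z` an independent standard Gaussian. -/
def qtanhG (β μ : ℝ) (v : NNReal) (q : ℝ) : ℝ :=
  ∫ x, ∫ z, Real.tanh (x + β * Real.sqrt q * z) ^ 2
    ∂(gaussianReal 0 1) ∂(gaussianReal μ v)

/-- The functional `Φ(m, q')` for a Gaussian external field `h ∼ N(μ, v)`. -/
def PhiG (β μ : ℝ) (v : NNReal) (q m q' : ℝ) : ℝ :=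
  Real.log 2 + β ^ 2 / 4 * (1 - q') ^ 2 - β ^ 2 / 4 * m * (q' ^ 2 - q ^ 2)
    + (1 / m) * ∫ x, ∫ z, Real.log (∫ z',
        Real.cosh (x + β * Real.sqrt q * z + β * Real.sqrt (q' - q) * z') ^ m
          ∂(gaussianReal 0 1)) ∂(gaussianReal 0 1) ∂(gaussianReal μ v)

/-- `(β, μ_h, σ_h²) ∈ 𝒜_{RS⁻}`: the AT condition and condition (AT+) hold for the SK
model with interaction strength `β` and external field `h ∼ N(μ_h, σ_h²)`, where `q` is
the unique solution of `q = E tanh²(h + β √q Z)`. -/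
def memRSminus (β μ : ℝ) (v : NNReal) : Prop :=
  0 < β ∧ ∃ q : ℝ, 0 < q ∧ q < 1 ∧ q = qtanhG β μ v q ∧
    (β ^ 2 * ∫ x, ∫ z, (Real.cosh (x + β * Real.sqrt q * z))⁻¹ ^ 4
        ∂(gaussianReal 0 1) ∂(gaussianReal μ v) < 1) ∧
    (∀ q' : ℝ, q < q' → q' ≤ 1 → deriv (fun m => PhiG β μ v q m q') 1 < 0)

/-- Partial derivative in the `i`-th field variable. -/
def partialD (N : ℕ) (i : Fin N) (f : (Fin N → ℝ) → ℝ) : (Fin N → ℝ) → ℝ :=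
  fun x => deriv (fun t => f (Function.update x i t)) (x i)

/-- Iterated partial derivatives along a list of field indices. -/
def iterPartialD (N : ℕ) : List (Fin N) → ((Fin N → ℝ) → ℝ) → ((Fin N → ℝ) → ℝ)
  | [], f => f
  | i :: l, f => partialD N i (iterPartialD N l f)

/-- The multi-point correlation function
`m_{i₁…i_k} = ∂_{h_{i₁}} ⋯ ∂_{h_{i_k}} log Z_N(h)`. -/
def kPoint (N : ℕ) (β : ℝ) (g : Fin N → Fin N → ℝ) (l : List (Fin N))
    (hv : Fin N → ℝ) : ℝ :=
  iterPartialD N l (fun hv' => Real.log (partitionZ N β g hv')) hv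

/-- The `(k,p)`-point correlation function
`m_{j₁…j_p;k} = N⁻ᵏ ∑_{i₁,…,i_k} m_{i₁i₁ … i_k i_k j₁…j_p}`. -/
def kpPoint (N : ℕ) (β : ℝ) (g : Fin N → Fin N → ℝ) (k p : ℕ) (j : Fin p → Fin N)
    (hv : Fin N → ℝ) : ℝ :=
  ((N : ℝ) ^ k)⁻¹ * ∑ it : Fin k → Fin N,
    kPoint N β g (((List.ofFn it).flatMap fun a => [a, a]) ++ List.ofFn j) hv

/-- The exponent `A_m`: `A_m = m/2` for `m ≤ 2` and `A_m = m/2 + 1/2` for `m ≥ 3`. -/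
def Aexp (m : ℕ) : ℝ := if m ≤ 2 then (m : ℝ) / 2 else (m : ℝ) / 2 + 1 / 2

/-- GOE disorder together with an independent i.i.d. Gaussian external field
`h_i ∼ N(μ, v)`: all entries `(g_{ij})_{i<j}` and all field variables `(h_i)` are jointly
independent with the indicated Gaussian laws, and `G` is symmetric with zero diagonal. -/
def IsSKGaussField (N : ℕ) {Ω : Type*} [MeasurableSpace Ω] (P : Measure Ω)
    (G : Ω → Fin N → Fin N → ℝ) (hf : Ω → Fin N → ℝ) (μ : ℝ) (v : NNReal) : Prop :=
  (∀ ω i j, G ω i j = G ω j i) ∧ (∀ ω i, G ω i i = 0) ∧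
  iIndepFun (m := fun _ : {p : Fin N × Fin N // p.1 < p.2} ⊕ Fin N =>
      (inferInstance : MeasurableSpace ℝ))
    (Sum.elim (fun p ω => G ω p.1.1 p.1.2) (fun i ω => hf ω i)) P ∧
  (∀ p : {p : Fin N × Fin N // p.1 < p.2},
    Measure.map (fun ω => G ω p.1.1 p.1.2) P = gaussianReal 0 (N : NNReal)⁻¹) ∧
  (∀ i : Fin N, Measure.map (fun ω => hf ω i) P = gaussianReal μ v)

open scoped Topology
set_option linter.unusedSectionVars false
set_option linter.unusedVariables false

section
open Finset (abs_sum_le_sum_abs add_sum_erase card_erase_of_mem card_univ mem_insert mem_range mem_singleton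
  mem_univ mul_prod_erase mul_sum ne_of_mem_erase prod_congr prod_const prod_insert prod_le_prod
  prod_mul_distrib prod_nonneg prod_range sdiff_singleton_eq_erase single_le_sum subset_univ sum_add_distrib
  sum_comm sum_congr sum_const sum_const_zero sum_div sum_eq_zero sum_filter sum_insert sum_le_sum
  sum_le_sum_of_subset_of_nonneg sum_mul sum_mul_sum sum_neg_distrib sum_nonneg sum_pair sum_pos
  sum_range_succ sum_singleton sum_sub_distrib sum_subset sum_subtype sum_update_of_mem univ univ_nonempty
  univ_unique)
open Fintype (card sum_prod_type sum_prod_type' sum_sum_type sum_bool sum_equiv)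
open Function (update update_self update_of_ne update_apply)
open Sum (inl inr elim_inl elim_inr)
open Set (Ioo)
variable {N : ℕ} {β μ v q : ℝ} {ρ : Type} [Fintype ρ] [DecidableEq ρ]

lemma mulL {a b c : ℝ} (h : b ≤ c) (ha : 0 ≤ a) : a * b ≤ a * c := mul_le_mul_of_nonneg_left h ha
lemma mulR {a b c : ℝ} (h : b ≤ c) (ha : 0 ≤ a) : b * a ≤ c * a := mul_le_mul_of_nonneg_right h ha

section
/-! ### M1 : Gaussian engine -/

abbrev g1 : Measure ℝ := gaussianReal 0 1

abbrev gam (K : Type) [Fintype K] : Measure (K → ℝ) := Measure.pi (fun _ : K => g1)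

lemma integrable_expabs (C : ℝ) : Integrable (fun t : ℝ => exp (C * |t|)) g1 :=
  integrable_exp_mul_abs (X := fun t => t) (integrable_exp_mul_gaussianReal C)
    (integrable_exp_mul_gaussianReal (-C))

/-- exponential growth -/
def EG {K : Type} [Fintype K] (f : (K → ℝ) → ℝ) : Prop :=
  ∃ C, 0 ≤ C ∧ ∀ w, |f w| ≤ C * exp (C * ∑ k, |w k|)

section
variable {K : Type} [Fintype K]

lemma EG.integrable {f : (K → ℝ) → ℝ} (h : EG f) (hc : Continuous f) : Integrable f (gam K) := by
  obtain ⟨C, hC, h⟩ := h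
  have h1 : Integrable (fun w : K → ℝ => ∏ k, exp (C * |w k|)) (gam K) :=
    Integrable.fintype_prod (f := fun _ t => exp (C * |t|)) (fun _ => integrable_expabs C)
  refine (h1.const_mul C).mono' hc.aestronglyMeasurable (ae_of_all _ fun w => ?_)
  rw [← Real.exp_sum, ← mul_sum]
  exact h w

lemma EG.mono {f g : (K → ℝ) → ℝ} (h : EG g) (hf : ∀ w, |f w| ≤ |g w|) : EG f := by
  obtain ⟨C, hC, h⟩ := h
  exact ⟨C, hC, fun w => (hf w).trans (h w)⟩

lemma EG.of_exp {f : (K → ℝ) → ℝ} (C D : ℝ) (h : ∀ w, |f w| ≤ C * exp (D * ∑ k, |w k|)) :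
    EG f := by
  refine ⟨|C| + |D|, by positivity, fun w => (h w).trans ?_⟩
  have h0 : 0 ≤ ∑ k, |w k| := sum_nonneg fun _ _ => abs_nonneg _
  have h1 : D * ∑ k, |w k| ≤ (|C| + |D|) * ∑ k, |w k| := by
    apply mulR _ h0
    linarith [le_abs_self D, abs_nonneg C]
  have h2 : C ≤ |C| + |D| := by linarith [le_abs_self C, abs_nonneg D]
  exact mul_le_mul h2 (exp_le_exp.2 h1) (exp_pos _).le (by positivity)

lemma EG.bdd {f : (K → ℝ) → ℝ} (C : ℝ) (h : ∀ w, |f w| ≤ C) : EG f :=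
  EG.of_exp C 0 (by simpa using h)

lemma EG.const (c : ℝ) : EG (fun _ : K → ℝ => c) := EG.bdd |c| (fun _ => le_rfl)

lemma EG.coord (k : K) : EG (fun w : K → ℝ => w k) := by
  refine EG.of_exp 1 1 fun w => ?_
  have h1 : |w k| ≤ ∑ k, |w k| :=
    single_le_sum (f := fun k => |w k|) (fun _ _ => abs_nonneg _) (mem_univ k)
  have := add_one_le_exp (∑ k, |w k|)
  simp only [one_mul]; linarith

lemma EG.mul {f g : (K → ℝ) → ℝ} (hf : EG f) (hg : EG g) : EG (fun w => f w * g w) := by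
  obtain ⟨C, hC, hf⟩ := hf
  obtain ⟨D, hD, hg⟩ := hg
  refine EG.of_exp (C * D) (C + D) fun w => ?_
  rw [abs_mul, add_mul, exp_add]
  calc |f w| * |g w| ≤ (C * exp (C * ∑ k, |w k|)) * (D * exp (D * ∑ k, |w k|)) :=
        mul_le_mul (hf w) (hg w) (abs_nonneg _) (by positivity)
    _ = _ := by ring

lemma EG.add {f g : (K → ℝ) → ℝ} (hf : EG f) (hg : EG g) : EG (fun w => f w + g w) := by
  obtain ⟨C, hC, hf⟩ := hf
  obtain ⟨D, hD, hg⟩ := hg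
  refine EG.of_exp (C + D) (C + D) fun w => ?_
  have h0 : 0 ≤ ∑ k, |w k| := sum_nonneg fun _ _ => abs_nonneg _
  have h1 : exp (C * ∑ k, |w k|) ≤ exp ((C + D) * ∑ k, |w k|) :=
    exp_le_exp.2 (mulR (by linarith) h0)
  have h2 : exp (D * ∑ k, |w k|) ≤ exp ((C + D) * ∑ k, |w k|) :=
    exp_le_exp.2 (mulR (by linarith) h0)
  calc |f w + g w| ≤ |f w| + |g w| := abs_add_le _ _
    _ ≤ C * exp (C * ∑ k, |w k|) + D * exp (D * ∑ k, |w k|) := add_le_add (hf w) (hg w)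
    _ ≤ C * exp ((C + D) * ∑ k, |w k|) + D * exp ((C + D) * ∑ k, |w k|) := by gcongr
    _ = _ := by ring

lemma EG.sum {ι : Type*} (s : Finset ι) {f : ι → (K → ℝ) → ℝ} (h : ∀ i ∈ s, EG (f i)) :
    EG (fun w => ∑ i ∈ s, f i w) := by
  classical
  induction s using Finset.induction_on with
  | empty => simpa using EG.const 0
  | insert a s ha ih =>
    simp only [sum_insert ha]
    exact (h a (by simp)).add (ih fun i hi => h i (by simp [hi]))

lemma EG.neg {f : (K → ℝ) → ℝ} (hf : EG f) : EG (fun w => - f w) :=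
  hf.mono (by simp)

lemma EG.sub {f g : (K → ℝ) → ℝ} (hf : EG f) (hg : EG g) : EG (fun w => f w - g w) := by
  simpa [sub_eq_add_neg] using hf.add hg.neg

lemma EG.scale {f : (K → ℝ) → ℝ} (hf : EG f) (a : K → ℝ) (θ : K → ℝ) :
    EG (fun w => f (fun k => θ k + a k * w k)) := by
  obtain ⟨C, hC, hf⟩ := hf
  refine EG.of_exp (C * exp (C * ∑ k, |θ k|)) (C * ∑ k, |a k|) fun w => (hf _).trans ?_
  rw [mul_assoc, ← exp_add, ]
  refine mulL (exp_le_exp.2 ?_) hC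
  rw [mul_assoc, ← mul_add]
  refine mulL ?_ hC
  rw [sum_mul, ← sum_add_distrib]
  refine sum_le_sum fun k _ => (abs_add_le _ _).trans ?_
  rw [abs_mul]
  have h1 : |w k| ≤ ∑ k, |w k| :=
    single_le_sum (f := fun k => |w k|) (fun _ _ => abs_nonneg _) (mem_univ k)
  gcongr

end

/-- one-dimensional Stein identity -/
lemma stein1 {f f' : ℝ → ℝ} (hd : ∀ t, HasDerivAt f (f' t) t) (hf' : Continuous f')
    (C : ℝ) (hb : ∀ t, |f t| ≤ C * exp (C * |t|)) (hb' : ∀ t, |f' t| ≤ C * exp (C * |t|)) :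
    ∫ t, t * f t ∂g1 = ∫ t, f' t ∂g1 := by
  have hc : Continuous f := continuous_iff_continuousAt.2 fun t => (hd t).continuousAt
  have hI : Integrable f g1 :=
    ((integrable_expabs C).const_mul C).mono' hc.aestronglyMeasurable (ae_of_all _ hb)
  have hI' : Integrable f' g1 :=
    ((integrable_expabs C).const_mul C).mono' hf'.aestronglyMeasurable (ae_of_all _ hb')
  have hIt : Integrable (fun t => t * f t) g1 := by
    refine ((integrable_expabs (C + 1)).const_mul |C|).mono'
      (continuous_id.mul hc).aestronglyMeasurable (ae_of_all _ fun t => ?_)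
    rw [norm_mul, norm_eq_abs, norm_eq_abs, add_mul, exp_add, one_mul]
    have h1 : |t| ≤ exp |t| := by linarith [add_one_le_exp |t|]
    have h2 : |f t| ≤ |C| * exp (C * |t|) :=
      (hb t).trans (mulR (le_abs_self C) (exp_pos _).le)
    calc |t| * |f t| ≤ exp |t| * (|C| * exp (C * |t|)) :=
          mul_le_mul h1 h2 (abs_nonneg _) (exp_pos _).le
      _ = _ := by ring
  have hp : ∀ t, HasDerivAt (gaussianPDFReal 0 1) (-t * gaussianPDFReal 0 1 t) t := by
    intro t
    have h1 : HasDerivAt (fun x : ℝ => -(x ^ 2) / 2) (-t) t := by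
      refine (((hasDerivAt_pow 2 t).fun_neg).div_const 2).congr_deriv ?_
      norm_num
      ring
    have h2 := (h1.exp).const_mul (√(2 * π))⁻¹
    have h3 : gaussianPDFReal 0 1 = fun x => (√(2 * π))⁻¹ * exp (-(x ^ 2) / 2) := by
      ext x; simp [gaussianPDFReal]
    rw [h3]
    refine h2.congr_deriv ?_
    ring
  have key : ∀ g : ℝ → ℝ, Integrable g g1 ↔ Integrable (fun t => g t * gaussianPDFReal 0 1 t) := by
    intro g
    rw [show (g1 : Measure ℝ) = volume.withDensity (gaussianPDF 0 1) from
      gaussianReal_of_var_ne_zero 0 one_ne_zero]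
    rw [integrable_withDensity_iff_integrable_smul' (measurable_gaussianPDF 0 1)
      (ae_of_all _ fun x => gaussianPDF_lt_top)]
    simp only [toReal_gaussianPDF, smul_eq_mul]
    simp only [mul_comm]
  have e : ∀ g : ℝ → ℝ, ∫ t, g t ∂g1 = ∫ t, g t * gaussianPDFReal 0 1 t := by
    intro g
    rw [integral_gaussianReal_eq_integral_smul one_ne_zero]
    simp [mul_comm]
  have h := integral_mul_deriv_eq_deriv_mul_of_integrable (u := f) (v := gaussianPDFReal 0 1)
    (u' := f') (v' := fun t => -t * gaussianPDFReal 0 1 t)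
    (fun x _ => hd x) (fun x _ => hp x) ?_ ?_ ?_
  · rw [e, e]
    have h2 : ∫ t, t * f t * gaussianPDFReal 0 1 t
      = - ∫ t, f t * (-t * gaussianPDFReal 0 1 t) := by
      rw [← integral_neg]; congr 1; ext t; ring
    rw [h2, h, neg_neg]
  · have := ((key _).1 hIt).neg
    refine this.congr (ae_of_all _ fun t => ?_)
    simp; ring
  · exact (key _).1 hI'
  · exact (key _).1 hI

section
variable {K : Type} [Fintype K] [DecidableEq K]

lemma mp_update (k : K) : MeasurePreserving (fun z : (K → ℝ) × ℝ => update z.1 k z.2)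
    ((gam K).prod g1) (gam K) := by
  have hm : Measurable (fun z : (K → ℝ) × ℝ => update z.1 k z.2) := by
    rw [measurable_pi_iff]
    intro j
    by_cases h : j = k
    · subst h; simpa using measurable_snd
    · simp only [update_of_ne h]
      exact (measurable_pi_apply j).comp measurable_fst
  refine ⟨hm, ?_⟩
  symm
  refine Measure.pi_eq fun s hs => ?_
  rw [Measure.map_apply hm (MeasurableSet.univ_pi hs)]
  have : (fun z : (K → ℝ) × ℝ => update z.1 k z.2) ⁻¹' (Set.univ.pi s)
      = (Set.univ.pi (fun j => if j = k then Set.univ else s j)) ×ˢ (s k) := by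
    ext ⟨w, t⟩
    simp only [Set.mem_preimage, Set.mem_pi, Set.mem_univ, true_imp_iff, Set.mem_prod]
    constructor
    · intro h
      refine ⟨fun j => ?_, by simpa using h k⟩
      by_cases hj : j = k
      · simp [hj]
      · simpa [hj] using h j
    · rintro ⟨h1, h2⟩ j
      by_cases hj : j = k
      · subst hj; simpa using h2
      · simpa [hj] using h1 j
  rw [this, Measure.prod_prod, Measure.pi_pi]
  rw [← mul_prod_erase univ (fun j => g1 (s j)) (mem_univ k),
    ← mul_prod_erase univ _ (mem_univ k)]
  simp only [if_true, measure_univ, one_mul]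
  rw [mul_comm]
  congr 1
  refine prod_congr rfl fun j hj => ?_
  rw [if_neg (ne_of_mem_erase hj)]

lemma sum_update_abs (w : K → ℝ) (k : K) (t : ℝ) :
    ∑ j, |update w k t j| ≤ ∑ j, |w j| + |t| := by
  rw [← add_sum_erase univ (fun j => |update w k t j|) (mem_univ k),
    ← add_sum_erase univ (fun j => |w j|) (mem_univ k)]
  have : ∑ x ∈ univ.erase k, |update w k t x| = ∑ x ∈ univ.erase k, |w x| :=
    sum_congr rfl fun j hj => by
      rw [update_of_ne (ne_of_mem_erase hj)]
  rw [this]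
  simp only [update_self]
  linarith [abs_nonneg (w k)]

lemma integral_update (k : K) {f : (K → ℝ) → ℝ} (hf : Integrable f (gam K)) :
    ∫ w, f w ∂(gam K) = ∫ w, ∫ t, f (update w k t) ∂g1 ∂(gam K) := by
  have h := mp_update k
  have h2 : Integrable (fun z : (K → ℝ) × ℝ => f (update z.1 k z.2))
      ((gam K).prod g1) := h.integrable_comp_of_integrable hf
  rw [← integral_prod _ h2]
  conv_lhs => rw [← h.map_eq]
  rw [integral_map h.measurable.aemeasurable]
  rw [h.map_eq]
  exact hf.aestronglyMeasurable

/-- Gaussian integration by parts -/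
lemma ibp (k : K) {f f' : (K → ℝ) → ℝ}
    (hd : ∀ w, HasDerivAt (fun t => f (update w k t)) (f' w) (w k))
    (hc : Continuous f) (hc' : Continuous f') (hE : EG f) (hE' : EG f') :
    ∫ w, w k * f w ∂(gam K) = ∫ w, f' w ∂(gam K) := by
  rw [integral_update k (((EG.coord k).mul hE).integrable (by fun_prop)),
    integral_update k (hE'.integrable hc')]
  congr 1
  ext w
  simp only [update_self]
  obtain ⟨C, hC, hE⟩ := hE
  obtain ⟨D, hD, hE'⟩ := hE'
  have aux : ∀ (C : ℝ) (g : (K → ℝ) → ℝ), 0 ≤ C → (∀ w, |g w| ≤ C * exp (C * ∑ k, |w k|)) → ∀ M,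
      C * exp (C * ∑ k, |w k|) + C ≤ M → ∀ t, |g (update w k t)| ≤ M * exp (M * |t|) := by
    intro C g hC hg M hM t
    have e0 := exp_pos (C * ∑ k, |w k|)
    have hCM : C ≤ M := by nlinarith
    refine (hg _).trans ?_
    calc C * exp (C * ∑ j, |update w k t j|)
        ≤ C * exp (C * (∑ j, |w j| + |t|)) := by
          have := sum_update_abs w k t
          gcongr
      _ = (C * exp (C * ∑ j, |w j|)) * exp (C * |t|) := by rw [mul_add, exp_add, mul_assoc]
      _ ≤ M * exp (M * |t|) := by
          have : C * |t| ≤ M * |t| := mulR hCM (abs_nonneg t)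
          refine mul_le_mul (by linarith) (exp_le_exp.2 this) (exp_pos _).le (by nlinarith)
  refine stein1 (f := fun t => f (update w k t)) (f' := fun t => f' (update w k t))
    (fun t => ?_) (hc'.comp (by fun_prop))
    (C * exp (C * ∑ k, |w k|) + C + (D * exp (D * ∑ k, |w k|) + D)) (fun t => ?_) (fun t => ?_)
  · have := hd (update w k t)
    simpa using this
  · exact aux C f hC hE _ (by nlinarith [exp_pos (D * ∑ k, |w k|)]) t
  · exact aux D f' hD hE' _ (by nlinarith [exp_pos (C * ∑ k, |w k|)]) t

end
end

section
/-- the differential with given partials -/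
def dif {K : Type} [Fintype K] (p : K → ℝ) : (K → ℝ) →L[ℝ] ℝ :=
  ∑ k, p k • (ContinuousLinearMap.proj k : (K → ℝ) →L[ℝ] ℝ)

lemma dif_apply {K : Type} [Fintype K] (p v : K → ℝ) : dif p v = ∑ k, p k * v k := by
  simp [dif]

section
variable {K : Type} [Fintype K]

lemma EG.unif {f : (K → ℝ) → ℝ} (hf : EG f) (M : ℝ) :
    ∃ D, 0 ≤ D ∧ ∀ θ b : K → ℝ, (∀ k, |θ k| ≤ M) → (∀ k, |b k| ≤ M) → ∀ y : K → ℝ,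
      |f (fun k => θ k + b k * y k)| ≤ D * exp (D * ∑ k, |y k|) := by
  obtain ⟨C, hC, hf⟩ := hf
  refine ⟨C * exp (C * (card K * |M|)) + C * |M|, by positivity,
    fun θ b hθ hb y => (hf _).trans ?_⟩
  have h0 : 0 ≤ ∑ k, |y k| := sum_nonneg fun _ _ => abs_nonneg _
  have h1 : ∑ k, |θ k + b k * y k| ≤ card K * |M| + |M| * ∑ k, |y k| := by
    calc ∑ k, |θ k + b k * y k| ≤ ∑ k, (|M| + |M| * |y k|) := by
          refine sum_le_sum fun k _ => (abs_add_le _ _).trans ?_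
          rw [abs_mul]
          have := (hθ k).trans (le_abs_self M)
          have := (hb k).trans (le_abs_self M)
          gcongr
      _ = _ := by rw [sum_add_distrib, ← mul_sum]; simp
  calc C * exp (C * ∑ k, |θ k + b k * y k|)
      ≤ C * exp (C * (card K * |M| + |M| * ∑ k, |y k|)) := by gcongr
    _ = C * exp (C * (card K * |M|)) * exp (C * |M| * ∑ k, |y k|) := by
        rw [mul_add, exp_add]; ring_nf
    _ ≤ _ := by
        have e1 : (0:ℝ) < exp (C * (card K * |M|)) := exp_pos _
        have e2 : 0 ≤ C * |M| := by positivity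
        have e3 : 0 ≤ C * exp (C * (card K * |M|)) := by positivity
        gcongr
        · linarith
        · linarith

lemma integrable_EGbound (D : ℝ) :
    Integrable (fun y : K → ℝ => D * exp (D * ∑ k, |y k|)) (gam K) :=
  (EG.of_exp |D| D fun y => (le_of_eq (abs_mul _ _)).trans (by
    rw [abs_of_pos (exp_pos _)])).integrable (by fun_prop)

lemma cont_int {g : (K → ℝ) → ℝ} (hc : Continuous g) (hE : EG g) :
    Continuous (fun p : (K → ℝ) × (K → ℝ) =>
      ∫ y, g (fun k => p.1 k + p.2 k * y k) ∂(gam K)) := by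
  rw [continuous_iff_continuousAt]
  intro p
  obtain ⟨D, hD, h⟩ := hE.unif (‖p‖ + 1)
  refine continuousAt_of_dominated (bound := fun y => D * exp (D * ∑ k, |y k|))
    (Eventually.of_forall fun p => (by fun_prop : Continuous _).aestronglyMeasurable) ?_
    (integrable_EGbound D) (ae_of_all _ fun y => (by fun_prop : Continuous _).continuousAt)
  filter_upwards [Metric.ball_mem_nhds p one_pos] with p' hp'
  refine ae_of_all _ fun y => h _ _ (fun k => ?_) (fun k => ?_) y
  all_goals
    have h1 : ‖p'‖ ≤ ‖p‖ + 1 := by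
      have := norm_sub_norm_le p' p
      rw [Metric.mem_ball, dist_eq_norm] at hp'
      linarith
  · exact ((norm_le_pi_norm p'.1 k).trans (norm_fst_le p')).trans h1
  · exact ((norm_le_pi_norm p'.2 k).trans (norm_snd_le p')).trans h1

lemma deriv_int {g : (K → ℝ) → ℝ} {g1 : K → (K → ℝ) → ℝ}
    (hg : ∀ θ, HasFDerivAt g (dif fun k => g1 k θ) θ)
    (hc : ∀ k, Continuous (g1 k)) (hE : EG g) (hE1 : ∀ k, EG (g1 k))
    {θ θ' b b' : ℝ → K → ℝ} {s ε M : ℝ} (hε : 0 < ε)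
    (hθ : ∀ t ∈ Metric.ball s ε, ∀ k, HasDerivAt (fun t => θ t k) (θ' t k) t)
    (hb : ∀ t ∈ Metric.ball s ε, ∀ k, HasDerivAt (fun t => b t k) (b' t k) t)
    (hM : ∀ t ∈ Metric.ball s ε, ∀ k, |θ t k| ≤ M ∧ |b t k| ≤ M ∧ |θ' t k| ≤ M ∧ |b' t k| ≤ M) :
    HasDerivAt (fun t => ∫ y, g (fun k => θ t k + b t k * y k) ∂(gam K))
      (∫ y, ∑ k, g1 k (fun k => θ s k + b s k * y k) * (θ' s k + b' s k * y k) ∂(gam K)) s := by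
  have hgc : Continuous g := continuous_iff_continuousAt.2 fun t => (hg t).continuousAt
  choose D hD h using fun k => (hE1 k).unif M
  have hs : s ∈ Metric.ball s ε := Metric.mem_ball_self hε
  refine (hasDerivAt_integral_of_dominated_loc_of_deriv_le (Metric.ball_mem_nhds s hε)
    (bound := fun y : K → ℝ => ∑ k, D k * exp (D k * ∑ k, |y k|) * (M + M * |y k|))
    (F := fun t (y : K → ℝ) => g (fun k => θ t k + b t k * y k))
    (F' := fun t (y : K → ℝ) => ∑ k, g1 k (fun k => θ t k + b t k * y k) * (θ' t k + b' t k * y k))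
    (Eventually.of_forall fun t => (by fun_prop : Continuous _).aestronglyMeasurable)
    ((hE.scale _ _).integrable (by fun_prop))
    ((by fun_prop : Continuous _).aestronglyMeasurable)
    (ae_of_all _ fun y t ht => ?_) ?_ (ae_of_all _ fun y t ht => ?_)).2
  · refine (abs_sum_le_sum_abs _ _).trans (sum_le_sum fun k _ => ?_)
    have hm := fun k => hM t ht k
    rw [abs_mul]
    refine mul_le_mul (h k _ _ (fun k => (hm k).1) (fun k => (hm k).2.1) y) ?_ (abs_nonneg _)
      (mul_nonneg (hD k) (exp_pos _).le)
    refine (abs_add_le _ _).trans (add_le_add (hm k).2.2.1 ?_)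
    rw [abs_mul]
    exact mulR (hm k).2.2.2 (abs_nonneg _)
  · refine integrable_finsetSum _ fun k _ => EG.integrable ?_ (by fun_prop)
    refine EG.mul (EG.of_exp (D k) (D k) fun y => ?_) ((EG.const M).add ((EG.const M).mul ?_))
    · rw [abs_of_nonneg (mul_nonneg (hD k) (exp_pos _).le)]
    · exact (EG.coord k).mono (by simp)
  · have h1 : HasDerivAt (fun t => (fun k => θ t k + b t k * y k))
        (fun k => θ' t k + b' t k * y k) t :=
      hasDerivAt_pi.2 fun k => (hθ t ht k).add ((hb t ht k).mul_const (y k))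
    have h2 := (hg _).comp_hasDerivAt t h1
    rw [dif_apply] at h2
    exact h2

/-- the square root path -/
lemma pathD (a b : ℝ) (ha : 0 ≤ a) (hab : 0 ≤ a + b) {s : ℝ} (hs : s ∈ Ioo (0:ℝ) 1) :
    HasDerivAt (fun s => √(a + s * b)) (b / (2 * √(a + s * b))) s ∧
      b / (2 * √(a + s * b)) * √(a + s * b) = b / 2 := by
  obtain ⟨h0, h1⟩ := hs
  by_cases hb : b = 0
  · subst hb; simp [hasDerivAt_const]
  · have hp : 0 < a + s * b := by
      rcases lt_or_gt_of_ne hb with h | h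
      · nlinarith
      · nlinarith
    refine ⟨?_, ?_⟩
    · have h := ((hasDerivAt_id s).mul_const b).const_add a
      have := h.sqrt hp.ne'
      simpa using this
    · have := (sqrt_pos.2 hp).ne'
      generalize √(a + s * b) = r at *
      field_simp

lemma pathB (a b : ℝ) (ha : 0 ≤ a) (hab : 0 ≤ a + b) {s ε : ℝ} (hε : 0 < ε)
    (hs : s ∈ Ioo ε (1 - ε)) :
    |√(a + s * b)| ≤ a + |b| + 1 ∧ |b / (2 * √(a + s * b))| ≤ (|b| + 1) / ε := by
  obtain ⟨h0, h1⟩ := hs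
  have hb1 := le_abs_self b
  have hb2 := neg_abs_le b
  have h3 : ε * |b| ≤ a + s * b := by
    rcases abs_cases b with ⟨e, h⟩ | ⟨e, h⟩ <;> rw [e] <;> nlinarith
  have hε1 : ε < 1 := by linarith
  constructor
  · rw [abs_of_nonneg (sqrt_nonneg _)]
    refine sqrt_le_iff.2 ⟨by positivity, ?_⟩
    nlinarith [abs_nonneg b]
  · by_cases hb : b = 0
    · subst hb; simp; positivity
    · have hb' := abs_pos.2 hb
      have hp : 0 < a + s * b := by nlinarith [mul_pos hε hb']
      have hq := sqrt_pos.2 hp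
      rw [abs_div, abs_of_pos (by positivity : 0 < 2 * √(a + s * b)),
        div_le_div_iff₀ (by positivity) hε]
      have h5 : √(a + s * b) ^ 2 = a + s * b := sq_sqrt hp.le
      -- |b| ε ≤ r^2 , want |b| ε ≤ (|b|+1) 2 r
      by_cases hr : √(a + s * b) ≤ 1
      · nlinarith
      · push Not at hr
        nlinarith

end
section
variable {K : Type} [Fintype K] [DecidableEq K]

lemma hasDerivAt_update_of_dif {g : (K → ℝ) → ℝ} {g1 : K → (K → ℝ) → ℝ}
    (hg : ∀ θ, HasFDerivAt g (dif fun k => g1 k θ) θ) (k : K) (w : K → ℝ) :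
    HasDerivAt (fun t => g (update w k t)) (g1 k w) (w k) := by
  have h1 := hasDerivAt_update w k (w k)
  have h2 := (hg (update w k (w k))).comp_hasDerivAt (w k) h1
  rw [dif_apply, Function.update_eq_self] at h2
  refine h2.congr_deriv ?_
  simp [Pi.single_apply]

lemma hasDerivAt_scale {f : (K → ℝ) → ℝ} {f' : ℝ} (k : K) (a θ w : K → ℝ)
    (h : HasDerivAt (fun t => f (update (fun j => θ j + a j * w j) k t)) f'
      (θ k + a k * w k)) :
    HasDerivAt (fun t => f (fun j => θ j + a j * update w k t j)) (a k * f') (w k) := by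
  have h1 : HasDerivAt (fun t => θ k + a k * t) (a k) (w k) := by
    simpa using ((hasDerivAt_id (w k)).const_mul (a k)).const_add (θ k)
  have h2 := h.comp (w k) h1
  refine (h2.congr_deriv (mul_comm _ _)).congr_of_eventuallyEq (Eventually.of_forall fun t => ?_)
  simp only [Function.comp]
  congr 1
  ext j
  by_cases hj : j = k
  · subst hj; simp
  · simp [update_of_ne hj]

/-- smart path -/
theorem smart_path {φ : (K → ℝ) → ℝ} {φ1 φ2 : K → (K → ℝ) → ℝ}
    (h1 : ∀ θ, HasFDerivAt φ (dif fun k => φ1 k θ) θ)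
    (h2 : ∀ k θ, HasDerivAt (fun t => φ1 k (update θ k t)) (φ2 k θ) (θ k))
    (hc1 : ∀ k, Continuous (φ1 k)) (hc2 : ∀ k, Continuous (φ2 k))
    (hE : EG φ) (hE1 : ∀ k, EG (φ1 k)) (hE2 : ∀ k, EG (φ2 k))
    (a b : K → ℝ) (ha : ∀ k, 0 ≤ a k) (hab : ∀ k, 0 ≤ a k + b k) {s : ℝ}
    (hs : s ∈ Ioo (0:ℝ) 1) (θ : K → ℝ) :
    HasDerivAt (fun s => ∫ w, φ (fun k => θ k + √(a k + s * b k) * w k) ∂(gam K))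
      (∑ k, b k / 2 * ∫ w, φ2 k (fun k => θ k + √(a k + s * b k) * w k) ∂(gam K)) s := by
  obtain ⟨h0, h1'⟩ := hs
  set ε := min s (1 - s) / 2 with hε
  have hm : 0 < min s (1 - s) := lt_min h0 (by linarith)
  have hε0 : 0 < ε := by positivity
  have hball : ∀ t ∈ Metric.ball s ε, t ∈ Ioo ε (1 - ε) := by
    intro t ht
    rw [Metric.mem_ball, dist_eq_norm, norm_eq_abs, abs_lt] at ht
    have := min_le_left s (1 - s)
    have := min_le_right s (1 - s)
    constructor <;> linarith
  have hball' : ∀ t ∈ Metric.ball s ε, t ∈ Ioo (0:ℝ) 1 := fun t ht =>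
    ⟨hε0.trans (hball t ht).1, by linarith [(hball t ht).2]⟩
  set M := ∑ k, (|θ k| + (a k + |b k| + 1) + (|b k| + 1) / ε) with hMd
  have hMk : ∀ k, |θ k| + (a k + |b k| + 1) + (|b k| + 1) / ε ≤ M := fun k =>
    single_le_sum (f := fun k => |θ k| + (a k + |b k| + 1) + (|b k| + 1) / ε)
      (fun k _ => by have := ha k; positivity) (mem_univ k)
  have key := deriv_int h1 hc1 hE hE1 (θ := fun _ => θ) (θ' := fun _ _ => 0)
    (b := fun s k => √(a k + s * b k)) (b' := fun s k => b k / (2 * √(a k + s * b k)))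
    (s := s) (ε := ε) (M := M) hε0 (fun t _ k => hasDerivAt_const _ _)
    (fun t ht k => (pathD (a k) (b k) (ha k) (hab k) (hball' t ht)).1) (fun t ht k => by
      have := pathB (a k) (b k) (ha k) (hab k) hε0 (hball t ht)
      have h3 := hMk k
      have e1 : 0 ≤ |θ k| := abs_nonneg _
      have e2 : 0 ≤ (|b k| + 1) / ε := by positivity
      have e3 : 0 ≤ a k + |b k| + 1 := by have := ha k; positivity
      refine ⟨by linarith, by linarith [this.1], by simp; linarith, by linarith [this.2]⟩)
  refine key.congr_deriv ?_
  rw [integral_finsetSum]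
  · refine sum_congr rfl fun k _ => ?_
    have hi := ibp k (f := fun w => φ1 k (fun k => θ k + √(a k + s * b k) * w k))
      (f' := fun w => √(a k + s * b k) * φ2 k (fun k => θ k + √(a k + s * b k) * w k))
      (fun w => hasDerivAt_scale k _ _ w (h2 k _)) (by fun_prop) (by fun_prop)
      ((hE1 k).scale _ _) ((EG.const _).mul ((hE2 k).scale _ _))
    have h4 := (pathD (a k) (b k) (ha k) (hab k) ⟨h0, h1'⟩).2
    rw [← h4, mul_assoc, ← integral_const_mul √(a k + s * b k), ← hi, ← integral_const_mul]
    congr 1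
    ext w
    ring
  · intro k _
    refine EG.integrable (EG.mul ((hE1 k).scale _ _) ((EG.const _).add ((EG.const _).mul (EG.coord k)))) (by fun_prop)

end
end

section
/-! ### M2 : finite Gibbs systems -/

structure GS (K S : Type) where
  c : S → ℝ
  A : K → S → ℝ

namespace GS
variable {K S : Type} [Fintype K] [Fintype S] [Nonempty S] (H : GS K S)

def ew (θ : K → ℝ) (x : S) : ℝ := exp (H.c x + ∑ k, θ k * H.A k x)
def Z (θ : K → ℝ) : ℝ := ∑ x, H.ew θ x
def p (θ : K → ℝ) (x : S) : ℝ := H.ew θ x / H.Z θ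
def av (θ : K → ℝ) (f : S → ℝ) : ℝ := ∑ x, f x * H.p θ x

lemma ew_pos (θ : K → ℝ) (x : S) : 0 < H.ew θ x := exp_pos _
lemma Z_pos (θ : K → ℝ) : 0 < H.Z θ :=
  sum_pos (fun x _ => H.ew_pos θ x) univ_nonempty
lemma p_pos (θ : K → ℝ) (x : S) : 0 < H.p θ x := div_pos (H.ew_pos θ x) (H.Z_pos θ)
lemma p_sum (θ : K → ℝ) : ∑ x, H.p θ x = 1 := by
  simp only [p]
  rw [← sum_div]
  exact div_self (H.Z_pos θ).ne'

lemma av_eq (θ : K → ℝ) (f : S → ℝ) : H.av θ f = (∑ x, f x * H.ew θ x) / H.Z θ := by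
  simp only [av, p, sum_div, mul_div_assoc]

lemma av_const (θ : K → ℝ) (c : ℝ) : H.av θ (fun _ => c) = c := by
  simp only [av]
  rw [← mul_sum, p_sum, mul_one]

lemma av_add (θ : K → ℝ) (f g : S → ℝ) :
    H.av θ (fun x => f x + g x) = H.av θ f + H.av θ g := by
  simp only [av, add_mul, sum_add_distrib]

lemma av_sub (θ : K → ℝ) (f g : S → ℝ) :
    H.av θ (fun x => f x - g x) = H.av θ f - H.av θ g := by
  simp only [av, sub_mul, sum_sub_distrib]

lemma av_smul (θ : K → ℝ) (c : ℝ) (f : S → ℝ) :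
    H.av θ (fun x => c * f x) = c * H.av θ f := by
  simp only [av, mul_sum, mul_assoc]

lemma av_sum {ι : Type*} (s : Finset ι) (θ : K → ℝ) (f : ι → S → ℝ) :
    H.av θ (fun x => ∑ i ∈ s, f i x) = ∑ i ∈ s, H.av θ (f i) := by
  simp only [av, sum_mul]
  rw [sum_comm]

lemma av_mono (θ : K → ℝ) {f g : S → ℝ} (h : ∀ x, f x ≤ g x) : H.av θ f ≤ H.av θ g :=
  sum_le_sum fun x _ => mulR (h x) (H.p_pos θ x).le

lemma av_nonneg (θ : K → ℝ) {f : S → ℝ} (h : ∀ x, 0 ≤ f x) : 0 ≤ H.av θ f :=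
  sum_nonneg fun x _ => mul_nonneg (h x) (H.p_pos θ x).le

lemma abs_av_le (θ : K → ℝ) (f : S → ℝ) : |H.av θ f| ≤ H.av θ (fun x => |f x|) := by
  refine (abs_sum_le_sum_abs _ _).trans (le_of_eq ?_)
  refine sum_congr rfl fun x _ => ?_
  rw [abs_mul, abs_of_pos (H.p_pos θ x)]

lemma abs_av_le_of (θ : K → ℝ) {f : S → ℝ} {C : ℝ} (h : ∀ x, |f x| ≤ C) : |H.av θ f| ≤ C :=
  (H.abs_av_le θ f).trans ((H.av_mono θ h).trans (le_of_eq (H.av_const θ C)))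

def bnd (f : S → ℝ) : ℝ := ∑ x, |f x|

lemma le_bnd (f : S → ℝ) (x : S) : |f x| ≤ bnd f :=
  single_le_sum (f := fun x => |f x|) (fun _ _ => abs_nonneg _) (mem_univ x)

lemma abs_av_bnd (θ : K → ℝ) (f : S → ℝ) : |H.av θ f| ≤ bnd f := H.abs_av_le_of θ (le_bnd f)

@[fun_prop] lemma continuous_ew (x : S) : Continuous (fun θ => H.ew θ x) := by
  unfold ew; fun_prop

@[fun_prop] lemma continuous_Z : Continuous (fun θ => H.Z θ) := by
  unfold Z; fun_prop

@[fun_prop] lemma continuous_av (f : S → ℝ) : Continuous (fun θ => H.av θ f) := by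
  simp only [av_eq]
  exact (by fun_prop : Continuous fun θ => ∑ x, f x * H.ew θ x).div₀ (by fun_prop)
    fun θ => (H.Z_pos θ).ne'

lemma hasFDerivAt_ew (x : S) (θ : K → ℝ) :
    HasFDerivAt (fun θ => H.ew θ x) (H.ew θ x • dif fun k => H.A k x) θ := by
  have h1 : HasFDerivAt (fun θ : K → ℝ => H.c x + ∑ k, θ k * H.A k x) (dif fun k => H.A k x) θ := by
    have h2 := (dif fun k => H.A k x).hasFDerivAt (x := θ)
    refine (h2.const_add (H.c x)).congr_of_eventuallyEq (Eventually.of_forall fun θ => ?_)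
    simp only [dif_apply, mul_comm]
  exact h1.exp

lemma hasFDerivAt_sum (f : S → ℝ) (θ : K → ℝ) :
    HasFDerivAt (fun θ => ∑ x, f x * H.ew θ x) (dif fun k => ∑ x, f x * H.A k x * H.ew θ x) θ := by
  have h := HasFDerivAt.fun_sum (u := univ) (A := fun x θ => f x * H.ew θ x)
    (A' := fun x => f x • (H.ew θ x • dif fun k => H.A k x)) (x := θ)
    fun x _ => (H.hasFDerivAt_ew x θ).const_mul (f x)
  refine h.congr_fderiv ?_
  ext v
  simp only [sum_apply, smul_apply, dif_apply,
    sum_mul, smul_eq_mul, mul_sum]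
  rw [sum_comm]
  refine sum_congr rfl fun k _ => sum_congr rfl fun x _ => ?_
  ring

lemma hasFDerivAt_Z (θ : K → ℝ) :
    HasFDerivAt (fun θ => H.Z θ) (dif fun k => ∑ x, H.A k x * H.ew θ x) θ := by
  have := H.hasFDerivAt_sum (fun _ => 1) θ
  simp only [one_mul] at this
  exact this

lemma hasFDerivAt_logZ (θ : K → ℝ) :
    HasFDerivAt (fun θ => log (H.Z θ)) (dif fun k => H.av θ (H.A k)) θ := by
  refine ((H.hasFDerivAt_Z θ).log (H.Z_pos θ).ne').congr_fderiv ?_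
  ext v
  simp only [smul_apply, dif_apply, smul_eq_mul, mul_sum, av_eq]
  refine sum_congr rfl fun k _ => ?_
  field_simp

/-- first derivative of an average -/
def d1 (f : S → ℝ) (k : K) (θ : K → ℝ) : ℝ :=
  H.av θ (fun x => f x * H.A k x) - H.av θ f * H.av θ (H.A k)

/-- second derivative of an average -/
def d2 (f : S → ℝ) (k : K) (θ : K → ℝ) : ℝ :=
  H.av θ (fun x => f x * H.A k x ^ 2) - 2 * H.av θ (fun x => f x * H.A k x) * H.av θ (H.A k)
    - H.av θ f * H.av θ (fun x => H.A k x ^ 2) + 2 * H.av θ f * (H.av θ (H.A k) * H.av θ (H.A k))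

lemma hasFDerivAt_av (f : S → ℝ) (θ : K → ℝ) :
    HasFDerivAt (fun θ => H.av θ f) (dif fun k => H.d1 f k θ) θ := by
  have h1 := (H.hasFDerivAt_sum f θ).fun_mul ((hasDerivAt_inv (H.Z_pos θ).ne').comp_hasFDerivAt θ
    (H.hasFDerivAt_Z θ))
  have h2 : HasFDerivAt (fun θ => H.av θ f) _ θ := h1.congr_of_eventuallyEq
    (Eventually.of_forall fun θ => by simp [av_eq, div_eq_mul_inv])
  refine h2.congr_fderiv ?_
  ext v
  have hZ := (H.Z_pos θ).ne'
  simp only [smul_apply, dif_apply, smul_eq_mul, mul_sum, av_eq,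
    add_apply, d1, Function.comp]
  rw [← sum_add_distrib]
  refine sum_congr rfl fun k _ => ?_
  field_simp
  ring

lemma hasDerivAt_av_update [DecidableEq K] (f : S → ℝ) (k : K) (θ : K → ℝ) :
    HasDerivAt (fun t => H.av (update θ k t) f) (H.d1 f k θ) (θ k) :=
  hasDerivAt_update_of_dif (H.hasFDerivAt_av f) k θ

lemma hasDerivAt_d1 [DecidableEq K] (f : S → ℝ) (k : K) (θ : K → ℝ) :
    HasDerivAt (fun t => H.d1 f k (update θ k t)) (H.d2 f k θ) (θ k) := by
  have h := (H.hasDerivAt_av_update (fun x => f x * H.A k x) k θ).sub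
    ((H.hasDerivAt_av_update f k θ).mul (H.hasDerivAt_av_update (H.A k) k θ))
  refine h.congr_deriv ?_
  simp only [Function.update_eq_self, d1, d2]
  have e1 : (fun x => f x * H.A k x * H.A k x) = fun x => f x * H.A k x ^ 2 := by
    ext x; ring
  have e2 : (fun x => H.A k x * H.A k x) = fun x => H.A k x ^ 2 := by
    ext x; ring
  rw [e1, e2]
  ring

@[fun_prop] lemma continuous_d1 (f : S → ℝ) (k : K) : Continuous (fun θ => H.d1 f k θ) := by
  unfold d1; fun_prop
@[fun_prop] lemma continuous_d2 (f : S → ℝ) (k : K) : Continuous (fun θ => H.d2 f k θ) := by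
  unfold d2; fun_prop

lemma EG_av (f : S → ℝ) : EG (fun θ => H.av θ f) := EG.bdd (bnd f) fun θ => H.abs_av_bnd θ f
lemma EG_d1 (f : S → ℝ) (k : K) : EG (fun θ => H.d1 f k θ) :=
  (H.EG_av _).sub ((H.EG_av _).mul (H.EG_av _))
lemma EG_d2 (f : S → ℝ) (k : K) : EG (fun θ => H.d2 f k θ) := by
  unfold d2
  exact (((H.EG_av _).sub (((EG.const 2).mul (H.EG_av _)).mul (H.EG_av _))).sub
    ((H.EG_av _).mul (H.EG_av _))).add (((EG.const 2).mul (H.EG_av f)).mul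
      ((H.EG_av (H.A k)).mul (H.EG_av (H.A k))))

/-- rescaled Gaussian average with variances `a` -/
def nu (a : K → ℝ) (f : S → ℝ) : ℝ := ∫ w, H.av (fun k => √(a k) * w k) f ∂(gam K)

lemma int_av (a : K → ℝ) (f : S → ℝ) : Integrable (fun w => H.av (fun k => a k * w k) f) (gam K) := by
  have := ((H.EG_av f).scale a 0).integrable (by fun_prop)
  simpa using this

lemma continuous_nu (f : S → ℝ) : Continuous (fun a => H.nu a f) := by
  have := (cont_int (H.continuous_av f) (H.EG_av f)).comp
    (g := fun p : (K → ℝ) × (K → ℝ) => _) (f := fun a : K → ℝ => ((0 : K → ℝ), fun k => √(a k)))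
    (by fun_prop)
  simpa [Function.comp_def, nu] using this

lemma nu_deriv [DecidableEq K] (f : S → ℝ) (a b : K → ℝ) (ha : ∀ k, 0 ≤ a k)
    (hab : ∀ k, 0 ≤ a k + b k) {s : ℝ} (hs : s ∈ Ioo (0:ℝ) 1) :
    HasDerivAt (fun s => H.nu (fun k => a k + s * b k) f)
      (∑ k, b k / 2 * ∫ w, H.d2 f k (fun k => √(a k + s * b k) * w k) ∂(gam K)) s := by
  have := smart_path (H.hasFDerivAt_av f) (H.hasDerivAt_d1 f) (H.continuous_d1 f)
    (H.continuous_d2 f) (H.EG_av f) (H.EG_d1 f) (H.EG_d2 f) a b ha hab hs 0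
  simpa [nu] using this

lemma nu_const (a : K → ℝ) (c : ℝ) : H.nu a (fun _ => c) = c := by
  simp [nu, av_const]

lemma nu_add (a : K → ℝ) (f g : S → ℝ) :
    H.nu a (fun x => f x + g x) = H.nu a f + H.nu a g := by
  simp only [nu, av_add]
  exact integral_add (H.int_av _ f) (H.int_av _ g)

lemma nu_sub (a : K → ℝ) (f g : S → ℝ) :
    H.nu a (fun x => f x - g x) = H.nu a f - H.nu a g := by
  simp only [nu, av_sub]
  exact integral_sub (H.int_av _ f) (H.int_av _ g)

lemma nu_smul (a : K → ℝ) (c : ℝ) (f : S → ℝ) :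
    H.nu a (fun x => c * f x) = c * H.nu a f := by
  simp only [nu, av_smul, integral_const_mul]

lemma nu_sum {ι : Type*} (s : Finset ι) (a : K → ℝ) (f : ι → S → ℝ) :
    H.nu a (fun x => ∑ i ∈ s, f i x) = ∑ i ∈ s, H.nu a (f i) := by
  simp only [nu, av_sum]
  exact integral_finsetSum _ fun i _ => H.int_av _ (f i)

lemma nu_mono (a : K → ℝ) {f g : S → ℝ} (h : ∀ x, f x ≤ g x) : H.nu a f ≤ H.nu a g :=
  integral_mono (H.int_av _ f) (H.int_av _ g) fun _ => H.av_mono _ h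

lemma nu_nonneg (a : K → ℝ) {f : S → ℝ} (h : ∀ x, 0 ≤ f x) : 0 ≤ H.nu a f :=
  integral_nonneg fun _ => H.av_nonneg _ h

lemma abs_nu_le (a : K → ℝ) (f : S → ℝ) : |H.nu a f| ≤ H.nu a (fun x => |f x|) := by
  refine abs_le.2 ⟨?_, H.nu_mono a fun x => le_abs_self _⟩
  have := H.nu_mono a (f := fun x => (-1) * |f x|) (g := f) fun x => by linarith [neg_abs_le (f x)]
  rw [nu_smul] at this
  linarith

lemma abs_nu_le_of (a : K → ℝ) {f g : S → ℝ} (h : ∀ x, |f x| ≤ g x) : |H.nu a f| ≤ H.nu a g :=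
  (H.abs_nu_le a f).trans (H.nu_mono a h)

/-! replicas -/

/-- replicated system -/
def rep (ρ : Type) [Fintype ρ] : GS K (ρ → S) where
  c x := ∑ a, H.c (x a)
  A k x := ∑ a, H.A k (x a)

variable {ρ : Type} [Fintype ρ] [DecidableEq ρ]

lemma rep_ew (θ : K → ℝ) (x : ρ → S) : (H.rep ρ).ew θ x = ∏ a, H.ew θ (x a) := by
  simp only [ew, rep]
  rw [← Real.exp_sum, sum_add_distrib]
  congr 2
  rw [sum_comm]
  exact sum_congr rfl fun k _ => mul_sum _ _ _

lemma sum_prod_eq {ι : Type} [Fintype ι] [DecidableEq ι] {T : Type} [Fintype T] (f : ι → T → ℝ) :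
    ∑ x : ι → T, ∏ i, f i (x i) = ∏ i, ∑ t, f i t := by
  rw [Finset.prod_univ_sum]
  simp

lemma rep_Z (θ : K → ℝ) : (H.rep ρ).Z θ = H.Z θ ^ card ρ := by
  simp only [Z, rep_ew]
  rw [sum_prod_eq (fun _ t => H.ew θ t)]
  simp

lemma rep_p (θ : K → ℝ) (x : ρ → S) : (H.rep ρ).p θ x = ∏ a, H.p θ (x a) := by
  simp only [p, rep_ew, rep_Z, Finset.prod_div_distrib]
  simp

/-- products of averages -/
lemma prod_av {ι : Type} [Fintype ι] [DecidableEq ι] (θ : K → ℝ) (f : ι → (ρ → S) → ℝ) :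
    ∏ i, (H.rep ρ).av θ (f i)
      = (H.rep (ρ × ι)).av θ (fun x => ∏ i, f i (fun a => x (a, i))) := by
  simp only [av]
  rw [← sum_prod_eq (fun i x => f i x * (H.rep ρ).p θ x)]
  let e : (ι → ρ → S) ≃ (ρ × ι → S) :=
    ⟨fun y z => y z.2 z.1, fun x i a => x (a, i), fun _ => rfl, fun _ => rfl⟩
  refine sum_equiv e _ _ fun y => ?_
  rw [prod_mul_distrib]
  congr 1
  simp only [rep_p]
  rw [Fintype.prod_prod_type, Finset.prod_comm]
  rfl

lemma av_reindex {ρ' : Type} [Fintype ρ'] [DecidableEq ρ'] (e : ρ' ≃ ρ) (θ : K → ℝ)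
    (f : (ρ' → S) → ℝ) :
    (H.rep ρ).av θ (fun x => f (fun a => x (e a))) = (H.rep ρ').av θ f := by
  simp only [av]
  refine sum_equiv (Equiv.arrowCongr e.symm (Equiv.refl S)) _ _ fun x => ?_
  simp only [rep_p]
  congr 1
  rw [← e.prod_comp]
  rfl

lemma av_sum_left {ρ' : Type} [Fintype ρ'] [DecidableEq ρ'] (θ : K → ℝ)
    (f : (ρ → S) → ℝ) (g : (ρ' → S) → ℝ) :
    (H.rep (ρ ⊕ ρ')).av θ (fun x => f (fun a => x (inl a)) * g (fun a => x (inr a)))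
      = (H.rep ρ).av θ f * (H.rep ρ').av θ g := by
  simp only [av]
  rw [sum_mul_sum, ← sum_prod_type']
  refine sum_equiv (Equiv.sumArrowEquivProdArrow ρ ρ' S) _ _ fun x => ?_
  simp only [rep_p, Fintype.prod_sum_type]
  simp only [Equiv.sumArrowEquivProdArrow, Equiv.coe_fn_mk, Function.comp_def]
  ring

/-- marginalisation -/
lemma av_inj {ρ' : Type} [Fintype ρ'] [DecidableEq ρ'] (e : ρ' → ρ) (he : Function.Injective e)
    (θ : K → ℝ) (f : (ρ' → S) → ℝ) :
    (H.rep ρ).av θ (fun x => f (fun a => x (e a))) = (H.rep ρ').av θ f := by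
  classical
  let e2 : ρ' ⊕ ((Set.range e)ᶜ : Set ρ) ≃ ρ :=
    ((Equiv.ofInjective e he).sumCongr (Equiv.refl _)).trans (Equiv.Set.sumCompl (Set.range e))
  have h1 := H.av_reindex e2 θ (fun x => f (fun a => x (inl a)) * 1)
  have h2 := H.av_sum_left (ρ' := ((Set.range e)ᶜ : Set ρ)) θ f (fun _ => 1)
  rw [h2, av_const, mul_one] at h1
  rw [← h1]
  simp only [mul_one]
  congr 1

lemma nu_inj {ρ' : Type} [Fintype ρ'] [DecidableEq ρ'] (e : ρ' → ρ) (he : Function.Injective e)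
    (a : K → ℝ) (f : (ρ' → S) → ℝ) :
    (H.rep ρ).nu a (fun x => f (fun a => x (e a))) = (H.rep ρ').nu a f := by
  simp only [nu, H.av_inj e he]

/-- the replica derivative kernel -/
def dk (c : S → S → ℝ) (f : (ρ → S) → ℝ) (x : ρ × Fin 3 → S) : ℝ :=
  f (fun a => x (a, 0)) * (1 / 2 * ∑ a, ∑ b, (c (x (a, 0)) (x (b, 0)) - 2 * c (x (a, 0)) (x (b, 1))
    - c (x (a, 1)) (x (b, 1)) + 2 * c (x (a, 1)) (x (b, 2))))

/-- covariance -/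
def cv (b : K → ℝ) (x y : S) : ℝ := ∑ k, b k * H.A k x * H.A k y

lemma rep_d2 (f : (ρ → S) → ℝ) (k : K) (θ : K → ℝ) :
    (H.rep ρ).d2 f k θ = 2 * (H.rep (ρ × Fin 3)).av θ (dk (fun x y => H.A k x * H.A k y) f) := by
  have h := fun f0 f1 f2 : (ρ → S) → ℝ => H.prod_av θ ![f0, f1, f2]
  simp only [Fin.prod_univ_three, Matrix.cons_val_zero, Matrix.cons_val_one,
    Matrix.cons_val_two, Matrix.head_cons, Matrix.tail_cons] at h
  have h0 := h (fun x => f x * (H.rep ρ).A k x ^ 2) (fun _ => 1) (fun _ => 1)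
  have h1 := h (fun x => f x * (H.rep ρ).A k x) ((H.rep ρ).A k) (fun _ => 1)
  have h2 := h f (fun x => (H.rep ρ).A k x ^ 2) (fun _ => 1)
  have h3 := h f ((H.rep ρ).A k) ((H.rep ρ).A k)
  rw [av_const] at h0 h1 h2
  have e0 : (H.rep ρ).d2 f k θ = (H.rep (ρ × Fin 3)).av θ (fun x =>
      (f (fun a => x (a, 0)) * (H.rep ρ).A k (fun a => x (a, 0)) ^ 2 * 1 * 1
      - 2 * (f (fun a => x (a, 0)) * (H.rep ρ).A k (fun a => x (a, 0))
        * (H.rep ρ).A k (fun a => x (a, 1)) * 1)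
      - f (fun a => x (a, 0)) * (H.rep ρ).A k (fun a => x (a, 1)) ^ 2 * 1
      + 2 * (f (fun a => x (a, 0)) * (H.rep ρ).A k (fun a => x (a, 1))
          * (H.rep ρ).A k (fun a => x (a, 2))))) := by
    rw [av_add, av_sub, av_sub, av_smul, av_smul]
    rw [← h0, ← h1, ← h2, ← h3]
    simp only [d2]
    ring
  rw [e0, ← av_smul]
  congr 1
  ext x
  simp only [dk, sum_add_distrib, sum_sub_distrib, ← mul_sum,
    ← sum_mul, rep]
  ring

lemma dk_sum {ι : Type*} (s : Finset ι) (b : ι → ℝ) (c : ι → S → S → ℝ) (f : (ρ → S) → ℝ)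
    (x : ρ × Fin 3 → S) :
    ∑ k ∈ s, b k * dk (c k) f x = dk (fun y z => ∑ k ∈ s, b k * c k y z) f x := by
  simp only [dk]
  have : ∀ k, b k * (f (fun a => x (a, 0)) * (1 / 2 * ∑ a, ∑ b, (c k (x (a, 0)) (x (b, 0))
    - 2 * c k (x (a, 0)) (x (b, 1))
    - c k (x (a, 1)) (x (b, 1)) + 2 * c k (x (a, 1)) (x (b, 2)))))
    = f (fun a => x (a, 0)) * (1 / 2 * (∑ a, ∑ b', b k * (c k (x (a, 0)) (x (b', 0))
    - 2 * c k (x (a, 0)) (x (b', 1))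
    - c k (x (a, 1)) (x (b', 1)) + 2 * c k (x (a, 1)) (x (b', 2))))) := by
    intro k
    simp only [← mul_sum]
    ring
  rw [sum_congr rfl fun k _ => this k]
  rw [← mul_sum, ← mul_sum, sum_comm]
  congr 2
  refine sum_congr rfl fun a _ => ?_
  rw [sum_comm]
  refine sum_congr rfl fun b' _ => ?_
  rw [mul_sum, mul_sum, ← sum_sub_distrib, ← sum_sub_distrib,
    ← sum_add_distrib]
  refine sum_congr rfl fun k _ => ?_
  ring

/-- derivative along the path in replica form -/
theorem rep_nu_deriv [DecidableEq K] (f : (ρ → S) → ℝ) (a b : K → ℝ) (ha : ∀ k, 0 ≤ a k)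
    (hab : ∀ k, 0 ≤ a k + b k) {s : ℝ} (hs : s ∈ Ioo (0:ℝ) 1) :
    HasDerivAt (fun s => (H.rep ρ).nu (fun k => a k + s * b k) f)
      ((H.rep (ρ × Fin 3)).nu (fun k => a k + s * b k) (dk (H.cv b) f)) s := by
  refine ((H.rep ρ).nu_deriv f a b ha hab hs).congr_deriv ?_
  have : dk (H.cv b) f = fun x => ∑ k, b k * dk (fun x y => H.A k x * H.A k y) f x := by
    ext x
    rw [dk_sum]
    congr 1
    ext y z
    simp only [cv, mul_assoc]
  rw [this, nu_sum]
  refine sum_congr rfl fun k _ => ?_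
  rw [nu_smul]
  simp only [rep_d2, integral_const_mul, nu]
  ring

end GS
end

section
/-! ### M3 : Guerra interpolation with one inner level -/

lemma ball_facts {s : ℝ} (hs : s ∈ Ioo (0:ℝ) 1) : ∃ ε, 0 < ε ∧
    ∀ t ∈ Metric.ball s ε, t ∈ Ioo ε (1 - ε) ∧ t ∈ Ioo (0:ℝ) 1 := by
  obtain ⟨h0, h1'⟩ := hs
  have hm : 0 < min s (1 - s) := lt_min h0 (by linarith)
  refine ⟨min s (1 - s) / 2, by positivity, fun t ht => ?_⟩
  rw [Metric.mem_ball, dist_eq_norm, norm_eq_abs, abs_lt] at ht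
  have := min_le_left s (1 - s)
  have := min_le_right s (1 - s)
  refine ⟨⟨?_, ?_⟩, ?_, ?_⟩ <;> linarith

namespace GS
variable {K S : Type} [Fintype K] [Fintype S] [Nonempty S] (H : GS K S)

def BA : ℝ := ∑ k, bnd (H.A k)

lemma bnd_nonneg (f : S → ℝ) : 0 ≤ bnd f := sum_nonneg fun _ _ => abs_nonneg _
lemma BA_nonneg : 0 ≤ H.BA := sum_nonneg fun _ _ => bnd_nonneg _
lemma bnd_le_BA (k : K) : bnd (H.A k) ≤ H.BA :=
  single_le_sum (f := fun k => bnd (H.A k)) (fun _ _ => bnd_nonneg _) (mem_univ k)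

lemma Z_lip (θ η : K → ℝ) : H.Z (fun k => θ k + η k) ≤ H.Z θ * exp (H.BA * ∑ k, |η k|) := by
  simp only [Z, sum_mul]
  refine sum_le_sum fun x _ => ?_
  simp only [ew]
  rw [← exp_add]
  refine exp_le_exp.2 ?_
  simp only [add_mul, sum_add_distrib]
  have : ∑ k, η k * H.A k x ≤ H.BA * ∑ k, |η k| := by
    rw [mul_sum]
    refine sum_le_sum fun k _ => (le_abs_self _).trans ?_
    rw [abs_mul, mul_comm]
    exact mulR ((le_bnd _ x).trans (H.bnd_le_BA k)) (abs_nonneg _)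
  linarith

lemma logZ_lip (θ η : K → ℝ) :
    |log (H.Z (fun k => θ k + η k)) - log (H.Z θ)| ≤ H.BA * ∑ k, |η k| := by
  have h : ∀ θ η : K → ℝ, log (H.Z (fun k => θ k + η k)) ≤ log (H.Z θ) + H.BA * ∑ k, |η k| := by
    intro θ η
    have := log_le_log (H.Z_pos _) (H.Z_lip θ η)
    rwa [log_mul (H.Z_pos _).ne' (exp_pos _).ne', log_exp] at this
  have h1 := h θ η
  have h2 := h (fun k => θ k + η k) (fun k => - η k)
  simp only [add_neg_cancel_right, abs_neg] at h2
  rw [abs_le]; constructor <;> linarith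

lemma abs_logZ (θ : K → ℝ) : |log (H.Z θ)| ≤ |log (H.Z 0)| + H.BA * ∑ k, |θ k| := by
  have := H.logZ_lip 0 θ
  simp only [Pi.zero_apply, zero_add] at this
  have h2 := abs_sub_abs_le_abs_sub (log (H.Z θ)) (log (H.Z 0))
  linarith

@[fun_prop] lemma continuous_logZ : Continuous (fun θ => log (H.Z θ)) :=
  (H.continuous_Z).log fun θ => (H.Z_pos θ).ne'

lemma EG_lin {f : (K → ℝ) → ℝ} (a b : ℝ) (h : ∀ θ, |f θ| ≤ a + b * ∑ k, |θ k|) : EG f := by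
  have : EG (fun θ : K → ℝ => a + b * ∑ k, |θ k|) :=
    (EG.const a).add ((EG.const b).mul (EG.sum _ fun k _ => (EG.coord k).mono (by simp)))
  exact this.mono fun θ => (h θ).trans (le_abs_self _)

lemma EG_logZ : EG (fun θ => log (H.Z θ)) := EG_lin _ _ H.abs_logZ

/-- `Z^n` -/
def G (n : ℝ) (θ : K → ℝ) : ℝ := exp (n * log (H.Z θ))

lemma G_pos (n : ℝ) (θ : K → ℝ) : 0 < H.G n θ := exp_pos _

@[fun_prop] lemma continuous_G (n : ℝ) : Continuous (H.G n) := by unfold G; fun_prop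

lemma EG_G (n : ℝ) : EG (H.G n) := by
  refine EG.of_exp (exp (|n| * |log (H.Z 0)|)) (|n| * H.BA) fun θ => ?_
  rw [abs_of_pos (H.G_pos n θ), ← exp_add, G]
  refine exp_le_exp.2 ?_
  have := (le_abs_self _).trans_eq (abs_mul n (log (H.Z θ)))
  have h2 := mulL (H.abs_logZ θ) (abs_nonneg n)
  nlinarith

lemma hasFDerivAt_fG (n : ℝ) {f : (K → ℝ) → ℝ} {f1 : K → (K → ℝ) → ℝ}
    (hf : ∀ θ, HasFDerivAt f (dif fun k => f1 k θ) θ) (θ : K → ℝ) :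
    HasFDerivAt (fun θ => f θ * H.G n θ)
      (dif fun k => (f1 k θ + n * (f θ * H.av θ (H.A k))) * H.G n θ) θ := by
  have h1 := (hf θ).fun_mul ((H.hasFDerivAt_logZ θ).const_mul n).exp
  refine h1.congr_fderiv ?_
  ext v
  simp only [smul_apply, dif_apply, smul_eq_mul, mul_sum, add_apply, G]
  rw [← sum_add_distrib]
  refine sum_congr rfl fun k _ => ?_
  ring

lemma hasFDerivAt_G (n : ℝ) (θ : K → ℝ) :
    HasFDerivAt (H.G n) (dif fun k => n * H.av θ (H.A k) * H.G n θ) θ := by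
  have := H.hasFDerivAt_fG n (f := fun _ => 1) (f1 := fun _ _ => 0) (fun θ => by
    refine (hasFDerivAt_const (1:ℝ) θ).congr_fderiv ?_
    ext v; simp [dif_apply]) θ
  simpa using this

/-- inner partition function -/
def P (n : ℝ) (b θ : K → ℝ) : ℝ := ∫ y, H.G n (fun k => θ k + b k * y k) ∂(gam K)

/-- unnormalised inner average -/
def un (n : ℝ) (b θ : K → ℝ) (f : (K → ℝ) → ℝ) : ℝ :=
  ∫ y, f (fun k => θ k + b k * y k) * H.G n (fun k => θ k + b k * y k) ∂(gam K)

def tl (n : ℝ) (b θ : K → ℝ) (f : (K → ℝ) → ℝ) : ℝ := H.un n b θ f / H.P n b θ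

lemma int_un (n : ℝ) (b θ : K → ℝ) {f : (K → ℝ) → ℝ} (hc : Continuous f) (hE : EG f) :
    Integrable (fun y => f (fun k => θ k + b k * y k) * H.G n (fun k => θ k + b k * y k)) (gam K) :=
  ((hE.mul (H.EG_G n)).scale b θ).integrable (by fun_prop)

lemma int_P (n : ℝ) (b θ : K → ℝ) :
    Integrable (fun y => H.G n (fun k => θ k + b k * y k)) (gam K) :=
  ((H.EG_G n).scale b θ).integrable (by fun_prop)

lemma P_pos (n : ℝ) (b θ : K → ℝ) : 0 < H.P n b θ := by
  refine (integral_pos_iff_support_of_nonneg (fun y => (H.G_pos n _).le) (H.int_P n b θ)).2 ?_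
  rw [Function.support_eq_univ fun y => (H.G_pos n _).ne']
  simp

lemma tl_const (n : ℝ) (b θ : K → ℝ) (c : ℝ) : H.tl n b θ (fun _ => c) = c := by
  simp only [tl, un, integral_const_mul]
  exact mul_div_cancel_right₀ c (H.P_pos n b θ).ne'

lemma tl_mono (n : ℝ) (b θ : K → ℝ) {f g : (K → ℝ) → ℝ} (hc : Continuous f) (hE : EG f)
    (hc' : Continuous g) (hE' : EG g) (h : ∀ θ, f θ ≤ g θ) : H.tl n b θ f ≤ H.tl n b θ g :=
  div_le_div_of_nonneg_right (integral_mono (H.int_un n b θ hc hE) (H.int_un n b θ hc' hE')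
    fun _ => mulR (h _) (H.G_pos _ _).le) (H.P_pos n b θ).le

lemma tl_le (n : ℝ) (b θ : K → ℝ) {f : (K → ℝ) → ℝ} (hc : Continuous f) {C : ℝ}
    (h : ∀ θ, |f θ| ≤ C) : |H.tl n b θ f| ≤ C := by
  have hE : EG f := EG.bdd C h
  rw [abs_le]
  constructor
  · have := H.tl_mono n b θ continuous_const (EG.const (-C)) hc hE fun θ => (abs_le.1 (h θ)).1
    rwa [tl_const] at this
  · have := H.tl_mono n b θ hc hE continuous_const (EG.const C) fun θ => (abs_le.1 (h θ)).2
    rwa [tl_const] at this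

lemma tl_smul (n : ℝ) (b θ : K → ℝ) (c : ℝ) (f : (K → ℝ) → ℝ) :
    H.tl n b θ (fun θ => c * f θ) = c * H.tl n b θ f := by
  simp only [tl, un, mul_assoc, integral_const_mul, mul_div_assoc]

lemma tl_sum {ι : Type*} (s : Finset ι) (n : ℝ) (b θ : K → ℝ) {f : ι → (K → ℝ) → ℝ}
    (hc : ∀ i, Continuous (f i)) (hE : ∀ i, EG (f i)) :
    H.tl n b θ (fun θ => ∑ i ∈ s, f i θ) = ∑ i ∈ s, H.tl n b θ (f i) := by
  simp only [tl, un, sum_mul]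
  rw [integral_finsetSum _ fun i _ => H.int_un n b θ (hc i) (hE i), sum_div]

lemma continuous_P (n : ℝ) : Continuous (fun p : (K → ℝ) × (K → ℝ) => H.P n p.2 p.1) :=
  cont_int (H.continuous_G n) (H.EG_G n)

lemma continuous_tl (n : ℝ) {f : (K → ℝ) → ℝ} (hc : Continuous f) (hE : EG f) :
    Continuous (fun p : (K → ℝ) × (K → ℝ) => H.tl n p.2 p.1 f) :=
  (cont_int (hc.mul (H.continuous_G n)) (hE.mul (H.EG_G n))).div₀ (H.continuous_P n)
    fun p => (H.P_pos n _ _).ne'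

lemma logP_bound (n M : ℝ) : ∃ C, 0 ≤ C ∧ ∀ b θ : K → ℝ, (∀ k, |b k| ≤ M) →
    |log (H.P n b θ)| ≤ C + C * ∑ k, |θ k| := by
  set D := |n| * H.BA * |M| with hD
  have hD0 : 0 ≤ D := by have := H.BA_nonneg; positivity
  set E1 := ∫ y : K → ℝ, exp (D * ∑ k, |y k|) ∂(gam K) with hE1
  set E0 := ∫ y : K → ℝ, exp (-D * ∑ k, |y k|) ∂(gam K) with hE0
  have hi : ∀ D : ℝ, Integrable (fun y : K → ℝ => exp (D * ∑ k, |y k|)) (gam K) := fun D =>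
    (EG.of_exp 1 D fun y => by rw [abs_of_pos (exp_pos _), one_mul]).integrable (by fun_prop)
  have hpos : ∀ D : ℝ, 0 < ∫ y : K → ℝ, exp (D * ∑ k, |y k|) ∂(gam K) := by
    intro D
    refine (integral_pos_iff_support_of_nonneg (fun y => (exp_pos _).le) (hi D)).2 ?_
    rw [Function.support_eq_univ fun y => (exp_pos _).ne']
    simp
  refine ⟨|n| * |log (H.Z 0)| + |n| * H.BA + |log E1| + |log E0|, by
    have := H.BA_nonneg; positivity, fun b θ hb => ?_⟩
  have key : ∀ y : K → ℝ, |n * log (H.Z fun k => θ k + b k * y k) - n * log (H.Z θ)|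
      ≤ D * ∑ k, |y k| := by
    intro y
    rw [← mul_sub, abs_mul]
    have h1 := H.logZ_lip θ (fun k => b k * y k)
    have h2 : ∑ k, |b k * y k| ≤ |M| * ∑ k, |y k| := by
      rw [mul_sum]
      refine sum_le_sum fun k _ => ?_
      rw [abs_mul]
      exact mulR ((hb k).trans (le_abs_self _)) (abs_nonneg _)
    calc |n| * _ ≤ |n| * (H.BA * (|M| * ∑ k, |y k|)) :=
          mulL (h1.trans (mulL h2 H.BA_nonneg))
            (abs_nonneg _)
      _ = _ := by rw [hD]; ring
  have hup : H.P n b θ ≤ exp (n * log (H.Z θ)) * E1 := by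
    rw [hE1, ← integral_const_mul]
    refine integral_mono (H.int_P n b θ) ((hi D).const_mul _) fun y => ?_
    simp only [G]
    rw [← exp_add]
    exact exp_le_exp.2 (by linarith [(abs_le.1 (key y)).2])
  have hlo : exp (n * log (H.Z θ)) * E0 ≤ H.P n b θ := by
    rw [hE0, ← integral_const_mul]
    refine integral_mono ((hi (-D)).const_mul _) (H.int_P n b θ) fun y => ?_
    simp only [G]
    rw [← exp_add]
    exact exp_le_exp.2 (by linarith [(abs_le.1 (key y)).1])
  have h1 := log_le_log (H.P_pos n b θ) hup
  have h2 := log_le_log (mul_pos (exp_pos _) (hpos (-D))) hlo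
  rw [log_mul (exp_pos _).ne' (hpos _).ne', log_exp] at h1 h2
  have h3 := mulL (H.abs_logZ θ) (abs_nonneg n)
  rw [← abs_mul] at h3
  have h0 : 0 ≤ ∑ k, |θ k| := sum_nonneg fun _ _ => abs_nonneg _
  have h4 : 0 ≤ (|n| * |log (H.Z 0)| + |log E1| + |log E0|) * ∑ k, |θ k| := by positivity
  have h5 : 0 ≤ |n| * H.BA := by have := H.BA_nonneg; positivity
  have a1 := le_abs_self (log E1)
  have a2 := neg_abs_le (log E0)
  have a3 := abs_nonneg (log E1)
  have a4 := abs_nonneg (log E0)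
  rw [abs_le]
  obtain ⟨c1, c2⟩ := abs_le.1 h3
  constructor <;> nlinarith

/-- the interpolating free energy -/
def F (n : ℝ) (a b : K → ℝ) : ℝ :=
  ∫ w, 1 / n * log (H.P n (fun k => √(b k)) (fun k => √(a k) * w k)) ∂(gam K)

lemma continuous_F (n : ℝ) : Continuous (fun p : (K → ℝ) × (K → ℝ) => H.F n p.1 p.2) := by
  rw [continuous_iff_continuousAt]
  intro p
  obtain ⟨C, hC, h⟩ := H.logP_bound n (∑ k, (|p.2 k| + 2))
  have hcl : Continuous fun p : (K → ℝ) × (K → ℝ) => log (H.P n p.2 p.1) :=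
    (H.continuous_P n).log fun p => (H.P_pos n _ _).ne'
  refine continuousAt_of_dominated
    (bound := fun w : K → ℝ => |1 / n| * (C + C * ∑ k, (|p.1 k| + 2) * |w k|))
    (Eventually.of_forall fun q => Continuous.aestronglyMeasurable ?_) ?_ ?_
    (ae_of_all _ fun w => Continuous.continuousAt ?_)
  · exact (hcl.comp (f := fun w : K → ℝ => ((fun k => √(q.1 k) * w k), (fun k => √(q.2 k))))
      (by fun_prop)).const_mul _
  · filter_upwards [Metric.ball_mem_nhds p one_pos] with q hq
    have hs : ∀ x y : ℝ, |x - y| ≤ 1 → √x ≤ |y| + 2 := by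
      intro x y hxy
      refine sqrt_le_iff.2 ⟨by positivity, ?_⟩
      have := le_abs_self x
      have := abs_sub_abs_le_abs_sub x y
      nlinarith [abs_nonneg y]
    rw [Metric.mem_ball, dist_eq_norm] at hq
    have h1 : ∀ k, |q.1 k - p.1 k| ≤ 1 := fun k =>
      ((norm_le_pi_norm (q - p).1 k).trans (norm_fst_le (q - p))).trans hq.le
    have h2 : ∀ k, |q.2 k - p.2 k| ≤ 1 := fun k =>
      ((norm_le_pi_norm (q - p).2 k).trans (norm_snd_le (q - p))).trans hq.le
    refine ae_of_all _ fun w => ?_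
    rw [norm_eq_abs, abs_mul]
    refine mulL ((h _ _ fun k => ?_).trans ?_) (abs_nonneg _)
    · rw [abs_of_nonneg (sqrt_nonneg _)]
      exact (hs _ _ (h2 k)).trans (single_le_sum (f := fun k => |p.2 k| + 2)
        (fun k _ => by positivity) (mem_univ k))
    · gcongr with k
      rw [abs_mul, abs_of_nonneg (sqrt_nonneg _)]
      exact mulR (hs _ _ (h1 k)) (abs_nonneg _)
  · refine EG.integrable ?_ (by fun_prop)
    exact (EG.const _).mul ((EG.const _).add ((EG.const _).mul (EG.sum _ fun k _ =>
      (EG.const _).mul ((EG.coord k).mono (by simp)))))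
  · exact (hcl.comp (f := fun q : (K → ℝ) × (K → ℝ) =>
      ((fun k => √(q.1 k) * w k), (fun k => √(q.2 k)))) (by fun_prop)).const_mul _

end GS
end

section
namespace GS
variable {K S : Type} [Fintype K] [Fintype S] [Nonempty S] (H : GS K S)

def dS (n : ℝ) (k : K) (θ : K → ℝ) : ℝ :=
  H.av θ (fun x => H.A k x ^ 2) + (n - 1) * (H.av θ (H.A k) * H.av θ (H.A k))

@[fun_prop] lemma continuous_dS (n : ℝ) (k : K) : Continuous (H.dS n k) := by
  unfold dS; fun_prop

def dB (n : ℝ) : ℝ := ∑ k, (bnd (fun x => H.A k x ^ 2) + |n - 1| * (bnd (H.A k) * bnd (H.A k)))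

lemma abs_dS (n : ℝ) (k : K) (θ : K → ℝ) : |H.dS n k θ| ≤ H.dB n := by
  have h1 : |H.dS n k θ| ≤ bnd (fun x => H.A k x ^ 2) + |n - 1| * (bnd (H.A k) * bnd (H.A k)) := by
    refine (abs_add_le _ _).trans (add_le_add (H.abs_av_bnd _ _) ?_)
    rw [abs_mul, abs_mul]
    have := H.abs_av_bnd θ (H.A k)
    gcongr
    exact bnd_nonneg _
  refine h1.trans (single_le_sum
    (f := fun k => bnd (fun x => H.A k x ^ 2) + |n - 1| * (bnd (H.A k) * bnd (H.A k)))
    (fun k _ => ?_) (mem_univ k))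
  have := bnd_nonneg (H.A k)
  have := bnd_nonneg (fun x => H.A k x ^ 2)
  positivity

lemma EG_dS (n : ℝ) (k : K) : EG (H.dS n k) := EG.bdd _ (H.abs_dS n k)

variable [DecidableEq K]

/-- derivative of `<A_k> Z^n` in direction `k` -/
lemma hasDerivAt_avG (n : ℝ) (k : K) (θ : K → ℝ) :
    HasDerivAt (fun t => H.av (update θ k t) (H.A k) * H.G n (update θ k t))
      (H.dS n k θ * H.G n θ) (θ k) := by
  have := hasDerivAt_update_of_dif (H.hasFDerivAt_fG n (H.hasFDerivAt_av (H.A k))) k θ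
  refine this.congr_deriv ?_
  simp only [d1, dS]
  have e2 : (fun x => H.A k x * H.A k x) = fun x => H.A k x ^ 2 := by
    ext x; ring
  rw [e2]; ring

/-- inner integration by parts -/
lemma inner_ibp (n : ℝ) (b θ : K → ℝ) (k : K) :
    ∫ y, y k * (H.av (fun k => θ k + b k * y k) (H.A k) * H.G n (fun k => θ k + b k * y k)) ∂(gam K)
      = b k * H.un n b θ (H.dS n k) := by
  rw [un, ← integral_const_mul]
  refine ibp k (f := fun y => H.av (fun k => θ k + b k * y k) (H.A k)
    * H.G n (fun k => θ k + b k * y k))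
    (fun w => hasDerivAt_scale (f := fun θ => H.av θ (H.A k) * H.G n θ) k _ _ w
      (H.hasDerivAt_avG n k _)) (by fun_prop) (by fun_prop)
    (((H.EG_av _).mul (H.EG_G n)).scale b θ)
    ((EG.const _).mul (((H.EG_dS n k).mul (H.EG_G n)).scale b θ))

/-- derivative in `s` of the inner free energy -/
lemma logP_deriv (n : ℝ) (hn : n ≠ 0) {θ θ' b b' : ℝ → K → ℝ} {s ε M : ℝ} (hε : 0 < ε)
    (hθ : ∀ t ∈ Metric.ball s ε, ∀ k, HasDerivAt (fun t => θ t k) (θ' t k) t)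
    (hb : ∀ t ∈ Metric.ball s ε, ∀ k, HasDerivAt (fun t => b t k) (b' t k) t)
    (hM : ∀ t ∈ Metric.ball s ε, ∀ k, |θ t k| ≤ M ∧ |b t k| ≤ M ∧ |θ' t k| ≤ M ∧ |b' t k| ≤ M) :
    HasDerivAt (fun t => 1 / n * log (H.P n (b t) (θ t)))
      (∑ k, (θ' s k * H.tl n (b s) (θ s) (fun θ => H.av θ (H.A k))
        + b' s k * b s k * H.tl n (b s) (θ s) (H.dS n k))) s := by
  have h := deriv_int (H.hasFDerivAt_G n) (fun k => by fun_prop) (H.EG_G n)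
    (fun k => ((EG.const n).mul (H.EG_av (H.A k))).mul (H.EG_G n)) hε hθ hb hM
  have h2 : HasDerivAt (fun t => H.P n (b t) (θ t)) _ s := h
  refine ((h2.log (H.P_pos n _ _).ne').const_mul (1 / n)).congr_deriv ?_
  rw [integral_finsetSum]
  · rw [sum_div, mul_sum]
    refine sum_congr rfl fun k _ => ?_
    have e : ∀ y : K → ℝ, n * H.av (fun k => θ s k + b s k * y k) (H.A k)
        * H.G n (fun k => θ s k + b s k * y k) * (θ' s k + b' s k * y k)
        = n * θ' s k * (H.av (fun k => θ s k + b s k * y k) (H.A k)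
          * H.G n (fun k => θ s k + b s k * y k)) + n * b' s k * (y k *
          (H.av (fun k => θ s k + b s k * y k) (H.A k)
          * H.G n (fun k => θ s k + b s k * y k))) := fun y => by ring
    simp only [e]
    rw [integral_add, integral_const_mul, integral_const_mul, inner_ibp]
    · simp only [tl, un]
      have := (H.P_pos n (b s) (θ s)).ne'
      field_simp
    · exact (H.int_un n _ _ (H.continuous_av _) (H.EG_av _)).const_mul _
    · exact (((EG.coord k).mul (((H.EG_av (H.A k)).mul (H.EG_G n)).scale (b s) (θ s))).integrable
        (by fun_prop)).const_mul _
  · intro k _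
    refine EG.integrable (EG.mul ((((EG.const n).mul (H.EG_av (H.A k))).mul (H.EG_G n)).scale _ _)
      ((EG.const _).add ((EG.const _).mul (EG.coord k)))) (by fun_prop)

lemma hasDerivAt_un (b θ : K → ℝ) (k : K) {f : (K → ℝ) → ℝ} {f1 : K → (K → ℝ) → ℝ}
    (hf : ∀ θ, HasFDerivAt f (dif fun k => f1 k θ) θ) (hc : ∀ k, Continuous (f1 k))
    (hE : EG f) (hE1 : ∀ k, EG (f1 k)) :
    HasDerivAt (fun t => ∫ y, f (fun j => update θ k t j + b j * y j) ∂(gam K))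
      (∫ y, f1 k (fun j => θ j + b j * y j) ∂(gam K)) (θ k) := by
  have h := deriv_int hf hc hE hE1 (θ := fun t => update θ k t)
    (θ' := fun _ => Pi.single k 1) (b := fun _ => b) (b' := fun _ => 0) (s := θ k) (ε := 1)
    (M := ∑ j, (|θ j| + |b j|) + 1 + |θ k|) one_pos
    (fun t _ j => (hasDerivAt_pi.1 (hasDerivAt_update θ k t)) j)
    (fun t _ j => hasDerivAt_const _ _) (fun t ht j => ?_)
  · refine h.congr_deriv ?_
    congr 1
    ext y
    simp [Pi.single_apply]
  · have h1 : |θ j| + |b j| ≤ ∑ j, (|θ j| + |b j|) :=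
      single_le_sum (f := fun j => |θ j| + |b j|) (fun _ _ => by positivity)
        (mem_univ j)
    have h2 := abs_nonneg (θ j)
    have h3 := abs_nonneg (b j)
    have h4 := abs_nonneg (θ k)
    rw [Metric.mem_ball, dist_eq_norm, norm_eq_abs] at ht
    have h5 := abs_sub_abs_le_abs_sub t (θ k)
    refine ⟨?_, by linarith, ?_, by simp; linarith⟩
    · by_cases hj : j = k
      · subst hj; simp; linarith
      · simp [update_of_ne hj]; linarith
    · by_cases hj : j = k
      · subst hj; simp; linarith
      · simp [hj]; linarith

lemma hasDerivAt_tl (n : ℝ) (b θ : K → ℝ) (k : K) :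
    HasDerivAt (fun t => H.tl n b (update θ k t) (fun θ => H.av θ (H.A k)))
      (H.tl n b θ (H.dS n k) - n * (H.tl n b θ (fun θ => H.av θ (H.A k))
        * H.tl n b θ (fun θ => H.av θ (H.A k)))) (θ k) := by
  have hfc : ∀ j, Continuous fun θ => (H.d1 (H.A k) j θ + n * (H.av θ (H.A k) * H.av θ (H.A j)))
    * H.G n θ := fun j => by fun_prop
  have hf := hasDerivAt_un b θ k (H.hasFDerivAt_fG n (H.hasFDerivAt_av (H.A k))) hfc
    ((H.EG_av _).mul (H.EG_G n))
    (fun j => (((H.EG_d1 _ _).add ((EG.const n).mul ((H.EG_av _).mul (H.EG_av _)))).mul (H.EG_G n)))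
  have hg := hasDerivAt_un b θ k (H.hasFDerivAt_G n) (fun j => by fun_prop)
    (H.EG_G n) (fun j => ((EG.const n).mul (H.EG_av (H.A j))).mul (H.EG_G n))
  have e1 : ∫ y, (H.d1 (H.A k) k (fun j => θ j + b j * y j) + n * (H.av (fun j => θ j + b j * y j) (H.A k)
      * H.av (fun j => θ j + b j * y j) (H.A k))) * H.G n (fun j => θ j + b j * y j) ∂(gam K)
      = H.un n b θ (H.dS n k) := by
    rw [un]
    congr 1
    ext y
    simp only [d1, dS]
    have e2 : (fun x => H.A k x * H.A k x) = fun x => H.A k x ^ 2 := by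
      ext x; ring
    rw [e2]; ring
  have e2 : ∫ y, n * H.av (fun j => θ j + b j * y j) (H.A k) * H.G n (fun j => θ j + b j * y j) ∂(gam K)
      = n * H.un n b θ (fun θ => H.av θ (H.A k)) := by
    simp only [un, mul_assoc, integral_const_mul]
  rw [e1] at hf
  rw [e2] at hg
  have hP : (∫ y, H.G n (fun j => update θ k (θ k) j + b j * y j) ∂(gam K)) ≠ 0 :=
    (H.P_pos n b (update θ k (θ k))).ne'
  refine (hf.fun_div hg hP).congr_deriv ?_
  have hP' := (H.P_pos n b θ).ne'
  simp only [Function.update_eq_self]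
  change (_ * H.P n b θ - H.un n b θ (fun θ => H.av θ (H.A k)) * _) / H.P n b θ ^ 2 = _
  simp only [tl]
  field_simp

/-- derivative of the interpolating free energy -/
theorem F_deriv (n : ℝ) (hn : n ≠ 0) (a a' b b' : K → ℝ) (ha : ∀ k, 0 ≤ a k)
    (haa : ∀ k, 0 ≤ a k + a' k) (hb : ∀ k, 0 ≤ b k) (hbb : ∀ k, 0 ≤ b k + b' k) {s : ℝ}
    (hs : s ∈ Ioo (0:ℝ) 1) :
    HasDerivAt (fun s => H.F n (fun k => a k + s * a' k) (fun k => b k + s * b' k))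
      (∫ w, ∑ k, ((a' k + b' k) / 2 * H.tl n (fun k => √(b k + s * b' k))
          (fun k => √(a k + s * a' k) * w k) (H.dS n k)
        - n * a' k / 2 * (H.tl n (fun k => √(b k + s * b' k))
          (fun k => √(a k + s * a' k) * w k) (fun θ => H.av θ (H.A k)) *
            H.tl n (fun k => √(b k + s * b' k))
          (fun k => √(a k + s * a' k) * w k) (fun θ => H.av θ (H.A k)))) ∂(gam K)) s := by
  obtain ⟨ε, hε, hball⟩ := ball_facts hs
  have hss : s ∈ Metric.ball s ε := Metric.mem_ball_self hε
  set Ma : K → ℝ := fun k => a k + |a' k| + 1 + (|a' k| + 1) / ε with hMa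
  set Mb : K → ℝ := fun k => b k + |b' k| + 1 + (|b' k| + 1) / ε with hMb
  have hMap : ∀ k, 0 ≤ Ma k := fun k => by have := ha k; positivity
  have hMbp : ∀ k, 0 ≤ Mb k := fun k => by have := hb k; positivity
  have hd : ∀ (w : K → ℝ), ∀ t ∈ Metric.ball s ε,
      HasDerivAt (fun s => 1 / n * log (H.P n (fun k => √(b k + s * b' k))
        (fun k => √(a k + s * a' k) * w k)))
      (∑ k, (a' k / (2 * √(a k + t * a' k)) * w k * H.tl n (fun k => √(b k + t * b' k))
        (fun k => √(a k + t * a' k) * w k) (fun θ => H.av θ (H.A k))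
        + b' k / 2 * H.tl n (fun k => √(b k + t * b' k))
        (fun k => √(a k + t * a' k) * w k) (H.dS n k))) t := by
    intro w t ht
    have hε' : 0 < ε - dist t s := by rw [Metric.mem_ball] at ht; linarith
    have hsub : Metric.ball t (ε - dist t s) ⊆ Metric.ball s ε :=
      Metric.ball_subset_ball' (by linarith)
    have h := H.logP_deriv n hn (s := t) (ε := ε - dist t s)
      (M := ∑ k, (Ma k * |w k| + Mb k))
      (θ := fun t k => √(a k + t * a' k) * w k)
      (θ' := fun t k => a' k / (2 * √(a k + t * a' k)) * w k)
      (b := fun t k => √(b k + t * b' k)) (b' := fun t k => b' k / (2 * √(b k + t * b' k)))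
      hε' (fun u hu k => ((pathD (a k) (a' k) (ha k) (haa k) (hball u (hsub hu)).2).1.mul_const _))
      (fun u hu k => (pathD (b k) (b' k) (hb k) (hbb k) (hball u (hsub hu)).2).1)
      (fun u hu k => by
        have h1 := pathB (a k) (a' k) (ha k) (haa k) hε (hball u (hsub hu)).1
        have h2 := pathB (b k) (b' k) (hb k) (hbb k) hε (hball u (hsub hu)).1
        have h3 : Ma k * |w k| + Mb k ≤ ∑ k, (Ma k * |w k| + Mb k) :=
          single_le_sum (f := fun k => Ma k * |w k| + Mb k)
            (fun k _ => add_nonneg (mul_nonneg (hMap k) (abs_nonneg _)) (hMbp k))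
            (mem_univ k)
        have p1 : 0 ≤ (|a' k| + 1) / ε := by positivity
        have p2 : 0 ≤ (|b' k| + 1) / ε := by positivity
        have p3 : 0 ≤ a k + |a' k| + 1 := by have := ha k; positivity
        have p4 : 0 ≤ b k + |b' k| + 1 := by have := hb k; positivity
        have q1 : |√(a k + u * a' k)| ≤ Ma k := h1.1.trans (by simp only [hMa]; linarith)
        have q2 : |a' k / (2 * √(a k + u * a' k))| ≤ Ma k := h1.2.trans (by simp only [hMa]; linarith)
        have q3 : |√(b k + u * b' k)| ≤ Mb k := h2.1.trans (by simp only [hMb]; linarith)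
        have q4 : |b' k / (2 * √(b k + u * b' k))| ≤ Mb k := h2.2.trans (by simp only [hMb]; linarith)
        have r1 := mulR q1 (abs_nonneg (w k))
        have r2 := mulR q2 (abs_nonneg (w k))
        have r3 := mul_nonneg (hMap k) (abs_nonneg (w k))
        have r4 := hMbp k
        rw [abs_mul, abs_mul]
        refine ⟨by linarith, by linarith, by linarith, by linarith⟩)
    refine h.congr_deriv (sum_congr rfl fun k _ => ?_)
    rw [(pathD (b k) (b' k) (hb k) (hbb k) (hball t ht).2).2]
  have hTc : ∀ (t : ℝ) {f : (K → ℝ) → ℝ}, Continuous f → EG f → Continuous fun w : K → ℝ =>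
      H.tl n (fun k => √(b k + t * b' k)) (fun k => √(a k + t * a' k) * w k) f := by
    intro t f hc hE
    exact (H.continuous_tl n hc hE).comp (f := fun w : K → ℝ =>
      ((fun k => √(a k + t * a' k) * w k), (fun k => √(b k + t * b' k)))) (by fun_prop)
  have hAc := fun k => H.continuous_av (H.A k)
  have hAE := fun k => H.EG_av (H.A k)
  have hT1 := fun k => hTc s (hAc k) (hAE k)
  have hT2 := fun k => hTc s (H.continuous_dS n k) (H.EG_dS n k)
  have hB1 : ∀ k b θ, |H.tl n b θ (fun θ => H.av θ (H.A k))| ≤ H.BA := fun k b θ =>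
    H.tl_le n b θ (hAc k) fun θ => (H.abs_av_bnd θ _).trans (H.bnd_le_BA k)
  have hB2 : ∀ k b θ, |H.tl n b θ (H.dS n k)| ≤ H.dB n := fun k b θ =>
    H.tl_le n b θ (H.continuous_dS n k) (H.abs_dS n k)
  have hE1 : ∀ k, EG fun w : K → ℝ => H.tl n (fun k => √(b k + s * b' k))
      (fun k => √(a k + s * a' k) * w k) (fun θ => H.av θ (H.A k)) := fun k =>
    EG.bdd H.BA fun w => hB1 k _ _
  have hE2 : ∀ k, EG fun w : K → ℝ => H.tl n (fun k => √(b k + s * b' k))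
      (fun k => √(a k + s * a' k) * w k) (H.dS n k) := fun k =>
    EG.bdd (H.dB n) fun w => hB2 k _ _
  obtain ⟨C, hC, hlog⟩ := H.logP_bound n (∑ k, √(b k + s * b' k))
  have hcl : ∀ t : ℝ, Continuous fun w : K → ℝ => 1 / n * log (H.P n (fun k => √(b k + t * b' k))
        (fun k => √(a k + t * a' k) * w k)) := fun t =>
    ((((H.continuous_P n).comp (f := fun w : K → ℝ =>
      ((fun k => √(a k + t * a' k) * w k), (fun k => √(b k + t * b' k)))) (by fun_prop))).log
      fun p => (H.P_pos n _ _).ne').const_mul _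
  have key := (hasDerivAt_integral_of_dominated_loc_of_deriv_le (μ := gam K)
    (Metric.ball_mem_nhds s hε)
    (F := fun t (w : K → ℝ) => 1 / n * log (H.P n (fun k => √(b k + t * b' k))
        (fun k => √(a k + t * a' k) * w k)))
    (bound := fun w : K → ℝ => ∑ k, (Ma k * |w k| * H.BA + |b' k / 2| * H.dB n))
    (Eventually.of_forall fun t => (hcl t).aestronglyMeasurable) ?_ ?_
    (ae_of_all _ fun w t ht => ?_) ?_ (ae_of_all _ fun w t ht => hd w t ht)).2
  · refine key.congr_deriv ?_
    have hi1 : ∀ k, Integrable (fun w : K → ℝ => w k * H.tl n (fun k => √(b k + s * b' k))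
        (fun k => √(a k + s * a' k) * w k) (fun θ => H.av θ (H.A k))) (gam K) := fun k =>
      ((EG.coord k).mul (hE1 k)).integrable (by have := hT1 k; fun_prop)
    have hi2 := fun k => (hE2 k).integrable (hT2 k)
    have hi3 := fun k => ((hE1 k).mul (hE1 k)).integrable ((hT1 k).mul (hT1 k))
    rw [integral_finsetSum, integral_finsetSum]
    · refine sum_congr rfl fun k _ => ?_
      have hI := ibp k (f := fun w => H.tl n (fun k => √(b k + s * b' k))
          (fun k => √(a k + s * a' k) * w k) (fun θ => H.av θ (H.A k)))
        (f' := fun w => √(a k + s * a' k) * (H.tl n (fun k => √(b k + s * b' k))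
          (fun k => √(a k + s * a' k) * w k) (H.dS n k) - n * (H.tl n (fun k => √(b k + s * b' k))
          (fun k => √(a k + s * a' k) * w k) (fun θ => H.av θ (H.A k)) *
          H.tl n (fun k => √(b k + s * b' k))
          (fun k => √(a k + s * a' k) * w k) (fun θ => H.av θ (H.A k)))))
        (fun w => by
          have h := hasDerivAt_scale (f := fun θ => H.tl n (fun k => √(b k + s * b' k)) θ
            (fun θ => H.av θ (H.A k))) k (fun k => √(a k + s * a' k)) 0 w
            (H.hasDerivAt_tl n (fun k => √(b k + s * b' k)) _ k)
          simpa using h) (hT1 k) (by have := hT1 k; have := hT2 k; fun_prop) (hE1 k)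
          ((EG.const _).mul ((hE2 k).sub ((EG.const n).mul ((hE1 k).mul (hE1 k)))))
      have hp := (pathD (a k) (a' k) (ha k) (haa k) hs).2
      simp only [mul_assoc]
      rw [integral_add ((hi1 k).const_mul _) ((hi2 k).const_mul _), integral_const_mul,
        integral_const_mul, hI, integral_const_mul, ← mul_assoc, hp]
      rw [integral_sub (hi2 k) ((hi3 k).const_mul n), integral_const_mul,
        integral_sub ((hi2 k).const_mul _), integral_const_mul]
      · simp only [mul_div_assoc, mul_assoc]
        rw [integral_const_mul, integral_const_mul]
        ring
      · simp only [mul_div_assoc, mul_assoc]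
        exact ((hi3 k).const_mul _).const_mul _
    · intro k _
      exact ((hi2 k).const_mul _).sub ((hi3 k).const_mul _)
    · intro k _
      simp only [mul_assoc]
      exact ((hi1 k).const_mul _).add ((hi2 k).const_mul _)
  · refine EG.integrable ((EG.const _).mul (EG_lin C (C * ∑ k, √(a k + s * a' k)) fun w => ?_))
      (hcl s)
    refine (hlog _ _ fun k => ?_).trans ?_
    · rw [abs_of_nonneg (sqrt_nonneg _)]
      exact single_le_sum (f := fun k => √(b k + s * b' k)) (fun k _ => sqrt_nonneg _)
        (mem_univ k)
    · rw [mul_assoc, mul_sum (univ) (fun k => |w k|)]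
      gcongr with k
      rw [abs_mul, abs_of_nonneg (sqrt_nonneg _)]
      exact mulR (single_le_sum (f := fun k => √(a k + s * a' k))
        (fun k _ => sqrt_nonneg _) (mem_univ k)) (abs_nonneg _)
  · refine Continuous.aestronglyMeasurable ?_
    refine continuous_finsetSum _ fun k _ => ?_
    have := hT1 k; have := hT2 k; fun_prop
  · refine (abs_sum_le_sum_abs _ _).trans (sum_le_sum fun k _ => ?_)
    refine (abs_add_le _ _).trans (add_le_add ?_ ?_)
    · rw [abs_mul, abs_mul]
      have h1 := (pathB (a k) (a' k) (ha k) (haa k) hε (hball t ht).1).2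
      have p3 : 0 ≤ a k + |a' k| + 1 := by have := ha k; positivity
      have q2 : |a' k / (2 * √(a k + t * a' k))| ≤ Ma k := h1.trans (by simp only [hMa]; linarith)
      refine mul_le_mul (mulR q2 (abs_nonneg _)) (hB1 k _ _) (abs_nonneg _)
        (mul_nonneg (hMap k) (abs_nonneg _))
    · rw [abs_mul]
      exact mulL (hB2 k _ _) (abs_nonneg _)
  · refine EG.integrable (EG.sum _ fun k _ => (((EG.const _).mul
      ((EG.coord k).mono (by simp))).mul (EG.const _)).add (EG.const _)) (by fun_prop)

end GS
end

section
lemma mvt01 {f f' : ℝ → ℝ} {C : ℝ} (hc : Continuous f)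
    (hd : ∀ s ∈ Ioo (0:ℝ) 1, HasDerivAt f (f' s) s)
    (hb : ∀ s ∈ Ioo (0:ℝ) 1, f' s ≤ C) : f 1 - f 0 ≤ C := by
  obtain ⟨c, hcm, h⟩ := exists_hasDerivAt_eq_slope f f' one_pos hc.continuousOn hd
  have := hb c hcm
  rw [h] at this
  simpa using this

lemma integral_le_const {K : Type} [Fintype K] {f : (K → ℝ) → ℝ} {C : ℝ} (h : ∀ w, f w ≤ C)
    (hC : Integrable f (gam K)) : ∫ w, f w ∂(gam K) ≤ C := by
  have := integral_mono hC (integrable_const C) h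
  simpa using this

namespace GS
variable {K S : Type} [Fintype K] [Fintype S] [Nonempty S] (H : GS K S)

lemma continuous_p (x : S) : Continuous (fun θ => H.p θ x) := by
  unfold p
  exact (H.continuous_ew x).div₀ H.continuous_Z fun θ => (H.Z_pos θ).ne'

lemma p_le_one (θ : K → ℝ) (x : S) : H.p θ x ≤ 1 := by
  rw [← H.p_sum θ]
  exact single_le_sum (f := fun x => H.p θ x) (fun x _ => (H.p_pos θ x).le)
    (mem_univ x)

lemma EG_p (x : S) : EG (fun θ => H.p θ x) := EG.bdd 1 fun θ => by
  rw [abs_of_pos (H.p_pos θ x)]; exact H.p_le_one θ x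

variable [DecidableEq K]

theorem GT_bound (n : ℝ) (hn : n ≠ 0) (a a' b b' : K → ℝ) (ha : ∀ k, 0 ≤ a k)
    (haa : ∀ k, 0 ≤ a k + a' k) (hb : ∀ k, 0 ≤ b k) (hbb : ∀ k, 0 ≤ b k + b' k) {d e1 e2 : ℝ}
    (h0 : ∀ x, H.cv a' x x + H.cv b' x x ≤ d)
    (h1 : ∀ x y, (n - 1) * (H.cv a' x y + H.cv b' x y) ≤ e1)
    (h2 : ∀ x y, -n * H.cv a' x y ≤ e2) :
    H.F n (fun k => a k + a' k) (fun k => b k + b' k) - H.F n a b ≤ (d + e1 + e2) / 2 := by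
  have hc : Continuous (fun s : ℝ => H.F n (fun k => a k + s * a' k) (fun k => b k + s * b' k)) :=
    (H.continuous_F n).comp (f := fun s : ℝ => ((fun k => a k + s * a' k), (fun k => b k + s * b' k)))
      (by fun_prop)
  have key := mvt01 (C := (d + e1 + e2) / 2) hc (fun s hs => H.F_deriv n hn a a' b b' ha haa hb hbb hs) (fun s hs => ?_)
  · simpa using key
  · have hT : ∀ bb θ : K → ℝ, ∑ k, ((a' k + b' k) / 2 * H.tl n bb θ (H.dS n k)
        - n * a' k / 2 * (H.tl n bb θ (fun θ => H.av θ (H.A k)) *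
            H.tl n bb θ (fun θ => H.av θ (H.A k)))) ≤ (d + e1 + e2) / 2 := by
      intro bb θ
      have hA : ∀ k, H.tl n bb θ (fun θ => H.av θ (H.A k))
          = ∑ x, H.A k x * H.tl n bb θ (fun θ => H.p θ x) := by
        intro k
        simp only [av]
        rw [H.tl_sum univ n bb θ (fun x => (H.continuous_p x).const_mul _)
          (fun x => (EG.const _).mul (H.EG_p x))]
        simp only [tl_smul]
      set pp : S → ℝ := fun x => H.tl n bb θ (fun θ => H.p θ x) with hpp
      have hpp0 : ∀ x, 0 ≤ pp x := fun x => by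
        have := H.tl_mono n bb θ continuous_const (EG.const 0) (H.continuous_p x) (H.EG_p x)
          fun θ => (H.p_pos θ x).le
        rwa [tl_const] at this
      have hpp1 : ∑ x, pp x = 1 := by
        simp only [hpp]
        rw [← H.tl_sum univ n bb θ (fun x => H.continuous_p x) (fun x => H.EG_p x)]
        simp only [p_sum, tl_const]
      have e3 : ∑ k, ((a' k + b' k) / 2 * H.tl n bb θ (H.dS n k))
          = H.tl n bb θ (fun θ => ∑ k, (a' k + b' k) / 2 * H.dS n k θ) := by
        rw [H.tl_sum univ n bb θ (fun k => (H.continuous_dS n k).const_mul _)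
          (fun k => (EG.const _).mul (H.EG_dS n k))]
        simp only [tl_smul]
      have e4 : H.tl n bb θ (fun θ => ∑ k, (a' k + b' k) / 2 * H.dS n k θ) ≤ (d + e1) / 2 := by
        rw [← H.tl_const n bb θ ((d + e1) / 2)]
        refine H.tl_mono n bb θ (by fun_prop) (EG.sum _ fun k _ => (EG.const _).mul (H.EG_dS n k))
          continuous_const (EG.const _) fun θ => ?_
        have e5 : ∑ k, (a' k + b' k) / 2 * H.dS n k θ
            = ∑ x, ∑ y, ((H.cv a' x x + H.cv b' x x) + (n - 1) * (H.cv a' x y + H.cv b' x y)) / 2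
              * (H.p θ x * H.p θ y) := by
          have e6 : ∀ k, H.dS n k θ = ∑ x, ∑ y, (H.A k x ^ 2 + (n - 1) * (H.A k x * H.A k y))
              * (H.p θ x * H.p θ y) := by
            intro k
            simp only [dS, add_mul, sum_add_distrib]
            congr 1
            · simp only [av]
              refine sum_congr rfl fun x _ => ?_
              rw [← mul_sum, ← mul_sum, p_sum, mul_one]
            · simp only [av]
              rw [sum_mul_sum, mul_sum]
              refine sum_congr rfl fun x _ => ?_
              rw [mul_sum]
              refine sum_congr rfl fun y _ => by ring
          simp only [e6, mul_sum]
          rw [sum_comm]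
          refine sum_congr rfl fun x _ => ?_
          rw [sum_comm]
          refine sum_congr rfl fun y _ => ?_
          simp only [cv, ← sum_add_distrib, mul_sum, sum_div, sum_mul]
          refine sum_congr rfl fun k _ => by ring
        rw [e5]
        calc _ ≤ ∑ x, ∑ y, (d + e1) / 2 * (H.p θ x * H.p θ y) := by
              refine sum_le_sum fun x _ => sum_le_sum fun y _ => ?_
              have := h0 x
              have := h1 x y
              refine mulR (by linarith)
                (mul_nonneg (H.p_pos θ x).le (H.p_pos θ y).le)
          _ = (d + e1) / 2 := by
              simp only [← mul_sum, p_sum, mul_one]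
      have e7 : -∑ k, n * a' k / 2 * (H.tl n bb θ (fun θ => H.av θ (H.A k)) *
            H.tl n bb θ (fun θ => H.av θ (H.A k))) ≤ e2 / 2 := by
        have : -∑ k, n * a' k / 2 * (H.tl n bb θ (fun θ => H.av θ (H.A k)) *
            H.tl n bb θ (fun θ => H.av θ (H.A k)))
            = ∑ x, ∑ y, (-n * H.cv a' x y) / 2 * (pp x * pp y) := by
          simp only [hA]
          simp only [sum_mul_sum]
          simp only [mul_sum]
          rw [← sum_neg_distrib]
          simp only [← sum_neg_distrib]
          rw [sum_comm]
          refine sum_congr rfl fun x _ => ?_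
          rw [sum_comm]
          refine sum_congr rfl fun y _ => ?_
          simp only [cv, mul_sum, sum_div, sum_mul]
          refine sum_congr rfl fun k _ => by ring
        rw [this]
        calc _ ≤ ∑ x, ∑ y, e2 / 2 * (pp x * pp y) := by
              refine sum_le_sum fun x _ => sum_le_sum fun y _ => ?_
              have := h2 x y
              refine mulR (by linarith) (mul_nonneg (hpp0 x) (hpp0 y))
          _ = e2 / 2 := by
              simp only [← mul_sum, hpp1, mul_one]
      rw [sum_sub_distrib, e3]
      linarith
    refine integral_le_const (fun w => hT _ _) ?_
    have hTc : ∀ {f : (K → ℝ) → ℝ}, Continuous f → EG f → Continuous fun w : K → ℝ =>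
        H.tl n (fun k => √(b k + s * b' k)) (fun k => √(a k + s * a' k) * w k) f := by
      intro f hc hE
      exact (H.continuous_tl n hc hE).comp (f := fun w : K → ℝ =>
        ((fun k => √(a k + s * a' k) * w k), (fun k => √(b k + s * b' k)))) (by fun_prop)
    have q1 := fun k => hTc (H.continuous_av (H.A k)) (H.EG_av (H.A k))
    have q2 := fun k => hTc (H.continuous_dS n k) (H.EG_dS n k)
    have p1 : ∀ k, EG _ := fun k => EG.bdd (f := fun w : K → ℝ => H.tl n (fun k => √(b k + s * b' k))
      (fun k => √(a k + s * a' k) * w k) (fun θ => H.av θ (H.A k))) _ fun w =>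
      H.tl_le n _ _ (H.continuous_av _) fun θ => H.abs_av_bnd θ _
    have p2 : ∀ k, EG _ := fun k => EG.bdd (f := fun w : K → ℝ => H.tl n (fun k => √(b k + s * b' k))
      (fun k => √(a k + s * a' k) * w k) (H.dS n k)) _ fun w =>
      H.tl_le n _ _ (H.continuous_dS n k) (H.abs_dS n k)
    refine EG.integrable (EG.sum _ fun k _ => ((EG.const _).mul (p2 k)).sub
      ((EG.const _).mul ((p1 k).mul (p1 k)))) (continuous_finsetSum _ fun k _ =>
      (continuous_const.mul (q2 k)).sub (continuous_const.mul ((q1 k).mul (q1 k))))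

/-- quenched free energy -/
def EL (a : K → ℝ) : ℝ := ∫ w, log (H.Z (fun k => √(a k) * w k)) ∂(gam K)

lemma continuous_EL : Continuous (fun a => H.EL a) := by
  have := (cont_int H.continuous_logZ H.EG_logZ).comp
    (g := fun p : (K → ℝ) × (K → ℝ) => _) (f := fun a : K → ℝ => ((0 : K → ℝ), fun k => √(a k)))
    (by fun_prop)
  simpa [Function.comp_def, EL] using this

lemma int_logZ (a : K → ℝ) : Integrable (fun w => log (H.Z (fun k => a k * w k))) (gam K) := by
  have := (H.EG_logZ.scale a 0).integrable (H.continuous_logZ.comp (by fun_prop : Continuous fun w : K → ℝ => fun k => (0 : K → ℝ) k + a k * w k))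
  simpa using this

lemma EL_deriv (a b : K → ℝ) (ha : ∀ k, 0 ≤ a k)
    (hab : ∀ k, 0 ≤ a k + b k) {s : ℝ} (hs : s ∈ Ioo (0:ℝ) 1) :
    HasDerivAt (fun s => H.EL (fun k => a k + s * b k))
      ((H.rep (Fin 2)).nu (fun k => a k + s * b k)
        (fun x => (H.cv b (x 0) (x 0) - H.cv b (x 0) (x 1)) / 2)) s := by
  have h := smart_path H.hasFDerivAt_logZ (fun k θ => H.hasDerivAt_av_update (H.A k) k θ)
    (fun k => H.continuous_av _) (fun k => H.continuous_d1 _ k) H.EG_logZ (fun k => H.EG_av _)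
    (fun k => H.EG_d1 _ k) a b ha hab hs 0
  simp only [Pi.zero_apply, zero_add] at h
  refine h.congr_deriv ?_
  have e : ∀ k θ, H.d1 (H.A k) k θ
      = (H.rep (Fin 2)).av θ (fun x => H.A k (x 0) * H.A k (x 0) - H.A k (x 0) * H.A k (x 1)) := by
    intro k θ
    have h2 := H.prod_av (ρ := Unit) (ι := Fin 2) θ ![fun x => H.A k (x ()), fun x => H.A k (x ())]
    have h3 := H.prod_av (ρ := Unit) (ι := Fin 2) θ ![fun x => H.A k (x ()) * H.A k (x ()), fun x => 1]
    have h4 : ∀ f : S → ℝ, (H.rep Unit).av θ (fun x => f (x ())) = H.av θ f := by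
      intro f
      simp only [av, rep_p]
      refine sum_equiv (Equiv.funUnique Unit S) _ _ fun x => by simp
    have h5 : ∀ f : (Fin 2 → S) → ℝ, (H.rep (Unit × Fin 2)).av θ (fun x => f (fun i => x ((), i)))
        = (H.rep (Fin 2)).av θ f := fun f =>
      H.av_inj (fun i : Fin 2 => ((), i)) (fun i j h => by simpa using h) θ f
    rw [av_sub, d1]
    simp only [Fin.prod_univ_two, Matrix.cons_val_zero, Matrix.cons_val_one, Matrix.cons_val_fin_one,
      mul_one, av_const, h4 (H.A k), h4 (fun x => H.A k x * H.A k x)] at h2 h3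
    rw [h2, h3, h5 (fun x => H.A k (x 0) * H.A k (x 1)), h5 (fun x => H.A k (x 0) * H.A k (x 0))]
  simp only [e]
  have e2 : (fun x : Fin 2 → S => (H.cv b (x 0) (x 0) - H.cv b (x 0) (x 1)) / 2)
      = fun x => ∑ k, b k / 2 * (H.A k (x 0) * H.A k (x 0) - H.A k (x 0) * H.A k (x 1)) := by
    ext x
    simp only [cv, ← sum_sub_distrib, sum_div]
    refine sum_congr rfl fun k _ => by ring
  rw [e2, nu_sum]
  simp only [nu_smul]
  rfl

lemma F_zero_in (n : ℝ) (hn : n ≠ 0) (a : K → ℝ) : H.F n a (fun _ => 0) = H.EL a := by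
  simp only [F, EL, P, sqrt_zero, zero_mul, add_zero, integral_const, probReal_univ, smul_eq_mul, one_mul, G, log_exp]
  congr 1; ext w; field_simp

lemma F_zero_out (n : ℝ) (hn : n ≠ 0) (b : K → ℝ) : H.F n (fun _ => 0) b
    = 1 / n * log (∫ w, exp (n * log (H.Z (fun k => √(b k) * w k))) ∂(gam K)) := by
  simp only [F, P, sqrt_zero, zero_mul, zero_add, integral_const, probReal_univ, smul_eq_mul, one_mul, G]

theorem conc (n : ℝ) (a : K → ℝ) (ha : ∀ k, 0 ≤ a k) {L : ℝ} (hL : ∀ x y, |H.cv a x y| ≤ L) :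
    ∫ w, exp (n * log (H.Z (fun k => √(a k) * w k))) ∂(gam K) ≤ exp (n * H.EL a + n ^ 2 * L / 2) := by
  by_cases hn : n = 0
  · subst hn; simp
  have hpos : 0 < ∫ w, exp (n * log (H.Z (fun k => √(a k) * w k))) ∂(gam K) := by
    have := H.P_pos n (fun k => √(a k)) 0
    simpa [P, G] using this
  rw [← log_le_iff_le_exp hpos]
  have hneg : ∀ x y, H.cv (fun k => - a k) x y = - H.cv a x y := by
    intro x y; simp only [cv, ← sum_neg_distrib]
    refine sum_congr rfl fun k _ => by ring
  rcases lt_or_gt_of_ne hn with h | h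
  · have key := H.GT_bound n hn (fun _ => 0) a a (fun k => - a k) (fun _ => le_rfl)
      (by simpa using ha) ha (by simp) (d := 0) (e1 := 0) (e2 := -n * L)
      (fun x => by rw [hneg]; linarith) (fun x y => by rw [hneg]; simp)
      (fun x y => mulL ((le_abs_self _).trans (hL x y)) (by linarith))
    simp only [zero_add, add_neg_cancel] at key
    rw [H.F_zero_in n hn, H.F_zero_out n hn] at key
    have k2 := mul_le_mul_of_nonpos_left key h.le
    have e : n * (H.EL a - 1 / n * log (∫ w, exp (n * log (H.Z (fun k => √(a k) * w k))) ∂(gam K)))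
      = n * H.EL a - log (∫ w, exp (n * log (H.Z (fun k => √(a k) * w k))) ∂(gam K)) := by
      field_simp
    rw [e] at k2
    nlinarith
  · have key := H.GT_bound n hn a (fun k => - a k) (fun _ => 0) a ha
      (by simp) (fun _ => le_rfl) (by simpa using ha) (d := 0) (e1 := 0) (e2 := n * L)
      (fun x => by rw [hneg]; linarith) (fun x y => by rw [hneg]; simp)
      (fun x y => by
        rw [hneg, neg_mul_neg]
        exact mulL ((le_abs_self _).trans (hL x y)) (by linarith))
    simp only [zero_add, add_neg_cancel] at key
    rw [H.F_zero_in n hn, H.F_zero_out n hn] at key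
    have k2 := mulL key h.le
    have e : n * (1 / n * log (∫ w, exp (n * log (H.Z (fun k => √(a k) * w k))) ∂(gam K)) - H.EL a)
      = log (∫ w, exp (n * log (H.Z (fun k => √(a k) * w k))) ∂(gam K)) - n * H.EL a := by
      field_simp
    rw [e] at k2
    nlinarith

end GS
end

section
section gram
variable {J K K' : Type} [Fintype J] [Fintype K] [Fintype K']

def lin (L : J → K → ℝ) (w : K → ℝ) (j : J) : ℝ := ∑ k, L j k * w k

@[fun_prop] lemma continuous_lin (L : J → K → ℝ) : Continuous (lin L) := by
  unfold lin; fun_prop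

lemma charFunDual_lin (L : J → K → ℝ) (ℓ : StrongDual ℝ (J → ℝ)) [DecidableEq J] :
    charFunDual ((gam K).map (lin L)) ℓ = Complex.exp (-((∑ i, ∑ j, ℓ (Pi.single i 1) * ℓ (Pi.single j 1)
      * ∑ k, L i k * L j k : ℝ) : ℂ) / 2) := by
  have h1 : ∀ w : K → ℝ, ℓ (lin L w) = ∑ k, (∑ j, ℓ (Pi.single j 1) * L j k) * w k := by
    intro w
    have h2 : lin L w = ∑ j, lin L w j • (Pi.single j (1:ℝ) : J → ℝ) := by
      ext i; simp [Finset.sum_apply, Pi.single_apply]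
    rw [h2, map_sum]
    simp only [map_smul, smul_eq_mul, lin, sum_mul]
    rw [sum_comm]
    refine sum_congr rfl fun k _ => sum_congr rfl fun j _ => by ring
  rw [charFunDual_apply, integral_map (by fun_prop) (by
    refine Continuous.aestronglyMeasurable ?_
    fun_prop)]
  have h3 : ∀ w : K → ℝ, Complex.exp ((ℓ (lin L w) : ℂ) * Complex.I)
      = ∏ k, Complex.exp (((∑ j, ℓ (Pi.single j 1) * L j k : ℝ) : ℂ) * (w k : ℂ) * Complex.I) := by
    intro w
    rw [h1, ← Complex.exp_sum]
    push_cast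
    rw [sum_mul]
  simp only [h3]
  rw [integral_fintype_prod_eq_prod (fun k (x : ℝ) => Complex.exp (((∑ j, ℓ (Pi.single j 1) * L j k : ℝ) : ℂ) * (x : ℂ) * Complex.I))]
  simp only [← charFun_apply_real, charFun_gaussianReal]
  rw [← Complex.exp_sum]
  congr 1
  simp only [Complex.ofReal_zero, mul_zero, zero_mul, zero_sub, NNReal.coe_one, Complex.ofReal_one, one_mul]
  rw [sum_neg_distrib, ← sum_div, neg_div]
  congr 2
  have hr : (∑ k, (∑ j, ℓ (Pi.single j 1) * L j k) ^ 2 : ℝ) = ∑ i, ∑ j, ℓ (Pi.single i 1) * ℓ (Pi.single j 1)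
      * ∑ k, L i k * L j k := by
    simp only [sq, sum_mul_sum]
    simp only [mul_sum]
    rw [sum_comm]
    refine sum_congr rfl fun i _ => ?_
    rw [sum_comm]
    refine sum_congr rfl fun j _ => sum_congr rfl fun k _ => by ring
  rw [← hr]
  push_cast
  rfl

/-- Gaussian vectors with the same Gram matrices have the same law -/
theorem gram_law (L : J → K → ℝ) (L' : J → K' → ℝ)
    (h : ∀ i j, ∑ k, L i k * L j k = ∑ k, L' i k * L' j k) :
    (gam K).map (lin L) = (gam K').map (lin L') := by
  classical
  have : IsProbabilityMeasure ((gam K).map (lin L)) :=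
    Measure.isProbabilityMeasure_map (by fun_prop)
  have : IsProbabilityMeasure ((gam K').map (lin L')) :=
    Measure.isProbabilityMeasure_map (by fun_prop)
  refine Measure.ext_of_charFunDual (funext fun ℓ => ?_)
  rw [charFunDual_lin, charFunDual_lin]
  simp only [h]

theorem gram_int (L : J → K → ℝ) (L' : J → K' → ℝ)
    (h : ∀ i j, ∑ k, L i k * L j k = ∑ k, L' i k * L' j k) {f : (J → ℝ) → ℝ} (hf : Continuous f) :
    ∫ w, f (lin L w) ∂(gam K) = ∫ w, f (lin L' w) ∂(gam K') := by
  have h1 := integral_map (μ := gam K) (φ := lin L) (by fun_prop) (hf.aestronglyMeasurable)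
  have h2 := integral_map (μ := gam K') (φ := lin L') (by fun_prop) (hf.aestronglyMeasurable)
  rw [← h1, ← h2, gram_law L L' h]

end gram

/-- independence of blocks -/
lemma int_indep {K : Type} [Fintype K] (p : K → Prop) (f : ({k // p k} → ℝ) → ℝ)
    (g : ({k // ¬ p k} → ℝ) → ℝ) :
    ∫ w, f (fun k => w k) * g (fun k => w k) ∂(gam K)
      = (∫ w, f (fun k => w k) ∂(gam K)) * ∫ w, g (fun k => w k) ∂(gam K) := by
  classical
  have hm := measurePreserving_piEquivPiSubtypeProd (fun _ : K => g1) p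
  have h := fun (F : ({k // p k} → ℝ) × ({k // ¬ p k} → ℝ) → ℝ) => hm.integral_comp' (g := F)
  have h1 := h (fun z : ({k // p k} → ℝ) × ({k // ¬ p k} → ℝ) => f z.1 * g z.2)
  have h2 := h (fun z : ({k // p k} → ℝ) × ({k // ¬ p k} → ℝ) => f z.1 * 1)
  have h3 := h (fun z : ({k // p k} → ℝ) × ({k // ¬ p k} → ℝ) => 1 * g z.2)
  rw [integral_prod_mul] at h1
  rw [integral_prod_mul (μ := Measure.pi fun _ : {k // p k} => g1) (ν := Measure.pi fun _ : {k // ¬ p k} => g1) f (fun _ => (1:ℝ))] at h2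
  rw [integral_prod_mul (μ := Measure.pi fun _ : {k // p k} => g1) (ν := Measure.pi fun _ : {k // ¬ p k} => g1) (fun _ => (1:ℝ)) g] at h3
  simp only [integral_const, probReal_univ, smul_eq_mul, mul_one, one_mul] at h2 h3
  rw [← h2, ← h3] at h1
  exact h1
end

section
/-! ### one dimensional analysis -/

def sp (b : Bool) : ℝ := if b then 1 else -1
lemma sp_sq (b : Bool) : sp b ^ 2 = 1 := by cases b <;> simp [sp]
lemma sp_mul_self (b : Bool) : sp b * sp b = 1 := by cases b <;> simp [sp]
lemma abs_sp (b : Bool) : |sp b| = 1 := by cases b <;> simp [sp]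

def S1 (μ : ℝ) : GS Unit Bool where
  c b := μ * sp b
  A _ b := sp b

lemma int_unit (f : ℝ → ℝ) : ∫ w, f (w ()) ∂(gam Unit) = ∫ t, f t ∂g1 := by
  have h := measurePreserving_funUnique g1 Unit
  exact h.integral_comp' (g := f)

lemma S1_Z (μ : ℝ) (θ : Unit → ℝ) : (S1 μ).Z θ = 2 * cosh (μ + θ ()) := by
  simp [GS.Z, GS.ew, S1, sp, cosh_eq]
  ring_nf

lemma S1_av (μ : ℝ) (θ : Unit → ℝ) : (S1 μ).av θ sp = tanh (μ + θ ()) := by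
  rw [GS.av_eq, S1_Z, tanh_eq_sinh_div_cosh]
  simp [GS.ew, S1, sp, sinh_eq]
  have := (cosh_pos (μ + θ ())).ne'
  field_simp
  ring_nf

def lc (x : ℝ) : ℝ := log (2 * cosh x)
@[fun_prop] lemma continuous_lc : Continuous lc := by
  unfold lc
  exact (continuous_const.mul continuous_cosh).log fun x => (mul_pos two_pos (cosh_pos x)).ne'

lemma lc_nonneg (x : ℝ) : 0 ≤ lc x := log_nonneg (by have := one_le_cosh x; linarith)
lemma lc_le (x : ℝ) : lc x ≤ log 2 + |x| := by
  unfold lc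
  rw [log_mul (by norm_num) (cosh_pos x).ne']
  have : cosh x ≤ exp |x| := by
    rw [← cosh_abs, cosh_eq]
    have : exp (-|x|) ≤ exp |x| := exp_le_exp.2 (by linarith [abs_nonneg x])
    linarith
  have h2 := log_le_log (cosh_pos x) this
  rw [log_exp] at h2
  linarith

lemma hasDerivAt_lc (x : ℝ) : HasDerivAt lc (tanh x) x := by
  have := ((hasDerivAt_cosh x).const_mul 2).log (by have := cosh_pos x; positivity)
  refine this.congr_deriv ?_
  rw [tanh_eq_sinh_div_cosh, mul_div_mul_left _ _ (by norm_num)]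

lemma hasDerivAt_tanh (x : ℝ) : HasDerivAt tanh (1 - tanh x ^ 2) x := by
  have h := (hasDerivAt_sinh x).fun_div (hasDerivAt_cosh x) (cosh_pos x).ne'
  refine (h.congr_deriv ?_).congr_of_eventuallyEq (Eventually.of_forall fun y => tanh_eq_sinh_div_cosh y)
  rw [tanh_eq_sinh_div_cosh]
  have := (cosh_pos x).ne'
  field_simp

lemma tanh_sq_le (x : ℝ) : tanh x ^ 2 ≤ 1 := by
  rw [tanh_eq_sinh_div_cosh, div_pow, div_le_one (by have := cosh_pos x; positivity)]
  have := cosh_sq x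
  linarith

lemma abs_tanh_le (x : ℝ) : |tanh x| ≤ 1 := abs_le_one_iff_mul_self_le_one.2 (by
  have := tanh_sq_le x; nlinarith)

@[fun_prop] lemma continuous_tanh' : Continuous tanh :=
  continuous_iff_continuousAt.2 fun x => (hasDerivAt_tanh x).continuousAt

def wt (m x : ℝ) : ℝ := exp (m * lc x)
lemma wt_pos (m x : ℝ) : 0 < wt m x := exp_pos _

def U (m b θ : ℝ) (f : ℝ → ℝ) : ℝ := ∫ y, f (θ + b * y) * wt m (θ + b * y) ∂g1
def PP (m b θ : ℝ) : ℝ := ∫ y, wt m (θ + b * y) ∂g1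
def T1 (m b θ : ℝ) (f : ℝ → ℝ) : ℝ := U m b θ f / PP m b θ

lemma wt_le {M m b θ : ℝ} (hm : |m| ≤ M) (hb : |b| ≤ M) (hθ : |θ| ≤ M) (y : ℝ) :
    wt m (θ + b * y) ≤ exp (M * (log 2 + M)) * exp (M * M * |y|) := by
  have hM : 0 ≤ M := (abs_nonneg m).trans hm
  unfold wt
  rw [← exp_add]
  refine exp_le_exp.2 ?_
  have h1 : |θ + b * y| ≤ M + M * |y| := by
    refine (abs_add_le _ _).trans (add_le_add hθ ?_)
    rw [abs_mul]
    exact mulR hb (abs_nonneg _)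
  calc m * lc (θ + b * y) ≤ M * lc (θ + b * y) :=
        mulR ((le_abs_self m).trans hm) (lc_nonneg _)
    _ ≤ M * (log 2 + (M + M * |y|)) := mulL ((lc_le _).trans (by linarith)) hM
    _ = _ := by ring

lemma cont_U {f : ℝ → ℝ} (hf : Continuous f) {C : ℝ} (hC : ∀ x, |f x| ≤ C) :
    Continuous (fun p : ℝ × ℝ × ℝ => U p.1 p.2.1 p.2.2 f) := by
  rw [continuous_iff_continuousAt]
  intro p
  have hC0 : 0 ≤ C := (abs_nonneg _).trans (hC 0)
  set M := ‖p‖ + 1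
  unfold U
  refine continuousAt_of_dominated (bound := fun y => C * (exp (M * (log 2 + M)) * exp (M * M * |y|)))
    ?_ ?_ ?_ ?_
  · refine Eventually.of_forall fun q => Continuous.aestronglyMeasurable ?_
    unfold wt; fun_prop
  · have : Metric.ball p 1 ∈ nhds p := Metric.ball_mem_nhds p one_pos
    filter_upwards [this] with q hq
    refine ae_of_all _ fun y => ?_
    have hq' : ‖q‖ ≤ M := by
      rw [Metric.mem_ball, dist_eq_norm] at hq
      have := norm_le_norm_add_norm_sub' q p
      simp only [M]; linarith
    have e1 : |q.1| ≤ M := (norm_fst_le q).trans hq'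
    have e2 : ‖q.2‖ ≤ M := (norm_snd_le q).trans hq'
    have e3 : |q.2.1| ≤ M := (norm_fst_le q.2).trans e2
    have e4 : |q.2.2| ≤ M := (norm_snd_le q.2).trans e2
    rw [norm_mul, norm_eq_abs, norm_eq_abs, abs_of_pos (wt_pos _ _)]
    exact mul_le_mul (hC _) (wt_le e1 e3 e4 y) (wt_pos _ _).le hC0
  · exact ((integrable_expabs (M * M)).const_mul _).const_mul _
  · refine ae_of_all _ fun y => Continuous.continuousAt ?_
    unfold wt; fun_prop

lemma PP_eq (m b θ : ℝ) : PP m b θ = U m b θ (fun _ => 1) := by simp [PP, U]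

lemma int_U (m b θ : ℝ) {f : ℝ → ℝ} (hf : Continuous f) {C : ℝ} (hC : ∀ x, |f x| ≤ C) :
    Integrable (fun y => f (θ + b * y) * wt m (θ + b * y)) g1 := by
  set M := |m| + |b| + |θ|
  have e1 := abs_nonneg m
  have e2 := abs_nonneg b
  have e3 := abs_nonneg θ
  have hC0 : 0 ≤ C := (abs_nonneg _).trans (hC 0)
  refine (((integrable_expabs (M * M)).const_mul (exp (M * (log 2 + M)))).const_mul C).mono'
    (Continuous.aestronglyMeasurable (by unfold wt; fun_prop)) (ae_of_all _ fun y => ?_)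
  rw [norm_mul, norm_eq_abs, norm_eq_abs, abs_of_pos (wt_pos _ _)]
  exact mul_le_mul (hC _) (wt_le (by simp only [M]; linarith) (by simp only [M]; linarith)
    (by simp only [M]; linarith) y) (wt_pos _ _).le hC0

lemma int_PP (m b θ : ℝ) : Integrable (fun y => wt m (θ + b * y)) g1 := by
  simpa using int_U m b θ (f := fun _ => 1) continuous_const (C := 1) (by simp)

lemma PP_pos (m b θ : ℝ) : 0 < PP m b θ :=
  (integral_pos_iff_support_of_nonneg (fun y => (wt_pos _ _).le) (int_PP m b θ)).2 (by
    rw [Function.support_eq_univ (fun y => (wt_pos _ _).ne')]; simp)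

lemma abs_T1 (m b θ : ℝ) {f : ℝ → ℝ} (hf : Continuous f) {C : ℝ} (hC : ∀ x, |f x| ≤ C) :
    |T1 m b θ f| ≤ C := by
  unfold T1
  rw [abs_div, abs_of_pos (PP_pos m b θ), div_le_iff₀ (PP_pos m b θ)]
  unfold U PP
  rw [← integral_const_mul]
  refine (abs_integral_le_integral_abs).trans (integral_mono (int_U m b θ hf hC).abs ((int_PP m b θ).const_mul C) fun y => ?_)
  simp only [abs_mul, abs_of_pos (wt_pos _ _)]
  exact mulR (hC _) (wt_pos _ _).le

lemma cont_T1 {f : ℝ → ℝ} (hf : Continuous f) {C : ℝ} (hC : ∀ x, |f x| ≤ C) :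
    Continuous (fun p : ℝ × ℝ × ℝ => T1 p.1 p.2.1 p.2.2 f) := by
  unfold T1
  refine (cont_U hf hC).div ?_ fun p => (PP_pos _ _ _).ne'
  simp only [PP_eq]
  exact cont_U continuous_const (C := 1) (by simp)

/-- bounded joint continuity after averaging -/
lemma cont_avg {X : Type} [TopologicalSpace X] [FirstCountableTopology X] {g : X → ℝ → ℝ}
    (hg : Continuous (fun p : X × ℝ => g p.1 p.2)) {C : ℝ} (hC : ∀ x y, |g x y| ≤ C) :
    Continuous (fun x => ∫ w, g x w ∂g1) := by
  refine continuous_of_dominated (bound := fun _ => C) (fun x => Continuous.aestronglyMeasurable (by fun_prop))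
    (fun x => ae_of_all _ fun y => hC x y) (integrable_const _) (ae_of_all _ fun y => by fun_prop)
end

section
lemma sp1 {φ φ1 φ2 : ℝ → ℝ} (h1 : ∀ x, HasDerivAt φ (φ1 x) x) (h2 : ∀ x, HasDerivAt φ1 (φ2 x) x)
    (hc2 : Continuous φ2) (C D : ℝ) (hE : ∀ x, |φ x| ≤ C * exp (D * |x|))
    (hE1 : ∀ x, |φ1 x| ≤ C * exp (D * |x|)) (hE2 : ∀ x, |φ2 x| ≤ C * exp (D * |x|))
    (a b : ℝ) (ha : 0 ≤ a) (hab : 0 ≤ a + b) {s : ℝ} (hs : s ∈ Ioo (0:ℝ) 1) (θ : ℝ) :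
    HasDerivAt (fun s => ∫ y, φ (θ + √(a + s * b) * y) ∂g1)
      (b / 2 * ∫ y, φ2 (θ + √(a + s * b) * y) ∂g1) s := by
  have hc1 : Continuous φ1 := continuous_iff_continuousAt.2 fun x => (h2 x).continuousAt
  have eg : ∀ f : ℝ → ℝ, (∀ x, |f x| ≤ C * exp (D * |x|)) → EG (fun w : Unit → ℝ => f (w ())) :=
    fun f h => EG.of_exp C D fun w => by simpa using h (w ())
  have key := smart_path (K := Unit) (φ := fun w => φ (w ())) (φ1 := fun _ w => φ1 (w ()))
    (φ2 := fun _ w => φ2 (w ())) (fun θ => by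
      have e1 : HasFDerivAt (fun w : Unit → ℝ => w ()) (ContinuousLinearMap.proj () : (Unit → ℝ) →L[ℝ] ℝ) θ :=
        (ContinuousLinearMap.proj () : (Unit → ℝ) →L[ℝ] ℝ).hasFDerivAt
      have := (h1 (θ ())).comp_hasFDerivAt θ e1
      refine this.congr_fderiv ?_
      ext v
      simp [dif_apply])
    (fun k θ => by simpa using h2 (θ ()))
    (fun _ => by fun_prop) (fun _ => by fun_prop) (eg _ hE) (fun _ => eg _ hE1) (fun _ => eg _ hE2)
    (fun _ => a) (fun _ => b) (fun _ => ha) (fun _ => hab) hs (fun _ => θ)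
  simp only [univ_unique, sum_singleton] at key
  rw [int_unit (fun y => φ2 (θ + √(a + s * b) * y))] at key
  refine key.congr_of_eventuallyEq (Eventually.of_forall fun t => ?_)
  exact (int_unit (fun y => φ (θ + √(a + t * b) * y))).symm

lemma hasDerivAt_fwt (m : ℝ) {f f1 : ℝ → ℝ} {x : ℝ} (h : HasDerivAt f (f1 x) x) :
    HasDerivAt (fun x => f x * wt m x) ((f1 x + m * (tanh x * f x)) * wt m x) x := by
  have h2 : HasDerivAt (fun x => wt m x) (wt m x * (m * tanh x)) x :=
    ((hasDerivAt_lc x).const_mul m).exp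
  refine (h.fun_mul h2).congr_deriv (by ring)

/-- derivative of weighted averages along the variance -/
lemma U_deriv (m : ℝ) {f f1 f2 : ℝ → ℝ} (h1 : ∀ x, HasDerivAt f (f1 x) x)
    (h2 : ∀ x, HasDerivAt f1 (f2 x) x) (hc2 : Continuous f2) (C : ℝ)
    (hf : ∀ x, |f x| ≤ C) (hf1 : ∀ x, |f1 x| ≤ C) (hf2 : ∀ x, |f2 x| ≤ C)
    (a : ℝ) (ha : 0 ≤ a) {s : ℝ} (hs : s ∈ Ioo (0:ℝ) 1) (θ : ℝ) :
    HasDerivAt (fun s => U m √(s * a) θ f)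
      (a / 2 * U m √(s * a) θ (fun x => f2 x + 2 * m * (tanh x * f1 x)
        + m * (1 - tanh x ^ 2) * f x + m ^ 2 * (tanh x ^ 2 * f x))) s := by
  have hC : 0 ≤ C := (abs_nonneg _).trans (hf 0)
  have hw : ∀ x, wt m x ≤ exp (|m| * log 2) * exp (|m| * |x|) := by
    intro x
    have := wt_le (M := |m|) (m := m) (b := 0) (θ := 0) le_rfl (by simp) (by simp)
    rw [← exp_add]
    refine exp_le_exp.2 ?_
    calc m * lc x ≤ |m| * lc x := mulR (le_abs_self m) (lc_nonneg _)
      _ ≤ |m| * (log 2 + |x|) := mulL (lc_le _) (abs_nonneg _)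
      _ = _ := by ring
  have hb : ∀ (g : ℝ → ℝ), (∀ x, |g x| ≤ (1 + 3 * |m| + m ^ 2) * C) → ∀ x, |g x * wt m x| ≤
      ((1 + 3 * |m| + m ^ 2) * C * exp (|m| * log 2)) * exp (|m| * |x|) := by
    intro g hg x
    rw [abs_mul, abs_of_pos (wt_pos m x), mul_assoc]
    exact mul_le_mul (hg x) (hw x) (wt_pos _ _).le (by positivity)
  have hcf : Continuous f := continuous_iff_continuousAt.2 fun x => (h1 x).continuousAt
  have hcf1 : Continuous f1 := continuous_iff_continuousAt.2 fun x => (h2 x).continuousAt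
  have bm : ∀ x y : ℝ, |y| ≤ C → |tanh x * y| ≤ C := fun x y hy => by
    rw [abs_mul]; nlinarith [abs_tanh_le x, abs_nonneg (tanh x), abs_nonneg y]
  have bq : ∀ x y : ℝ, |y| ≤ C → |tanh x ^ 2 * y| ≤ C := fun x y hy => by
    have := bm x _ (bm x y hy)
    rwa [← mul_assoc, ← sq] at this
  have bq' : ∀ x y : ℝ, |y| ≤ C → |(1 - tanh x ^ 2) * y| ≤ C := fun x y hy => by
    rw [abs_mul, abs_of_nonneg (by linarith [tanh_sq_le x])]
    nlinarith [tanh_sq_le x, sq_nonneg (tanh x), abs_nonneg y]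
  have hm0 := abs_nonneg m
  have key := sp1 (φ := fun x => f x * wt m x)
    (φ1 := fun x => (f1 x + m * (tanh x * f x)) * wt m x)
    (φ2 := fun x => (f2 x + 2 * m * (tanh x * f1 x)
        + m * (1 - tanh x ^ 2) * f x + m ^ 2 * (tanh x ^ 2 * f x)) * wt m x)
    (fun x => hasDerivAt_fwt m (h1 x)) (fun x => by
      refine (hasDerivAt_fwt m (f := fun x => f1 x + m * (tanh x * f x))
        (f1 := fun x => f2 x + m * ((1 - tanh x ^ 2) * f x + tanh x * f1 x))
        ((h2 x).fun_add (((hasDerivAt_tanh x).fun_mul (h1 x)).const_mul m))).congr_deriv ?_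
      ring)
    (by unfold wt; fun_prop) _ _ (hb f fun x => (hf x).trans (by nlinarith [sq_nonneg m]))
    (hb _ fun x => by
      refine (abs_add_le _ _).trans ?_
      rw [abs_mul]
      have e1 := bm x _ (hf x)
      have e2 := hf1 x
      have := mulL e1 hm0
      nlinarith [sq_nonneg m])
    (hb _ fun x => by
      have e1 := mulL (bm x _ (hf1 x)) hm0
      have e2 := mulL (bq' x _ (hf x)) hm0
      have e3 := mulL (bq x _ (hf x)) (sq_nonneg m)
      have e4 := hf2 x
      rw [← abs_mul] at e1 e2
      rw [← abs_of_nonneg (sq_nonneg m), ← abs_mul, abs_of_nonneg (sq_nonneg m)] at e3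
      rw [abs_le] at *
      constructor <;> nlinarith)
    0 a le_rfl (by linarith) hs θ
  simp only [zero_add] at key
  exact key

def tq (x : ℝ) : ℝ := tanh x ^ 2
def tf (x : ℝ) : ℝ := tanh x ^ 4
@[fun_prop] lemma continuous_tq : Continuous tq := by unfold tq; fun_prop
@[fun_prop] lemma continuous_tf : Continuous tf := by unfold tf; fun_prop
lemma abs_tq (x : ℝ) : |tq x| ≤ 1 := by
  unfold tq; rw [abs_of_nonneg (sq_nonneg _)]; exact tanh_sq_le x
lemma abs_tf (x : ℝ) : |tf x| ≤ 1 := by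
  unfold tf; rw [abs_of_nonneg (by positivity)]
  have := tanh_sq_le x
  have := sq_nonneg (tanh x)
  nlinarith

def Zt (m b θ : ℝ) : ℝ := (2 + (5 * m - 8) * T1 m b θ tq + (m ^ 2 - 5 * m + 6) * T1 m b θ tf
  - m * T1 m b θ tq - (m ^ 2 - m) * (T1 m b θ tq * T1 m b θ tq)) / 2

lemma U_add (m b θ : ℝ) {f g : ℝ → ℝ} (hf : Continuous f) (hg : Continuous g) {C : ℝ}
    (hC : ∀ x, |f x| ≤ C) (hC' : ∀ x, |g x| ≤ C) (x y z : ℝ) :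
    U m b θ (fun t => x + y * f t + z * g t) = x * PP m b θ + y * U m b θ f + z * U m b θ g := by
  unfold U PP
  have h1 := int_PP m b θ
  have h2 := int_U m b θ hf hC
  have h3 := int_U m b θ hg hC'
  have h12 : Integrable (fun t => x * wt m (θ + b * t) + y * (f (θ + b * t) * wt m (θ + b * t))) g1 :=
    (h1.const_mul x).add (h2.const_mul y)
  rw [← integral_const_mul, ← integral_const_mul, ← integral_const_mul, ← integral_add (h1.const_mul x) (h2.const_mul y),
    ← integral_add h12 (h3.const_mul z)]
  congr 1
  ext t
  ring

lemma T1_deriv (m : ℝ) (a : ℝ) (ha : 0 ≤ a) {s : ℝ} (hs : s ∈ Ioo (0:ℝ) 1) (θ : ℝ) :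
    HasDerivAt (fun s => T1 m √(s * a) θ tq) (a * Zt m √(s * a) θ) s := by
  have d0 : ∀ x, HasDerivAt tq (2 * (tanh x * (1 - tanh x ^ 2))) x := fun x => by
    refine ((hasDerivAt_tanh x).fun_pow 2).congr_deriv ?_
    norm_num; ring
  have d1 : ∀ x, HasDerivAt (fun x => 2 * (tanh x * (1 - tanh x ^ 2)))
      (2 * ((1 - tanh x ^ 2) * (1 - 3 * tanh x ^ 2))) x := fun x => by
    refine (((hasDerivAt_tanh x).fun_mul (((hasDerivAt_tanh x).fun_pow 2).const_sub 1)).const_mul 2).congr_deriv ?_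
    norm_num; ring
  have b1 : ∀ x, |2 * (tanh x * (1 - tanh x ^ 2))| ≤ 4 := fun x => by
    have := abs_le.1 (abs_tanh_le x)
    have := tanh_sq_le x
    have h0 := sq_nonneg (tanh x)
    rw [abs_le]; constructor <;> nlinarith
  have b2 : ∀ x, |2 * ((1 - tanh x ^ 2) * (1 - 3 * tanh x ^ 2))| ≤ 4 := fun x => by
    have := tanh_sq_le x
    have h0 := sq_nonneg (tanh x)
    rw [abs_le]; constructor <;> nlinarith
  have hU := U_deriv m d0 d1 (by fun_prop) 4 (fun x => (abs_tq x).trans (by norm_num)) b1 b2 a ha hs θ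
  have hP := U_deriv m (f := fun _ => 1) (f1 := fun _ => 0) (f2 := fun _ => 0)
    (fun x => hasDerivAt_const _ _) (fun x => hasDerivAt_const _ _) continuous_const 1 (by simp) (by simp) (by simp) a ha hs θ
  have e1 : (fun x => 2 * ((1 - tanh x ^ 2) * (1 - 3 * tanh x ^ 2)) + 2 * m * (tanh x * (2 * (tanh x * (1 - tanh x ^ 2))))
      + m * (1 - tanh x ^ 2) * tq x + m ^ 2 * (tanh x ^ 2 * tq x))
      = fun x => 2 + (5 * m - 8) * tq x + (m ^ 2 - 5 * m + 6) * tf x := by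
    ext x; unfold tq tf; ring
  have e2 : (fun x => (0:ℝ) + 2 * m * (tanh x * 0) + m * (1 - tanh x ^ 2) * 1 + m ^ 2 * (tanh x ^ 2 * 1))
      = fun x => m + (m ^ 2 - m) * tq x + 0 * tf x := by
    ext x; unfold tq tf; ring
  rw [e1, U_add m _ θ continuous_tq continuous_tf abs_tq abs_tf] at hU
  rw [e2, U_add m _ θ continuous_tq continuous_tf abs_tq abs_tf] at hP
  simp only [← PP_eq] at hP
  refine (hU.fun_div hP (PP_pos _ _ _).ne').congr_deriv ?_
  have := (PP_pos m √(s * a) θ).ne'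
  unfold Zt T1
  generalize PP m √(s * a) θ = pp at *
  generalize U m √(s * a) θ tq = uu at *
  generalize U m √(s * a) θ tf = ff at *
  field_simp
  ring

lemma abs_Zt (m b θ : ℝ) : |Zt m b θ| ≤ (2 + |5 * m - 8| + |m ^ 2 - 5 * m + 6| + |m| + |m ^ 2 - m|) / 2 := by
  have h1 := abs_T1 m b θ continuous_tq abs_tq
  have h2 := abs_T1 m b θ continuous_tf abs_tf
  unfold Zt
  rw [abs_div, abs_two]
  gcongr
  have h3 : |T1 m b θ tq * T1 m b θ tq| ≤ 1 := by rw [abs_mul]; nlinarith [abs_nonneg (T1 m b θ tq)]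
  have f : ∀ x y : ℝ, |y| ≤ 1 → |x * y| ≤ |x| := fun x y hy => by
    rw [abs_mul]; nlinarith [abs_nonneg x]
  refine (abs_sub _ _).trans (add_le_add ((abs_sub _ _).trans (add_le_add ((abs_add_le _ _).trans (add_le_add
    ((abs_add_le _ _).trans (add_le_add (by simp) (f _ _ h1))) (f _ _ h2))) (f _ _ h1))) (f _ _ h3))

def tau (μ v m s : ℝ) : ℝ := ∫ w, T1 m √s (μ + √v * w) tq ∂g1
def zeta (μ v m s : ℝ) : ℝ := ∫ w, Zt m √s (μ + √v * w) ∂g1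

lemma cT1 {f : ℝ → ℝ} (hf : Continuous f) {C : ℝ} (hC : ∀ x, |f x| ≤ C) (μ v : ℝ) :
    Continuous (fun p : (ℝ × ℝ) × ℝ => T1 p.1.1 √p.1.2 (μ + √v * p.2) f) :=
  (cont_T1 hf hC).comp (f := fun p : (ℝ × ℝ) × ℝ => (p.1.1, √p.1.2, μ + √v * p.2)) (by fun_prop)

lemma cont_tau (μ v : ℝ) : Continuous (fun p : ℝ × ℝ => tau μ v p.1 p.2) := by
  unfold tau
  exact cont_avg (g := fun (p : ℝ × ℝ) w => T1 p.1 √p.2 (μ + √v * w) tq) (cT1 continuous_tq abs_tq μ v)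
    (fun p w => abs_T1 _ _ _ continuous_tq abs_tq)

lemma cont_zeta (μ v : ℝ) : Continuous (fun p : ℝ × ℝ => zeta μ v p.1 p.2) := by
  unfold zeta
  have c1 := cT1 continuous_tq abs_tq μ v
  have c2 := cT1 continuous_tf abs_tf μ v
  have hg : Continuous (fun p : (ℝ × ℝ) × ℝ => Zt p.1.1 √p.1.2 (μ + √v * p.2)) := by
    unfold Zt
    fun_prop
  rw [continuous_iff_continuousAt]
  intro p
  refine continuousAt_of_dominated (F := fun (p : ℝ × ℝ) w => Zt p.1 √p.2 (μ + √v * w)) (bound := fun _ =>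
    (2 + |5 * p.1 - 8| + |p.1 ^ 2 - 5 * p.1 + 6| + |p.1| + |p.1 ^ 2 - p.1|) / 2 + 1)
    (Eventually.of_forall fun q => Continuous.aestronglyMeasurable
      (hg.comp (f := fun w => (q, w)) (by fun_prop))) ?_ (integrable_const _)
    (ae_of_all _ fun y => (hg.comp (f := fun q => (q, y)) (by fun_prop)).continuousAt)
  have hcc : Continuous (fun p : ℝ × ℝ => (2 + |5 * p.1 - 8| + |p.1 ^ 2 - 5 * p.1 + 6| + |p.1| + |p.1 ^ 2 - p.1|) / 2) := by
    fun_prop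
  have := (hcc.tendsto p).eventually_lt_const (lt_add_one _)
  filter_upwards [this] with q hq
  exact ae_of_all _ fun w => (abs_Zt _ _ _).trans hq.le

lemma tau_deriv (μ v m : ℝ) (a : ℝ) (ha : 0 ≤ a) {s : ℝ} (hs : s ∈ Ioo (0:ℝ) 1) :
    HasDerivAt (fun s => tau μ v m (s * a)) (a * zeta μ v m (s * a)) s := by
  have key := hasDerivAt_integral_of_dominated_loc_of_deriv_le (μ := g1) (s := Ioo (0:ℝ) 1) (x₀ := s)
    (F := fun s w => T1 m √(s * a) (μ + √v * w) tq)
    (F' := fun s w => a * Zt m √(s * a) (μ + √v * w))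
    (bound := fun _ => a * ((2 + |5 * m - 8| + |m ^ 2 - 5 * m + 6| + |m| + |m ^ 2 - m|) / 2))
    (Ioo_mem_nhds hs.1 hs.2)
    (Eventually.of_forall fun t => Continuous.aestronglyMeasurable
      ((cT1 continuous_tq abs_tq μ v).comp (f := fun w => ((m, t * a), w)) (by fun_prop)))
    ((integrable_const (1:ℝ)).mono' (Continuous.aestronglyMeasurable
      ((cT1 continuous_tq abs_tq μ v).comp (f := fun w => ((m, s * a), w)) (by fun_prop)))
      (ae_of_all _ fun w => abs_T1 _ _ _ continuous_tq abs_tq))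
    (Continuous.aestronglyMeasurable (by
      have c1 := ((cT1 continuous_tq abs_tq μ v).comp (f := fun w => ((m, s * a), w)) (by fun_prop))
      have c2 := ((cT1 continuous_tf abs_tf μ v).comp (f := fun w => ((m, s * a), w)) (by fun_prop))
      simp only [Function.comp_def] at c1 c2
      unfold Zt
      fun_prop))
    (ae_of_all _ fun w t ht => by
      rw [norm_eq_abs, abs_mul, abs_of_nonneg ha]
      exact mulL (abs_Zt _ _ _) ha)
    (integrable_const _)
    (ae_of_all _ fun w t ht => T1_deriv m a ha ht _)
  refine key.2.congr_deriv ?_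
  rw [zeta, integral_const_mul]
end

section
def FF (μ v m a : ℝ) : ℝ := ∫ w, 1 / m * log (PP m √a (μ + √v * w)) ∂g1

lemma S1_P (μ m b θ : ℝ) : (S1 μ).P m (fun _ => b) (fun _ => θ) = PP m b (μ + θ) := by
  unfold GS.P PP GS.G wt lc
  simp only [S1_Z]
  rw [int_unit (fun y => exp (m * log (2 * cosh (μ + (θ + b * y)))))]
  simp only [add_assoc]

lemma S1_F (μ v m a : ℝ) : (S1 μ).F m (fun _ => v) (fun _ => a) = FF μ v m a := by
  unfold GS.F FF
  rw [← int_unit (fun w => 1 / m * log (PP m √a (μ + √v * w)))]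
  congr 1
  ext w
  rw [← S1_P]

lemma S1_tl (μ m b θ : ℝ) : (S1 μ).tl m (fun _ => b) (fun _ => θ) ((S1 μ).dS m ())
    = 1 + (m - 1) * T1 m b (μ + θ) tq := by
  have h : (S1 μ).dS m () = fun η : Unit → ℝ => 1 + (m - 1) * tq (μ + η ()) := by
    ext η
    have e1 : (fun x => (S1 μ).A () x ^ 2) = fun _ => (1:ℝ) := by ext x; simp [S1, sp_sq]
    have e2 : (S1 μ).av η ((S1 μ).A ()) = tanh (μ + η ()) := S1_av μ η
    rw [GS.dS, e1, GS.av_const, e2, tq, sq]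
  rw [GS.tl, GS.un, S1_P, h]
  simp only [GS.G, S1_Z]
  rw [int_unit (fun y => (1 + (m - 1) * tq (μ + (θ + b * y))) * exp (m * log (2 * cosh (μ + (θ + b * y)))))]
  have : ∀ y, (1 + (m - 1) * tq (μ + (θ + b * y))) * exp (m * log (2 * cosh (μ + (θ + b * y))))
     = (fun t => 1 + (m-1) * tq t + 0 * tf t) (μ + θ + b * y) * wt m (μ + θ + b * y) := by
    intro y; simp [wt, lc, add_assoc]
  simp only [this]
  have e3 := U_add m b (μ + θ) continuous_tq continuous_tf abs_tq abs_tf 1 (m - 1) 0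
  rw [U] at e3
  rw [e3, T1]
  have := (PP_pos m b (μ + θ)).ne'
  field_simp
  ring

lemma cont_FF (μ v m : ℝ) : Continuous (fun a => FF μ v m a) := by
  simp only [← S1_F]
  exact ((S1 μ).continuous_F m).comp (f := fun a : ℝ => ((fun _ => v), (fun _ => a))) (by fun_prop)

lemma FF_deriv (μ v m : ℝ) (hm : m ≠ 0) (hv : 0 ≤ v) (a : ℝ) (ha : 0 ≤ a) {s : ℝ} (hs : s ∈ Ioo (0:ℝ) 1) :
    HasDerivAt (fun s => FF μ v m (s * a)) (a / 2 * (1 + (m - 1) * tau μ v m (s * a))) s := by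
  have key := (S1 μ).F_deriv m hm (fun _ => v) (fun _ => 0) (fun _ => 0) (fun _ => a) (fun _ => hv)
    (fun _ => by linarith) (fun _ => le_rfl) (fun _ => by linarith) hs
  simp only [mul_zero, add_zero, zero_add, zero_div, zero_mul, sub_zero, univ_unique, sum_singleton] at key
  simp only [S1_F] at key
  refine key.congr_deriv ?_
  have h1 : ∀ w : Unit → ℝ, a / 2 * (S1 μ).tl m (fun _ => √(s * a)) (fun k => √v * w k) ((S1 μ).dS m default)
      = a / 2 * (1 + (m - 1) * T1 m √(s * a) (μ + √v * w ()) tq) := fun w => by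
    rw [← S1_tl]
  simp only [h1]
  rw [int_unit (fun w => a / 2 * (1 + (m - 1) * T1 m √(s * a) (μ + √v * w) tq)), integral_const_mul, integral_add
    (integrable_const _), integral_const_mul, integral_const]
  · simp [tau]
  · refine Integrable.const_mul ((integrable_const (1:ℝ)).mono' (Continuous.aestronglyMeasurable
      ((cT1 continuous_tq abs_tq μ v).comp (f := fun w => ((m, s * a), w)) (by fun_prop)))
      (ae_of_all _ fun w => abs_T1 _ _ _ continuous_tq abs_tq)) _

def hh (μ v m a : ℝ) : ℝ := a * ∫ s in (0:ℝ)..1, tau μ v m (s * a)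

lemma cont_hh (μ v : ℝ) : Continuous (fun p : ℝ × ℝ => hh μ v p.1 p.2) := by
  unfold hh
  refine continuous_snd.mul (intervalIntegral.continuous_parametric_intervalIntegral_of_continuous'
    (f := fun (p : ℝ × ℝ) s => tau μ v p.1 (s * p.2)) ?_ 0 1)
  exact (cont_tau μ v).comp (f := fun p : (ℝ × ℝ) × ℝ => (p.1.1, p.2 * p.1.2)) (by fun_prop)

lemma FF_zero (μ v m : ℝ) (hm : m ≠ 0) : FF μ v m 0 = ∫ w, lc (μ + √v * w) ∂g1 := by
  unfold FF PP wt
  simp only [sqrt_zero, zero_mul, add_zero, integral_const, probReal_univ, smul_eq_mul, one_mul, log_exp]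
  congr 1; ext w; field_simp

lemma FF_eq (μ v m : ℝ) (hm : m ≠ 0) (hv : 0 ≤ v) (a : ℝ) (ha : 0 ≤ a) :
    FF μ v m a = (∫ w, lc (μ + √v * w) ∂g1) + a / 2 + (m - 1) / 2 * hh μ v m a := by
  have hc : Continuous (fun s => tau μ v m (s * a)) :=
    (cont_tau μ v).comp (f := fun s : ℝ => (m, s * a)) (by fun_prop)
  have h := intervalIntegral.integral_eq_sub_of_hasDerivAt_of_le (a := (0:ℝ)) (b := 1)
    (f := fun s => FF μ v m (s * a)) (f' := fun s => a / 2 * (1 + (m - 1) * tau μ v m (s * a))) zero_le_one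
    ((cont_FF μ v m).comp (f := fun s : ℝ => s * a) (by fun_prop)).continuousOn
    (fun s hs => FF_deriv μ v m hm hv a ha hs) (Continuous.intervalIntegrable (by fun_prop) _ _)
  simp only [one_mul, zero_mul] at h
  rw [FF_zero μ v m hm, intervalIntegral.integral_const_mul, intervalIntegral.integral_add (by simp)
    (Continuous.intervalIntegrable (by fun_prop) _ _), intervalIntegral.integral_const_mul] at h
  simp only [intervalIntegral.integral_const, sub_zero, smul_eq_mul, mul_one] at h
  unfold hh
  linarith

lemma tau_zero (μ v m : ℝ) : tau μ v m 0 = ∫ w, tq (μ + √v * w) ∂g1 := by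
  unfold tau T1 U PP
  congr 1; ext w
  simp only [sqrt_zero, zero_mul, add_zero, integral_const, probReal_univ, smul_eq_mul, one_mul]
  rw [mul_div_cancel_right₀ _ (wt_pos _ _).ne']

lemma zeta_zero (μ v : ℝ) : zeta μ v 1 0 = ∫ w, (1 - tanh (μ + √v * w) ^ 2) ^ 2 ∂g1 := by
  unfold zeta Zt T1 U PP
  congr 1; ext w
  simp only [sqrt_zero, zero_mul, add_zero, integral_const, probReal_univ, smul_eq_mul, one_mul]
  rw [mul_div_cancel_right₀ _ (wt_pos _ _).ne', mul_div_cancel_right₀ _ (wt_pos _ _).ne']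
  unfold tq tf
  ring

/-- the 1RSB functional, one dimensional form -/
def Ph (β μ v q m u : ℝ) : ℝ := β ^ 2 / 4 * (1 - u) ^ 2 - β ^ 2 / 4 * m * (u ^ 2 - q ^ 2)
  + FF μ v m (β ^ 2 * (u - q))

theorem ATp (β μ v q : ℝ) (hβ : 0 < β) (hv : 0 ≤ v) (hq1 : q < 1)
    (hq : q = ∫ w, tq (μ + √v * w) ∂g1)
    (hAT : β ^ 2 * ∫ w, (1 - tanh (μ + √v * w) ^ 2) ^ 2 ∂g1 < 1)
    (hP : ∀ u, q < u → u ≤ 1 → deriv (fun m => Ph β μ v q m u) 1 < 0) :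
    ∃ m c, 1 < m ∧ m < 2 ∧ 0 < c ∧ ∀ a, 0 ≤ a → a ≤ β ^ 2 * (1 - q) →
      FF μ v m a ≤ (∫ w, lc (μ + √v * w) ∂g1) + a / 2
        + (m - 1) / 2 * (a * q + a ^ 2 / (2 * β ^ 2) - c * a ^ 2) := by
  set A := β ^ 2 * (1 - q) with hA
  have hβ2 : 0 < β ^ 2 := by positivity
  have hA0 : 0 < A := mul_pos hβ2 (by linarith)
  set B : ℝ → ℝ := fun a => a * q + a ^ 2 / (2 * β ^ 2) with hB
  have step1 : ∀ a, 0 < a → a ≤ A → hh μ v 1 a < B a := by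
    intro a ha haA
    set u := q + a / β ^ 2 with hu
    have hua : β ^ 2 * (u - q) = a := by simp only [hu]; field_simp; ring
    have hd := hP u (by simp only [hu]; have : 0 < a / β ^ 2 := by positivity
                        linarith) (by
      have : a / β ^ 2 ≤ 1 - q := by rw [div_le_iff₀ hβ2]; linarith
      linarith)
    have hdiff : HasDerivAt (fun m => Ph β μ v q m u) (deriv (fun m => Ph β μ v q m u) 1) 1 :=
      (differentiableAt_of_deriv_ne_zero hd.ne).hasDerivAt
    have hform : ∀ m, m ≠ 0 → Ph β μ v q m u - Ph β μ v q 1 u = (m - 1) / 2 * (hh μ v m a - B a) := by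
      intro m hm
      unfold Ph
      rw [hua, FF_eq μ v m hm hv a ha.le, FF_eq μ v 1 one_ne_zero hv a ha.le]
      have : u ^ 2 - q ^ 2 = 2 * q * (a / β ^ 2) + (a / β ^ 2) ^ 2 := by simp only [hu]; ring
      rw [this]
      simp only [hB]
      field_simp
      ring
    have ht := (hasDerivAt_iff_tendsto_slope.1 hdiff).mono_left (nhdsWithin_mono (1:ℝ)
      (fun x (hx : x ∈ Set.Ioi (1:ℝ)) => (ne_of_gt hx : x ≠ 1)))
    have ht2 : Tendsto (fun m => (hh μ v m a - B a) / 2) (𝓝[>] 1) (𝓝 ((hh μ v 1 a - B a) / 2)) := by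
      have : Continuous (fun m => (hh μ v m a - B a) / 2) := by
        have := (cont_hh μ v).comp (f := fun m : ℝ => (m, a)) (by fun_prop)
        simp only [Function.comp_def] at this
        fun_prop
      exact (this.tendsto 1).mono_left nhdsWithin_le_nhds
    have heq : (slope (fun m => Ph β μ v q m u) 1) =ᶠ[𝓝[>] 1] fun m => (hh μ v m a - B a) / 2 := by
      filter_upwards [self_mem_nhdsWithin] with m hm
      have hm1 : (1:ℝ) < m := hm
      have h1 : m - 1 ≠ 0 := by linarith
      rw [slope_def_field, hform m (by linarith)]
      field_simp
    have := tendsto_nhds_unique (ht.congr' heq) ht2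
    linarith
  -- near zero
  set κ := ((∫ w, (1 - tanh (μ + √v * w) ^ 2) ^ 2 ∂g1) + 1 / β ^ 2) / 2 with hκ
  have hAT' : (∫ w, (1 - tanh (μ + √v * w) ^ 2) ^ 2 ∂g1) < 1 / β ^ 2 := by
    rw [lt_div_iff₀ hβ2]; linarith
  have hz : ∀ᶠ p : ℝ × ℝ in 𝓝 (1, 0), zeta μ v p.1 p.2 < κ := by
    refine ((cont_zeta μ v).tendsto (1, 0)).eventually_lt_const ?_
    rw [zeta_zero, hκ]; linarith
  obtain ⟨δ, hδ, hzδ⟩ := Metric.eventually_nhds_iff.1 hz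
  have hK : ∀ᶠ m in 𝓝 (1:ℝ), ∀ a ∈ Set.Icc (δ / 2) A, hh μ v m a < B a := by
    refine isCompact_Icc.eventually_forall_of_forall_eventually fun a ha => ?_
    have c1 : Continuous (fun z : ℝ × ℝ => B z.2) := by simp only [hB]; fun_prop
    exact ((cont_hh μ v).tendsto (1, a)).eventually_lt (c1.tendsto (1, a))
      (step1 a (by linarith [ha.1]) ha.2)
  have hm : ∃ m, 1 < m ∧ m < 2 ∧ m < 1 + δ ∧ ∀ a ∈ Set.Icc (δ / 2) A, hh μ v m a < B a := by
    have h1 : ∀ᶠ m in 𝓝[>] (1:ℝ), (∀ a ∈ Set.Icc (δ / 2) A, hh μ v m a < B a) ∧ m < 2 ∧ m < 1 + δ :=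
      (hK.and (((continuous_id.tendsto (1:ℝ)).eventually_lt_const one_lt_two).and
        ((continuous_id.tendsto (1:ℝ)).eventually_lt_const (by simp; linarith)))).filter_mono nhdsWithin_le_nhds
    obtain ⟨m, hm1, hm2⟩ := (h1.and self_mem_nhdsWithin).exists
    exact ⟨m, hm2, hm1.2.1, hm1.2.2, hm1.1⟩
  obtain ⟨m, hm1, hm2, hmδ, hmK⟩ := hm
  -- small a
  have hsmall : ∀ a, 0 ≤ a → a ≤ δ / 2 → hh μ v m a ≤ a * q + κ / 2 * a ^ 2 := by
    intro a ha haδ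
    have htau : ∀ r, 0 ≤ r → r ≤ δ / 2 → tau μ v m r ≤ q + κ * r := by
      intro r hr hrδ
      have h := mvt01 (f := fun s => tau μ v m (s * r)) (f' := fun s => r * zeta μ v m (s * r)) (C := r * κ)
        ((cont_tau μ v).comp (f := fun s : ℝ => (m, s * r)) (by fun_prop))
        (fun s hs => tau_deriv μ v m r hr hs) (fun s hs => by
          refine mulL (hzδ (y := (m, s * r)) ?_).le hr
          have e2 : 0 ≤ s * r := mul_nonneg hs.1.le hr
          have e3 : s * r ≤ 1 * r := mulR hs.2.le hr
          rw [Prod.dist_eq, max_lt_iff]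
          simp only [Real.dist_eq, sub_zero]
          rw [abs_of_nonneg e2, abs_of_pos (by linarith)]
          constructor <;> linarith)
      simp only [one_mul, zero_mul, tau_zero, ← hq] at h
      linarith
    unfold hh
    have hκ0 : 0 ≤ κ := by
      have : 0 ≤ ∫ w, (1 - tanh (μ + √v * w) ^ 2) ^ 2 ∂g1 := integral_nonneg fun w => sq_nonneg _
      have : 0 < 1 / β ^ 2 := by positivity
      simp only [hκ]; linarith
    have : ∫ s in (0:ℝ)..1, tau μ v m (s * a) ≤ ∫ s in (0:ℝ)..1, (q + κ * a * s) := by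
      refine intervalIntegral.integral_mono_on zero_le_one (Continuous.intervalIntegrable
        ((cont_tau μ v).comp (f := fun s : ℝ => (m, s * a)) (by fun_prop)) _ _)
        (Continuous.intervalIntegrable (by fun_prop) _ _) fun s hs => ?_
      have e3 : s * a ≤ 1 * a := mulR hs.2 ha
      have := htau (s * a) (mul_nonneg hs.1 ha) (by linarith)
      linarith
    rw [intervalIntegral.integral_add (by simp) (Continuous.intervalIntegrable (by fun_prop) _ _),
      intervalIntegral.integral_const_mul, integral_id] at this
    simp only [intervalIntegral.integral_const, sub_zero, smul_eq_mul] at this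
    have := mulL this ha
    nlinarith
  -- large a
  have hlarge : ∃ η, 0 < η ∧ ∀ a ∈ Set.Icc (δ / 2) A, hh μ v m a ≤ B a - η := by
    by_cases hne : (Set.Icc (δ / 2) A).Nonempty
    · have cB : Continuous (fun a => B a - hh μ v m a) := by
        have := (cont_hh μ v).comp (f := fun a : ℝ => (m, a)) (by fun_prop)
        simp only [Function.comp_def] at this
        simp only [hB]
        fun_prop
      obtain ⟨x, hx, hmin⟩ := isCompact_Icc.exists_isMinOn hne cB.continuousOn
      refine ⟨B x - hh μ v m x, by linarith [hmK x hx], fun a ha => ?_⟩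
      have := hmin ha
      simp only [Set.mem_setOf_eq] at this
      linarith
    · exact ⟨1, one_pos, fun a ha => (hne ⟨a, ha⟩).elim⟩
  obtain ⟨η, hη, hηK⟩ := hlarge
  set c := min ((1 / β ^ 2 - κ) / 2) (η / A ^ 2) with hc
  have hκ1 : κ < 1 / β ^ 2 := by simp only [hκ]; linarith
  have hc0 : 0 < c := lt_min (by linarith) (by positivity)
  refine ⟨m, c, hm1, hm2, hc0, fun a ha haA => ?_⟩
  rw [FF_eq μ v m (by linarith) hv a ha]
  have hfin : hh μ v m a ≤ a * q + a ^ 2 / (2 * β ^ 2) - c * a ^ 2 := by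
    rcases le_or_gt a (δ / 2) with h | h
    · have h1 := hsmall a ha h
      have h2 : c ≤ (1 / β ^ 2 - κ) / 2 := min_le_left _ _
      have h3 : a ^ 2 / (2 * β ^ 2) = a ^ 2 * (1 / β ^ 2) / 2 := by field_simp
      rw [h3]
      nlinarith [sq_nonneg a]
    · have h1 := hηK a ⟨h.le, haA⟩
      have h2 : c ≤ η / A ^ 2 := min_le_right _ _
      have h3 : c * a ^ 2 ≤ η := by
        calc c * a ^ 2 ≤ η / A ^ 2 * A ^ 2 := by gcongr
          _ = η := by field_simp
      simp only [hB] at h1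
      linarith
  have := mulL hfin (show 0 ≤ (m - 1) / 2 by linarith)
  linarith
end

section
lemma gauss_eq_map (μ : ℝ) (v : NNReal) : gaussianReal μ v = g1.map (fun x => μ + √(v:ℝ) * x) := by
  have h1 : g1.map (fun x => √(v:ℝ) * x) = gaussianReal 0 v := by
    rw [gaussianReal_map_const_mul]
    congr 1
    · simp
    · ext; simp
  have h2 : (fun x => μ + √(v:ℝ) * x) = (fun x => μ + x) ∘ (fun x => √(v:ℝ) * x) := rfl
  rw [h2, ← Measure.map_map (by fun_prop) (by fun_prop), h1, gaussianReal_map_const_add, zero_add]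

lemma int_gauss (μ : ℝ) (v : NNReal) {f : ℝ → ℝ} (hf : Measurable f) :
    ∫ x, f x ∂(gaussianReal μ v) = ∫ x, f (μ + √(v:ℝ) * x) ∂g1 := by
  rw [gauss_eq_map, integral_map (by fun_prop) hf.aestronglyMeasurable]

lemma int_two {f : ℝ → ℝ} (hf : Continuous f) (C D : ℝ) (hE : ∀ x, |f x| ≤ C * exp (D * |x|)) (μ a b : ℝ) :
    ∫ x, ∫ z, f (μ + a * x + b * z) ∂g1 ∂g1 = ∫ w, f (μ + √(a ^ 2 + b ^ 2) * w) ∂g1 := by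
  have hC : 0 ≤ C := by
    have := (abs_nonneg _).trans (hE 0); simpa using this
  have hEG : EG (fun w : Fin 2 → ℝ => f (μ + a * w 0 + b * w 1)) := by
    refine EG.of_exp (C * exp (|D| * |μ|)) (|D| * (|a| + |b|)) fun w => (hE _).trans ?_
    rw [mul_assoc, ← exp_add]
    refine mulL (exp_le_exp.2 ?_) hC
    rw [Fin.sum_univ_two]
    calc D * |μ + a * w 0 + b * w 1| ≤ |D| * |μ + a * w 0 + b * w 1| :=
          mulR (le_abs_self D) (abs_nonneg _)
      _ ≤ |D| * (|μ| + |a| * |w 0| + |b| * |w 1|) := by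
          refine mulL ?_ (abs_nonneg _)
          refine (abs_add_le _ _).trans (add_le_add ((abs_add_le _ _).trans ?_) (abs_mul _ _).le)
          rw [abs_mul]
      _ ≤ _ := by
          have h0 := abs_nonneg D
          have h1 := mul_nonneg (abs_nonneg a) (abs_nonneg (w 1))
          have h2 := mul_nonneg (abs_nonneg b) (abs_nonneg (w 0))
          nlinarith
  have h1 := gram_int (J := Unit) (K := Fin 2) (K' := Unit) (fun _ k => if k = 0 then a else b)
    (fun _ _ => √(a ^ 2 + b ^ 2)) (fun i j => by
      simp [Fin.sum_univ_two]
      rw [mul_self_sqrt (by positivity)]; ring) (f := fun t => f (μ + t ())) (by fun_prop)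
  simp only [lin, Fin.sum_univ_two, univ_unique, sum_singleton, if_true] at h1
  rw [int_unit (fun w => f (μ + √(a ^ 2 + b ^ 2) * w))] at h1
  rw [← h1]
  have hm := measurePreserving_finTwoArrow g1
  have hi := hm.integral_comp' (g := fun z : ℝ × ℝ => f (μ + a * z.1 + b * z.2))
  have hintg : Integrable (fun z : ℝ × ℝ => f (μ + a * z.1 + b * z.2)) (g1.prod g1) := by
    refine (hm.integrable_comp_emb (MeasurableEquiv.measurableEmbedding _)).1 ?_
    exact hEG.integrable (by fun_prop)
  rw [integral_prod _ hintg] at hi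
  rw [← hi]
  refine integral_congr_ae (ae_of_all _ fun w => ?_)
  simp [MeasurableEquiv.finTwoArrow, add_assoc]

lemma sech4 (x : ℝ) : (cosh x)⁻¹ ^ 4 = (1 - tanh x ^ 2) ^ 2 := by
  rw [tanh_eq_sinh_div_cosh]
  have h := (cosh_pos x).ne'
  have := cosh_sq x
  field_simp
  rw [show cosh x ^ 2 - sinh x ^ 2 = 1 by linarith]; ring

lemma logPP_le (m b θ : ℝ) : |log (PP m b θ)| ≤ |log (PP m b 0)| + |m| * |θ| := by
  have h : ∀ x y, PP m b x ≤ PP m b y * exp (|m| * |x - y|) := by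
    intro x y
    unfold PP
    rw [← integral_mul_const]
    refine integral_mono (int_PP m b x) ((int_PP m b y).mul_const _) fun z => ?_
    simp only [wt]
    rw [← exp_add]
    refine exp_le_exp.2 ?_
    have hl : |lc (x + b * z) - lc (y + b * z)| ≤ |x - y| := by
      have := Convex.norm_image_sub_le_of_norm_hasDerivWithin_le (f := lc) (f' := tanh) (C := 1) (s := Set.univ)
        (fun t _ => (hasDerivAt_lc t).hasDerivWithinAt) (fun t _ => abs_tanh_le t) convex_univ
        (Set.mem_univ (y + b * z)) (Set.mem_univ (x + b * z))
      simp only [norm_eq_abs, one_mul] at this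
      rwa [show x + b * z - (y + b * z) = x - y by ring] at this
    have : m * (lc (x + b * z) - lc (y + b * z)) ≤ |m| * |x - y| := by
      refine (le_abs_self _).trans ?_
      rw [abs_mul]
      exact mulL hl (abs_nonneg _)
    linarith
  have h1 : ∀ x y, log (PP m b x) ≤ log (PP m b y) + |m| * |x - y| := by
    intro x y
    have := log_le_log (PP_pos m b x) (h x y)
    rwa [log_mul (PP_pos m b y).ne' (exp_pos _).ne', log_exp] at this
  have e1 := h1 θ 0
  have e2 := h1 0 θ
  simp only [sub_zero, zero_sub, abs_neg] at e1 e2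
  have e3 := le_abs_self (log (PP m b 0))
  have e4 := neg_abs_le (log (PP m b 0))
  rw [abs_le]
  constructor <;> linarith

lemma cont_logPP (m b : ℝ) : Continuous (fun θ => log (PP m b θ)) := by
  refine Continuous.log ?_ fun θ => (PP_pos m b θ).ne'
  have e : (fun θ => PP m b θ) = fun θ => U m b θ (fun _ => 1) := funext (PP_eq m b)
  change Continuous (fun θ => PP m b θ)
  rw [e]
  exact (cont_U (f := fun _ => 1) continuous_const (C := 1) (by simp)).comp (f := fun θ : ℝ => (m, b, θ)) (by fun_prop)

lemma logcosh_int (m b θ : ℝ) : log (∫ z, cosh (θ + b * z) ^ m ∂g1) = log (PP m b θ) - m * log 2 := by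
  have : ∀ z, cosh (θ + b * z) ^ m = exp (-(m * log 2)) * wt m (θ + b * z) := by
    intro z
    unfold wt lc
    rw [log_mul two_ne_zero (cosh_pos _).ne', rpow_def_of_pos (cosh_pos _), ← exp_add]
    congr 1; ring
  simp only [this]
  rw [integral_const_mul]
  change log (exp _ * PP m b θ) = _
  rw [log_mul (exp_pos _).ne' (PP_pos m b θ).ne', log_exp]
  ring

lemma PhiG_eq (β μ : ℝ) (v : NNReal) (q m u : ℝ) (hq : 0 ≤ q) (hβ : 0 < β) (hqu : q ≤ u) (hm : m ≠ 0) :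
    PhiG β μ v q m u = Ph β μ (v + β ^ 2 * q) q m u := by
  unfold PhiG Ph
  simp only [logcosh_int]
  have hb : β * √(u - q) = √(β ^ 2 * (u - q)) := by
    rw [sqrt_mul (by positivity), sqrt_sq hβ.le]
  rw [hb]
  set b := √(β ^ 2 * (u - q))
  have hcg : Continuous (fun θ => log (PP m b θ) - m * log 2) := (cont_logPP m b).sub continuous_const
  have hgr : ∀ θ, |log (PP m b θ) - m * log 2| ≤ (|log (PP m b 0)| + |m * log 2| + |m|) * exp (1 * |θ|) := by
    intro θ
    have h1 := logPP_le m b θ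
    have h2 := abs_sub (log (PP m b θ)) (m * log 2)
    have h3 : |θ| + 1 ≤ exp (1 * |θ|) := by rw [one_mul]; exact add_one_le_exp _
    have h0 := abs_nonneg θ
    have e1 := abs_nonneg (log (PP m b 0))
    have e2 := abs_nonneg (m * log 2)
    have e3 := abs_nonneg m
    calc |log (PP m b θ) - m * log 2| ≤ (|log (PP m b 0)| + |m * log 2| + |m|) * (|θ| + 1) := by nlinarith
      _ ≤ _ := mulL h3 (by positivity)
  have hmeas : Measurable (fun x => ∫ z, (log (PP m b (x + β * √q * z)) - m * log 2) ∂g1) :=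
    (StronglyMeasurable.integral_prod_right (f := fun x z => log (PP m b (x + β * √q * z)) - m * log 2)
      ((hcg.comp (f := fun p : ℝ × ℝ => p.1 + β * √q * p.2) (by fun_prop)).stronglyMeasurable)).measurable
  rw [int_gauss μ v hmeas, int_two hcg _ _ hgr]
  have h4 : √(v:ℝ) ^ 2 + (β * √q) ^ 2 = v + β ^ 2 * q := by
    rw [mul_pow, Real.sq_sqrt (NNReal.coe_nonneg v), sq_sqrt hq]
  rw [h4, FF, integral_const_mul]
  have h5 : ∫ w, (log (PP m b (μ + √(v + β ^ 2 * q) * w)) - m * log 2) ∂g1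
      = (∫ w, log (PP m b (μ + √(v + β ^ 2 * q) * w)) ∂g1) - m * log 2 := by
    rw [integral_sub _ (integrable_const _)]
    · simp
    · have : EG (fun w : Unit → ℝ => log (PP m b (μ + √(v + β ^ 2 * q) * w ()))) :=
        EG.scale (f := fun w : Unit → ℝ => log (PP m b (w ())))
          (GS.EG_lin |log (PP m b 0)| |m| fun θ => by simpa using logPP_le m b (θ ())) (fun _ => √(v + β ^ 2 * q)) (fun _ => μ)
      have hi := this.integrable ((cont_logPP m b).comp (f := fun w : Unit → ℝ => μ + √(v + β ^ 2 * q) * w ()) (by fun_prop))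
      exact ((measurePreserving_funUnique g1 Unit).integrable_comp_emb (MeasurableEquiv.measurableEmbedding _)
        (g := fun w => log (PP m b (μ + √(v + β ^ 2 * q) * w)))).1 hi
  rw [h5]
  field_simp
  ring

/-- the hypotheses in one dimensional form -/
structure HYP (β μ v q : ℝ) : Prop where
  hβ : 0 < β
  hv : 0 ≤ v
  hq0 : 0 < q
  hq1 : q < 1
  hq : q = ∫ w, tq (μ + √(v + β ^ 2 * q) * w) ∂g1
  hAT : β ^ 2 * ∫ w, (1 - tanh (μ + √(v + β ^ 2 * q) * w) ^ 2) ^ 2 ∂g1 < 1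
  hP : ∃ m c, 1 < m ∧ m < 2 ∧ 0 < c ∧ ∀ a, 0 ≤ a → a ≤ β ^ 2 * (1 - q) →
      FF μ (v + β ^ 2 * q) m a ≤ (∫ w, lc (μ + √(v + β ^ 2 * q) * w) ∂g1) + a / 2
        + (m - 1) / 2 * (a * q + a ^ 2 / (2 * β ^ 2) - c * a ^ 2)

theorem HYP_of_mem (β μ : ℝ) (v : NNReal) (h : memRSminus β μ v) : ∃ q, HYP β μ v q := by
  obtain ⟨hβ, q, hq0, hq1, hq, hAT, hP⟩ := h
  have h4 : √(v:ℝ) ^ 2 + (β * √q) ^ 2 = v + β ^ 2 * q := by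
    rw [mul_pow, Real.sq_sqrt (NNReal.coe_nonneg v), sq_sqrt hq0.le]
  have conv : ∀ f : ℝ → ℝ, Continuous f → (∀ x, |f x| ≤ 1) →
      ∫ x, ∫ z, f (x + β * √q * z) ∂g1 ∂(gaussianReal μ v) = ∫ w, f (μ + √(v + β ^ 2 * q) * w) ∂g1 := by
    intro f hf hb
    rw [int_gauss μ v, int_two hf 1 0 (by simpa using hb), h4]
    exact (StronglyMeasurable.integral_prod_right (f := fun x z => f (x + β * √q * z))
      ((hf.comp (f := fun p : ℝ × ℝ => p.1 + β * √q * p.2) (by fun_prop)).stronglyMeasurable)).measurable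
  have e1 : q = ∫ w, tq (μ + √(v + β ^ 2 * q) * w) ∂g1 := by
    rw [← conv tq continuous_tq abs_tq]; exact hq
  have e2 : β ^ 2 * ∫ w, (1 - tanh (μ + √(v + β ^ 2 * q) * w) ^ 2) ^ 2 ∂g1 < 1 := by
    rw [← conv (fun x => (1 - tanh x ^ 2) ^ 2) (by fun_prop)]
    · simpa only [sech4] using hAT
    · intro x
      rw [abs_of_nonneg (sq_nonneg _)]
      have := tanh_sq_le x
      have := sq_nonneg (tanh x)
      nlinarith
  refine ⟨q, hβ, v.2, hq0, hq1, e1, e2, ATp β μ _ q hβ (by positivity) hq1 e1 e2 fun u hu hu1 => ?_⟩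
  have := hP u hu hu1
  have heq : (fun m => PhiG β μ v q m u) =ᶠ[𝓝 1] fun m => Ph β μ (v + β ^ 2 * q) q m u := by
    filter_upwards [isOpen_ne.mem_nhds (one_ne_zero : (1:ℝ) ≠ 0)] with m hm
    exact PhiG_eq β μ v q m u hq0.le hβ hu.le hm
  rwa [heq.deriv_eq] at this
end

section
/-- forgetting coordinates -/
lemma gam_inj {K K' : Type} [Fintype K] [Fintype K'] [DecidableEq K] [DecidableEq K'] (e : K' → K)
    (he : Function.Injective e) {f : (K' → ℝ) → ℝ} (hf : Continuous f) :
    ∫ w, f (fun k => w (e k)) ∂(gam K) = ∫ w, f w ∂(gam K') := by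
  have h := gram_int (fun (j : K') (k : K) => if k = e j then (1:ℝ) else 0)
    (fun (j : K') (k : K') => if k = j then (1:ℝ) else 0) (f := f) (by
      intro i j
      simp [he.eq_iff]) hf
  have e1 : ∀ w : K → ℝ, lin (fun (j : K') (k : K) => if k = e j then (1:ℝ) else 0) w = fun k => w (e k) := by
    intro w; ext j; simp [lin]
  have e2 : ∀ w : K' → ℝ, lin (fun (j : K') (k : K') => if k = j then (1:ℝ) else 0) w = w := by
    intro w; ext j; simp [lin]
  simpa only [e1, e2] using h

/-- a linear form is a one dimensional Gaussian -/
lemma int_lin1 {K : Type} [Fintype K] (L : K → ℝ) {f : ℝ → ℝ} (hf : Continuous f) (V : ℝ)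
    (hV : ∑ k, L k ^ 2 = V) :
    ∫ w, f (∑ k, L k * w k) ∂(gam K) = ∫ w, f (√V * w) ∂g1 := by
  have hV0 : 0 ≤ V := hV ▸ sum_nonneg fun _ _ => sq_nonneg _
  have h := gram_int (fun (_ : Unit) (k : K) => L k) (fun (_ : Unit) (_ : Unit) => √V)
    (f := fun x => f (x ())) (by
      intro i j
      simp only [← sq, hV]; simp [sq_sqrt hV0]) (by fun_prop)
  rw [← int_unit (fun w => f (√V * w))]
  simpa [lin] using h

abbrev PI' (N : ℕ) := {p : Fin N × Fin N // p.1 < p.2}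
abbrev Sp (N : ℕ) := Fin N → Bool

def sgP (p : PI' N) (σ : Sp N) : ℝ := sp (σ p.1.1) * sp (σ p.1.2)

/-- overlap -/
def R (σ τ : Sp N) : ℝ := (∑ i, sp (σ i) * sp (τ i)) / N

lemma sum_PI (f : Fin N → ℝ) : ∑ p : PI' N, f p.1.1 * f p.1.2 = ((∑ i, f i) ^ 2 - ∑ i, f i ^ 2) / 2 := by
  have h1 : ∑ p : PI' N, f p.1.1 * f p.1.2 = ∑ i, ∑ j, if i < j then f i * f j else 0 := by
    rw [← sum_prod_type' (f := fun i j => if i < j then f i * f j else 0), ← sum_filter]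
    exact (sum_subtype _ (by simp) (fun p : Fin N × Fin N => f p.1 * f p.2)).symm
  have h2 : ∑ i, ∑ j, (if i < j then f i * f j else 0) = ∑ i, ∑ j, if j < i then f i * f j else 0 := by
    rw [sum_comm]
    refine sum_congr rfl fun i _ => sum_congr rfl fun j _ => ?_
    rw [mul_comm]
  have h3 : (∑ i, f i) ^ 2 = (∑ i, ∑ j, if i < j then f i * f j else 0)
      + (∑ i, ∑ j, if j < i then f i * f j else 0) + ∑ i, f i ^ 2 := by
    rw [sq, sum_mul_sum, ← sum_add_distrib, ← sum_add_distrib]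
    refine sum_congr rfl fun i _ => ?_
    rw [← sum_add_distrib]
    have : f i ^ 2 = ∑ j, if i = j then f i * f j else 0 := by simp [sq]
    rw [this, ← sum_add_distrib]
    refine sum_congr rfl fun j _ => ?_
    rcases lt_trichotomy i j with h | h | h
    · simp [h, h.not_gt, h.ne]
    · simp [h]
    · simp [h, h.not_gt, h.ne']
  rw [h1, h3, ← h2]; ring

lemma sum_sp (hN : N ≠ 0) (σ τ : Sp N) : ∑ i, sp (σ i) * sp (τ i) = N * R σ τ := by
  unfold R; field_simp

lemma sum_sgP (hN : N ≠ 0) (σ τ : Sp N) :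
    ∑ p : PI' N, sgP p σ * sgP p τ = (N ^ 2 * R σ τ ^ 2 - N) / 2 := by
  have h := sum_PI (fun i => sp (σ i) * sp (τ i))
  rw [sum_sp hN] at h
  simp only [mul_pow, sp_sq, mul_one, sum_const, card_univ, Fintype.card_fin, nsmul_eq_mul] at h
  rw [← h]
  exact sum_congr rfl fun p _ => by unfold sgP; ring

lemma R_self (hN : N ≠ 0) (σ : Sp N) : R σ σ = 1 := by
  unfold R; simp [sp_mul_self, hN]

lemma R_comm (σ τ : Sp N) : R σ τ = R τ σ := by
  unfold R; simp [mul_comm]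

lemma abs_R (σ τ : Sp N) : |R σ τ| ≤ 1 := by
  unfold R
  rw [abs_div, Nat.abs_cast]
  refine div_le_one_of_le₀ ?_ (Nat.cast_nonneg N)
  refine (abs_sum_le_sum_abs _ _).trans ?_
  simp [abs_mul, abs_sp]

/-- the SK system: couplings and fields -/
def SKs (N : ℕ) (μ : ℝ) : GS (PI' N ⊕ Fin N) (Sp N) where
  c σ := ∑ i, μ * sp (σ i)
  A k σ := Sum.elim (fun p => sgP p σ) (fun i => sp (σ i)) k

/-- variances -/
def vr (x y : ℝ) : PI' N ⊕ Fin N → ℝ := Sum.elim (fun _ => x) (fun _ => y)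

lemma SKs_cv (hN : N ≠ 0) (μ x y : ℝ) (σ τ : Sp N) :
    (SKs N μ).cv (vr x y) σ τ = x * ((N ^ 2 * R σ τ ^ 2 - N) / 2) + y * (N * R σ τ) := by
  simp only [GS.cv, SKs, vr, sum_sum_type, elim_inl, elim_inr, mul_assoc]
  rw [← mul_sum, ← mul_sum, sum_sgP hN, sum_sp hN]

/-- variances at time `t` -/
def va (β v q t : ℝ) : PI' N ⊕ Fin N → ℝ := vr (t * (β ^ 2 / N)) (v + β ^ 2 * q * (1 - t))

lemma va_eq (β v q t : ℝ) : (va β v q t : PI' N ⊕ Fin N → ℝ)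
    = fun k => vr 0 (v + β ^ 2 * q) k + t * vr (β ^ 2 / N) (- (β ^ 2 * q)) k := by
  ext k; rcases k with k | k <;> simp [va, vr]; ring

lemma va_nonneg {β v q t : ℝ} (hv : 0 ≤ v) (hq : 0 ≤ q) (h0 : 0 ≤ t) (h1 : t ≤ 1)
    (k : PI' N ⊕ Fin N) : 0 ≤ va β v q t k := by
  have : 0 ≤ 1 - t := by linarith
  rcases k with k | k <;> simp only [va, vr, elim_inl, elim_inr] <;> positivity

/-- derivative of the free energy -/
lemma phi_deriv (hN : N ≠ 0) {β μ v q : ℝ} (hv : 0 ≤ v) (hq : 0 ≤ q) {t : ℝ} (ht : t ∈ Ioo (0:ℝ) 1) :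
    HasDerivAt (fun t => (SKs N μ).EL (va β v q t))
      (N * (β ^ 2 / 4) * ((1 - q) ^ 2 - ((SKs N μ).rep (Fin 2)).nu (va β v q t) fun x => (R (x 0) (x 1) - q) ^ 2)) t := by
  have h := (SKs N μ).EL_deriv (vr 0 (v + β ^ 2 * q)) (vr (β ^ 2 / N) (- (β ^ 2 * q)))
    (by intro k; rcases k with k | k <;> simp only [vr, elim_inl, elim_inr] <;> positivity)
    (by intro k; rcases k with k | k <;> simp only [vr, elim_inl, elim_inr] <;> ring_nf <;> positivity) ht
  simp only [← va_eq] at h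
  refine h.congr_deriv ?_
  have e : (fun x : Fin 2 → Sp N => ((SKs N μ).cv (vr (β ^ 2 / N) (- (β ^ 2 * q))) (x 0) (x 0)
      - (SKs N μ).cv (vr (β ^ 2 / N) (- (β ^ 2 * q))) (x 0) (x 1)) / 2)
      = fun x => N * (β ^ 2 / 4) * ((1 - q) ^ 2 - (R (x 0) (x 1) - q) ^ 2) := by
    ext x
    rw [SKs_cv hN, SKs_cv hN, R_self hN]
    field_simp; ring
  rw [e, GS.nu_smul, GS.nu_sub, GS.nu_const]
end

section
/-- two spins at one site -/
def Q1 (μ : ℝ) : GS Bool (Bool × Bool) where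
  c x := μ * (sp x.1 + sp x.2)
  A b x := if b then sp x.1 + sp x.2 else sp x.1 - sp x.2

lemma sum_BB (f : Bool × Bool → ℝ) : ∑ x, f x = f (true, true) + f (true, false) + f (false, true) + f (false, false) := by
  rw [sum_prod_type]; simp; ring

lemma exp_sp (b : Bool) (y : ℝ) : exp (y * sp b) = cosh y + sp b * sinh y := by
  cases b <;> simp [sp, cosh_eq, sinh_eq] <;> ring

lemma Q1_ew (μ : ℝ) (θ : Bool → ℝ) (x : Bool × Bool) : (Q1 μ).ew θ x
    = exp ((μ + θ true + θ false) * sp x.1) * exp ((μ + θ true - θ false) * sp x.2) := by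
  rw [← exp_add]; simp [GS.ew, Q1]; ring

lemma Q1_tilt (μ lam : ℝ) (θ : Bool → ℝ) :
    ∑ x : Bool × Bool, exp (lam * (sp x.1 * sp x.2)) * (Q1 μ).ew θ x
      = (2 * cosh (μ + θ true + θ false)) * (2 * cosh (μ + θ true - θ false))
        * (cosh lam + sinh lam * (tanh (μ + θ true + θ false) * tanh (μ + θ true - θ false))) := by
  have e : ∀ x : Bool × Bool, exp (lam * (sp x.1 * sp x.2)) = cosh lam + sp x.1 * sp x.2 * sinh lam := by
    rintro ⟨a, b⟩; cases a <;> cases b <;> simp [sp, cosh_eq, sinh_eq] <;> ring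
  simp only [Q1_ew, e, exp_sp, sum_BB]
  generalize μ + θ true + θ false = a
  generalize μ + θ true - θ false = b
  rw [tanh_eq_sinh_div_cosh, tanh_eq_sinh_div_cosh]
  have h1 := (cosh_pos a).ne'
  have h2 := (cosh_pos b).ne'
  simp only [sp, if_true, Bool.false_eq_true, if_false]
  field_simp; ring

lemma Q1_Z (μ : ℝ) (θ : Bool → ℝ) : (Q1 μ).Z θ
    = (2 * cosh (μ + θ true + θ false)) * (2 * cosh (μ + θ true - θ false)) := by
  have := Q1_tilt μ 0 θ
  simpa [GS.Z] using this

lemma log_tilt {lam T : ℝ} (hl : |lam| ≤ 1) (hT : |T| ≤ 1) : log (cosh lam + sinh lam * T) ≤ lam * T + lam ^ 2 := by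
  have h1 := abs_le.1 (abs_exp_sub_one_sub_id_le hl)
  have h2 := abs_le.1 (abs_exp_sub_one_sub_id_le (x := -lam) (by rwa [abs_neg]))
  have hT := abs_le.1 hT
  have h3 : cosh lam + sinh lam * T - 1 ≤ lam * T + lam ^ 2 := by
    rw [cosh_eq, sinh_eq]
    nlinarith [mulL h1.2 (show 0 ≤ 1 + T by linarith),
      mulL h2.2 (show 0 ≤ 1 - T by linarith)]
  have h4 : 0 < cosh lam + sinh lam * T := by
    have : cosh lam + sinh lam * T = ((1 + T) * exp lam + (1 - T) * exp (-lam)) / 2 := by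
      rw [cosh_eq, sinh_eq]; ring
    rw [this]
    rcases lt_or_ge T 0 with h | h
    · have := mul_pos (show 0 < 1 - T by linarith) (exp_pos (-lam))
      have := mul_nonneg (show 0 ≤ 1 + T by linarith) (exp_pos lam).le
      linarith
    · have := mul_nonneg (show 0 ≤ 1 - T by linarith) (exp_pos (-lam)).le
      have := mul_pos (show 0 < 1 + T by linarith) (exp_pos lam)
      linarith
  exact (log_le_sub_one_of_pos h4).trans h3

lemma Q1_av (μ : ℝ) (θ : Bool → ℝ) (c0 c1 c2 c3 : ℝ) :
    (Q1 μ).av θ (fun x => c0 + c1 * sp x.1 + c2 * sp x.2 + c3 * (sp x.1 * sp x.2))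
      = c0 + c1 * tanh (μ + θ true + θ false) + c2 * tanh (μ + θ true - θ false)
        + c3 * (tanh (μ + θ true + θ false) * tanh (μ + θ true - θ false)) := by
  rw [GS.av_eq, Q1_Z]
  simp only [Q1_ew, exp_sp, sum_BB]
  generalize μ + θ true + θ false = a
  generalize μ + θ true - θ false = b
  rw [tanh_eq_sinh_div_cosh, tanh_eq_sinh_div_cosh]
  have h1 := (cosh_pos a).ne'
  have h2 := (cosh_pos b).ne'
  simp only [sp, if_true, Bool.false_eq_true, if_false]
  field_simp; ring

def f12 (x : Bool × Bool) : ℝ := sp x.1 * sp x.2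

lemma Q1_f12 (μ : ℝ) (θ : Bool → ℝ) :
    (Q1 μ).av θ f12 = tanh (μ + θ true + θ false) * tanh (μ + θ true - θ false) := by
  have := Q1_av μ θ 0 0 0 1
  simp only [zero_mul, zero_add, one_mul] at this
  exact this

lemma Q1_d2 (μ : ℝ) (θ : Bool → ℝ) : (Q1 μ).d2 f12 true θ - (Q1 μ).d2 f12 false θ
    = 4 * (1 - tanh (μ + θ true + θ false) ^ 2) * (1 - tanh (μ + θ true - θ false) ^ 2) := by
  unfold GS.d2
  have e : ∀ (f : Bool × Bool → ℝ) (c0 c1 c2 c3 : ℝ),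
      (∀ x, f x = c0 + c1 * sp x.1 + c2 * sp x.2 + c3 * (sp x.1 * sp x.2)) → (Q1 μ).av θ f =
        c0 + c1 * tanh (μ + θ true + θ false) + c2 * tanh (μ + θ true - θ false)
        + c3 * (tanh (μ + θ true + θ false) * tanh (μ + θ true - θ false)) :=
    fun f c0 c1 c2 c3 h => by rw [funext h]; exact Q1_av μ θ c0 c1 c2 c3
  rw [e (fun x => f12 x * (Q1 μ).A true x ^ 2) 2 0 0 2, e (fun x => f12 x * (Q1 μ).A true x) 0 1 1 0,
    e ((Q1 μ).A true) 0 1 1 0, e f12 0 0 0 1, e (fun x => (Q1 μ).A true x ^ 2) 2 0 0 2,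
    e (fun x => f12 x * (Q1 μ).A false x ^ 2) (-2) 0 0 2, e (fun x => f12 x * (Q1 μ).A false x) 0 (-1) 1 0,
    e ((Q1 μ).A false) 0 1 (-1) 0, e (fun x => (Q1 μ).A false x ^ 2) 2 0 0 (-2)]
  · ring
  all_goals
    rintro ⟨a, b⟩
    cases a <;> cases b <;> simp [f12, Q1, sp] <;> norm_num

/-- variances of the two fields -/
def v2 (x y : ℝ) : Bool → ℝ := fun b => if b then x else y

lemma int_bool {f : ℝ → ℝ} (hf : Continuous f) (μ : ℝ) {x y V : ℝ} (hx : 0 ≤ x) (hy : 0 ≤ y) (hV : x + y = V)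
    (s : ℝ) (hs : s ^ 2 = 1) :
    ∫ w, f (μ + √x * w true + s * (√y * w false)) ∂(gam Bool) = ∫ w, f (μ + √V * w) ∂g1 := by
  have h := int_lin1 (fun b : Bool => if b then √x else s * √y) (f := fun z => f (μ + z)) (by fun_prop) V (by
    simp [mul_pow, sq_sqrt hx, sq_sqrt hy, hs, hV])
  rw [← h]
  congr 1; ext w; congr 1; simp; ring

lemma int_bool_bdd {f : ℝ → ℝ} (hf : Continuous f) (C : ℝ) (hC : ∀ x, |f x| ≤ C) (μ x y : ℝ) (s : ℝ) :
    Integrable (fun w : Bool → ℝ => f (μ + x * w true + s * (y * w false))) (gam Bool) :=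
  EG.integrable (EG.bdd C fun w => hC _) (by fun_prop)

lemma Q1_ET (μ : ℝ) {V d : ℝ} (hd : 0 ≤ d) (hdV : d ≤ V) :
    (∫ w, tq (μ + √V * w) ∂g1) - 2 * d * (∫ w, (1 - tanh (μ + √V * w) ^ 2) ^ 2 ∂g1)
      ≤ (Q1 μ).nu (v2 (V - d) d) f12 := by
  have hV : 0 ≤ V := hd.trans hdV
  set E := ∫ w, (1 - tanh (μ + √V * w) ^ 2) ^ 2 ∂g1 with hE
  have ea : ∀ s, (fun k => v2 V 0 k + s * v2 (-d) d k) = v2 (V - s * d) (s * d) := by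
    intro s; ext k; cases k <;> simp [v2]; ring
  have eb : ∀ s k, v2 V 0 k + s * v2 (-d) d k = v2 (V - s * d) (s * d) k := fun s k => congrFun (ea s) k
  have hder : ∀ s ∈ Ioo (0:ℝ) 1, HasDerivAt (fun s => - (Q1 μ).nu (fun k => v2 V 0 k + s * v2 (-d) d k) f12) _ s :=
    fun s hs => ((Q1 μ).nu_deriv f12 (v2 V 0) (v2 (-d) d) (by intro k; cases k <;> simp [v2, hV])
      (by intro k; cases k <;> simp [v2, hd, hdV]) hs).neg
  have h := mvt01 (C := 2 * d * E) (((Q1 μ).continuous_nu f12).comp (f := fun s : ℝ => fun k => v2 V 0 k + s * v2 (-d) d k)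
    (by fun_prop)).neg hder (by
      intro s hs
      have hs0 : 0 ≤ V - s * d := by nlinarith [hs.1, hs.2]
      have hs1 : 0 ≤ s * d := mul_nonneg hs.1.le hd
      have i1 := (((Q1 μ).EG_d2 f12 true).scale (fun k => √(v2 V 0 k + s * v2 (-d) d k)) 0).integrable (by
        exact ((Q1 μ).continuous_d2 f12 true).comp (by fun_prop))
      have i2 := (((Q1 μ).EG_d2 f12 false).scale (fun k => √(v2 V 0 k + s * v2 (-d) d k)) 0).integrable (by
        exact ((Q1 μ).continuous_d2 f12 false).comp (by fun_prop))
      simp only [Pi.zero_apply, zero_add] at i1 i2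
      have hsub := integral_sub i1 i2
      rw [sum_bool]
      have e1 : v2 (-d) d true = -d := rfl
      have e2 : v2 (-d) d false = d := rfl
      rw [e1, e2]
      have hb : ∫ w, ((Q1 μ).d2 f12 true (fun k => √(v2 V 0 k + s * v2 (-d) d k) * w k)
          - (Q1 μ).d2 f12 false (fun k => √(v2 V 0 k + s * v2 (-d) d k) * w k)) ∂(gam Bool) ≤ 4 * E := by
        have c1 : Continuous (fun x => (1 - tanh x ^ 2) ^ 2) := by fun_prop
        have b1 : ∀ x, |(1 - tanh x ^ 2) ^ 2| ≤ 1 := fun x => by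
          have := tanh_sq_le x
          rw [abs_of_nonneg (sq_nonneg _)]; nlinarith [sq_nonneg (tanh x)]
        have j1 := int_bool_bdd c1 1 b1 μ √(V - s * d) √(s * d) 1
        have j2 := int_bool_bdd c1 1 b1 μ √(V - s * d) √(s * d) (-1)
        have k1 := int_bool c1 μ hs0 hs1 (V := V) (by ring) 1 (by norm_num)
        have k2 := int_bool c1 μ hs0 hs1 (V := V) (by ring) (-1) (by norm_num)
        have hle := integral_mono (i1.sub i2) ((j1.const_mul 2).add (j2.const_mul 2)) (fun w => by
          simp only [Pi.sub_apply, Pi.add_apply, eb, Q1_d2]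
          simp only [v2, if_true, Bool.false_eq_true, if_false, one_mul, neg_one_mul, ← sub_eq_add_neg]
          nlinarith [sq_nonneg ((1 - tanh (μ + √(V - s * d) * w true + √(s * d) * w false) ^ 2)
            - (1 - tanh (μ + √(V - s * d) * w true - √(s * d) * w false) ^ 2))])
        refine hle.trans (le_of_eq ?_)
        rw [integral_add' (j1.const_mul 2) (j2.const_mul 2), integral_const_mul, integral_const_mul, k1, k2]
        rw [hE]; ring
      rw [hsub] at hb
      nlinarith)
  replace h : - (Q1 μ).nu (fun k => v2 V 0 k + 1 * v2 (-d) d k) f12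
      - - (Q1 μ).nu (fun k => v2 V 0 k + 0 * v2 (-d) d k) f12 ≤ 2 * d * E := h
  rw [ea 1, ea 0] at h
  simp only [one_mul, zero_mul, sub_zero] at h
  have e0 : (Q1 μ).nu (v2 V 0) f12 = ∫ w, tq (μ + √V * w) ∂g1 := by
    rw [← int_bool continuous_tq μ hV le_rfl (V := V) (by ring) 1 (by norm_num)]
    unfold GS.nu
    congr 1; ext w
    rw [Q1_f12]; simp [v2, tq]; ring
  rw [e0] at h
  linarith
end

section
/-- restriction of a system -/
def GS.sub {K S : Type} (H : GS K S) (p : S → Prop) : GS K {x // p x} where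
  c x := H.c x
  A k x := H.A k x

abbrev KP (N : ℕ) := PI' N ⊕ (Bool × Fin N)

/-- pairs of configurations -/
def PSf (N : ℕ) (μ : ℝ) : GS (KP N) (Sp N × Sp N) where
  c x := ∑ i, μ * (sp (x.1 i) + sp (x.2 i))
  A k x := Sum.elim (fun p => sgP p x.1 + sgP p x.2) (fun bi => (Q1 μ).A bi.1 (x.1 bi.2, x.2 bi.2)) k

instance (N : ℕ) (u : ℝ) : Fintype {x : Sp N × Sp N // R x.1 x.2 = u} := Fintype.ofFinite _

/-- pairs with overlap `u` -/
def PS (N : ℕ) (μ u : ℝ) : GS (KP N) {x : Sp N × Sp N // R x.1 x.2 = u} := (PSf N μ).sub _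

def vp (p x y : ℝ) : KP N → ℝ := Sum.elim (fun _ => p) (fun bi => v2 x y bi.1)

lemma PS_cv (hN : N ≠ 0) (μ u p x y : ℝ) (X Y : {x : Sp N × Sp N // R x.1 x.2 = u}) :
    (PS N μ u).cv (vp (p / N) x y) X Y
      = p * (N * (R X.1.1 Y.1.1 ^ 2 + R X.1.1 Y.1.2 ^ 2 + R X.1.2 Y.1.1 ^ 2 + R X.1.2 Y.1.2 ^ 2) / 2 - 2)
        + x * (N * (R X.1.1 Y.1.1 + R X.1.1 Y.1.2 + R X.1.2 Y.1.1 + R X.1.2 Y.1.2))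
        + y * (N * (R X.1.1 Y.1.1 - R X.1.1 Y.1.2 - R X.1.2 Y.1.1 + R X.1.2 Y.1.2)) := by
  have hN' : (N:ℝ) ≠ 0 := Nat.cast_ne_zero.2 hN
  simp only [GS.cv, PS, GS.sub, PSf, vp, sum_sum_type, elim_inl, elim_inr, sum_prod_type,
    sum_bool, v2, Q1, if_true, Bool.false_eq_true, if_false]
  have e1 : ∑ k : PI' N, p / N * (sgP k X.1.1 + sgP k X.1.2) * (sgP k Y.1.1 + sgP k Y.1.2)
      = p / N * (∑ k : PI' N, sgP k X.1.1 * sgP k Y.1.1 + ∑ k : PI' N, sgP k X.1.1 * sgP k Y.1.2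
        + ∑ k : PI' N, sgP k X.1.2 * sgP k Y.1.1 + ∑ k : PI' N, sgP k X.1.2 * sgP k Y.1.2) := by
    simp only [← sum_add_distrib, mul_sum]
    exact sum_congr rfl fun k _ => by ring
  have e2 : ∑ i, x * (sp (X.1.1 i) + sp (X.1.2 i)) * (sp (Y.1.1 i) + sp (Y.1.2 i))
      = x * (∑ i, sp (X.1.1 i) * sp (Y.1.1 i) + ∑ i, sp (X.1.1 i) * sp (Y.1.2 i)
        + ∑ i, sp (X.1.2 i) * sp (Y.1.1 i) + ∑ i, sp (X.1.2 i) * sp (Y.1.2 i)) := by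
    simp only [← sum_add_distrib, mul_sum]
    exact sum_congr rfl fun k _ => by ring
  have e3 : ∑ i, y * (sp (X.1.1 i) - sp (X.1.2 i)) * (sp (Y.1.1 i) - sp (Y.1.2 i))
      = y * (∑ i, sp (X.1.1 i) * sp (Y.1.1 i) - ∑ i, sp (X.1.1 i) * sp (Y.1.2 i)
        - ∑ i, sp (X.1.2 i) * sp (Y.1.1 i) + ∑ i, sp (X.1.2 i) * sp (Y.1.2 i)) := by
    simp only [← sum_add_distrib, ← sum_sub_distrib, mul_sum]
    exact sum_congr rfl fun k _ => by ring
  rw [e1, e2, e3]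
  simp only [sum_sgP hN, sum_sp hN]
  field_simp
  ring

lemma vp_add (p x y p' x' y' : ℝ) :
    (fun k => (vp p x y : KP N → ℝ) k + vp p' x' y' k) = vp (p + p') (x + x') (y + y') := by
  ext k; rcases k with k | ⟨b, k⟩
  · simp [vp]
  · cases b <;> simp [vp, v2]

lemma vp_nonneg {p x y : ℝ} (hp : 0 ≤ p) (hx : 0 ≤ x) (hy : 0 ≤ y) (k : KP N) : 0 ≤ vp p x y k := by
  rcases k with k | ⟨b, k⟩
  · simpa [vp]
  · cases b <;> simpa [vp, v2]

lemma vp_zero : (vp 0 0 0 : KP N → ℝ) = fun _ => 0 := by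
  ext k; rcases k with k | ⟨b, k⟩ <;> simp [vp, v2]

/-- Guerra–Talagrand bound for pairs -/
lemma PS_GT (hN : N ≠ 0) (μ u : ℝ) [Nonempty {x : Sp N × Sp N // R x.1 x.2 = u}] {n T B q w x y s : ℝ}
    (hn : 0 < n) (hn1 : n ≤ 1) (hT : 0 ≤ T) (hB : 0 ≤ B) (h1 : 0 ≤ q + w) (h2 : 0 ≤ q - w) (hx : 0 ≤ x) (hy : 0 ≤ y) :
    (PS N μ u).EL (vp (T / N) B 0) ≤ (PS N μ u).F n (vp 0 (B + T * (q + w) / 2) (T * (q - w) / 2)) (vp 0 (T * x) (T * y))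
      + N * T / 2 * (1 + u ^ 2 - 2 * q - 2 * w * u - 2 * (x + y) - 2 * (x - y) * u
        + (1 - n) * ((q + (x + y)) ^ 2 + (w + (x - y)) ^ 2) + n * (q ^ 2 + w ^ 2)) := by
  classical
  have hN' : (0:ℝ) < N := Nat.cast_pos.2 (Nat.pos_of_ne_zero hN)
  have ha' : (vp (T / N) (-(T * (q + w) / 2)) (-(T * (q - w) / 2)) : KP N → ℝ) = vp (T / N) (-(T * (q + w) / 2)) (-(T * (q - w) / 2)) := rfl
  have hb' : (vp 0 (-(T * x)) (-(T * y)) : KP N → ℝ) = vp (0 / N) (-(T * x)) (-(T * y)) := by rw [zero_div]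
  have key := (PS N μ u).GT_bound n hn.ne' (vp 0 (B + T * (q + w) / 2) (T * (q - w) / 2))
    (vp (T / N) (-(T * (q + w) / 2)) (-(T * (q - w) / 2))) (vp 0 (T * x) (T * y)) (vp 0 (-(T * x)) (-(T * y)))
    (vp_nonneg le_rfl (by positivity) (by positivity))
    (by
      intro k
      rw [congrFun (vp_add _ _ _ _ _ _) k]
      refine vp_nonneg (by positivity) ?_ ?_ k <;> linarith)
    (vp_nonneg le_rfl (by positivity) (by positivity))
    (by
      intro k
      rw [congrFun (vp_add _ _ _ _ _ _) k]
      refine vp_nonneg (by positivity) ?_ ?_ k <;> linarith)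
    (d := N * T * (1 + u ^ 2 - 2 * q - 2 * w * u - 2 * (x + y) - 2 * (x - y) * u) - 2 * T)
    (e1 := (1 - n) * (N * T * ((q + (x + y)) ^ 2 + (w + (x - y)) ^ 2) + 2 * T))
    (e2 := n * (N * T * (q ^ 2 + w ^ 2) + 2 * T))
    (by
      intro X
      rw [hb', PS_cv hN, PS_cv hN, R_self hN, R_self hN, R_comm X.1.2 X.1.1, X.2]
      refine le_of_eq ?_; ring)
    (by
      intro X Y
      rw [hb', PS_cv hN, PS_cv hN]
      generalize R X.1.1 Y.1.1 = a
      generalize R X.1.1 Y.1.2 = b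
      generalize R X.1.2 Y.1.1 = c
      generalize R X.1.2 Y.1.2 = d
      have h := mul_nonneg (mul_nonneg (show 0 ≤ 1 - n by linarith) (mul_nonneg hN'.le hT))
        (show 0 ≤ (a - (q + (x + y))) ^ 2 + (d - (q + (x + y))) ^ 2 + (b - (w + (x - y))) ^ 2 + (c - (w + (x - y))) ^ 2 by positivity)
      nlinarith)
    (by
      intro X Y
      rw [PS_cv hN]
      generalize R X.1.1 Y.1.1 = a
      generalize R X.1.1 Y.1.2 = b
      generalize R X.1.2 Y.1.1 = c
      generalize R X.1.2 Y.1.2 = d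
      have h := mul_nonneg (mul_nonneg hn.le (mul_nonneg hN'.le hT))
        (show 0 ≤ (a - q) ^ 2 + (d - q) ^ 2 + (b - w) ^ 2 + (c - w) ^ 2 by positivity)
      nlinarith)
  rw [vp_add, vp_add] at key
  have e0 : (vp (0 + 0) (T * x + -(T * x)) (T * y + -(T * y)) : KP N → ℝ) = fun _ => 0 := by
    simp [vp_zero]
  rw [e0, (PS N μ u).F_zero_in n hn.ne'] at key
  have e1 : (vp (0 + T / N) (B + T * (q + w) / 2 + -(T * (q + w) / 2)) (T * (q - w) / 2 + -(T * (q - w) / 2)) : KP N → ℝ)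
      = vp (T / N) B 0 := by
    congr 1 <;> ring
  rw [e1] at key
  have : ((N * T * (1 + u ^ 2 - 2 * q - 2 * w * u - 2 * (x + y) - 2 * (x - y) * u) - 2 * T)
    + ((1 - n) * (N * T * ((q + (x + y)) ^ 2 + (w + (x - y)) ^ 2) + 2 * T)) + (n * (N * T * (q ^ 2 + w ^ 2) + 2 * T))) / 2
    = N * T / 2 * (1 + u ^ 2 - 2 * q - 2 * w * u - 2 * (x + y) - 2 * (x - y) * u
        + (1 - n) * ((q + (x + y)) ^ 2 + (w + (x - y)) ^ 2) + n * (q ^ 2 + w ^ 2)) := by ring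
  linarith

lemma PSf_ew (μ : ℝ) (θ : KP N → ℝ) (hθ : ∀ p, θ (inl p) = 0) (x : Sp N × Sp N) :
    (PSf N μ).ew θ x = ∏ i, (Q1 μ).ew (fun b => θ (inr (b, i))) (x.1 i, x.2 i) := by
  simp only [GS.ew]
  rw [← Real.exp_sum, sum_add_distrib]
  simp only [PSf, sum_sum_type, hθ, zero_mul, sum_const_zero, zero_add, elim_inr, sum_prod_type]
  congr 2
  rw [sum_comm]

lemma PS_Z_le (hN : N ≠ 0) (μ u lam : ℝ) (θ : KP N → ℝ) (hθ : ∀ p, θ (inl p) = 0) :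
    (PS N μ u).Z θ ≤ exp (- (N * (lam * u))) *
      ∏ i, ∑ x : Bool × Bool, exp (lam * (sp x.1 * sp x.2)) * (Q1 μ).ew (fun b => θ (inr (b, i))) x := by
  have h1 : (PS N μ u).Z θ = ∑ x : {x : Sp N × Sp N // R x.1 x.2 = u}, exp (- (N * (lam * u))) *
      ∏ i, (exp (lam * (sp (x.1.1 i) * sp (x.1.2 i))) * (Q1 μ).ew (fun b => θ (inr (b, i))) (x.1.1 i, x.1.2 i)) := by
    unfold GS.Z
    refine sum_congr rfl fun x _ => ?_
    rw [prod_mul_distrib, ← PSf_ew μ θ hθ, ← Real.exp_sum, ← mul_sum, sum_sp hN, x.2, ← mul_assoc,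
      ← exp_add, show -(N * (lam * u)) + lam * (N * u) = 0 by ring, exp_zero, one_mul]
    rfl
  rw [h1, ← mul_sum]
  refine mulL ?_ (exp_pos _).le
  have h2 := GS.sum_prod_eq (fun (i : Fin N) (x : Bool × Bool) => exp (lam * (sp x.1 * sp x.2)) * (Q1 μ).ew (fun b => θ (inr (b, i))) x)
  rw [← h2, ← Equiv.sum_comp (Equiv.arrowProdEquivProdArrow (Fin N) (fun _ => Bool) (fun _ => Bool)).symm]
  have h3 := Finset.sum_subtype_of_mem (p := fun x : Sp N × Sp N => R x.1 x.2 = u)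
    (fun x : Sp N × Sp N => ∏ i, (exp (lam * (sp (x.1 i) * sp (x.2 i))) * (Q1 μ).ew (fun b => θ (inr (b, i))) (x.1 i, x.2 i)))
    (s := univ.filter fun x => R x.1 x.2 = u) (by simp)
  have h4 : ∑ x : {x : Sp N × Sp N // R x.1 x.2 = u},
      ∏ i, (exp (lam * (sp (x.1.1 i) * sp (x.1.2 i))) * (Q1 μ).ew (fun b => θ (inr (b, i))) (x.1.1 i, x.1.2 i))
      = ∑ x ∈ univ.filter (fun x : Sp N × Sp N => R x.1 x.2 = u),
        ∏ i, (exp (lam * (sp (x.1 i) * sp (x.2 i))) * (Q1 μ).ew (fun b => θ (inr (b, i))) (x.1 i, x.2 i)) :=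
    (sum_subtype _ (by simp) (fun x : Sp N × Sp N =>
        ∏ i, (exp (lam * (sp (x.1 i) * sp (x.2 i))) * (Q1 μ).ew (fun b => θ (inr (b, i))) (x.1 i, x.2 i)))).symm
  rw [h4]
  refine (sum_le_sum_of_subset_of_nonneg (subset_univ _) fun x _ _ =>
    prod_nonneg fun i _ => mul_nonneg (exp_pos _).le ((Q1 μ).ew_pos _ _).le).trans (le_of_eq ?_)
  rfl
end

section
lemma gam_site (i : Fin N) {f : (Bool → ℝ) → ℝ} (hf : Continuous f) :
    ∫ w, f (fun b => w (inr (b, i))) ∂(gam (KP N)) = ∫ w, f w ∂(gam Bool) := by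
  classical
  exact gam_inj (fun b : Bool => (inr (b, i) : KP N)) (by intro a b h; simpa using h) hf

lemma Q1_logZ (μ : ℝ) (θ : Bool → ℝ) : log ((Q1 μ).Z θ) = lc (μ + θ true + θ false) + lc (μ + θ true - θ false) := by
  rw [Q1_Z, log_mul (by have := cosh_pos (μ + θ true + θ false); positivity)
    (by have := cosh_pos (μ + θ true - θ false); positivity)]
  rfl

lemma int_lc_bool (μ x y s : ℝ) : Integrable (fun w : Bool → ℝ => lc (μ + x * w true + s * (y * w false))) (gam Bool) := by
  refine EG.integrable (GS.EG_lin (log 2 + |μ|) (|x| + |s| * |y|) fun w => ?_) (by fun_prop)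
  rw [abs_of_nonneg (lc_nonneg _)]
  have h1 := lc_le (μ + x * w true + s * (y * w false))
  have h2 := abs_add_three μ (x * w true) (s * (y * w false))
  simp only [abs_mul, sum_bool] at h2 ⊢
  have : 0 ≤ |x| * |w false| := by positivity
  have : 0 ≤ |s| * |y| * |w true| := by positivity
  nlinarith

lemma Q1_EL (μ : ℝ) {x y V : ℝ} (hx : 0 ≤ x) (hy : 0 ≤ y) (hV : x + y = V) :
    (Q1 μ).EL (v2 x y) = 2 * ∫ w, lc (μ + √V * w) ∂g1 := by
  unfold GS.EL
  simp only [Q1_logZ]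
  have h1 := int_bool continuous_lc μ hx hy hV 1 (by norm_num)
  have h2 := int_bool continuous_lc μ hx hy hV (-1) (by norm_num)
  have h3 := integral_add (int_lc_bool μ √x √y 1) (int_lc_bool μ √x √y (-1))
  rw [h1, h2] at h3
  rw [two_mul, ← h3]
  congr 1; ext w
  simp [v2, sub_eq_add_neg]

lemma PS_EL0 (hN : N ≠ 0) (μ u : ℝ) [Nonempty {x : Sp N × Sp N // R x.1 x.2 = u}] (x y : ℝ) {lam : ℝ} (hl : |lam| ≤ 1) :
    (PS N μ u).EL (vp 0 x y) ≤ N * ((Q1 μ).EL (v2 x y) + lam * ((Q1 μ).nu (v2 x y) f12 - u) + lam ^ 2) := by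
  have hpt : ∀ w : KP N → ℝ, log ((PS N μ u).Z (fun k => √(vp 0 x y k) * w k))
      ≤ - (N * (lam * u)) + ∑ i, (log ((Q1 μ).Z (fun b => √(v2 x y b) * w (inr (b, i))))
        + (lam * (Q1 μ).av (fun b => √(v2 x y b) * w (inr (b, i))) f12 + lam ^ 2)) := by
    intro w
    have h := PS_Z_le hN μ u lam (fun k => √(vp 0 x y k) * w k) (by intro p; simp [vp])
    have h' := log_le_log ((PS N μ u).Z_pos _) h
    have hpos : ∀ i : Fin N, 0 < ∑ z : Bool × Bool, exp (lam * (sp z.1 * sp z.2)) * (Q1 μ).ew (fun b => √(vp 0 x y (inr (b, i) : KP N)) * w (inr (b, i))) z :=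
      fun i => sum_pos (fun z _ => mul_pos (exp_pos _) ((Q1 μ).ew_pos _ _)) univ_nonempty
    rw [log_mul (exp_pos _).ne' (Finset.prod_pos fun i _ => hpos i).ne', log_exp, log_prod fun i _ => (hpos i).ne'] at h'
    refine h'.trans (add_le_add_right (sum_le_sum fun i _ => ?_) _)
    rw [Q1_tilt, Q1_f12, Q1_Z]
    have e : ∀ b, vp 0 x y (inr (b, i) : KP N) = v2 x y b := fun b => rfl
    simp only [e]
    set a := μ + √(v2 x y true) * w (inr (true, i)) + √(v2 x y false) * w (inr (false, i))
    set b := μ + √(v2 x y true) * w (inr (true, i)) - √(v2 x y false) * w (inr (false, i))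
    have hT : |tanh a * tanh b| ≤ 1 := by
      rw [abs_mul]; exact mul_le_one₀ (abs_tanh_le _) (abs_nonneg _) (abs_tanh_le _)
    rcases eq_or_ne (cosh lam + sinh lam * (tanh a * tanh b)) 0 with h0 | h0
    · have h5 := hpos i
      rw [Q1_tilt] at h5
      simp only [e] at h5
      have : 0 < (2 * cosh a) * (2 * cosh b) * (cosh lam + sinh lam * (tanh a * tanh b)) := h5
      rw [h0] at this; simp at this
    · rw [log_mul (by have := cosh_pos a; have := cosh_pos b; positivity) h0]
      have := log_tilt hl hT
      linarith
  have i1 : ∀ i : Fin N, Integrable (fun w : KP N → ℝ => log ((Q1 μ).Z (fun b => √(v2 x y b) * w (inr (b, i))))) (gam (KP N)) := by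
    intro i
    obtain ⟨C, hC, h⟩ := ((Q1 μ).EG_logZ.scale (fun b => √(v2 x y b)) 0)
    refine EG.integrable ?_ ((Q1 μ).continuous_logZ.comp (by fun_prop))
    refine ⟨C, hC, fun w => ?_⟩
    have h1 := h (fun b => w (inr (b, i)))
    simp only [Pi.zero_apply, zero_add] at h1
    refine h1.trans ?_
    gcongr
    rw [sum_sum_type, sum_prod_type, sum_bool, sum_bool]
    have a0 : 0 ≤ ∑ p : PI' N, |w (inl p)| := sum_nonneg fun _ _ => abs_nonneg _
    have a1 := single_le_sum (f := fun i => |w (inr (true, i))|) (fun _ _ => abs_nonneg _) (mem_univ i)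
    have a2 := single_le_sum (f := fun i => |w (inr (false, i))|) (fun _ _ => abs_nonneg _) (mem_univ i)
    linarith
  have i2 : ∀ i : Fin N, Integrable (fun w : KP N → ℝ => lam * (Q1 μ).av (fun b => √(v2 x y b) * w (inr (b, i))) f12 + lam ^ 2) (gam (KP N)) := by
    intro i
    exact ((EG.bdd (GS.bnd f12) fun w => (Q1 μ).abs_av_bnd _ f12).integrable
      (((Q1 μ).continuous_av f12).comp (by fun_prop))).const_mul lam |>.add (integrable_const _)
  have i12 : ∀ i : Fin N, Integrable (fun w : KP N → ℝ => log ((Q1 μ).Z (fun b => √(v2 x y b) * w (inr (b, i))))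
        + (lam * (Q1 μ).av (fun b => √(v2 x y b) * w (inr (b, i))) f12 + lam ^ 2)) (gam (KP N)) := fun i => (i1 i).add (i2 i)
  have hi : Integrable (fun w : KP N → ℝ => - (N * (lam * u)) + ∑ i, (log ((Q1 μ).Z (fun b => √(v2 x y b) * w (inr (b, i))))
        + (lam * (Q1 μ).av (fun b => √(v2 x y b) * w (inr (b, i))) f12 + lam ^ 2))) (gam (KP N)) :=
    (integrable_const _).add (integrable_finsetSum _ fun i _ => i12 i)
  refine (integral_mono ((PS N μ u).int_logZ _) hi hpt).trans (le_of_eq ?_)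
  rw [integral_add (integrable_const _) (integrable_finsetSum _ fun i _ => i12 i),
    integral_finsetSum _ fun i _ => i12 i]
  have hs : ∀ i : Fin N, ∫ w : KP N → ℝ, (log ((Q1 μ).Z (fun b => √(v2 x y b) * w (inr (b, i))))
        + (lam * (Q1 μ).av (fun b => √(v2 x y b) * w (inr (b, i))) f12 + lam ^ 2)) ∂(gam (KP N))
      = (Q1 μ).EL (v2 x y) + (lam * (Q1 μ).nu (v2 x y) f12 + lam ^ 2) := by
    intro i
    have c1 : Continuous (fun w : Bool → ℝ => log ((Q1 μ).Z (fun b => √(v2 x y b) * w b))) :=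
      (Q1 μ).continuous_logZ.comp (by fun_prop)
    have c2 : Continuous (fun w : Bool → ℝ => (lam * (Q1 μ).av (fun b => √(v2 x y b) * w b) f12 + lam ^ 2)) :=
      (continuous_const.mul (((Q1 μ).continuous_av f12).comp (by fun_prop))).add continuous_const
    have g := gam_site i (c1.add c2)
    simp only [Pi.add_apply] at g
    rw [g, integral_add ((Q1 μ).int_logZ _), integral_add, integral_const_mul]
    · simp [GS.EL, GS.nu]
    · exact ((Q1 μ).int_av _ f12).const_mul lam
    · exact integrable_const _
    · exact (((Q1 μ).int_av _ f12).const_mul lam).add (integrable_const _)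
  simp only [hs]
  simp
  ring
end

section
lemma cont_site (i : Fin N) {f : (Bool → ℝ) → ℝ} (hf : Continuous f) :
    Continuous (fun w : KP N → ℝ => f (fun b => w (inr (b, i)))) :=
  hf.comp (continuous_pi fun b => continuous_apply _)

lemma PP_neg (m b θ : ℝ) : PP m (-b) θ = PP m b θ := by
  unfold PP
  have h : (g1).map (fun x => -x) = g1 := by unfold g1; rw [gaussianReal_map_neg]; simp
  conv_rhs => rw [← h]
  rw [integral_map (by fun_prop) (Continuous.aestronglyMeasurable (by unfold wt; fun_prop))]
  simp

lemma pair_le (n b s θ θ' : ℝ) (hs : s = 1 ∨ s = -1) :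
    Integrable (fun z => exp (n * (lc (θ + b * z) + lc (θ' + s * (b * z))))) g1 ∧
    ∫ z, exp (n * (lc (θ + b * z) + lc (θ' + s * (b * z)))) ∂g1
      ≤ exp (1 / 2 * (log (PP (2 * n) b θ) + log (PP (2 * n) b θ'))) := by
  have hB : PP (2 * n) (s * b) θ' = PP (2 * n) b θ' := by
    rcases hs with h | h
    · rw [h, one_mul]
    · rw [h, neg_one_mul, PP_neg]
  set A := PP (2 * n) b θ with hA
  set B := PP (2 * n) b θ' with hB'
  have hA0 : 0 < A := PP_pos _ _ _
  have hB0 : 0 < B := PP_pos _ _ _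
  have i1 := int_PP (2 * n) b θ
  have i2 := int_PP (2 * n) (s * b) θ'
  have hpt : ∀ z, exp (n * (lc (θ + b * z) + lc (θ' + s * (b * z))))
      ≤ exp (1 / 2 * (log A + log B)) * (1 / 2 * (A⁻¹ * wt (2 * n) (θ + b * z) + B⁻¹ * wt (2 * n) (θ' + s * b * z))) := by
    intro z
    set X := lc (θ + b * z)
    have e : s * (b * z) = s * b * z := by ring
    rw [e]
    set Y := lc (θ' + s * b * z)
    have e1 : A⁻¹ * wt (2 * n) (θ + b * z) = exp (n * X - 1 / 2 * log A) ^ 2 := by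
      rw [← exp_nat_mul, show ((2:ℕ):ℝ) * (n * X - 1 / 2 * log A) = - log A + 2 * n * X by push_cast; ring, exp_add, exp_neg, exp_log hA0]
      rfl
    have e2 : B⁻¹ * wt (2 * n) (θ' + s * b * z) = exp (n * Y - 1 / 2 * log B) ^ 2 := by
      rw [← exp_nat_mul, show ((2:ℕ):ℝ) * (n * Y - 1 / 2 * log B) = - log B + 2 * n * Y by push_cast; ring, exp_add, exp_neg, exp_log hB0]
      rfl
    have e3 : exp (n * (X + Y)) = exp (1 / 2 * (log A + log B)) * (exp (n * X - 1 / 2 * log A) * exp (n * Y - 1 / 2 * log B)) := by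
      rw [← exp_add, ← exp_add]; congr 1; ring
    rw [e1, e2, e3]
    refine mulL ?_ (exp_pos _).le
    nlinarith [sq_nonneg (exp (n * X - 1 / 2 * log A) - exp (n * Y - 1 / 2 * log B))]
  have hi : Integrable (fun z => exp (1 / 2 * (log A + log B)) * (1 / 2 * (A⁻¹ * wt (2 * n) (θ + b * z) + B⁻¹ * wt (2 * n) (θ' + s * b * z)))) g1 :=
    (((i1.const_mul _).add (i2.const_mul _)).const_mul _).const_mul _
  have hI : Integrable (fun z => exp (n * (lc (θ + b * z) + lc (θ' + s * (b * z))))) g1 := by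
    refine hi.mono' (Continuous.aestronglyMeasurable (by fun_prop)) (ae_of_all _ fun z => ?_)
    rw [norm_eq_abs, abs_of_pos (exp_pos _)]
    exact hpt z
  refine ⟨hI, (integral_mono hI hi hpt).trans (le_of_eq ?_)⟩
  rw [integral_const_mul, integral_const_mul, integral_add (i1.const_mul _) (i2.const_mul _), integral_const_mul, integral_const_mul]
  have e1 : ∫ z, wt (2 * n) (θ + b * z) ∂g1 = A := rfl
  have e2 : ∫ z, wt (2 * n) (θ' + s * b * z) ∂g1 = B := hB
  rw [e1, e2]
  field_simp; norm_num

set_option maxHeartbeats 400000 in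
lemma PS_F_pt (hN : N ≠ 0) (μ u : ℝ) [Nonempty {x : Sp N × Sp N // R x.1 x.2 = u}] {x y n κ : ℝ} (hn : 0 < n)
    (sg : Bool) (w : KP N → ℝ) : log ((PS N μ u).P n (fun k => √((vp 0 (if sg then κ else 0) (if sg then 0 else κ) : KP N → ℝ) k)) (fun k => √(vp 0 x y k) * w k))
      ≤ ∑ i, 1 / 2 * (log (PP (2 * n) √κ (μ + √x * w (inr (true, i)) + 1 * (√y * w (inr (false, i)))))
        + log (PP (2 * n) √κ (μ + √x * w (inr (true, i)) + (-1) * (√y * w (inr (false, i)))))) := by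
  classical
  set H := PS N μ u
  set bb : KP N → ℝ := vp 0 (if sg then κ else 0) (if sg then 0 else κ) with hbb
  set s : ℝ := if sg then 1 else -1 with hs
  have hs' : s = 1 ∨ s = -1 := by cases sg <;> simp [s]
  have hs2 : s ^ 2 = 1 := by rcases hs' with h | h <;> rw [h] <;> norm_num
  set ℓ : ℝ → ℝ := fun θ => log (PP (2 * n) √κ θ) with hℓ
  have hℓc : Continuous ℓ := cont_logPP _ _
  set a : Fin N → ℝ := fun i => μ + √x * w (inr (true, i)) + 1 * (√y * w (inr (false, i)))
  set b : Fin N → ℝ := fun i => μ + √x * w (inr (true, i)) + (-1) * (√y * w (inr (false, i)))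
  have h1 : ∀ z : KP N → ℝ, H.G n (fun k => √(vp 0 x y k) * w k + √(bb k) * z k)
      ≤ ∏ i, exp (n * (lc (a i + √κ * z (inr (sg, i))) + lc (b i + s * (√κ * z (inr (sg, i)))))) := by
    intro z
    have h := PS_Z_le hN μ u 0 (fun k => √(vp 0 x y k) * w k + √(bb k) * z k) (by intro p; simp [vp, bb])
    simp only [zero_mul, mul_zero, neg_zero, exp_zero, one_mul] at h
    have h' := log_le_log (H.Z_pos _) h
    change log (H.Z _) ≤ log (∏ i, (Q1 μ).Z _) at h'
    rw [log_prod fun i _ => ((Q1 μ).Z_pos _).ne'] at h'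
    simp only [Q1_logZ] at h'
    unfold GS.G
    rw [← exp_sum]
    refine exp_le_exp.2 ?_
    rw [← mul_sum]
    refine mulL (h'.trans (le_of_eq ?_)) hn.le
    refine sum_congr rfl fun i _ => ?_
    simp only [a, b, s, bb]
    cases sg <;> simp [vp, v2] <;> ring_nf
  have hcp : Continuous (fun z : Fin N → ℝ => ∏ i, exp (n * (lc (a i + √κ * z i) + lc (b i + s * (√κ * z i))))) :=
    continuous_finsetProd _ fun i _ => by fun_prop
  have hpp : ∀ i, (∫ z, exp (n * (lc (a i + √κ * z) + lc (b i + s * (√κ * z)))) ∂g1) ≤ exp (1 / 2 * (ℓ (a i) + ℓ (b i))) :=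
    fun i => (pair_le n √κ s (a i) (b i) hs').2
  have hintg : Integrable (fun z : KP N → ℝ => ∏ i, exp (n * (lc (a i + √κ * z (inr (sg, i))) + lc (b i + s * (√κ * z (inr (sg, i))))))) (gam (KP N)) := by
    refine EG.integrable ?_ (hcp.comp (g := fun z : Fin N → ℝ => ∏ i, exp (n * (lc (a i + √κ * z i) + lc (b i + s * (√κ * z i))))) (f := fun z : KP N → ℝ => fun i => z (inr (sg, i))) (by fun_prop))
    refine EG.of_exp (exp (∑ i, n * (2 * log 2 + |a i| + |b i|))) (n * (2 * √κ)) fun z => ?_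
    rw [← exp_sum, abs_of_pos (exp_pos _), ← exp_add]
    refine exp_le_exp.2 ?_
    have t1 : ∑ i, n * (lc (a i + √κ * z (inr (sg, i))) + lc (b i + s * (√κ * z (inr (sg, i)))))
        ≤ ∑ i, (n * (2 * log 2 + |a i| + |b i|) + n * (2 * √κ) * |z (inr (sg, i))|) := by
      refine sum_le_sum fun i _ => ?_
      have t2 := lc_le (a i + √κ * z (inr (sg, i)))
      have t3 := lc_le (b i + s * (√κ * z (inr (sg, i))))
      have t4 := abs_add_le (a i) (√κ * z (inr (sg, i)))
      have t5 := abs_add_le (b i) (s * (√κ * z (inr (sg, i))))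
      have t6 : |s| = 1 := by rcases hs' with h | h <;> rw [h] <;> norm_num
      rw [abs_mul s, t6] at t5
      rw [abs_mul, abs_of_nonneg (sqrt_nonneg κ)] at t4 t5
      have : lc (a i + √κ * z (inr (sg, i))) + lc (b i + s * (√κ * z (inr (sg, i)))) ≤ (2 * log 2 + |a i| + |b i|) + (2 * √κ) * |z (inr (sg, i))| := by linarith
      nlinarith
    refine t1.trans ?_
    rw [sum_add_distrib, ← mul_sum (a := n * (2 * √κ))]
    have : ∑ i, |z (inr (sg, i))| ≤ ∑ k, |z k| := by
      rw [sum_sum_type, sum_prod_type, sum_bool]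
      have a0 : 0 ≤ ∑ p : PI' N, |z (inl p)| := sum_nonneg fun _ _ => abs_nonneg _
      have a1 : 0 ≤ ∑ i, |z (inr (true, i))| := sum_nonneg fun _ _ => abs_nonneg _
      have a2 : 0 ≤ ∑ i, |z (inr (false, i))| := sum_nonneg fun _ _ => abs_nonneg _
      cases sg <;> linarith
    gcongr
  have h2 : H.P n (fun k => √(bb k)) (fun k => √(vp 0 x y k) * w k) ≤ ∏ i, exp (1 / 2 * (ℓ (a i) + ℓ (b i))) := by
    refine (integral_mono (H.int_P n _ _) hintg h1).trans ?_
    have g := gam_inj (fun i : Fin N => (inr (sg, i) : KP N)) (by intro a b h; simpa using h) hcp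
    rw [g]
    unfold gam
    rw [integral_fintype_prod_eq_prod (f := fun i z => exp (n * (lc (a i + √κ * z) + lc (b i + s * (√κ * z)))))]
    exact prod_le_prod (fun i _ => integral_nonneg fun z => (exp_pos _).le) fun i _ => hpp i
  have h3 := log_le_log (H.P_pos n _ _) h2
  rw [← exp_sum, log_exp] at h3
  exact h3

lemma PS_F_le (hN : N ≠ 0) (μ u : ℝ) [Nonempty {x : Sp N × Sp N // R x.1 x.2 = u}] {x y V n κ : ℝ} (hn : 0 < n)
    (hx : 0 ≤ x) (hy : 0 ≤ y) (hV : x + y = V) (sg : Bool) :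
    (PS N μ u).F n (vp 0 x y) (vp 0 (if sg then κ else 0) (if sg then 0 else κ)) ≤ N * (2 * FF μ V (2 * n) κ) := by
  classical
  set H := PS N μ u
  set bb : KP N → ℝ := vp 0 (if sg then κ else 0) (if sg then 0 else κ) with hbb
  set s : ℝ := if sg then 1 else -1 with hs
  have hs' : s = 1 ∨ s = -1 := by cases sg <;> simp [s]
  have hs2 : s ^ 2 = 1 := by rcases hs' with h | h <;> rw [h] <;> norm_num
  set ℓ : ℝ → ℝ := fun θ => log (PP (2 * n) √κ θ) with hℓ
  have hℓc : Continuous ℓ := cont_logPP _ _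
  have hpt : ∀ w : KP N → ℝ, log (H.P n (fun k => √(bb k)) (fun k => √(vp 0 x y k) * w k))
      ≤ ∑ i, 1 / 2 * (ℓ (μ + √x * w (inr (true, i)) + 1 * (√y * w (inr (false, i))))
        + ℓ (μ + √x * w (inr (true, i)) + (-1) * (√y * w (inr (false, i))))) := fun w => PS_F_pt hN μ u hn sg w
  have jl : ∀ (c1 c2 s : ℝ), Integrable (fun w : Bool → ℝ => ℓ (μ + c1 * w true + s * (c2 * w false))) (gam Bool) := by
    intro c1 c2 s
    refine EG.integrable (GS.EG_lin (|log (PP (2 * n) √κ 0)| + |2 * n| * |μ|) (|2 * n| * (|c1| + |s| * |c2|)) fun w => ?_) (hℓc.comp (by fun_prop))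
    refine (logPP_le _ _ _).trans ?_
    have h2 := abs_add_three μ (c1 * w true) (s * (c2 * w false))
    simp only [abs_mul s, abs_mul c1, abs_mul c2, sum_bool] at h2 ⊢
    have : 0 ≤ |c1| * |w false| := by positivity
    have : 0 ≤ |s| * |c2| * |w true| := by positivity
    have h3 : |μ + c1 * w true + s * (c2 * w false)| ≤ |μ| + (|c1| + |s| * |c2|) * (|w true| + |w false|) := by nlinarith
    have := mulL h3 (abs_nonneg (2 * n))
    linarith
  set ff : (Bool → ℝ) → ℝ := fun w => 1 / 2 * (ℓ (μ + √x * w true + 1 * (√y * w false)) + ℓ (μ + √x * w true + (-1) * (√y * w false))) with hff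
  have hffc : Continuous ff := by unfold ff; fun_prop
  have hffi : Integrable ff (gam Bool) := ((jl √x √y 1).add (jl √x √y (-1))).const_mul _
  have hffI : ∫ w, ff w ∂(gam Bool) = ∫ w, ℓ (μ + √V * w) ∂g1 := by
    unfold ff
    rw [integral_const_mul, integral_add (jl √x √y 1) (jl √x √y (-1)), int_bool hℓc μ hx hy hV 1 (by norm_num), int_bool hℓc μ hx hy hV (-1) (by norm_num)]
    ring
  have iw : ∀ i : Fin N, Integrable (fun w : KP N → ℝ => ff (fun b => w (inr (b, i)))) (gam (KP N)) := by
    intro i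
    have hc : Continuous (fun w : KP N → ℝ => ff (fun b => w (inr (b, i)))) := cont_site i hffc
    refine EG.integrable ?_ hc
    refine GS.EG_lin (|log (PP (2 * n) √κ 0)| + |2 * n| * |μ|) (|2 * n| * (|√x| + |√y|)) fun w => ?_
    have hw : ∀ b, |w (inr (b, i))| ≤ ∑ k, |w k| := fun b =>
      single_le_sum (f := fun k => |w k|) (fun _ _ => abs_nonneg _) (mem_univ _)
    generalize (∑ k, |w k|) = W at hw ⊢
    have hl : ∀ s : ℝ, |s| = 1 → |ℓ (μ + √x * w (inr (true, i)) + s * (√y * w (inr (false, i))))| ≤ |log (PP (2 * n) √κ 0)| + |2 * n| * |μ| + |2 * n| * (|√x| + |√y|) * W := by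
      intro s hs
      refine (logPP_le _ _ _).trans ?_
      have h2 := abs_add_three μ (√x * w (inr (true, i))) (s * (√y * w (inr (false, i))))
      rw [abs_mul s, hs, abs_mul, abs_mul] at h2
      have h4 := mulL (hw true) (abs_nonneg √x)
      have h5 := mulL (hw false) (abs_nonneg √y)
      have h3 : |μ + √x * w (inr (true, i)) + s * (√y * w (inr (false, i)))| ≤ |μ| + (|√x| + |√y|) * W := by rw [add_mul]; linarith
      have := mulL h3 (abs_nonneg (2 * n))
      linarith
    have l1 := hl 1 (by norm_num)
    have l2 := hl (-1) (by norm_num)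
    have l3 := abs_add_le (ℓ (μ + √x * w (inr (true, i)) + 1 * (√y * w (inr (false, i))))) (ℓ (μ + √x * w (inr (true, i)) + (-1) * (√y * w (inr (false, i)))))
    simp only [hff]
    rw [abs_mul, show |(1:ℝ)/2| = 1/2 by norm_num]
    linarith
  have hsum : Integrable (fun w : KP N → ℝ => 1 / n * ∑ i, ff (fun b => w (inr (b, i)))) (gam (KP N)) :=
    (integrable_finsetSum _ fun i _ => iw i).const_mul _
  have hFi : Integrable (fun w : KP N → ℝ => 1 / n * log (H.P n (fun k => √(bb k)) (fun k => √(vp 0 x y k) * w k))) (gam (KP N)) := by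
    obtain ⟨C, hC, hb⟩ := H.logP_bound n (∑ k, √(bb k))
    have hE : EG (fun θ : KP N → ℝ => log (H.P n (fun k => √(bb k)) θ)) := GS.EG_lin C C fun θ => hb _ θ fun k => by
      rw [abs_of_nonneg (sqrt_nonneg _)]
      exact single_le_sum (f := fun k => √(bb k)) (fun _ _ => sqrt_nonneg _) (mem_univ k)
    have hc : Continuous (fun θ : KP N → ℝ => log (H.P n (fun k => √(bb k)) θ)) :=
      ((H.continuous_P n).comp (f := fun θ : KP N → ℝ => (θ, fun k => √(bb k))) (by fun_prop)).log fun θ => (H.P_pos n _ _).ne'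
    have := (hE.scale (fun k => √(vp 0 x y k)) 0).integrable (hc.comp (by fun_prop))
    simpa using this.const_mul (1 / n)
  unfold GS.F
  refine (integral_mono hFi hsum fun w => mulL (hpt w) (by positivity)).trans (le_of_eq ?_)
  rw [integral_const_mul, integral_finsetSum _ fun i _ => iw i]
  have : ∀ i : Fin N, ∫ w : KP N → ℝ, ff (fun b => w (inr (b, i))) ∂(gam (KP N)) = ∫ w, ℓ (μ + √V * w) ∂g1 := fun i => by
    rw [gam_site i hffc, hffI]
  simp only [this]
  simp only [FF, integral_const_mul, sum_const, card_univ, Fintype.card_fin, nsmul_eq_mul, hℓ]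
  field_simp
end

section
def phi0 (β μ v q : ℝ) : ℝ := ∫ w, lc (μ + √(v + β ^ 2 * q) * w) ∂g1
def sech4i (β μ v q : ℝ) : ℝ := ∫ w, (1 - tanh (μ + √(v + β ^ 2 * q) * w) ^ 2) ^ 2 ∂g1

lemma sech4i_nonneg (β μ v q : ℝ) : 0 ≤ sech4i β μ v q := integral_nonneg fun w => sq_nonneg _

lemma abs_u_le {u : ℝ} (h : Nonempty {x : Sp N × Sp N // R x.1 x.2 = u}) : |u| ≤ 1 := by
  obtain ⟨x, hx⟩ := h
  rw [← hx]; exact abs_R _ _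

lemma nu_f12_zero (μ : ℝ) {V : ℝ} (hV : 0 ≤ V) : (Q1 μ).nu (v2 V 0) f12 = ∫ w, tq (μ + √V * w) ∂g1 := by
  rw [← int_bool continuous_tq μ hV le_rfl (V := V) (by ring) 1 (by norm_num)]
  unfold GS.nu
  congr 1; ext w
  rw [Q1_f12]; simp [v2, tq]; ring

lemma PS_b (hN : N ≠ 0) {β μ v q : ℝ} (h : HYP β μ v q) (u : ℝ) [hne : Nonempty {x : Sp N × Sp N // R x.1 x.2 = u}]
    {t w : ℝ} (ht0 : 0 ≤ t) (ht1 : t ≤ 1) (hw1 : -q ≤ w) (hw2 : w ≤ q) (hw : w = u ∨ (w = q ∧ q ≤ u) ∨ (w = -q ∧ u ≤ -q)) :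
    (PS N μ u).EL (vp (t * β ^ 2 / N) (v + β ^ 2 * q * (1 - t)) 0)
      ≤ N * (2 * (phi0 β μ v q + t * β ^ 2 * (1 - q) ^ 2 / 4) + t * β ^ 2 * (u - w) ^ 2 / 2
        - (1 - β ^ 2 * sech4i β μ v q) ^ 2 * (u - q) ^ 2 / 4) := by
  have hβ := h.hβ
  have hq0 := h.hq0
  have hv := h.hv
  have hu := abs_u_le hne
  set V := v + β ^ 2 * q with hV
  set E := sech4i β μ v q with hE
  have hE0 : 0 ≤ E := sech4i_nonneg _ _ _ _
  have hαt : β ^ 2 * E < 1 := h.hAT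
  have hV0 : 0 ≤ V := by positivity
  have hb2 : 0 < β ^ 2 := by positivity
  set T := t * β ^ 2 with hT
  have hT0 : 0 ≤ T := by positivity
  have hTb : T ≤ β ^ 2 := mul_le_of_le_one_left hb2.le ht1
  have hB : 0 ≤ v + β ^ 2 * q * (1 - t) := by
    have : 0 ≤ 1 - t := by linarith
    positivity
  have key := PS_GT hN μ u (n := 1) (T := T) (B := v + β ^ 2 * q * (1 - t)) (q := q) (w := w) (x := 0) (y := 0) (s := 0)
    one_pos le_rfl hT0 hB (by linarith) (by linarith) le_rfl le_rfl
  simp only [mul_zero, vp_zero] at key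
  rw [GS.F_zero_in _ _ one_ne_zero] at key
  set d := T * (q - w) / 2 with hd
  have hd0 : 0 ≤ d := by have : 0 ≤ q - w := by linarith
                         positivity
  have e1 : v + β ^ 2 * q * (1 - t) + T * (q + w) / 2 = V - d := by rw [hd, hV, hT]; ring
  rw [e1] at key
  have hdV : d ≤ V := by
    have h1 : d ≤ β ^ 2 * q := by
      rw [hd]
      have : T * (q - w) ≤ β ^ 2 * (2 * q) := mul_le_mul hTb (by linarith) (by linarith) hb2.le
      linarith
    linarith
  set f := (Q1 μ).nu (v2 (V - d) d) f12 with hf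
  have hf1 : |f| ≤ 1 := by
    have := (Q1 μ).abs_nu_le_of (v2 (V - d) d) (f := f12) (g := fun _ => 1) (fun x => by
      unfold f12; rw [abs_mul, abs_sp, abs_sp]; norm_num)
    rwa [GS.nu_const] at this
  have hlam : |-(f - u) / 2| ≤ 1 := by
    rw [abs_le] at *
    constructor <;> linarith [hf1.1, hf1.2, hu.1, hu.2]
  have k2 := PS_EL0 hN μ u (V - d) d hlam
  rw [Q1_EL μ (by linarith) hd0 (V := V) (by ring), ← hf] at k2
  have hphi : ∫ w, lc (μ + √V * w) ∂g1 = phi0 β μ v q := rfl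
  rw [hphi] at k2
  have hfu : (1 - β ^ 2 * E) ^ 2 * (u - q) ^ 2 ≤ (f - u) ^ 2 := by
    have hET := Q1_ET μ hd0 hdV
    rw [← hf, ← h.hq] at hET
    have hET' : q - 2 * d * E ≤ f := hET
    have hα0 : 0 ≤ β ^ 2 * E := by positivity
    have hlow : w ≤ q → q - w ≤ q - u → (1 - β ^ 2 * E) ^ 2 * (u - q) ^ 2 ≤ (f - u) ^ 2 := by
      intro a1 a2
      have : (1 - β ^ 2 * E) * (q - u) ≤ f - u := by
        have : 2 * d * E ≤ β ^ 2 * E * (q - u) := by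
          calc 2 * d * E = (t * (q - w)) * (β ^ 2 * E) := by rw [hd, hT]; ring
            _ ≤ (q - u) * (β ^ 2 * E) := by
              refine mulR ?_ hα0
              have : 0 ≤ (1 - t) * (q - w) := mul_nonneg (by linarith) (by linarith)
              linarith
            _ = _ := by ring
        linarith
      have h0 : 0 ≤ (1 - β ^ 2 * E) * (q - u) := mul_nonneg (by linarith) (by linarith)
      calc _ = ((1 - β ^ 2 * E) * (q - u)) ^ 2 := by ring
        _ ≤ _ := pow_le_pow_left₀ h0 this 2
    rcases hw with hw | ⟨hw, hwu⟩ | ⟨hw, hwu⟩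
    · exact hlow hw2 (by rw [hw])
    · have hd00 : d = 0 := by rw [hd, hw]; ring
      have : f = q := by
        rw [hf, hd00, sub_zero, nu_f12_zero μ hV0, ← h.hq]
      rw [this, show (q - u) ^ 2 = (u - q) ^ 2 by ring]
      have h1 : (1 - β ^ 2 * E) ^ 2 ≤ 1 := pow_le_one₀ (by linarith) (by linarith)
      exact mul_le_of_le_one_left (sq_nonneg _) h1
    · exact hlow hw2 (by linarith)
  refine key.trans ((add_le_add_left k2 _).trans ?_)
  have hN' : (0:ℝ) < N := Nat.cast_pos.2 (Nat.pos_of_ne_zero hN)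
  have : (N:ℝ) * (2 * phi0 β μ v q + -(f - u) / 2 * (f - u) + (-(f - u) / 2) ^ 2)
      + N * T / 2 * (1 + u ^ 2 - 2 * q - 2 * w * u - 2 * (0 + 0) - 2 * (0 - 0) * u + (1 - 1) * ((q + (0 + 0)) ^ 2 + (w + (0 - 0)) ^ 2) + 1 * (q ^ 2 + w ^ 2))
      = N * (2 * (phi0 β μ v q + T * (1 - q) ^ 2 / 4) + T * (u - w) ^ 2 / 2 - (f - u) ^ 2 / 4) := by ring
  simp only [add_zero, sub_zero, mul_zero, zero_mul] at this ⊢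
  rw [this]
  refine mulL ?_ hN'.le
  linarith

lemma PS_c (hN : N ≠ 0) {β μ v q : ℝ} (h : HYP β μ v q) : ∃ c, 0 < c ∧ ∀ (N : ℕ) (hN : N ≠ 0) (u : ℝ)
    [hne : Nonempty {x : Sp N × Sp N // R x.1 x.2 = u}] (t : ℝ) (ht0 : 0 ≤ t) (ht1 : t ≤ 1) (hu : q ≤ |u|),
    (PS N μ u).EL (vp (t * β ^ 2 / N) (v + β ^ 2 * q * (1 - t)) 0)
      ≤ N * (2 * (phi0 β μ v q + t * β ^ 2 * (1 - q) ^ 2 / 4) - c * (t * β ^ 2) ^ 2 * (|u| - q) ^ 2) := by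
  obtain ⟨m, c, hm1, hm2, hc, hF⟩ := h.hP
  refine ⟨(m - 1) * c, mul_pos (by linarith) hc, ?_⟩
  intro N hN u hne t ht0 ht1 hu
  have hβ := h.hβ
  have hq0 := h.hq0
  have hv := h.hv
  have hu1 := abs_u_le hne
  set V := v + β ^ 2 * q with hV
  have hV0 : 0 ≤ V := by positivity
  have hb2 : 0 < β ^ 2 := by positivity
  set T := t * β ^ 2 with hT
  have hT0 : 0 ≤ T := by positivity
  have hTb : T ≤ β ^ 2 := mul_le_of_le_one_left hb2.le ht1
  set κ := |u| - q with hκ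
  have hκ0 : 0 ≤ κ := by linarith
  have hB : 0 ≤ v + β ^ 2 * q * (1 - t) := by
    have : 0 ≤ 1 - t := by linarith
    positivity
  have hN' : (0:ℝ) < N := Nat.cast_pos.2 (Nat.pos_of_ne_zero hN)
  have hFF := hF (T * κ) (by positivity) (by
    have : κ ≤ 1 - q := by linarith
    calc T * κ ≤ β ^ 2 * (1 - q) := mul_le_mul hTb this hκ0 hb2.le)
  change FF μ V m (T * κ) ≤ phi0 β μ v q + _ + _ at hFF
  have fin : (N:ℝ) * (2 * FF μ V m (T * κ)) + N * T / 2 * ((1 - |u|) ^ 2 - m * (|u| ^ 2 - q ^ 2))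
      ≤ N * (2 * (phi0 β μ v q + T * (1 - q) ^ 2 / 4) - (m - 1) * c * T ^ 2 * κ ^ 2) := by
    have hu' : |u| = q + κ := by rw [hκ]; ring
    rw [hu']
    have e2 : (T * κ) ^ 2 / (2 * β ^ 2) = t * T * κ ^ 2 / 2 := by rw [hT]; field_simp
    rw [e2] at hFF
    have : 0 ≤ (m - 1) * (1 - t) * (T * κ ^ 2) / 2 := by
      have : 0 ≤ m - 1 := by linarith
      have : 0 ≤ 1 - t := by linarith
      positivity
    rw [show (N:ℝ) * T / 2 * ((1 - (q + κ)) ^ 2 - m * ((q + κ) ^ 2 - q ^ 2)) = N * (T / 2 * ((1 - (q + κ)) ^ 2 - m * ((q + κ) ^ 2 - q ^ 2))) by ring, ← mul_add]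
    refine mulL ?_ hN'.le
    nlinarith
  rcases le_or_gt 0 u with hs | hs
  · have key := PS_GT hN μ u (n := m / 2) (T := T) (B := v + β ^ 2 * q * (1 - t)) (q := q) (w := q) (x := κ) (y := 0) (s := 0)
      (by linarith) (by linarith) hT0 hB (by linarith) (by linarith) hκ0 le_rfl
    have e1 : v + β ^ 2 * q * (1 - t) + T * (q + q) / 2 = V := by rw [hV, hT]; ring
    rw [e1, sub_self, mul_zero, zero_div] at key
    have k2 := PS_F_le hN μ u (x := V) (y := 0) (V := V) (n := m / 2) (κ := T * κ) (by linarith) hV0 le_rfl (by ring) true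
    simp only [if_true] at k2
    rw [show 2 * (m / 2) = m by ring] at k2
    refine key.trans ((add_le_add_left k2 _).trans (le_trans (le_of_eq ?_) fin))
    rw [abs_of_nonneg hs] at hκ ⊢
    rw [show κ = u - q from hκ]
    ring
  · have key := PS_GT hN μ u (n := m / 2) (T := T) (B := v + β ^ 2 * q * (1 - t)) (q := q) (w := -q) (x := 0) (y := κ) (s := 0)
      (by linarith) (by linarith) hT0 hB (by linarith) (by linarith) le_rfl hκ0
    have k2 := PS_F_le hN μ u (x := v + β ^ 2 * q * (1 - t) + T * (q + -q) / 2) (y := T * (q - -q) / 2) (V := V) (n := m / 2) (κ := T * κ) (by linarith)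
      (by simpa using hB) (by rw [sub_neg_eq_add]; positivity) (by rw [hV, hT]; ring) false
    simp only [Bool.false_eq_true, if_false] at k2
    rw [show 2 * (m / 2) = m by ring] at k2
    rw [mul_zero] at key
    refine key.trans ((add_le_add_left k2 _).trans (le_trans (le_of_eq ?_) fin))
    rw [abs_of_neg hs] at hκ ⊢
    rw [show κ = -u - q from hκ]
    ring

theorem PS_bound (h : HYP β μ v q) : ∃ c, 0 < c ∧ ∀ (N : ℕ) (hN : N ≠ 0) (u : ℝ)
    [hne : Nonempty {x : Sp N × Sp N // R x.1 x.2 = u}] (t : ℝ) (ht0 : 0 ≤ t) (ht1 : t ≤ 1),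
    (PS N μ u).EL (vp (t * β ^ 2 / N) (v + β ^ 2 * q * (1 - t)) 0)
      ≤ N * (2 * (phi0 β μ v q + t * β ^ 2 * (1 - q) ^ 2 / 4) - c * (u - q) ^ 2) := by
  obtain ⟨c, hc, hcc⟩ := PS_c one_ne_zero h
  have hβ := h.hβ
  have hq0 := h.hq0
  have hb2 : 0 < β ^ 2 := by positivity
  set A := (1 - β ^ 2 * sech4i β μ v q) ^ 2 with hA
  have hα : β ^ 2 * sech4i β μ v q < 1 := h.hAT
  have hA0 : 0 < A := by have : 0 < 1 - β ^ 2 * sech4i β μ v q := by linarith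
                         positivity
  set c1 := A / 8
  set c2 := c * A ^ 2 / 16
  set c3 := c * A ^ 3 * q ^ 2 / (64 * β ^ 2)
  have hc1 : 0 < c1 := by positivity
  have hc2 : 0 < c2 := by positivity
  have hc3 : 0 < c3 := by positivity
  refine ⟨min c1 (min c2 c3), by positivity, ?_⟩
  intro N hN u hne t ht0 ht1
  have hN' : (0:ℝ) < N := Nat.cast_pos.2 (Nat.pos_of_ne_zero hN)
  have hu1 := abs_u_le hne
  have hT0 : 0 ≤ t * β ^ 2 := by positivity
  have hTb : t * β ^ 2 ≤ β ^ 2 := by nlinarith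
  have B := fun w => PS_b hN h u (w := w) ht0 ht1
  have Cc := hcc N hN u t ht0 ht1
  set T := t * β ^ 2 with hT
  have m1 : min c1 (min c2 c3) ≤ c1 := min_le_left _ _
  have m2 : min c1 (min c2 c3) ≤ c2 := (min_le_right _ _).trans (min_le_left _ _)
  have m3 : min c1 (min c2 c3) ≤ c3 := (min_le_right _ _).trans (min_le_right _ _)
  set cm := min c1 (min c2 c3)
  have hsq := sq_nonneg (u - q)
  -- reduce to gain
  have red : ∀ g, cm * (u - q) ^ 2 ≤ g → (PS N μ u).EL (vp (T / N) (v + β ^ 2 * q * (1 - t)) 0)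
      ≤ N * (2 * (phi0 β μ v q + T * (1 - q) ^ 2 / 4) - g) → (PS N μ u).EL (vp (T / N) (v + β ^ 2 * q * (1 - t)) 0)
      ≤ N * (2 * (phi0 β μ v q + T * (1 - q) ^ 2 / 4) - cm * (u - q) ^ 2) := by
    intro g hg hle
    refine hle.trans (mulL ?_ hN'.le)
    linarith
  have redb : ∀ w, -q ≤ w → w ≤ q → (w = u ∨ (w = q ∧ q ≤ u) ∨ (w = -q ∧ u ≤ -q)) → T * (u - w) ^ 2 / 2 ≤ c1 * (u - q) ^ 2 →
      (PS N μ u).EL (vp (T / N) (v + β ^ 2 * q * (1 - t)) 0)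
      ≤ N * (2 * (phi0 β μ v q + T * (1 - q) ^ 2 / 4) - cm * (u - q) ^ 2) := by
    intro w h1 h2 h3 h4
    refine red (c1 * (u - q) ^ 2) (mulR m1 hsq) ((B w h1 h2 h3).trans (mulL ?_ hN'.le))
    have : A * (u - q) ^ 2 / 4 = c1 * (u - q) ^ 2 + c1 * (u - q) ^ 2 := by simp only [c1]; ring
    linarith
  rcases le_or_gt u (-q) with hu | hu
  · by_cases hT4 : T ≤ A / 4
    · refine redb (-q) le_rfl (by linarith) (Or.inr (Or.inr ⟨rfl, hu⟩)) ?_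
      have : (u - -q) ^ 2 ≤ (u - q) ^ 2 := by nlinarith
      calc T * (u - -q) ^ 2 / 2 ≤ (A / 4) * (u - q) ^ 2 / 2 := by gcongr
        _ = _ := by simp only [c1]; ring
    push Not at hT4
    by_cases hκ : β ^ 2 * (u - -q) ^ 2 ≤ A * q ^ 2
    · refine redb (-q) le_rfl (by linarith) (Or.inr (Or.inr ⟨rfl, hu⟩)) ?_
      have h4 : 4 * q ^ 2 ≤ (u - q) ^ 2 := by nlinarith
      have : T * (u - -q) ^ 2 ≤ β ^ 2 * (u - -q) ^ 2 := by gcongr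
      simp only [c1]
      nlinarith
    · push Not at hκ
      have hun : |u| = -u := abs_of_neg (by linarith)
      have := Cc (by rw [hun]; linarith)
      refine red _ ?_ this
      rw [hun]
      have e : (-u - q) ^ 2 = (u - -q) ^ 2 := by ring
      rw [e]
      have h1 : A * q ^ 2 / β ^ 2 ≤ (u - -q) ^ 2 := by rw [div_le_iff₀ hb2]; linarith
      have h2 : (u - q) ^ 2 ≤ 4 := by
        rw [hun] at hu1
        have := h.hq1
        nlinarith
      calc cm * (u - q) ^ 2 ≤ c3 * 4 := mul_le_mul m3 h2 hsq hc3.le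
        _ = c * (A / 4) ^ 2 * (A * q ^ 2 / β ^ 2) := by simp only [c3]; field_simp; ring
        _ ≤ c * T ^ 2 * (u - -q) ^ 2 := by gcongr
  rcases le_or_gt u q with hu2 | hu2
  · refine redb u hu.le hu2 (Or.inl rfl) ?_
    rw [sub_self]
    have := mul_nonneg hc1.le hsq
    simpa using this
  · by_cases hT4 : T ≤ A / 4
    · refine redb q (by linarith) le_rfl (Or.inr (Or.inl ⟨rfl, hu2.le⟩)) ?_
      calc T * (u - q) ^ 2 / 2 ≤ (A / 4) * (u - q) ^ 2 / 2 := by gcongr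
        _ = _ := by simp only [c1]; ring
    · push Not at hT4
      have hun : |u| = u := abs_of_pos (by linarith)
      have := Cc (by rw [hun]; linarith)
      refine red _ ?_ this
      rw [hun]
      refine mulR (m2.trans ?_) hsq
      calc c2 = c * (A / 4) ^ 2 := by simp only [c2]; ring
        _ ≤ c * T ^ 2 := by gcongr
end

section
/-- extension of the fields to the pair system -/
def ext2 (θ : PI' N ⊕ Fin N → ℝ) : KP N → ℝ :=
  Sum.elim (fun p => θ (inl p)) (fun bi => if bi.1 then θ (inr bi.2) else 0)

lemma PSf_ext (μ : ℝ) (θ : PI' N ⊕ Fin N → ℝ) (x : Sp N × Sp N) :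
    (PSf N μ).ew (ext2 θ) x = (SKs N μ).ew θ x.1 * (SKs N μ).ew θ x.2 := by
  simp only [GS.ew, ← exp_add]
  congr 1
  simp only [PSf, SKs, ext2, sum_sum_type, elim_inl, elim_inr, sum_prod_type, sum_bool, Q1]
  simp only [if_true, Bool.false_eq_true, if_false, zero_mul, sum_const_zero, add_zero]
  simp only [mul_add, sum_add_distrib]
  ring

lemma av_ind (μ u : ℝ) (θ : PI' N ⊕ Fin N → ℝ) :
    ((SKs N μ).rep (Fin 2)).av θ (fun x => if R (x 0) (x 1) = u then 1 else 0)
      = (PS N μ u).Z (ext2 θ) / (SKs N μ).Z θ ^ 2 := by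
  rw [GS.av_eq, GS.rep_Z]
  simp only [Fintype.card_fin]
  congr 1
  have h1 : (PS N μ u).Z (ext2 θ) = ∑ x : Sp N × Sp N, if R x.1 x.2 = u then (PSf N μ).ew (ext2 θ) x else 0 := by
    rw [← sum_filter]
    exact (sum_subtype (p := fun x : Sp N × Sp N => R x.1 x.2 = u) _ (by simp) (fun x : Sp N × Sp N => (PSf N μ).ew (ext2 θ) x)).symm
  rw [h1, ← (finTwoArrowEquiv (Sp N)).sum_comp]
  refine sum_congr rfl fun x _ => ?_
  rw [PSf_ext, GS.rep_ew]
  simp [Fin.prod_univ_two]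

lemma PS_transfer (μ u : ℝ) [Nonempty {x : Sp N × Sp N // R x.1 x.2 = u}] (x y : ℝ) {g : ℝ → ℝ} (hg : Continuous g) :
    ∫ w, g (log ((PS N μ u).Z (ext2 fun k => √(vr x y k) * w k))) ∂(gam (PI' N ⊕ Fin N))
      = ∫ w, g (log ((PS N μ u).Z (fun k => √(vp x y 0 k) * w k))) ∂(gam (KP N)) := by
  have hc : Continuous (fun w : PI' N ⊕ Fin N → ℝ => g (log ((PS N μ u).Z (ext2 fun k => √(vr x y k) * w k)))) := by
    refine hg.comp ((PS N μ u).continuous_logZ.comp (continuous_pi fun k => ?_))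
    rcases k with k | ⟨b, i⟩
    · simp only [ext2, elim_inl]; fun_prop
    · cases b <;> simp only [ext2, elim_inr, Bool.false_eq_true, if_false, if_true] <;> fun_prop
  rw [← gam_inj (Sum.map id (fun i => (true, i)) : PI' N ⊕ Fin N → KP N) (by
    rintro (a | a) (b | b) h <;> simp_all [Sum.map]) hc]
  refine integral_congr_ae (Eventually.of_forall fun w => ?_)
  simp only
  congr 3
  ext k
  rcases k with k | ⟨b, i⟩
  · simp [ext2, vr, vp]
  · cases b <;> simp [ext2, vr, vp, v2]

lemma SKs_cv_le (hN : N ≠ 0) {β μ v q t : ℝ} (hv : 0 ≤ v) (hq : 0 ≤ q) (h0 : 0 ≤ t) (h1 : t ≤ 1) (σ τ : Sp N) :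
    |(SKs N μ).cv (va β v q t) σ τ| ≤ (N:ℝ) * (β ^ 2 + v + β ^ 2 * q) := by
  have hN' : (0:ℝ) < N := by positivity
  have hN1 : (1:ℝ) ≤ N := by exact_mod_cast Nat.one_le_iff_ne_zero.mpr hN
  rw [va, SKs_cv hN]
  have hR := abs_R σ τ
  have hR2 : R σ τ ^ 2 ≤ 1 := by rw [← sq_abs]; nlinarith [abs_nonneg (R σ τ)]
  have e : t * (β ^ 2 / N) * ((N ^ 2 * R σ τ ^ 2 - N) / 2) = t * β ^ 2 * ((N * R σ τ ^ 2 - 1) / 2) := by field_simp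
  rw [e]
  have k1 : |t * β ^ 2 * ((N * R σ τ ^ 2 - 1) / 2)| ≤ β ^ 2 * N := by
    rw [abs_mul, abs_of_nonneg (by positivity)]
    have : |((N:ℝ) * R σ τ ^ 2 - 1) / 2| ≤ (N:ℝ) := by
      rw [abs_le]; constructor <;> nlinarith [sq_nonneg (R σ τ)]
    calc _ ≤ t * β ^ 2 * N := by gcongr
      _ ≤ 1 * β ^ 2 * N := by gcongr
      _ = _ := by ring
  have k2 : |(v + β ^ 2 * q * (1 - t)) * (N * R σ τ)| ≤ (v + β ^ 2 * q) * N := by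
    have h1t : 0 ≤ 1 - t := by linarith
    rw [abs_mul, abs_mul, abs_of_nonneg (a := v + β ^ 2 * q * (1 - t)) (by positivity), Nat.abs_cast]
    calc _ ≤ (v + β ^ 2 * q * 1) * (N * 1) := by gcongr; linarith
      _ = _ := by ring
  refine (abs_add_le _ _).trans ((add_le_add k1 k2).trans (le_of_eq (by ring)))

lemma PS_cv_le (hN : N ≠ 0) {β μ v q t u : ℝ} (hv : 0 ≤ v) (hq : 0 ≤ q) (h0 : 0 ≤ t) (h1 : t ≤ 1)
    (X Y : {x : Sp N × Sp N // R x.1 x.2 = u}) :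
    |(PS N μ u).cv (vp (t * (β ^ 2 / N)) (v + β ^ 2 * q * (1 - t)) 0) X Y| ≤ 4 * (N * (β ^ 2 + v + β ^ 2 * q)) := by
  have hN' : (0:ℝ) < N := by positivity
  have hN1 : (1:ℝ) ≤ N := by exact_mod_cast Nat.one_le_iff_ne_zero.mpr hN
  rw [← mul_div_assoc, PS_cv hN]
  have sqle : ∀ σ τ : Sp N, R σ τ ^ 2 ≤ 1 := fun σ τ => by
    have := abs_R σ τ
    rw [← sq_abs]; nlinarith [abs_nonneg (R σ τ)]
  have a1 := sqle X.1.1 Y.1.1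
  have a2 := sqle X.1.1 Y.1.2
  have a3 := sqle X.1.2 Y.1.1
  have a4 := sqle X.1.2 Y.1.2
  have b1 := abs_le.mp (abs_R X.1.1 Y.1.1)
  have b2 := abs_le.mp (abs_R X.1.1 Y.1.2)
  have b3 := abs_le.mp (abs_R X.1.2 Y.1.1)
  have b4 := abs_le.mp (abs_R X.1.2 Y.1.2)
  generalize R X.1.1 Y.1.1 = r1 at *
  generalize R X.1.1 Y.1.2 = r2 at *
  generalize R X.1.2 Y.1.1 = r3 at *
  generalize R X.1.2 Y.1.2 = r4 at *
  have k1 : |t * β ^ 2 * (N * (r1 ^ 2 + r2 ^ 2 + r3 ^ 2 + r4 ^ 2) / 2 - 2)| ≤ β ^ 2 * (4 * N) := by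
    rw [abs_mul, abs_of_nonneg (by positivity)]
    have : |((N:ℝ) * (r1 ^ 2 + r2 ^ 2 + r3 ^ 2 + r4 ^ 2) / 2 - 2)| ≤ 4 * (N:ℝ) := by
      have p1 : (0:ℝ) ≤ N * (r1 ^ 2 + r2 ^ 2 + r3 ^ 2 + r4 ^ 2) := by positivity
      have p2 : (N:ℝ) * (r1 ^ 2 + r2 ^ 2 + r3 ^ 2 + r4 ^ 2) ≤ (N:ℝ) * 4 := by gcongr; linarith
      rw [abs_le]; constructor <;> linarith
    calc _ ≤ t * β ^ 2 * (4 * N) := by gcongr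
      _ ≤ 1 * β ^ 2 * (4 * N) := by gcongr
      _ = _ := by ring
  have k2 : |(v + β ^ 2 * q * (1 - t)) * (N * (r1 + r2 + r3 + r4))| ≤ (v + β ^ 2 * q) * (4 * N) := by
    have h1t : 0 ≤ 1 - t := by linarith
    have : |r1 + r2 + r3 + r4| ≤ 4 := by rw [abs_le]; constructor <;> linarith
    rw [abs_mul, abs_mul, abs_of_nonneg (a := v + β ^ 2 * q * (1 - t)) (by positivity), Nat.abs_cast]
    calc _ ≤ (v + β ^ 2 * q * 1) * (N * 4) := by gcongr; linarith
      _ = _ := by ring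
  rw [zero_mul, add_zero]
  refine (abs_add_le _ _).trans ((add_le_add k1 k2).trans (le_of_eq (by ring)))

/-- probability of a given overlap -/
lemma nu_ind_le (hN : N ≠ 0) {β μ v q t : ℝ} (hv : 0 ≤ v) (hq : 0 ≤ q) (h0 : 0 ≤ t) (h1 : t ≤ 1) (u : ℝ)
    [Nonempty {x : Sp N × Sp N // R x.1 x.2 = u}] {n : ℝ} (hn0 : 0 ≤ n) (hn1 : n ≤ 1) :
    ((SKs N μ).rep (Fin 2)).nu (va β v q t) (fun x => if R (x 0) (x 1) = u then 1 else 0)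
      ≤ exp (n * ((PS N μ u).EL (vp (t * (β ^ 2 / N)) (v + β ^ 2 * q * (1 - t)) 0) - 2 * (SKs N μ).EL (va β v q t))
        + 8 * n ^ 2 * (N * (β ^ 2 + v + β ^ 2 * q))) := by
  set a : PI' N ⊕ Fin N → ℝ := va β v q t with ha
  set B := v + β ^ 2 * q * (1 - t)
  set EX := (PS N μ u).EL (vp (t * (β ^ 2 / N)) B 0) with hEX
  set EY := (SKs N μ).EL a with hEY
  set L := N * (β ^ 2 + v + β ^ 2 * q)
  have h1t : 0 ≤ 1 - t := by linarith
  have hB : 0 ≤ B := by positivity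
  set X : (PI' N ⊕ Fin N → ℝ) → ℝ := fun w => log ((PS N μ u).Z (ext2 fun k => √(a k) * w k)) with hX
  set Y : (PI' N ⊕ Fin N → ℝ) → ℝ := fun w => log ((SKs N μ).Z (fun k => √(a k) * w k)) with hY
  have t1 : ∫ w, exp (2 * n * X w) ∂(gam (PI' N ⊕ Fin N)) ≤ exp (2 * n * EX + (2 * n) ^ 2 * (4 * L) / 2) := by
    have := PS_transfer (N := N) μ u (t * (β ^ 2 / N)) B (g := fun z => exp (2 * n * z)) (by fun_prop)
    refine (le_of_eq this).trans ?_
    exact (PS N μ u).conc (2 * n) _ (vp_nonneg (by positivity) hB le_rfl) (PS_cv_le hN hv hq h0 h1)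
  have t2 : ∫ w, exp (-(4 * n) * Y w) ∂(gam (PI' N ⊕ Fin N)) ≤ exp (-(4 * n) * EY + (-(4 * n)) ^ 2 * L / 2) :=
    (SKs N μ).conc (-(4 * n)) _ (va_nonneg hv hq h0 h1) (SKs_cv_le hN hv hq h0 h1)
  have i2 : Integrable (fun w => exp (-(4 * n) * Y w)) (gam (PI' N ⊕ Fin N)) := by
    simpa [GS.G] using (SKs N μ).int_P (-(4 * n)) (fun k => √(a k)) 0
  have i1 : Integrable (fun w => exp (2 * n * X w)) (gam (PI' N ⊕ Fin N)) := by
    have hE : EG (fun θ : PI' N ⊕ Fin N → ℝ => (PS N μ u).G (2 * n) (ext2 θ)) := by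
      obtain ⟨C, hC, hb⟩ := (PS N μ u).EG_G (2 * n)
      refine ⟨C, hC, fun θ => (hb _).trans (le_of_eq ?_)⟩
      simp [ext2, sum_prod_type]
    have hc : Continuous (fun θ : PI' N ⊕ Fin N → ℝ => (PS N μ u).G (2 * n) (ext2 θ)) := by
      refine ((PS N μ u).continuous_G _).comp (continuous_pi fun k => ?_)
      rcases k with k | ⟨b, i⟩
      · simp only [ext2, elim_inl]; fun_prop
      · cases b <;> simp only [ext2, elim_inr, Bool.false_eq_true, if_false, if_true] <;> fun_prop
    have := (hE.scale (fun k => √(a k)) 0).integrable (hc.comp (by fun_prop))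
    simpa [GS.G] using this
  have pt : ∀ w : PI' N ⊕ Fin N → ℝ, ((SKs N μ).rep (Fin 2)).av (fun k => √(a k) * w k) (fun x => if R (x 0) (x 1) = u then 1 else 0)
      ≤ exp (n * (EX - 2 * EY)) / 2 * (exp (-(2 * n * EX)) * exp (2 * n * X w) + exp (4 * n * EY) * exp (-(4 * n) * Y w)) := by
    intro w
    have hle : ((SKs N μ).rep (Fin 2)).av (fun k => √(a k) * w k) (fun x => if R (x 0) (x 1) = u then 1 else 0) ≤ 1 := by
      refine (((SKs N μ).rep (Fin 2)).av_mono _ (g := fun _ => 1) fun x => ?_).trans_eq (GS.av_const _ _ _)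
      split_ifs <;> norm_num
    have hz1 := (PS N μ u).Z_pos (ext2 fun k => √(a k) * w k)
    have hz2 := (SKs N μ).Z_pos (fun k => √(a k) * w k)
    rw [av_ind] at hle ⊢
    have e1 : (PS N μ u).Z (ext2 fun k => √(a k) * w k) / (SKs N μ).Z (fun k => √(a k) * w k) ^ 2 = exp (X w - 2 * Y w) := by
      simp only [X, Y]
      rw [exp_sub, exp_log hz1, mul_comm, exp_mul, exp_log hz2]
      norm_cast
    rw [e1] at hle ⊢
    have hneg : X w - 2 * Y w ≤ 0 := by
      by_contra hc
      push Not at hc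
      have := one_lt_exp_iff.mpr hc
      linarith
    have s1 : exp (X w - 2 * Y w) ≤ exp (n * (X w - 2 * Y w)) := exp_le_exp.2 (by nlinarith)
    refine s1.trans ?_
    have e2 : n * (X w - 2 * Y w) = n * (EX - 2 * EY) + (n * (X w - EX) + - (2 * n) * (Y w - EY)) := by ring
    rw [e2, exp_add, exp_add (n * (X w - EX)), ← exp_add (-(2 * n * EX)), ← exp_add (4 * n * EY), div_mul_eq_mul_div, mul_div_assoc]
    refine mulL ?_ (exp_pos _).le
    have e3 : -(2 * n * EX) + 2 * n * X w = n * (X w - EX) + n * (X w - EX) := by ring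
    have e4 : 4 * n * EY + -(4 * n) * Y w = - (2 * n) * (Y w - EY) + - (2 * n) * (Y w - EY) := by ring
    rw [e3, e4, exp_add (n * (X w - EX)) (n * (X w - EX)), exp_add (- (2 * n) * (Y w - EY)) (- (2 * n) * (Y w - EY))]
    nlinarith [sq_nonneg (exp (n * (X w - EX)) - exp (- (2 * n) * (Y w - EY)))]
  have hintg : Integrable (fun w => exp (-(2 * n * EX)) * exp (2 * n * X w) + exp (4 * n * EY) * exp (-(4 * n) * Y w)) (gam (PI' N ⊕ Fin N)) :=
    (i1.const_mul _).add (i2.const_mul _)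
  have := integral_mono (((SKs N μ).rep (Fin 2)).int_av (fun k => √(a k)) (fun x => if R (x 0) (x 1) = u then 1 else 0))
    (hintg.const_mul (exp (n * (EX - 2 * EY)) / 2)) pt
  rw [GS.nu]
  refine this.trans ?_
  rw [integral_const_mul, integral_add (i1.const_mul _) (i2.const_mul _), integral_const_mul, integral_const_mul, exp_add, div_mul_eq_mul_div, mul_div_assoc]
  refine mulL ?_ (exp_pos _).le
  have f1 : exp (-(2 * n * EX)) * ∫ w, exp (2 * n * X w) ∂(gam (PI' N ⊕ Fin N)) ≤ exp (8 * n ^ 2 * L) := by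
    refine (mulL t1 (exp_pos _).le).trans (le_of_eq ?_)
    rw [← exp_add]; congr 1; ring
  have f2 : exp (4 * n * EY) * ∫ w, exp (-(4 * n) * Y w) ∂(gam (PI' N ⊕ Fin N)) ≤ exp (8 * n ^ 2 * L) := by
    refine (mulL t2 (exp_pos _).le).trans (le_of_eq ?_)
    rw [← exp_add]; congr 1; ring
  linarith
end

section
lemma R_vals (σ τ : Sp N) : ∃ k ∈ Finset.range (N + 1), R σ τ = ((N:ℝ) - 2 * k) / N := by
  refine ⟨(univ.filter fun i => σ i ≠ τ i).card, ?_, ?_⟩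
  · rw [mem_range, Nat.lt_succ_iff]
    exact (Finset.card_filter_le _ _).trans (by simp)
  · rw [R]
    congr 1
    have : ∀ i, sp (σ i) * sp (τ i) = 1 - 2 * (if σ i ≠ τ i then 1 else 0) := by
      intro i
      cases σ i <;> cases τ i <;> simp [sp] <;> norm_num
    simp only [this, sum_sub_distrib, ← mul_sum, Finset.sum_boole]
    simp

lemma nu_R_le (μ : ℝ) (a : PI' N ⊕ Fin N → ℝ) (P : ℝ → Prop) [DecidablePred P] {E : ℝ} (hE0 : 0 ≤ E)
    (hE : ∀ u, P u → Nonempty {x : Sp N × Sp N // R x.1 x.2 = u} →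
      ((SKs N μ).rep (Fin 2)).nu a (fun x => if R (x 0) (x 1) = u then 1 else 0) ≤ E) :
    ((SKs N μ).rep (Fin 2)).nu a (fun x => if P (R (x 0) (x 1)) then 1 else 0) ≤ (N + 1) * E := by
  set u : ℕ → ℝ := fun k => ((N:ℝ) - 2 * k) / N
  have h1 : ∀ x : Fin 2 → Sp N, (if P (R (x 0) (x 1)) then (1:ℝ) else 0)
      ≤ ∑ k ∈ Finset.range (N + 1), if P (u k) then (if R (x 0) (x 1) = u k then 1 else 0) else 0 := by
    intro x
    have nn : ∀ k ∈ Finset.range (N + 1), (0:ℝ) ≤ if P (u k) then (if R (x 0) (x 1) = u k then 1 else 0) else 0 := by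
      intro k _; split_ifs <;> norm_num
    by_cases hP : P (R (x 0) (x 1))
    · obtain ⟨k, hk, he⟩ := R_vals (x 0) (x 1)
      refine le_trans ?_ (single_le_sum nn hk)
      have : R (x 0) (x 1) = u k := he
      rw [this] at hP ⊢
      simp [hP]
    · rw [if_neg hP]
      exact sum_nonneg nn
  refine (GS.nu_mono _ a h1).trans ?_
  rw [GS.nu_sum]
  have h2 : ∀ k ∈ Finset.range (N + 1), ((SKs N μ).rep (Fin 2)).nu a
      (fun x => if P (u k) then (if R (x 0) (x 1) = u k then 1 else 0) else 0) ≤ E := by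
    intro k _
    by_cases hP : P (u k)
    · simp only [hP, if_true]
      by_cases hne : Nonempty {x : Sp N × Sp N // R x.1 x.2 = u k}
      · exact hE _ hP hne
      · have : ∀ x : Fin 2 → Sp N, (if R (x 0) (x 1) = u k then (1:ℝ) else 0) = 0 := by
          intro x
          rw [if_neg]
          intro hx
          exact hne ⟨⟨(x 0, x 1), hx⟩⟩
        simp only [this, GS.nu_const]
        exact hE0
    · simp only [hP, if_false, GS.nu_const]
      exact hE0
  refine (sum_le_sum h2).trans ?_
  simp

def DD (N : ℕ) (β μ v q t : ℝ) : ℝ := phi0 β μ v q + t * β ^ 2 * (1 - q) ^ 2 / 4 - (SKs N μ).EL (va β v q t) / N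

lemma tail_t (hN : N ≠ 0) {β μ v q : ℝ} (h : HYP β μ v q) {c : ℝ} (hc : 0 < c)
    (hb : ∀ (u : ℝ) [hne : Nonempty {x : Sp N × Sp N // R x.1 x.2 = u}] (t : ℝ) (ht0 : 0 ≤ t) (ht1 : t ≤ 1),
    (PS N μ u).EL (vp (t * β ^ 2 / N) (v + β ^ 2 * q * (1 - t)) 0)
      ≤ N * (2 * (phi0 β μ v q + t * β ^ 2 * (1 - q) ^ 2 / 4) - c * (u - q) ^ 2)) {t δ : ℝ} (ht0 : 0 ≤ t) (ht1 : t ≤ 1)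
    (hδ : 0 < δ) (hδ' : δ ≤ 16 * (β ^ 2 + v + β ^ 2 * q)) :
    ((SKs N μ).rep (Fin 2)).nu (va β v q t) (fun x => if 2 * DD N β μ v q t + δ ≤ c * (R (x 0) (x 1) - q) ^ 2 then 1 else 0)
      ≤ (N + 1) * exp (- (N * δ ^ 2 / (32 * (β ^ 2 + v + β ^ 2 * q)))) := by
  refine nu_R_le μ _ (fun u => 2 * DD N β μ v q t + δ ≤ c * (u - q) ^ 2) (exp_pos _).le ?_
  intro u hu hne
  have hN' : (0:ℝ) < N := by positivity
  have hv := h.hv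
  have hq := h.hq0
  have hβ := h.hβ
  set K := β ^ 2 + v + β ^ 2 * q with hK
  have hK0 : 0 < K := by positivity
  refine (nu_ind_le hN (n := δ / (16 * K)) hv hq.le ht0 ht1 u (by positivity) ?_).trans (exp_le_exp.2 ?_)
  · rw [div_le_one (by positivity)]; exact hδ'
  have h1 := hb u t ht0 ht1
  rw [mul_div_assoc] at h1
  set EX := (PS N μ u).EL (vp (t * (β ^ 2 / N)) (v + β ^ 2 * q * (1 - t)) 0)
  have h2 : EX - 2 * (SKs N μ).EL (va β v q t) ≤ - (N * δ) := by
    have e : (SKs N μ).EL (va β v q t) = N * (phi0 β μ v q + t * β ^ 2 * (1 - q) ^ 2 / 4 - DD N β μ v q t) := by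
      simp only [DD]; field_simp; ring
    rw [e]
    have : N * (2 * DD N β μ v q t + δ) ≤ N * (c * (u - q) ^ 2) := mulL hu hN'.le
    linarith
  have h3 : δ / (16 * K) * (EX - 2 * (SKs N μ).EL (va β v q t)) ≤ δ / (16 * K) * (- (N * δ)) :=
    mulL h2 (by positivity)
  have e : - (N * δ ^ 2 / (32 * K)) = δ / (16 * K) * (- (N * δ)) + 8 * (δ / (16 * K)) ^ 2 * (N * K) := by
    field_simp; ring
  rw [e]
  linarith

lemma cont_DD (N : ℕ) (β μ v q : ℝ) : Continuous (fun t => DD N β μ v q t) := by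
  have : Continuous (fun t => (SKs N μ).EL (va β v q t)) := by
    refine (SKs N μ).continuous_EL.comp (continuous_pi fun k => ?_)
    rcases k with k | k <;> simp only [va, vr, elim_inl, elim_inr] <;> fun_prop
  unfold DD
  fun_prop

lemma DD_deriv (hN : N ≠ 0) {β μ v q : ℝ} (hv : 0 ≤ v) (hq : 0 ≤ q) {t : ℝ} (ht : t ∈ Ioo (0:ℝ) 1) :
    HasDerivAt (fun t => DD N β μ v q t) (β ^ 2 / 4 * ((SKs N μ).rep (Fin 2)).nu (va β v q t) fun x => (R (x 0) (x 1) - q) ^ 2) t := by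
  have hN' : (N:ℝ) ≠ 0 := by positivity
  have h1 := (phi_deriv hN (β := β) (μ := μ) hv hq ht).div_const (N:ℝ)
  have h2 : HasDerivAt (fun t => phi0 β μ v q + t * β ^ 2 * (1 - q) ^ 2 / 4) (1 * β ^ 2 * (1 - q) ^ 2 / 4) t :=
    ((((hasDerivAt_id t).mul_const (β ^ 2)).mul_const ((1 - q) ^ 2)).div_const 4).const_add _
  refine (h2.fun_sub h1).congr_deriv ?_
  field_simp
  ring

lemma SKs_Z_field (μ : ℝ) (θ : PI' N ⊕ Fin N → ℝ) (hθ : ∀ p, θ (inl p) = 0) :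
    (SKs N μ).Z θ = ∏ i, (2 * cosh (μ + θ (inr i))) := by
  have h1 : ∀ i : Fin N, 2 * cosh (μ + θ (inr i)) = ∑ b : Bool, exp ((μ + θ (inr i)) * sp b) := by
    intro i
    rw [cosh_eq]; simp [sp]; ring
  simp only [h1]
  rw [← GS.sum_prod_eq, GS.Z]
  refine sum_congr rfl fun σ _ => ?_
  rw [GS.ew, ← exp_sum]
  congr 1
  simp only [SKs, sum_sum_type, elim_inl, elim_inr, hθ, zero_mul, sum_const_zero, zero_add, ← sum_add_distrib]
  refine sum_congr rfl fun i _ => by ring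

lemma gam_coord {K : Type} [Fintype K] [DecidableEq K] (k : K) {f : ℝ → ℝ} (hf : Continuous f) :
    ∫ w, f (w k) ∂(gam K) = ∫ w, f w ∂g1 := by
  have := gam_inj (fun _ : Unit => k) (fun _ _ _ => rfl) (f := fun w => f (w ())) (by fun_prop)
  rw [← int_unit]
  exact this

lemma DD_zero (hN : N ≠ 0) (β μ v q : ℝ) : DD N β μ v q 0 = 0 := by
  have hN' : (N:ℝ) ≠ 0 := by positivity
  have h1 : ∀ w : PI' N ⊕ Fin N → ℝ, log ((SKs N μ).Z (fun k => √(va β v q 0 k) * w k))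
      = ∑ i : Fin N, lc (μ + √(v + β ^ 2 * q) * w (inr i)) := by
    intro w
    rw [SKs_Z_field μ _ (by intro p; simp [va, vr]), log_prod]
    · refine sum_congr rfl fun i _ => ?_
      simp [va, vr, lc]
    · intro i _
      have := cosh_pos (μ + √(va β v q 0 (inr i)) * w (inr i))
      positivity
  have h2 : (SKs N μ).EL (va β v q 0) = N * phi0 β μ v q := by
    rw [GS.EL]
    simp only [h1]
    rw [integral_finsetSum]
    · have : ∀ i : Fin N, ∫ w : PI' N ⊕ Fin N → ℝ, lc (μ + √(v + β ^ 2 * q) * w (inr i)) ∂(gam (PI' N ⊕ Fin N)) = phi0 β μ v q := by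
        intro i
        rw [gam_coord (K := PI' N ⊕ Fin N) (inr i) (f := fun z => lc (μ + √(v + β ^ 2 * q) * z)) (by fun_prop), phi0]
      simp [this]
    · intro i _
      refine EG.integrable (GS.EG_lin (log 2 + |μ|) (√(v + β ^ 2 * q)) fun θ => ?_) (by fun_prop)
      rw [abs_of_nonneg (lc_nonneg _)]
      refine (lc_le _).trans ?_
      have a1 := abs_add_le μ (√(v + β ^ 2 * q) * θ (inr i))
      rw [abs_mul, abs_of_nonneg (sqrt_nonneg _)] at a1
      have a2 : |θ (inr i)| ≤ ∑ k, |θ k| := single_le_sum (f := fun k => |θ k|) (fun _ _ => abs_nonneg _) (mem_univ _)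
      have a3 := mulL a2 (sqrt_nonneg (v + β ^ 2 * q))
      linarith
  rw [DD, h2]
  field_simp
  ring

lemma DD_nonneg (hN : N ≠ 0) {β μ v q : ℝ} (hv : 0 ≤ v) (hq : 0 ≤ q) {t : ℝ} (h0 : 0 ≤ t) (h1 : t ≤ 1) : 0 ≤ DD N β μ v q t := by
  have hm : MonotoneOn (fun t => DD N β μ v q t) (Set.Icc 0 1) := by
    refine monotoneOn_of_deriv_nonneg (convex_Icc _ _) (cont_DD N β μ v q).continuousOn ?_ ?_
    · intro t ht
      rw [interior_Icc] at ht
      exact (DD_deriv hN hv hq ht).differentiableAt.differentiableWithinAt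
    · intro t ht
      rw [interior_Icc] at ht
      rw [(DD_deriv hN hv hq ht).deriv]
      exact mul_nonneg (by positivity) (GS.nu_nonneg _ _ fun x => sq_nonneg _)
  have := hm ⟨le_rfl, zero_le_one⟩ ⟨h0, h1⟩ h0
  simpa [DD_zero hN] using this

lemma DD_one_le (hN : N ≠ 0) {β μ v q : ℝ} (h : HYP β μ v q) {c : ℝ} (hc : 0 < c)
    (hb : ∀ (u : ℝ) [hne : Nonempty {x : Sp N × Sp N // R x.1 x.2 = u}] (t : ℝ) (ht0 : 0 ≤ t) (ht1 : t ≤ 1),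
    (PS N μ u).EL (vp (t * β ^ 2 / N) (v + β ^ 2 * q * (1 - t)) 0)
      ≤ N * (2 * (phi0 β μ v q + t * β ^ 2 * (1 - q) ^ 2 / 4) - c * (u - q) ^ 2)) {δ : ℝ}
    (hδ : 0 < δ) (hδ' : δ ≤ 16 * (β ^ 2 + v + β ^ 2 * q)) :
    DD N β μ v q 1 ≤ exp (β ^ 2 / (2 * c)) * (β ^ 2 / 4 * (δ / c + 4 * ((N + 1) * exp (- (N * δ ^ 2 / (32 * (β ^ 2 + v + β ^ 2 * q))))))) := by
  set κ := β ^ 2 / (2 * c) with hκ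
  have hκ0 : 0 ≤ κ := by positivity
  set E := ((N:ℝ) + 1) * exp (- (N * δ ^ 2 / (32 * (β ^ 2 + v + β ^ 2 * q))))
  have hE : 0 ≤ E := by positivity
  have key := mvt01 (f := fun t => exp (- κ * t) * DD N β μ v q t)
    (f' := fun t => exp (- κ * t) * (-κ) * DD N β μ v q t + exp (- κ * t) * (β ^ 2 / 4 * ((SKs N μ).rep (Fin 2)).nu (va β v q t) fun x => (R (x 0) (x 1) - q) ^ 2))
    (C := β ^ 2 / 4 * (δ / c + 4 * E)) (by have := cont_DD N β μ v q; fun_prop) ?_ ?_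
  · replace key : exp (- κ * 1) * DD N β μ v q 1 - exp (- κ * 0) * DD N β μ v q 0 ≤ β ^ 2 / 4 * (δ / c + 4 * E) := key
    rw [DD_zero hN, mul_zero, sub_zero, mul_one] at key
    have e : DD N β μ v q 1 = exp κ * (exp (-κ) * DD N β μ v q 1) := by
      rw [← mul_assoc, ← exp_add]; simp
    rw [e]
    exact mulL key (exp_pos _).le
  · intro s hs
    have h1 : HasDerivAt (fun t => exp (- κ * t)) (exp (- κ * s) * (-κ)) s := by
      simpa using ((hasDerivAt_id s).const_mul (-κ)).exp
    exact h1.fun_mul (DD_deriv hN h.hv h.hq0.le hs)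
  · intro s hs
    have hD := DD_nonneg hN (β := β) (μ := μ) h.hv h.hq0.le hs.1.le hs.2.le
    have ht := tail_t hN h hc hb hs.1.le hs.2.le hδ hδ'
    set D := DD N β μ v q s
    have hnu : ((SKs N μ).rep (Fin 2)).nu (va β v q s) (fun x => (R (x 0) (x 1) - q) ^ 2) ≤ (2 * D + δ) / c + 4 * E := by
      have : ∀ x : Fin 2 → Sp N, (R (x 0) (x 1) - q) ^ 2 ≤ (2 * D + δ) / c + 4 * (if 2 * D + δ ≤ c * (R (x 0) (x 1) - q) ^ 2 then 1 else 0) := by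
        intro x
        split_ifs with hx
        · have h1 := abs_le.1 (abs_R (x 0) (x 1))
          have h2 := h.hq0
          have h3 := h.hq1
          have : (R (x 0) (x 1) - q) ^ 2 ≤ 4 := by nlinarith
          have : 0 ≤ (2 * D + δ) / c := by positivity
          linarith
        · push Not at hx
          rw [mul_zero, add_zero, le_div_iff₀ hc]
          linarith
      refine (GS.nu_mono _ _ this).trans ?_
      rw [GS.nu_add, GS.nu_const, GS.nu_smul]
      linarith
    have hexp : exp (- κ * s) ≤ 1 := exp_le_one_iff.2 (by nlinarith [hs.1])
    have e : exp (- κ * s) * (-κ) * D + exp (- κ * s) * (β ^ 2 / 4 * ((SKs N μ).rep (Fin 2)).nu (va β v q s) fun x => (R (x 0) (x 1) - q) ^ 2)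
      = exp (- κ * s) * (β ^ 2 / 4 * (((SKs N μ).rep (Fin 2)).nu (va β v q s) (fun x => (R (x 0) (x 1) - q) ^ 2) - 2 * D / c)) := by
      simp only [hκ]; field_simp; ring
    rw [e]
    have h5 : ((SKs N μ).rep (Fin 2)).nu (va β v q s) (fun x => (R (x 0) (x 1) - q) ^ 2) - 2 * D / c ≤ δ / c + 4 * E := by
      rw [add_div] at hnu; linarith
    calc exp (- κ * s) * (β ^ 2 / 4 * (((SKs N μ).rep (Fin 2)).nu (va β v q s) (fun x => (R (x 0) (x 1) - q) ^ 2) - 2 * D / c))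
        ≤ exp (- κ * s) * (β ^ 2 / 4 * (δ / c + 4 * E)) := by gcongr
      _ ≤ 1 * (β ^ 2 / 4 * (δ / c + 4 * E)) := by gcongr
      _ = _ := one_mul _

/-- polynomial times exponential is bounded -/
lemma poly_exp_bdd (r : ℕ) {a : ℝ} (ha : 0 < a) : ∃ C, 0 ≤ C ∧ ∀ N : ℕ, (N:ℝ) ^ r * ((N + 1) * exp (-(N * a))) ≤ C := by
  have h1 : Tendsto (fun x : ℝ => x ^ r * ((x + 1) * exp (-(x * a)))) atTop (𝓝 0) := by
    have t1 := (tendsto_rpow_mul_exp_neg_mul_atTop_nhds_zero ((r + 1 : ℕ) : ℝ) a ha)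
    have t2 := (tendsto_rpow_mul_exp_neg_mul_atTop_nhds_zero (r : ℝ) a ha)
    have := t1.add t2
    rw [add_zero] at this
    refine this.congr fun x => ?_
    rw [rpow_natCast, rpow_natCast, pow_succ, mul_comm x a]
    ring_nf
  have h2 := (h1.comp tendsto_natCast_atTop_atTop).bddAbove_range
  obtain ⟨C, hC⟩ := h2
  refine ⟨max C 0, le_max_right _ _, fun N => le_max_of_le_left (hC ⟨N, rfl⟩)⟩

/-- the overlap concentrates -/
theorem overlap_tail (h : HYP β μ v q) (ε : ℝ) (hε : 0 < ε) (r : ℕ) : ∃ C, 0 ≤ C ∧ ∀ N : ℕ, N ≠ 0 →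
    (N:ℝ) ^ r * ((SKs N μ).rep (Fin 2)).nu (va β v q 1) (fun x => if ε ≤ |R (x 0) (x 1) - q| then 1 else 0) ≤ C := by
  obtain ⟨c, hc, hb⟩ := PS_bound h
  have hv := h.hv
  have hq := h.hq0
  have hβ := h.hβ
  set K := β ^ 2 + v + β ^ 2 * q with hK
  have hK0 : 0 < K := by positivity
  set Q := exp (β ^ 2 / (2 * c)) * (β ^ 2 / 4) with hQ
  have hQ0 : 0 < Q := by positivity
  set δ := min (c * (c * ε ^ 2 / 8) / Q) (16 * K) with hδ
  have hδ0 : 0 < δ := by positivity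
  set δ' := min (c * ε ^ 2 / 2) (16 * K) with hδ'
  have hδ'0 : 0 < δ' := by positivity
  obtain ⟨C2, hC20, hC2⟩ := poly_exp_bdd r (a := δ' ^ 2 / (32 * K)) (by positivity)
  obtain ⟨C1, hC10, hC1⟩ := poly_exp_bdd 1 (a := δ ^ 2 / (32 * K)) (by positivity)
  have hQδ : Q * (δ / c) ≤ c * ε ^ 2 / 8 := by
    have : δ ≤ c * (c * ε ^ 2 / 8) / Q := min_le_left _ _
    rw [le_div_iff₀ hQ0] at this
    rw [← mul_div_assoc, div_le_iff₀ hc]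
    linarith
  obtain ⟨N0, hN0⟩ := exists_nat_gt (Q * 4 * C1 / (c * ε ^ 2 / 8))
  refine ⟨max C2 ((N0:ℝ) ^ r), le_max_of_le_left hC20, fun N hN => ?_⟩
  have hN' : (0:ℝ) < N := by positivity
  by_cases hlt : N < N0
  · refine le_max_of_le_right ?_
    have h1 : ((SKs N μ).rep (Fin 2)).nu (va β v q 1) (fun x => if ε ≤ |R (x 0) (x 1) - q| then 1 else 0) ≤ 1 := by
      refine (((SKs N μ).rep (Fin 2)).nu_mono _ (g := fun _ => 1) fun x => ?_).trans_eq (GS.nu_const _ _ _)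
      split_ifs <;> norm_num
    calc _ ≤ (N:ℝ) ^ r * 1 := by gcongr
      _ ≤ (N0:ℝ) ^ r := by rw [mul_one]; gcongr
  · push Not at hlt
    refine le_max_of_le_left ?_
    have hD := DD_one_le hN h hc (fun u _ t => hb N hN u t) hδ0 (min_le_right _ _)
    have hE := hC1 N
    set E := ((N:ℝ) + 1) * exp (- (N * δ ^ 2 / (32 * K))) with hEdef
    have hE' : N * E ≤ C1 := by
      rw [pow_one] at hE
      rw [hEdef, mul_div_assoc]; exact hE
    have hE0 : 0 ≤ E := by positivity
    have hEs : Q * (4 * E) ≤ c * ε ^ 2 / 8 := by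
      have hpos : 0 < c * ε ^ 2 / 8 := by positivity
      rw [div_lt_iff₀ hpos] at hN0
      have hNN : (N0:ℝ) ≤ N := by exact_mod_cast hlt
      have h1 : N * (Q * (4 * E)) ≤ N * (c * ε ^ 2 / 8) := by
        calc N * (Q * (4 * E)) = Q * 4 * (N * E) := by ring
          _ ≤ Q * 4 * C1 := by gcongr
          _ ≤ N0 * (c * ε ^ 2 / 8) := hN0.le
          _ ≤ _ := by gcongr
      exact le_of_mul_le_mul_left h1 hN'
    have hD' : 2 * DD N β μ v q 1 + δ' ≤ c * ε ^ 2 := by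
      have e : exp (β ^ 2 / (2 * c)) * (β ^ 2 / 4 * (δ / c + 4 * E)) = Q * (δ / c) + Q * (4 * E) := by rw [hQ]; ring
      rw [e] at hD
      have : δ' ≤ c * ε ^ 2 / 2 := min_le_left _ _
      linarith
    have ht := tail_t hN h hc (fun u _ t => hb N hN u t) zero_le_one le_rfl hδ'0 (min_le_right _ _)
    refine le_trans ?_ (hC2 N)
    refine mulL ?_ (by positivity)
    rw [← mul_div_assoc]
    refine le_trans (GS.nu_mono _ _ fun x => ?_) ht
    by_cases hx : ε ≤ |R (x 0) (x 1) - q|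
    · rw [if_pos hx, if_pos]
      refine hD'.trans (mulL ?_ hc.le)
      rw [← sq_abs (R (x 0) (x 1) - q)]
      gcongr
    · rw [if_neg hx]
      split_ifs <;> norm_num
end

section
/-! cavity path at a site -/

def a0 (β v q : ℝ) (i : Fin N) : PI' N ⊕ Fin N → ℝ :=
  Sum.elim (fun p => if p.1.1 = i ∨ p.1.2 = i then 0 else β ^ 2 / N) (fun j => if j = i then v + β ^ 2 * q else v)
def b0 (β q : ℝ) (i : Fin N) : PI' N ⊕ Fin N → ℝ :=
  Sum.elim (fun p => if p.1.1 = i ∨ p.1.2 = i then β ^ 2 / N else 0) (fun j => if j = i then - (β ^ 2 * q) else 0)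
def ai (β v q : ℝ) (i : Fin N) (s : ℝ) : PI' N ⊕ Fin N → ℝ := fun k => a0 β v q i k + s * b0 β q i k

lemma ai_zero (β v q : ℝ) (i : Fin N) : ai β v q i 0 = a0 β v q i := by ext k; simp [ai]
lemma ai_one (β v q : ℝ) (i : Fin N) : ai β v q i 1 = va β v q 1 := by
  ext k
  rcases k with k | k <;> simp only [ai, a0, b0, va, vr, elim_inl, elim_inr] <;> split_ifs <;> ring

lemma a0_nonneg {β v q : ℝ} (hv : 0 ≤ v) (hq : 0 ≤ q) (i : Fin N) (k : PI' N ⊕ Fin N) : 0 ≤ a0 β v q i k := by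
  rcases k with k | k <;> simp only [a0, elim_inl, elim_inr] <;> split_ifs <;> positivity
lemma a1_nonneg {β v q : ℝ} (hv : 0 ≤ v) (hq : 0 ≤ q) (i : Fin N) (k : PI' N ⊕ Fin N) : 0 ≤ a0 β v q i k + b0 β q i k := by
  rcases k with k | k <;> simp only [a0, b0, elim_inl, elim_inr] <;> split_ifs <;> ring_nf <;> positivity

lemma sum_PI_site (f : Fin N → ℝ) (i : Fin N) :
    ∑ p : PI' N, (if p.1.1 = i ∨ p.1.2 = i then f p.1.1 * f p.1.2 else 0) = f i * ∑ j, f j - f i ^ 2 := by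
  have h1 := sum_PI f
  have h2 := sum_PI (update f i 0)
  have h3 : ∀ p : PI' N, (if p.1.1 = i ∨ p.1.2 = i then f p.1.1 * f p.1.2 else 0)
      = f p.1.1 * f p.1.2 - update f i 0 p.1.1 * update f i 0 p.1.2 := by
    intro p
    simp only [update_apply]
    by_cases h : p.1.1 = i <;> by_cases h' : p.1.2 = i <;> simp [h, h']
  have h4 : ∑ j, update f i 0 j = ∑ j, f j - f i := by
    rw [sum_update_of_mem (mem_univ i), ← add_sum_erase _ f (mem_univ i), sdiff_singleton_eq_erase]; ring
  have h5 : ∑ j, update f i 0 j ^ 2 = ∑ j, f j ^ 2 - f i ^ 2 := by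
    have : ∀ j, update f i 0 j ^ 2 = update (fun j => f j ^ 2) i 0 j := by
      intro j; simp only [update_apply]; split_ifs <;> simp
    simp only [this]
    rw [sum_update_of_mem (mem_univ i), ← add_sum_erase _ (fun j => f j ^ 2) (mem_univ i), sdiff_singleton_eq_erase]; ring
  simp only [h3, sum_sub_distrib]
  rw [h1, h2, h4, h5]; ring

/-- the product of the spins at a site -/
def ee (i : Fin N) (σ τ : Sp N) : ℝ := sp (σ i) * sp (τ i)
lemma ee_sq (i : Fin N) (σ τ : Sp N) : ee i σ τ * ee i σ τ = 1 := by
  simp only [ee]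
  rw [show sp (σ i) * sp (τ i) * (sp (σ i) * sp (τ i)) = sp (σ i) * sp (σ i) * (sp (τ i) * sp (τ i)) by ring, sp_mul_self, sp_mul_self, one_mul]
lemma abs_ee (i : Fin N) (σ τ : Sp N) : |ee i σ τ| = 1 := by simp [ee, abs_mul, abs_sp]
lemma ee_self (i : Fin N) (σ : Sp N) : ee i σ σ = 1 := by simp [ee, sp_mul_self]

lemma b0_cv (hN : N ≠ 0) (μ β q : ℝ) (i : Fin N) (σ τ : Sp N) :
    (SKs N μ).cv (b0 β q i) σ τ = β ^ 2 * (ee i σ τ * (R σ τ - q)) - β ^ 2 / N := by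
  have hN' : (N:ℝ) ≠ 0 := by positivity
  have h1 := sum_PI_site (fun j => sp (σ j) * sp (τ j)) i
  rw [sum_sp hN] at h1
  simp only [GS.cv, SKs, b0, sum_sum_type, elim_inl, elim_inr]
  have h2 : ∑ p : PI' N, (if p.1.1 = i ∨ p.1.2 = i then β ^ 2 / N else 0) * sgP p σ * sgP p τ
      = β ^ 2 / N * ∑ p : PI' N, (if p.1.1 = i ∨ p.1.2 = i then (sp (σ p.1.1) * sp (τ p.1.1)) * (sp (σ p.1.2) * sp (τ p.1.2)) else 0) := by
    rw [mul_sum]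
    refine sum_congr rfl fun p _ => ?_
    simp only [sgP]
    split_ifs <;> ring
  rw [h2, h1]
  simp only [ite_mul, zero_mul, Finset.sum_ite_eq', mem_univ, if_true]
  have h3 := ee_sq i σ τ
  simp only [ee] at h3 ⊢
  have h3' : (sp (σ i) * sp (τ i)) ^ 2 = 1 := by rw [sq]; exact h3
  rw [h3']
  field_simp
  ring

section
variable {ρ : Type} [Fintype ρ] [DecidableEq ρ]

def dl (N : ℕ) : ℝ := (√(N:ℝ))⁻¹
lemma dl_nonneg (N : ℕ) : 0 ≤ dl N := by unfold dl; positivity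
lemma dl_sq (N : ℕ) : dl N ^ 2 = 1 / N := by rw [dl, inv_pow, sq_sqrt (by positivity), one_div]

/-- size of an overlap fluctuation -/
def tt (q : ℝ) (x : ρ → Sp N) (a b : ρ) : ℝ := if a = b then dl N else |R (x a) (x b) - q| + dl N
def TT (q : ℝ) (x : ρ → Sp N) : ℝ := ∑ a, ∑ b, tt q x a b

lemma tt_nonneg (q : ℝ) (x : ρ → Sp N) (a b : ρ) : 0 ≤ tt q x a b := by
  have := dl_nonneg N; unfold tt; split_ifs <;> positivity
lemma TT_nonneg (q : ℝ) (x : ρ → Sp N) : 0 ≤ TT q x :=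
  sum_nonneg fun a _ => sum_nonneg fun b _ => tt_nonneg q x a b
lemma tt_le (q : ℝ) (x : ρ → Sp N) (a b : ρ) : tt q x a b ≤ TT q x :=
  (single_le_sum (f := fun b => tt q x a b) (fun b _ => tt_nonneg q x a b) (mem_univ b)).trans
    (single_le_sum (f := fun a => ∑ b, tt q x a b) (fun a _ => sum_nonneg fun b _ => tt_nonneg q x a b) (mem_univ a))
lemma TT_ge [Nonempty ρ] {N : ℕ} (q : ℝ) (x : ρ → Sp N) : dl N ≤ TT q x := by
  obtain ⟨a⟩ := ‹Nonempty ρ›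
  refine le_trans (le_of_eq ?_) (tt_le q x a a)
  simp [tt]
lemma U_le (q : ℝ) (x : ρ → Sp N) {a b : ρ} (h : a ≠ b) : |R (x a) (x b) - q| ≤ TT q x := by
  refine le_trans ?_ (tt_le q x a b)
  rw [tt, if_neg h]
  linarith [dl_nonneg N]
lemma TT_inj {ρ' : Type} [Fintype ρ'] [DecidableEq ρ'] {N : ℕ} (q : ℝ) (x : ρ → Sp N) (e : ρ' → ρ) (he : Function.Injective e) :
    TT q (fun a => x (e a)) ≤ TT q x := by
  have h1 : ∀ a b, tt q (fun a => x (e a)) a b = tt q x (e a) (e b) := by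
    intro a b; simp only [tt, he.eq_iff]
  simp only [TT, h1]
  have h2 : ∀ f : ρ → ℝ, (∀ a, 0 ≤ f a) → ∑ a, f (e a) ≤ ∑ a, f a := by
    intro f hf
    rw [← Finset.sum_image (f := f) (s := univ) (g := e) (fun a _ b _ h => he h)]
    exact sum_le_sum_of_subset_of_nonneg (subset_univ _) fun a _ _ => hf a
  refine (sum_le_sum fun a _ => h2 (fun b => tt q x (e a) b) fun b => tt_nonneg q x _ _).trans ?_
  exact h2 (fun a => ∑ b, tt q x a b) fun a => sum_nonneg fun b _ => tt_nonneg q x _ _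

/-- the kernel -/
def ker (q : ℝ) (i : Fin N) (x : ρ × Fin 3 → Sp N) : ℝ :=
  ∑ a : ρ, ∑ b : ρ, ((if a = b then 0 else ee i (x (a, 0)) (x (b, 0)) * (R (x (a, 0)) (x (b, 0)) - q))
    - 2 * (ee i (x (a, 0)) (x (b, 1)) * (R (x (a, 0)) (x (b, 1)) - q))
    - (if a = b then 0 else ee i (x (a, 1)) (x (b, 1)) * (R (x (a, 1)) (x (b, 1)) - q))
    + 2 * (ee i (x (a, 1)) (x (b, 2)) * (R (x (a, 1)) (x (b, 2)) - q)))

lemma dk_ker (hN : N ≠ 0) (μ β q : ℝ) (i : Fin N) (F : (ρ → Sp N) → ℝ) (x : ρ × Fin 3 → Sp N) :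
    GS.dk ((SKs N μ).cv (b0 β q i)) F x = F (fun a => x (a, 0)) * (β ^ 2 / 2 * ker q i x) := by
  rw [GS.dk, ker]
  congr 1
  rw [mul_sum, mul_sum]
  refine sum_congr rfl fun a _ => ?_
  rw [mul_sum, mul_sum]
  refine sum_congr rfl fun b _ => ?_
  simp only [b0_cv hN]
  by_cases h : a = b
  · subst h
    simp only [if_true, ee_self, R_self hN]; ring
  · simp only [if_neg h]; ring

lemma abs_ker (q : ℝ) (i : Fin N) (x : ρ × Fin 3 → Sp N) :
    |ker q i x| ≤ (6 * (card ρ : ℝ) ^ 2) * TT q x := by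
  have e1 : ∀ c d : ρ × Fin 3, c ≠ d → |ee i (x c) (x d) * (R (x c) (x d) - q)| ≤ TT q x := by
    intro c d h
    rw [abs_mul, abs_ee, one_mul]; exact U_le q x h
  have h0 := TT_nonneg q x
  have h1 : ∀ a b : ρ, |(if a = b then 0 else ee i (x (a, 0)) (x (b, 0)) * (R (x (a, 0)) (x (b, 0)) - q))
    - 2 * (ee i (x (a, 0)) (x (b, 1)) * (R (x (a, 0)) (x (b, 1)) - q))
    - (if a = b then 0 else ee i (x (a, 1)) (x (b, 1)) * (R (x (a, 1)) (x (b, 1)) - q))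
    + 2 * (ee i (x (a, 1)) (x (b, 2)) * (R (x (a, 1)) (x (b, 2)) - q))| ≤ 6 * TT q x := by
    intro a b
    have k1 := abs_le.1 (e1 (a, 0) (b, 1) (by simp))
    have k2 := abs_le.1 (e1 (a, 1) (b, 2) (by simp))
    by_cases h : a = b
    · simp only [h, if_true]
      subst h
      rw [abs_le]; constructor <;> linarith
    · simp only [h, if_false]
      have k3 := abs_le.1 (e1 (a, 0) (b, 0) (by simp [h]))
      have k4 := abs_le.1 (e1 (a, 1) (b, 1) (by simp [h]))
      rw [abs_le]; constructor <;> linarith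
  refine (abs_sum_le_sum_abs _ _).trans ((sum_le_sum fun a _ => (abs_sum_le_sum_abs _ _).trans (sum_le_sum fun b _ => h1 a b)).trans (le_of_eq ?_))
  simp only [sum_const, card_univ, nsmul_eq_mul]; ring

lemma abs_ker' {q : ℝ} (hq : 0 ≤ q) (hq1 : q ≤ 1) (i : Fin N) (x : ρ × Fin 3 → Sp N) :
    |ker q i x| ≤ 12 * (card ρ : ℝ) ^ 2 := by
  have e1 : ∀ c d : ρ × Fin 3, |ee i (x c) (x d) * (R (x c) (x d) - q)| ≤ 2 := by
    intro c d
    rw [abs_mul, abs_ee, one_mul]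
    have := abs_le.1 (abs_R (x c) (x d))
    rw [abs_le]; constructor <;> linarith
  have h1 : ∀ a b : ρ, |(if a = b then 0 else ee i (x (a, 0)) (x (b, 0)) * (R (x (a, 0)) (x (b, 0)) - q))
    - 2 * (ee i (x (a, 0)) (x (b, 1)) * (R (x (a, 0)) (x (b, 1)) - q))
    - (if a = b then 0 else ee i (x (a, 1)) (x (b, 1)) * (R (x (a, 1)) (x (b, 1)) - q))
    + 2 * (ee i (x (a, 1)) (x (b, 2)) * (R (x (a, 1)) (x (b, 2)) - q))| ≤ 12 := by
    intro a b
    have k1 := abs_le.1 (e1 (a, 0) (b, 1))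
    have k2 := abs_le.1 (e1 (a, 1) (b, 2))
    by_cases h : a = b
    · simp only [h, if_true]
      subst h
      rw [abs_le]; constructor <;> linarith
    · simp only [h, if_false]
      have k3 := abs_le.1 (e1 (a, 0) (b, 0))
      have k4 := abs_le.1 (e1 (a, 1) (b, 1))
      rw [abs_le]; constructor <;> linarith
  refine (abs_sum_le_sum_abs _ _).trans ((sum_le_sum fun a _ => (abs_sum_le_sum_abs _ _).trans (sum_le_sum fun b _ => h1 a b)).trans (le_of_eq ?_))
  simp only [sum_const, card_univ, nsmul_eq_mul]; ring

/-- the cavity expectations -/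
def nuS (β μ v q : ℝ) (i : Fin N) (s : ℝ) (F : (ρ → Sp N) → ℝ) : ℝ := ((SKs N μ).rep ρ).nu (ai β v q i s) F
/-- the SK expectation -/
def nuSK (β μ v q : ℝ) (F : (ρ → Sp N) → ℝ) : ℝ := ((SKs N μ).rep ρ).nu (va β v q 1) F

lemma nuS_one (β μ v q : ℝ) (i : Fin N) (F : (ρ → Sp N) → ℝ) : nuS β μ v q i 1 F = nuSK β μ v q F := by
  rw [nuS, ai_one, nuSK]

lemma nuS_cont (β μ v q : ℝ) (i : Fin N) (F : (ρ → Sp N) → ℝ) : Continuous (fun s => nuS β μ v q i s F) := by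
  unfold nuS
  refine (GS.continuous_nu _ F).comp (continuous_pi fun k => ?_)
  unfold ai; fun_prop

lemma nuS_deriv (hN : N ≠ 0) {β μ v q : ℝ} (hv : 0 ≤ v) (hq : 0 ≤ q) (i : Fin N) (F : (ρ → Sp N) → ℝ) {s : ℝ}
    (hs : s ∈ Ioo (0:ℝ) 1) :
    HasDerivAt (fun s => nuS β μ v q i s F) (nuS β μ v q i s (fun x : ρ × Fin 3 → Sp N => F (fun a => x (a, 0)) * (β ^ 2 / 2 * ker q i x))) s := by
  have h := (SKs N μ).rep_nu_deriv F (a0 β v q i) (b0 β q i) (a0_nonneg hv hq i) (a1_nonneg hv hq i) hs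
  have e : GS.dk ((SKs N μ).cv (b0 β q i)) F = fun x : ρ × Fin 3 → Sp N => F (fun a => x (a, 0)) * (β ^ 2 / 2 * ker q i x) := by
    ext x; exact dk_ker hN μ β q i F x
  rw [e] at h
  exact h

lemma mvt_abs {f f' : ℝ → ℝ} {C : ℝ} (hc : Continuous f) (hd : ∀ s ∈ Ioo (0:ℝ) 1, HasDerivAt f (f' s) s)
    (hb : ∀ s ∈ Ioo (0:ℝ) 1, |f' s| ≤ C) (hC : 0 ≤ C) {s : ℝ} (h0 : 0 ≤ s) (h1 : s ≤ 1) : |f s - f 0| ≤ C := by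
  rcases h0.eq_or_lt with rfl | h0
  · simpa using hC
  obtain ⟨c, hcm, h⟩ := exists_hasDerivAt_eq_slope f f' h0 hc.continuousOn fun x hx => hd x ⟨hx.1, hx.2.trans_le h1⟩
  have := hb c ⟨hcm.1, hcm.2.trans_le h1⟩
  rw [h, abs_div, sub_zero, abs_of_pos h0, div_le_iff₀ h0] at this
  exact this.trans (by nlinarith)

lemma nuS_proj (β μ v q : ℝ) (i : Fin N) (s : ℝ) (F : (ρ → Sp N) → ℝ) :
    nuS β μ v q i s (fun x : ρ × Fin 3 → Sp N => F (fun a => x (a, 0))) = nuS β μ v q i s F :=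
  (SKs N μ).nu_inj (fun a : ρ => (a, (0 : Fin 3))) (fun a b h => by simpa using h) _ F

/-- comparison of the cavity measure with the SK measure -/
lemma nuS_comp (hN : N ≠ 0) {β μ v q : ℝ} (hv : 0 ≤ v) (hq : 0 ≤ q) (hq1 : q ≤ 1) (i : Fin N) (F : (ρ → Sp N) → ℝ)
    (hF : ∀ x, 0 ≤ F x) {s : ℝ} (h0 : 0 ≤ s) (h1 : s ≤ 1) :
    nuS β μ v q i s F ≤ exp (β ^ 2 / 2 * (12 * (card ρ : ℝ) ^ 2)) * nuSK β μ v q F := by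
  set κ := β ^ 2 / 2 * (12 * (card ρ : ℝ) ^ 2) with hκ
  have hκ0 : 0 ≤ κ := by positivity
  have hnn : ∀ s, 0 ≤ nuS β μ v q i s F := fun s => GS.nu_nonneg _ _ hF
  have hm : MonotoneOn (fun s => exp (κ * s) * nuS β μ v q i s F) (Set.Icc 0 1) := by
    have hd : ∀ s ∈ Ioo (0:ℝ) 1, HasDerivAt (fun s => exp (κ * s) * nuS β μ v q i s F)
        (exp (κ * s) * κ * nuS β μ v q i s F + exp (κ * s) * (nuS β μ v q i s (fun x : ρ × Fin 3 → Sp N => F (fun a => x (a, 0)) * (β ^ 2 / 2 * ker q i x)))) s := by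
      intro s hs
      have h1 : HasDerivAt (fun t => exp (κ * t)) (exp (κ * s) * κ) s := by
        simpa using ((hasDerivAt_id s).const_mul κ).exp
      exact h1.fun_mul (nuS_deriv hN hv hq i F hs)
    refine monotoneOn_of_deriv_nonneg (convex_Icc _ _) ?_ ?_ ?_
    · have := nuS_cont β μ v q i F
      exact (by fun_prop : Continuous (fun s => exp (κ * s) * nuS β μ v q i s F)).continuousOn
    · intro s hs
      rw [interior_Icc] at hs
      exact (hd s hs).differentiableAt.differentiableWithinAt
    · intro s hs
      rw [interior_Icc] at hs
      rw [(hd s hs).deriv, mul_assoc, ← mul_add]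
      refine mul_nonneg (exp_pos _).le ?_
      have hle : |nuS β μ v q i s (fun x : ρ × Fin 3 → Sp N => F (fun a => x (a, 0)) * (β ^ 2 / 2 * ker q i x))|
          ≤ nuS β μ v q i s (fun x : ρ × Fin 3 → Sp N => κ * F (fun a => x (a, 0))) := by
        refine GS.abs_nu_le_of _ _ fun x => ?_
        rw [abs_mul, abs_of_nonneg (hF _), mul_comm, abs_mul, abs_of_nonneg (by positivity : 0 ≤ β ^ 2 / 2), hκ]
        have := abs_ker' hq hq1 i x
        exact mulR (mulL this (by positivity)) (hF _)
      have e : nuS β μ v q i s (fun x : ρ × Fin 3 → Sp N => κ * F (fun a => x (a, 0))) = κ * nuS β μ v q i s F := by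
        rw [← nuS_proj (F := F)]; exact ((SKs N μ).rep (ρ × Fin 3)).nu_smul _ _ _
      rw [e] at hle
      linarith [(abs_le.1 hle).1]
  have := hm ⟨h0, h1⟩ ⟨zero_le_one, le_rfl⟩ h1
  simp only [mul_one, nuS_one] at this
  have h2 : 1 * nuS β μ v q i s F ≤ exp (κ * s) * nuS β μ v q i s F :=
    mulR (one_le_exp (by positivity)) (hnn s)
  linarith

/-- moments -/
def MM (N : ℕ) (β μ v q : ℝ) (j : ℕ) : ℝ :=
  nuSK (N := N) β μ v q (fun x : Fin 2 → Sp N => (|R (x 0) (x 1) - q| + dl N) ^ j)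

lemma MM_nonneg (N : ℕ) (β μ v q : ℝ) (j : ℕ) : 0 ≤ MM N β μ v q j := GS.nu_nonneg _ _ fun x => by have := dl_nonneg N; positivity

lemma nu_TT [Nonempty ρ] {N : ℕ} (β μ v q : ℝ) (j : ℕ) :
    nuSK β μ v q (fun x : ρ → Sp N => TT q x ^ j) ≤ ((card (ρ × ρ) : ℝ)) ^ (j + 1) * MM N β μ v q j := by
  have hc : (0:ℝ) < card (ρ × ρ) := by exact_mod_cast Fintype.card_pos
  have h1 : ∀ x : ρ → Sp N, |TT q x ^ j| ≤ (card (ρ × ρ) : ℝ) ^ j * ∑ ab : ρ × ρ, tt q x ab.1 ab.2 ^ j := by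
    intro x
    rw [abs_of_nonneg (pow_nonneg (TT_nonneg q x) _)]
    have e : TT q x = ∑ ab : ρ × ρ, tt q x ab.1 ab.2 := by rw [TT, sum_prod_type]
    rw [e]
    rcases j with _ | j
    · simp only [pow_zero, sum_const, card_univ, nsmul_eq_mul, one_mul, mul_one]
      exact_mod_cast Fintype.card_pos
    · have h := pow_sum_div_card_le_sum_pow (s := (univ : Finset (ρ × ρ))) (f := fun ab => tt q x ab.1 ab.2) (fun ab _ => tt_nonneg q x _ _) j
      rw [card_univ, div_le_iff₀ (by positivity)] at h
      refine h.trans ?_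
      rw [mul_comm]
      have h1 : (1:ℝ) ≤ card (ρ × ρ) := by exact_mod_cast Fintype.card_pos
      exact mulR (pow_le_pow_right₀ h1 (Nat.le_succ j)) (sum_nonneg fun ab _ => pow_nonneg (tt_nonneg q x _ _) _)
  have h2 : ∀ ab : ρ × ρ, nuSK β μ v q (fun x : ρ → Sp N => tt q x ab.1 ab.2 ^ j) ≤ MM N β μ v q j := by
    rintro ⟨a, b⟩
    by_cases h : a = b
    · simp only [tt, h, if_true]
      have : nuSK β μ v q (fun x : ρ → Sp N => dl N ^ j) = nuSK β μ v q (fun x : Fin 2 → Sp N => dl N ^ j) := by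
        simp only [nuSK, GS.nu_const]
      rw [this]
      refine GS.nu_mono _ _ fun x => ?_
      have := dl_nonneg N
      gcongr
      linarith [abs_nonneg (R (x 0) (x 1) - q)]
    · simp only [tt, h, if_false]
      refine le_of_eq ((SKs N μ).nu_inj (![a, b]) ?_ _ (fun x : Fin 2 → Sp N => (|R (x 0) (x 1) - q| + dl N) ^ j))
      intro x y
      fin_cases x <;> fin_cases y <;> simp [h, Ne.symm h]
  have h3 := ((SKs N μ).rep ρ).abs_nu_le_of (va β v q 1) h1
  refine (le_abs_self _).trans (h3.trans ?_)
  rw [GS.nu_smul, GS.nu_sum, pow_succ, mul_assoc]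
  refine mulL ?_ (by positivity)
  refine (sum_le_sum fun ab _ => h2 ab).trans (le_of_eq ?_)
  simp [card_univ]

end
end

section
section
variable {ρ : Type} [Fintype ρ] [DecidableEq ρ]

lemma nuS_smul (β μ v q : ℝ) (i : Fin N) (s c : ℝ) (F : (ρ → Sp N) → ℝ) :
    nuS β μ v q i s (fun x => c * F x) = c * nuS β μ v q i s F := GS.nu_smul _ _ _ _
lemma nuSK_sub (β μ v q : ℝ) (F G : (ρ → Sp N) → ℝ) :
    nuSK β μ v q (fun x => F x - G x) = nuSK β μ v q F - nuSK β μ v q G := GS.nu_sub _ _ _ _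
lemma nuSK_add (β μ v q : ℝ) (F G : (ρ → Sp N) → ℝ) :
    nuSK β μ v q (fun x => F x + G x) = nuSK β μ v q F + nuSK β μ v q G := GS.nu_add _ _ _ _
lemma nuSK_smul (β μ v q c : ℝ) (F : (ρ → Sp N) → ℝ) :
    nuSK β μ v q (fun x => c * F x) = c * nuSK β μ v q F := GS.nu_smul _ _ _ _
lemma nuSK_sum {ι : Type*} (t : Finset ι) (β μ v q : ℝ) (F : ι → (ρ → Sp N) → ℝ) :
    nuSK β μ v q (fun x => ∑ l ∈ t, F l x) = ∑ l ∈ t, nuSK β μ v q (F l) := GS.nu_sum _ _ _ _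
lemma nuS_sum {ι : Type*} (t : Finset ι) (β μ v q : ℝ) (i : Fin N) (s : ℝ) (F : ι → (ρ → Sp N) → ℝ) :
    nuS β μ v q i s (fun x => ∑ l ∈ t, F l x) = ∑ l ∈ t, nuS β μ v q i s (F l) := GS.nu_sum _ _ _ _
lemma nuSK_mono (β μ v q : ℝ) {F G : (ρ → Sp N) → ℝ} (h : ∀ x, F x ≤ G x) :
    nuSK β μ v q F ≤ nuSK β μ v q G := GS.nu_mono _ _ h
lemma nuSK_inj {ρ' : Type} [Fintype ρ'] [DecidableEq ρ'] {N : ℕ} (e : ρ' → ρ) (he : Function.Injective e) (β μ v q : ℝ) (F : (ρ' → Sp N) → ℝ) :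
    nuSK β μ v q (fun x : ρ → Sp N => F (fun a => x (e a))) = nuSK β μ v q F := GS.nu_inj _ e he _ _

lemma B1 (h : HYP β μ v q) (ρ : Type) [Fintype ρ] [DecidableEq ρ] [Nonempty ρ] (j : ℕ) :
    ∃ K, 0 ≤ K ∧ ∀ {N : ℕ} (_ : N ≠ 0) (i : Fin N) (F : (ρ → Sp N) → ℝ) (c : ℝ), 0 ≤ c → (∀ x, |F x| ≤ c * TT q x ^ j) →
      ∀ s, 0 ≤ s → s ≤ 1 → |nuS β μ v q i s F| ≤ c * K * MM N β μ v q j := by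
  refine ⟨exp (β ^ 2 / 2 * (12 * (card ρ : ℝ) ^ 2)) * (card (ρ × ρ) : ℝ) ^ (j + 1), by positivity, ?_⟩
  intro N hN i F c hc hF s h0 h1
  have e1 : |nuS β μ v q i s F| ≤ nuS β μ v q i s (fun x => c * TT q x ^ j) := GS.abs_nu_le_of _ _ hF
  rw [nuS_smul] at e1
  have e2 := nuS_comp hN (μ := μ) (β := β) h.hv h.hq0.le h.hq1.le i (fun x : ρ → Sp N => TT q x ^ j) (fun x => pow_nonneg (TT_nonneg q x) _) h0 h1
  have e3 := nu_TT (ρ := ρ) (N := N) β μ v q j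
  calc _ ≤ c * (exp (β ^ 2 / 2 * (12 * (card ρ : ℝ) ^ 2)) * ((card (ρ × ρ) : ℝ) ^ (j + 1) * MM N β μ v q j)) :=
        e1.trans (mulL (e2.trans (mulL e3 (exp_pos _).le)) hc)
    _ = _ := by ring

lemma B1' (h : HYP β μ v q) (ρ : Type) [Fintype ρ] [DecidableEq ρ] [Nonempty ρ] (j : ℕ) :
    ∃ K, 0 ≤ K ∧ ∀ {N : ℕ} (_ : N ≠ 0) (F : (ρ → Sp N) → ℝ) (c : ℝ), 0 ≤ c → (∀ x, |F x| ≤ c * TT q x ^ j) →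
      |nuSK β μ v q F| ≤ c * K * MM N β μ v q j := by
  obtain ⟨K, hK, hb⟩ := B1 h ρ j
  refine ⟨K, hK, fun {N} hN F c hc hF => ?_⟩
  rw [← nuS_one _ _ _ _ (⟨0, Nat.pos_of_ne_zero hN⟩ : Fin N)]
  exact hb hN _ F c hc hF 1 zero_le_one le_rfl

lemma dF_bd {β q : ℝ} (i : Fin N) {F : (ρ → Sp N) → ℝ} {c : ℝ} (hc : 0 ≤ c) {j : ℕ} (hF : ∀ x, |F x| ≤ c * TT q x ^ j)
    (x : ρ × Fin 3 → Sp N) :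
    |F (fun a => x (a, 0)) * (β ^ 2 / 2 * ker q i x)| ≤ c * (β ^ 2 / 2 * (6 * (card ρ : ℝ) ^ 2)) * TT q x ^ (j + 1) := by
  have h1 := hF (fun a => x (a, 0))
  have h2 := TT_inj q x (fun a : ρ => (a, (0 : Fin 3))) (fun a b h => by simpa using h)
  have h3 := pow_le_pow_left₀ (TT_nonneg q _) h2 j
  rw [abs_mul, abs_mul, abs_of_nonneg (by positivity : 0 ≤ β ^ 2 / 2)]
  calc _ ≤ (c * TT q x ^ j) * (β ^ 2 / 2 * ((6 * (card ρ : ℝ) ^ 2) * TT q x)) :=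
        mul_le_mul (h1.trans (mulL h3 hc)) (mulL (abs_ker q i x) (by positivity))
          (by positivity) (mul_nonneg hc (pow_nonneg (TT_nonneg q x) _))
    _ = _ := by ring

lemma B2 (h : HYP β μ v q) (ρ : Type) [Fintype ρ] [DecidableEq ρ] [Nonempty ρ] (j : ℕ) :
    ∃ K, 0 ≤ K ∧ ∀ {N : ℕ} (_ : N ≠ 0) (i : Fin N) (F : (ρ → Sp N) → ℝ) (c : ℝ), 0 ≤ c → (∀ x, |F x| ≤ c * TT q x ^ j) →
      ∀ s, 0 ≤ s → s ≤ 1 → |nuS β μ v q i s F - nuS β μ v q i 0 F| ≤ c * K * MM N β μ v q (j + 1) := by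
  obtain ⟨K, hK, hb⟩ := B1 h (ρ × Fin 3) (j + 1)
  refine ⟨(β ^ 2 / 2 * (6 * (card ρ : ℝ) ^ 2)) * K, by positivity, ?_⟩
  intro N hN i F c hc hF s h0 h1
  have hM := MM_nonneg N β μ v q (j + 1)
  refine mvt_abs (nuS_cont β μ v q i F) (fun s hs => nuS_deriv hN h.hv h.hq0.le i F hs) ?_ (by positivity) h0 h1
  intro s hs
  refine (hb hN i _ (c * (β ^ 2 / 2 * (6 * (card ρ : ℝ) ^ 2))) (by positivity) (dF_bd i hc hF) s hs.1.le hs.2.le).trans (le_of_eq ?_)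
  ring

lemma B3 (h : HYP β μ v q) (ρ : Type) [Fintype ρ] [DecidableEq ρ] [Nonempty ρ] (j : ℕ) :
    ∃ K, 0 ≤ K ∧ ∀ {N : ℕ} (_ : N ≠ 0) (i : Fin N) (F : (ρ → Sp N) → ℝ) (c : ℝ), 0 ≤ c → (∀ x, |F x| ≤ c * TT q x ^ j) →
      |nuSK β μ v q F - nuS β μ v q i 0 F - nuS β μ v q i 0 (fun x : ρ × Fin 3 → Sp N => F (fun a => x (a, 0)) * (β ^ 2 / 2 * ker q i x))|
        ≤ c * K * MM N β μ v q (j + 2) := by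
  obtain ⟨K, hK, hb⟩ := B2 h (ρ × Fin 3) (j + 1)
  refine ⟨(β ^ 2 / 2 * (6 * (card ρ : ℝ) ^ 2)) * K, by positivity, ?_⟩
  intro N hN i F c hc hF
  have hM := MM_nonneg N β μ v q (j + 2)
  set D := nuS β μ v q i 0 (fun x : ρ × Fin 3 → Sp N => F (fun a => x (a, 0)) * (β ^ 2 / 2 * ker q i x)) with hD
  have hc' := nuS_cont β μ v q i F
  have := mvt_abs (f := fun s => nuS β μ v q i s F - s * D) (C := c * (β ^ 2 / 2 * (6 * (card ρ : ℝ) ^ 2) * K) * MM N β μ v q (j + 2)) (by fun_prop)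
    (fun s hs => (nuS_deriv hN h.hv h.hq0.le i F hs).fun_sub ((hasDerivAt_id s).mul_const D)) ?_ (by positivity) (s := 1) zero_le_one le_rfl
  · simp only [nuS_one, one_mul, zero_mul, sub_zero] at this
    rw [show nuSK β μ v q F - nuS β μ v q i 0 F - D = nuSK β μ v q F - D - nuS β μ v q i 0 F by ring]
    exact this
  · intro s hs
    rw [one_mul, hD]
    refine (hb hN i _ (c * (β ^ 2 / 2 * (6 * (card ρ : ℝ) ^ 2))) (by positivity) (dF_bd i hc hF) s hs.1.le hs.2.le).trans (le_of_eq ?_)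
    ring

/-! factorisation at time zero -/

def updS (i : Fin N) (x : ρ → Sp N) (η : ρ → Bool) : ρ → Sp N := fun a => update (x a) i (η a)

lemma sum_updS (i : Fin N) (f : (ρ → Sp N) → ℝ) :
    ∑ x : ρ → Sp N, ∑ η : ρ → Bool, f (updS i x η) = card (ρ → Bool) * ∑ x, f x := by
  let e : (ρ → Sp N) × (ρ → Bool) ≃ (ρ → Sp N) × (ρ → Bool) :=
    { toFun := fun z => (updS i z.1 z.2, fun a => z.1 a i)
      invFun := fun z => (updS i z.1 z.2, fun a => z.1 a i)
      left_inv := fun z => Prod.ext (by ext a : 1; simp [updS]) (by ext a : 1; simp [updS])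
      right_inv := fun z => Prod.ext (by ext a : 1; simp [updS]) (by ext a : 1; simp [updS]) }
  rw [← sum_prod_type' (f := fun x η => f (updS i x η)), ← e.sum_comp (fun z => f (updS i z.1 z.2)), sum_prod_type]
  have : ∀ (x : ρ → Sp N) (η : ρ → Bool), f (updS i (e (x, η)).1 (e (x, η)).2) = f x := by
    intro x η; congr 1; ext a : 1; simp [e, updS]
  simp only [this, sum_const, card_univ, nsmul_eq_mul]
  rw [mul_sum]

lemma ew_updS (μ : ℝ) (i : Fin N) (θ : PI' N ⊕ Fin N → ℝ) (hθ : ∀ p : PI' N, p.1.1 = i ∨ p.1.2 = i → θ (inl p) = 0)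
    (σ : Sp N) (η : Bool) :
    (SKs N μ).ew θ (update σ i η)
      = (S1 μ).ew (fun _ => θ (inr i)) η * (SKs N μ).ew (update θ (inr i) (-μ)) σ := by
  simp only [GS.ew, SKs, S1]
  rw [← exp_add]
  congr 1
  have e1 : ∀ p : PI' N, θ (inl p) * sgP p (update σ i η) = θ (inl p) * sgP p σ := by
    intro p
    by_cases h : p.1.1 = i ∨ p.1.2 = i
    · rw [hθ p h]; ring
    · push Not at h
      simp [sgP, update_of_ne h.1, update_of_ne h.2]
  simp only [sum_sum_type, elim_inl, elim_inr, e1, update_of_ne (Sum.inl_ne_inr), sum_const, card_univ,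
    Fintype.card_unit, one_smul]
  have e2 : ∑ j, μ * sp (update σ i η j) + ∑ j, θ (inr j) * sp (update σ i η j)
     = μ * sp η + θ (inr i) * sp η + (∑ j, μ * sp (σ j) + ∑ j, update θ (inr i) (-μ) (inr j) * sp (σ j)) := by
    simp only [← sum_add_distrib]
    rw [← add_sum_erase _ _ (mem_univ i), ← add_sum_erase _ (fun j => μ * sp (σ j) + _) (mem_univ i)]
    have : ∀ j ∈ univ.erase i, μ * sp (update σ i η j) + θ (inr j) * sp (update σ i η j)
        = μ * sp (σ j) + update θ (inr i) (-μ) (inr j) * sp (σ j) := by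
      intro j hj
      have hj := ne_of_mem_erase hj
      rw [update_of_ne hj, update_of_ne (by simpa using hj)]
    rw [sum_congr rfl this]
    simp only [update_self]
    ring
  linarith [e2]

lemma av_fact (μ : ℝ) (i : Fin N) (θ : PI' N ⊕ Fin N → ℝ) (hθ : ∀ p : PI' N, p.1.1 = i ∨ p.1.2 = i → θ (inl p) = 0)
    (Φ : (ρ → Bool) → ℝ) (G : (ρ → Sp N) → ℝ) (hG : ∀ x η, G (updS i x η) = G x) :
    ((SKs N μ).rep ρ).av θ (fun x => Φ (fun a => x a i) * G x)
      = ((S1 μ).rep ρ).av (fun _ => θ (inr i)) Φ * ((SKs N μ).rep ρ).av (update θ (inr i) (-μ)) G := by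
  have key : ∀ (Φ : (ρ → Bool) → ℝ) (G : (ρ → Sp N) → ℝ) (hG : ∀ x η, G (updS i x η) = G x),
      card (ρ → Bool) * ∑ x, Φ (fun a => x a i) * G x * ((SKs N μ).rep ρ).ew θ x
      = (∑ η, Φ η * ((S1 μ).rep ρ).ew (fun _ => θ (inr i)) η) * ∑ x, G x * ((SKs N μ).rep ρ).ew (update θ (inr i) (-μ)) x := by
    intro Φ G hG
    rw [← sum_updS i (fun x => Φ (fun a => x a i) * G x * ((SKs N μ).rep ρ).ew θ x), sum_comm, sum_mul_sum]
    refine sum_congr rfl fun η _ => sum_congr rfl fun x _ => ?_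
    have e : ((SKs N μ).rep ρ).ew θ (updS i x η) = ((S1 μ).rep ρ).ew (fun _ => θ (inr i)) η * ((SKs N μ).rep ρ).ew (update θ (inr i) (-μ)) x := by
      simp only [GS.rep_ew, updS, ew_updS μ i θ hθ, prod_mul_distrib]
    rw [hG, e]
    simp only [updS, update_self]
    ring
  have k1 := key Φ G hG
  have k2 := key (fun _ => 1) (fun _ => 1) (fun _ _ => rfl)
  simp only [one_mul] at k2
  rw [GS.av_eq, GS.av_eq, GS.av_eq]
  have hc : (0:ℝ) < card (ρ → Bool) := by exact_mod_cast Fintype.card_pos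
  have z1 := ((SKs N μ).rep ρ).Z_pos θ
  have z2 := ((S1 μ).rep ρ).Z_pos (fun _ => θ (inr i))
  have z3 := ((SKs N μ).rep ρ).Z_pos (update θ (inr i) (-μ))
  change _ * ((SKs N μ).rep ρ).Z θ = ((S1 μ).rep ρ).Z (fun _ => θ (inr i)) * ((SKs N μ).rep ρ).Z (update θ (inr i) (-μ)) at k2
  rw [div_mul_div_comm, div_eq_div_iff z1.ne' (by positivity), ← k1, ← k2]
  ring

/-- single site expectation -/
def site (β μ v q : ℝ) (Φ : (ρ → Bool) → ℝ) : ℝ := ((S1 μ).rep ρ).nu (fun _ => v + β ^ 2 * q) Φ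

lemma nuS_fact (β μ v q : ℝ) (i : Fin N)
    (Φ : (ρ → Bool) → ℝ) (G : (ρ → Sp N) → ℝ) (hG : ∀ x η, G (updS i x η) = G x) :
    nuS β μ v q i 0 (fun x => Φ (fun a => x a i) * G x) = site β μ v q Φ * nuS β μ v q i 0 G := by
  have key : ∀ Φ : (ρ → Bool) → ℝ, nuS β μ v q i 0 (fun x => Φ (fun a => x a i) * G x)
     = site β μ v q Φ * ∫ w, ((SKs N μ).rep ρ).av (update (fun k => √(a0 β v q i k) * w k) (inr i) (-μ)) G ∂(gam (PI' N ⊕ Fin N)) := by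
    intro Φ
    have e : ∀ w : PI' N ⊕ Fin N → ℝ, ((SKs N μ).rep ρ).av (fun k => √(a0 β v q i k) * w k) (fun x => Φ (fun a => x a i) * G x)
        = ((S1 μ).rep ρ).av (fun _ => √(v + β ^ 2 * q) * w (inr i)) Φ
          * ((SKs N μ).rep ρ).av (update (fun k => √(a0 β v q i k) * w k) (inr i) (-μ)) G := by
      intro w
      rw [av_fact μ i _ _ Φ G hG]
      · simp [a0]
      · intro p hp; simp [a0, hp]
    rw [nuS, ai_zero, GS.nu]
    simp only [e]
    have h := int_indep (K := PI' N ⊕ Fin N) (fun k => k = inr i)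
      (fun w => ((S1 μ).rep ρ).av (fun _ => √(v + β ^ 2 * q) * w ⟨inr i, rfl⟩) Φ)
      (fun w => ((SKs N μ).rep ρ).av (fun k => if hk : k = inr i then -μ else √(a0 β v q i k) * w ⟨k, hk⟩) G)
    have e2 : ∀ w : PI' N ⊕ Fin N → ℝ, update (fun k => √(a0 β v q i k) * w k) (inr i) (-μ)
        = (fun k => if hk : k = inr i then -μ else √(a0 β v q i k) * w k) := by
      intro w; ext k; rw [update_apply]; split_ifs <;> rfl
    simp only [e2]
    refine h.trans ?_
    congr 1
    rw [site, GS.nu]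
    have c1 : Continuous (fun t : ℝ => ((S1 μ).rep ρ).av (fun _ => √(v + β ^ 2 * q) * t) Φ) :=
      (GS.continuous_av _ Φ).comp (continuous_pi fun _ => by fun_prop)
    rw [gam_coord (inr i) c1, int_unit (fun t => ((S1 μ).rep ρ).av (fun _ => √(v + β ^ 2 * q) * t) Φ)]
  have h1 := key (fun _ => 1)
  simp only [one_mul] at h1
  rw [key Φ, h1]
  have : site (ρ := ρ) β μ v q (fun _ => 1) = 1 := GS.nu_const _ _ _
  rw [this, one_mul]

end
end

section
/-! elementary product estimates -/
lemma prod_est {ι : Type} [DecidableEq ι] (A B D : ι → ℝ) {c T : ℝ} (hc : 0 ≤ c) (hT : 0 ≤ T) (hA : ∀ l, |A l| ≤ c * T) (hB : ∀ l, |B l| ≤ c * T)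
    (hD : ∀ l, |D l| ≤ c * T ^ 2) (hABD : ∀ l, A l = B l + D l) (s : Finset ι) :
    |∏ l ∈ s, B l| ≤ c ^ s.card * T ^ s.card ∧ |∏ l ∈ s, A l - ∏ l ∈ s, B l| ≤ s.card * c ^ s.card * T ^ (s.card + 1)
    ∧ |∏ l ∈ s, A l - ∏ l ∈ s, B l - ∑ l ∈ s, D l * ∏ m ∈ s.erase l, B m| ≤ (s.card : ℝ) ^ 2 * c ^ s.card * T ^ (s.card + 2) := by
  induction s using Finset.induction_on with
  | empty => simp
  | insert a s ha ih =>
    obtain ⟨h1, h2, h3⟩ := ih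
    rw [prod_insert ha, prod_insert ha, sum_insert ha, Finset.erase_insert ha, Finset.card_insert_of_notMem ha]
    have e : ∑ l ∈ s, D l * ∏ m ∈ (insert a s).erase l, B m = B a * ∑ l ∈ s, D l * ∏ m ∈ s.erase l, B m := by
      rw [mul_sum]
      refine sum_congr rfl fun l hl => ?_
      have hal : a ≠ l := fun h => ha (h ▸ hl)
      rw [Finset.erase_insert_of_ne hal, prod_insert (fun h => ha (Finset.mem_of_mem_erase h))]
      ring
    rw [e]
    have hcT : 0 ≤ c * T := by positivity
    have hcT2 : 0 ≤ c * T ^ 2 := by positivity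
    refine ⟨?_, ?_, ?_⟩
    · rw [abs_mul]
      exact (mul_le_mul (hB a) h1 (abs_nonneg _) hcT).trans (le_of_eq (by ring))
    · rw [show A a * ∏ l ∈ s, A l - B a * ∏ l ∈ s, B l = A a * (∏ l ∈ s, A l - ∏ l ∈ s, B l) + D a * ∏ l ∈ s, B l by rw [hABD a]; ring]
      refine (abs_add_le _ _).trans ?_
      rw [abs_mul, abs_mul]
      refine (add_le_add (mul_le_mul (hA a) h2 (abs_nonneg _) hcT) (mul_le_mul (hD a) h1 (abs_nonneg _) hcT2)).trans (le_of_eq ?_)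
      push_cast; ring
    · rw [show A a * ∏ l ∈ s, A l - B a * ∏ l ∈ s, B l - (D a * ∏ l ∈ s, B l + B a * ∑ l ∈ s, D l * ∏ m ∈ s.erase l, B m)
        = B a * (∏ l ∈ s, A l - ∏ l ∈ s, B l - ∑ l ∈ s, D l * ∏ m ∈ s.erase l, B m) + D a * (∏ l ∈ s, A l - ∏ l ∈ s, B l) by rw [hABD a]; ring]
      refine (abs_add_le _ _).trans ?_
      rw [abs_mul, abs_mul]
      refine (add_le_add (mul_le_mul (hB a) h3 (abs_nonneg _) hcT) (mul_le_mul (hD a) h2 (abs_nonneg _) hcT2)).trans ?_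
      have : 0 ≤ c ^ (s.card + 1) * T ^ (s.card + 1 + 2) := by positivity
      push_cast
      have e3 : c * T * ((s.card:ℝ) ^ 2 * c ^ s.card * T ^ (s.card + 2)) + c * T ^ 2 * (s.card * c ^ s.card * T ^ (s.card + 1))
        = ((s.card:ℝ) ^ 2 + s.card) * (c ^ (s.card + 1) * T ^ (s.card + 1 + 2)) := by ring
      rw [e3, mul_assoc]
      exact mulR (by nlinarith [(Nat.cast_nonneg s.card : (0:ℝ) ≤ s.card)]) this

section
variable {ρ : Type} [Fintype ρ] [DecidableEq ρ]

/-! slots -/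
def VV (q : ℝ) (x : ρ → ρ → ℝ) (X : ρ → Sp N) : ℝ := ∑ a, ∑ b, x a b * (R (X a) (X b) - q)
def psi (x : ρ → ρ → ℝ) (η : ρ → Bool) : ℝ := ∑ a, ∑ b, x a b * (sp (η a) * sp (η b))
def phi (q : ℝ) (x : ρ → ρ → ℝ) (η : ρ → Bool) : ℝ := ∑ a, ∑ b, x a b * (sp (η a) * sp (η b) - q)
def nx (x : ρ → ρ → ℝ) : ℝ := ∑ a, ∑ b, |x a b|
def Vm (q : ℝ) (i : Fin N) (x : ρ → ρ → ℝ) (X : ρ → Sp N) : ℝ := VV q x X - psi x (fun a => X a i) / N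

lemma nx_nonneg (x : ρ → ρ → ℝ) : 0 ≤ nx x := sum_nonneg fun a _ => sum_nonneg fun b _ => abs_nonneg _

lemma abs_dsum (x y : ρ → ρ → ℝ) {C : ℝ} (h : ∀ a b, x a b = 0 ∨ |y a b| ≤ C) : |∑ a, ∑ b, x a b * y a b| ≤ nx x * C := by
  rw [nx, sum_mul]
  refine (abs_sum_le_sum_abs _ _).trans (sum_le_sum fun a _ => ?_)
  rw [sum_mul]
  refine (abs_sum_le_sum_abs _ _).trans (sum_le_sum fun b _ => ?_)
  rw [abs_mul]
  rcases h a b with h | h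
  · simp [h]
  · exact mulL h (abs_nonneg _)

lemma abs_VV (q : ℝ) {x : ρ → ρ → ℝ} (hx : ∀ a, x a a = 0) (X : ρ → Sp N) : |VV q x X| ≤ nx x * TT q X := by
  refine abs_dsum x _ fun a b => ?_
  by_cases h : a = b
  · left; rw [h, hx]
  · right; exact U_le q X h
lemma abs_sp2 (a b : Bool) : |sp a * sp b| = 1 := by rw [abs_mul, abs_sp, abs_sp, one_mul]
lemma abs_psi (x : ρ → ρ → ℝ) (η : ρ → Bool) : |psi x η| ≤ nx x := by
  rw [← mul_one (nx x)]
  exact abs_dsum x _ fun a b => Or.inr (abs_sp2 _ _).le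
lemma abs_phi {q : ℝ} (h0 : 0 ≤ q) (h1 : q ≤ 1) (x : ρ → ρ → ℝ) (η : ρ → Bool) : |phi q x η| ≤ nx x * 2 := by
  refine abs_dsum x _ fun a b => Or.inr ?_
  have := abs_le.1 (abs_sp2 (η a) (η b)).le
  rw [abs_le]; constructor <;> linarith

lemma dl_le_one (hN : N ≠ 0) : dl N ≤ 1 := by
  have : (1:ℝ) ≤ N := by exact_mod_cast Nat.one_le_iff_ne_zero.2 hN
  exact inv_le_one_of_one_le₀ (Real.one_le_sqrt.2 this)

lemma invN_le [Nonempty ρ] {N : ℕ} (q : ℝ) (X : ρ → Sp N) : 1 / (N:ℝ) ≤ TT q X ^ 2 := by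
  rw [← dl_sq]; exact pow_le_pow_left₀ (dl_nonneg N) (TT_ge q X) 2
lemma invN_le' [Nonempty ρ] {N : ℕ} (hN : N ≠ 0) (q : ℝ) (X : ρ → Sp N) : 1 / (N:ℝ) ≤ TT q X := by
  rw [← dl_sq]
  nlinarith [dl_nonneg N, TT_ge q X, dl_le_one hN]

lemma MM_dl (N : ℕ) (β μ v q : ℝ) (j : ℕ) : 1 / (N:ℝ) * MM N β μ v q j ≤ MM N β μ v q (j + 2) := by
  rw [MM, MM, ← nuSK_smul]
  refine nuSK_mono _ _ _ _ fun x => ?_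
  have h := dl_nonneg N
  rw [pow_add, mul_comm, ← dl_sq]
  gcongr
  linarith [abs_nonneg (R (x 0) (x 1) - q)]

lemma R_sub_inv (i : Fin N) (σ τ : Sp N) (a b : Bool) :
    R (update σ i a) (update τ i b) - sp a * sp b / N = R σ τ - ee i σ τ / N := by
  simp only [R, ee, ← sub_div]
  congr 1
  rw [← add_sum_erase _ _ (mem_univ i), ← add_sum_erase _ (fun j => sp (σ j) * sp (τ j)) (mem_univ i)]
  simp only [update_self]
  have : ∀ j ∈ univ.erase i, sp (update σ i a j) * sp (update τ i b j) = sp (σ j) * sp (τ j) := by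
    intro j hj
    rw [update_of_ne (ne_of_mem_erase hj), update_of_ne (ne_of_mem_erase hj)]
  rw [sum_congr rfl this]
  ring

lemma Vm_eq (q : ℝ) (i : Fin N) (x : ρ → ρ → ℝ) (X : ρ → Sp N) :
    Vm q i x X = ∑ a, ∑ b, x a b * (R (X a) (X b) - ee i (X a) (X b) / N - q) := by
  simp only [Vm, VV, psi, ee, sum_div, ← sum_sub_distrib]
  refine sum_congr rfl fun a _ => sum_congr rfl fun b _ => ?_
  ring

lemma Vm_inv (q : ℝ) (i : Fin N) (x : ρ → ρ → ℝ) (X : ρ → Sp N) (η : ρ → Bool) : Vm q i x (updS i X η) = Vm q i x X := by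
  simp only [Vm_eq]
  refine sum_congr rfl fun a _ => sum_congr rfl fun b _ => ?_
  rw [← R_sub_inv i (X a) (X b) (η a) (η b)]
  simp [updS, ee]

lemma VV_site (hN : N ≠ 0) (q : ℝ) (x : ρ → ρ → ℝ) (X : ρ → Sp N) : VV q x X = 1 / N * ∑ i, phi q x (fun a => X a i) := by
  have hN' : (N:ℝ) ≠ 0 := by positivity
  simp only [VV, phi]
  symm
  rw [sum_comm, mul_sum]
  refine sum_congr rfl fun a _ => ?_
  rw [sum_comm, mul_sum]
  refine sum_congr rfl fun b _ => ?_
  rw [← mul_sum, sum_sub_distrib, sum_sp hN]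
  simp only [sum_const, card_univ, Fintype.card_fin, nsmul_eq_mul]
  field_simp

/-- one-replacement lemma -/
lemma SW (h : HYP β μ v q) (ρ : Type) [Fintype ρ] [DecidableEq ρ] [Nonempty ρ] (j : ℕ) :
    ∃ K, 0 ≤ K ∧ ∀ {N : ℕ} (_ : N ≠ 0) (i : Fin N) (Φ : (ρ → Bool) → ℝ) (b : ℝ), (∀ η, |Φ η| ≤ b) →
      ∀ (G G' : (ρ → Sp N) → ℝ) (c : ℝ), 0 ≤ c → (∀ x, |G x| ≤ c * TT q x ^ j) → (∀ x, |G x - G' x| ≤ c * TT q x ^ (j + 1)) →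
      (∀ x η, G (updS i x η) = G x) →
      ∀ s, 0 ≤ s → s ≤ 1 → |nuS β μ v q i s (fun x => Φ (fun a => x a i) * G x) - site β μ v q Φ * nuSK β μ v q G'|
         ≤ b * c * K * MM N β μ v q (j + 1) := by
  obtain ⟨K1, hK1, h1⟩ := B1' h ρ (j + 1)
  obtain ⟨K2, hK2, h2⟩ := B2 h ρ j
  refine ⟨K1 + 2 * K2, by positivity, ?_⟩
  intro N hN i Φ b hb G G' c hc hG hGG' hinv s s0 s1
  have hb0 : 0 ≤ b := (abs_nonneg _).trans (hb (fun _ => true))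
  have a1 := h2 hN i (fun x => Φ (fun a => x a i) * G x) (b * c) (by positivity) (fun x => by
    rw [abs_mul, mul_assoc]; exact mul_le_mul (hb _) (hG x) (abs_nonneg _) hb0) s s0 s1
  rw [nuS_fact β μ v q i Φ G hinv] at a1
  have a2 := h2 hN i G c hc hG 1 zero_le_one le_rfl
  rw [nuS_one] at a2
  have a3 := h1 hN (fun x => G x - G' x) c hc hGG'
  rw [nuSK_sub] at a3
  have hsite : |site β μ v q Φ| ≤ b := by
    refine (GS.abs_nu_le_of _ _ hb).trans (le_of_eq (GS.nu_const _ _ _))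
  set M := MM N β μ v q (j + 1)
  set S := site β μ v q Φ
  calc _ = |(nuS β μ v q i s (fun x => Φ (fun a => x a i) * G x) - S * nuS β μ v q i 0 G)
        + S * (-(nuSK β μ v q G - nuS β μ v q i 0 G) + (nuSK β μ v q G - nuSK β μ v q G'))| := by congr 1; ring
    _ ≤ b * c * K2 * M + b * (c * K2 * M + c * K1 * M) := by
      refine (abs_add_le _ _).trans (add_le_add a1 ?_)
      rw [abs_mul]
      refine mul_le_mul hsite ((abs_add_le _ _).trans (add_le_add ?_ a3)) (abs_nonneg _) hb0
      rw [abs_neg]; exact a2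
    _ = _ := by ring

/-- signed kernel sum -/
def KS (u : ρ × Fin 3 → ρ × Fin 3 → ℝ) : ℝ := ∑ a : ρ, ∑ b : ρ, ((if a = b then 0 else u (a, 0) (b, 0))
    - 2 * u (a, 0) (b, 1) - (if a = b then 0 else u (a, 1) (b, 1)) + 2 * u (a, 1) (b, 2))

lemma KS_smul (c : ℝ) (u : ρ × Fin 3 → ρ × Fin 3 → ℝ) : c * KS u = KS (fun a b => c * u a b) := by
  simp only [KS, mul_sum]
  refine sum_congr rfl fun a _ => sum_congr rfl fun b _ => ?_
  split_ifs <;> ring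

lemma KS_nu (β μ v q : ℝ) (i : Fin N) (s : ℝ) (u : ρ × Fin 3 → ρ × Fin 3 → (ρ × Fin 3 → Sp N) → ℝ) :
    nuS β μ v q i s (fun x => KS (fun c d => u c d x)) = KS (fun c d => nuS β μ v q i s (u c d)) := by
  simp only [KS]
  rw [nuS_sum]
  refine sum_congr rfl fun a _ => ?_
  rw [nuS_sum]
  refine sum_congr rfl fun b _ => ?_
  simp only [nuS]
  rw [GS.nu_add, GS.nu_sub, GS.nu_sub, GS.nu_smul, GS.nu_smul]
  split_ifs
  · rw [GS.nu_const]
  · rfl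

lemma KS_sub_le {u u' : ρ × Fin 3 → ρ × Fin 3 → ℝ} {C : ℝ} (h : ∀ c d, c ≠ d → |u c d - u' c d| ≤ C) (hC : 0 ≤ C) :
    |KS u - KS u'| ≤ 6 * (card ρ : ℝ) ^ 2 * C := by
  have h1 : ∀ a b : ρ, |((if a = b then 0 else u (a, 0) (b, 0)) - 2 * u (a, 0) (b, 1) - (if a = b then 0 else u (a, 1) (b, 1)) + 2 * u (a, 1) (b, 2))
     - ((if a = b then 0 else u' (a, 0) (b, 0)) - 2 * u' (a, 0) (b, 1) - (if a = b then 0 else u' (a, 1) (b, 1)) + 2 * u' (a, 1) (b, 2))| ≤ 6 * C := by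
    intro a b
    have k1 := abs_le.1 (h (a, 0) (b, 1) (by simp))
    have k2 := abs_le.1 (h (a, 1) (b, 2) (by simp))
    by_cases hab : a = b
    · simp only [hab, if_true]
      subst hab
      rw [abs_le]; constructor <;> linarith
    · simp only [hab, if_false]
      have k3 := abs_le.1 (h (a, 0) (b, 0) (by simp [hab]))
      have k4 := abs_le.1 (h (a, 1) (b, 1) (by simp [hab]))
      rw [abs_le]; constructor <;> linarith
  simp only [KS, ← sum_sub_distrib]
  refine (abs_sum_le_sum_abs _ _).trans ((sum_le_sum fun a _ => (abs_sum_le_sum_abs _ _).trans (sum_le_sum fun b _ => h1 a b)).trans (le_of_eq ?_))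
  simp only [sum_const, card_univ, nsmul_eq_mul]; ring

def kap (β μ v q : ℝ) (x : ρ → ρ → ℝ) (c d : ρ × Fin 3) : ℝ :=
  site β μ v q (fun η : ρ × Fin 3 → Bool => phi q x (fun a => η (a, 0)) * (sp (η c) * sp (η d)))
def kap' (β μ v q : ℝ) (x y : ρ → ρ → ℝ) : ℝ := site β μ v q (fun η : ρ → Bool => phi q x η * psi y η)

end
end

section
section
variable {ρ : Type} [Fintype ρ] [DecidableEq ρ]

/-! site values -/
lemma av_prod_sp (μ : ℝ) (n : ℕ) (θ : Unit → ℝ) : ((S1 μ).rep (Fin n)).av θ (fun η => ∏ a, sp (η a)) = tanh (μ + θ ()) ^ n := by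
  simp only [GS.av, GS.rep_p, ← prod_mul_distrib]
  rw [GS.sum_prod_eq (fun _ t => sp t * (S1 μ).p θ t), ← S1_av μ θ]
  simp [GS.av]

def qh (β μ v q : ℝ) : ℝ := ∫ w, tf (μ + √(v + β ^ 2 * q) * w) ∂g1

lemma site_sub (β μ v q : ℝ) (Φ Ψ : (ρ → Bool) → ℝ) : site β μ v q (fun η => Φ η - Ψ η) = site β μ v q Φ - site β μ v q Ψ := GS.nu_sub _ _ _ _
lemma site_smul (β μ v q c : ℝ) (Φ : (ρ → Bool) → ℝ) : site β μ v q (fun η => c * Φ η) = c * site β μ v q Φ := GS.nu_smul _ _ _ _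
lemma site_const (β μ v q c : ℝ) : site β μ v q (fun η : ρ → Bool => c) = c := GS.nu_const _ _ _
lemma site_sum {ι : Type*} (s : Finset ι) (β μ v q : ℝ) (Φ : ι → (ρ → Bool) → ℝ) :
    site β μ v q (fun η => ∑ l ∈ s, Φ l η) = ∑ l ∈ s, site β μ v q (Φ l) := GS.nu_sum _ _ _ _

lemma site_prod (β μ v q : ℝ) {n : ℕ} (e : Fin n → ρ) (he : Function.Injective e) :
    site β μ v q (fun η => ∏ a, sp (η (e a))) = ∫ w, tanh (μ + √(v + β ^ 2 * q) * w) ^ n ∂g1 := by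
  rw [site, GS.nu_inj (S1 μ) e he _ (fun η => ∏ a, sp (η a)), GS.nu]
  simp only [av_prod_sp]
  exact int_unit (fun t => tanh (μ + √(v + β ^ 2 * q) * t) ^ n)

lemma site2 (h : HYP β μ v q) {a b : ρ} (hab : a ≠ b) : site β μ v q (fun η => sp (η a) * sp (η b)) = q := by
  have := site_prod β μ v q ![a, b] (by intro x y; fin_cases x <;> fin_cases y <;> simp [hab, Ne.symm hab])
  simp only [Fin.prod_univ_two, Matrix.cons_val_zero, Matrix.cons_val_one] at this
  rw [this]; exact h.hq.symm

lemma site4 (β μ v q : ℝ) {a b c d : ρ} (hab : a ≠ b) (hac : a ≠ c) (had : a ≠ d) (hbc : b ≠ c) (hbd : b ≠ d) (hcd : c ≠ d) :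
    site β μ v q (fun η => sp (η a) * sp (η b) * (sp (η c) * sp (η d))) = qh β μ v q := by
  have := site_prod β μ v q ![a, b, c, d] (by
    intro x y; fin_cases x <;> fin_cases y <;> simp [hab, hac, had, hbc, hbd, hcd, Ne.symm hab, Ne.symm hac, Ne.symm had, Ne.symm hbc, Ne.symm hbd, Ne.symm hcd])
  simp only [Fin.prod_univ_four, Matrix.cons_val] at this
  simp only [← mul_assoc]
  exact this

lemma site4v (h : HYP β μ v q) {a b c d : ρ} (hab : a ≠ b) (hcd : c ≠ d) :
    site β μ v q (fun η => sp (η a) * sp (η b) * (sp (η c) * sp (η d)))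
      = if (a = c ∧ b = d) ∨ (a = d ∧ b = c) then 1 else if a = c ∨ a = d ∨ b = c ∨ b = d then q else qh β μ v q := by
  have key : ∀ {a b d : ρ}, b ≠ d → site β μ v q (fun η => sp (η a) * sp (η b) * (sp (η a) * sp (η d))) = q := by
    intro a b d hbd
    refine (congrArg (site β μ v q) (funext fun η => ?_)).trans (site2 h hbd)
    have := sp_mul_self (η a)
    linear_combination (sp (η b) * sp (η d)) * this
  have key1 : ∀ {a b : ρ}, site β μ v q (fun η => sp (η a) * sp (η b) * (sp (η a) * sp (η b))) = 1 := by
    intro a b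
    refine (congrArg (site β μ v q) (funext fun η => ?_)).trans (site_const (ρ := ρ) β μ v q 1)
    have h1 := sp_mul_self (η a)
    have h2 := sp_mul_self (η b)
    linear_combination (sp (η b) * sp (η b)) * h1 + h2
  have sw1 : ∀ a b c d : ρ, site β μ v q (fun η => sp (η a) * sp (η b) * (sp (η c) * sp (η d))) = site β μ v q (fun η => sp (η b) * sp (η a) * (sp (η c) * sp (η d))) := by
    intro a b c d; congr 1; ext η; ring
  have sw2 : ∀ a b c d : ρ, site β μ v q (fun η => sp (η a) * sp (η b) * (sp (η c) * sp (η d))) = site β μ v q (fun η => sp (η a) * sp (η b) * (sp (η d) * sp (η c))) := by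
    intro a b c d; congr 1; ext η; ring
  by_cases h1 : a = c
  · subst h1
    by_cases h2 : b = d
    · subst h2; simp [key1]
    · simp [h2, hcd, key h2]
  by_cases h2 : a = d
  · subst h2
    by_cases h3 : b = c
    · subst h3; rw [sw2]; simp [key1]
    · rw [sw2]; simp [h1, h3, key h3]
  by_cases h3 : b = c
  · subst h3
    rw [sw1]; simp [h1, h2, key h2]
  by_cases h4 : b = d
  · subst h4
    rw [sw1, sw2]; simp [h1, h2, h3, key h1]
  simp [h1, h2, h3, h4, site4 β μ v q hab h1 h2 h3 h4 hcd]

lemma site_phi (h : HYP β μ v q) {x : ρ → ρ → ℝ} (hx : ∀ a, x a a = 0) : site β μ v q (phi q x) = 0 := by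
  have : phi q x = fun η => ∑ a, ∑ b, x a b * (sp (η a) * sp (η b) - q) := rfl
  rw [this, site_sum]
  refine sum_eq_zero fun a _ => ?_
  rw [site_sum]
  refine sum_eq_zero fun b _ => ?_
  rw [site_smul]
  by_cases hab : a = b
  · rw [hab, hx, zero_mul]
  · rw [site_sub, site_const, site2 h hab, sub_self, mul_zero]

lemma ker_KS (q : ℝ) (i : Fin N) (X : ρ × Fin 3 → Sp N) : ker q i X = KS (fun c d => ee i (X c) (X d) * (R (X c) (X d) - q)) := rfl

lemma card_erase' {ι : Type} [Fintype ι] [DecidableEq ι] (l : ι) : (univ.erase l).card + 1 = card ι := by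
  rw [card_erase_of_mem (mem_univ l), card_univ]
  have : 0 < card ι := Fintype.card_pos_iff.2 ⟨l⟩
  omega

set_option maxHeartbeats 2000000 in
/-- the cavity expansion at one site -/
lemma CE1 (h : HYP β μ v q) {ρ : Type} [Fintype ρ] [DecidableEq ρ] [Nonempty ρ] {ι : Type} [Fintype ι] [DecidableEq ι]
    (x0 : ρ → ρ → ℝ) (hx0 : ∀ a, x0 a a = 0) (xs : ι → ρ → ρ → ℝ) (hxs : ∀ l a, xs l a a = 0) :
    ∃ C, 0 ≤ C ∧ ∀ {N : ℕ} (_ : N ≠ 0) (i : Fin N),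
      |nuSK β μ v q (fun X : ρ → Sp N => phi q x0 (fun a => X a i) * ∏ l, VV q (xs l) X)
        - 1 / N * ∑ l, kap' β μ v q x0 (xs l) * nuSK β μ v q (fun X : ρ → Sp N => ∏ m ∈ univ.erase l, VV q (xs m) X)
        - β ^ 2 / 2 * KS (fun c d => kap β μ v q x0 c d * nuSK β μ v q (fun X : ρ × Fin 3 → Sp N => (∏ l, VV q (xs l) (fun a => X (a, 0))) * (R (X c) (X d) - q)))|
      ≤ C * MM N β μ v q (card ι + 2) := by
  classical
  set k := card ι with hk
  set c : ℝ := 2 * ∑ l, nx (xs l) with hc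
  have hc0 : 0 ≤ c := by rw [hc]; exact mul_nonneg zero_le_two (sum_nonneg fun l _ => nx_nonneg _)
  have hnx : ∀ l, 2 * nx (xs l) ≤ c := fun l => by
    rw [hc]; exact mulL (single_le_sum (f := fun l => nx (xs l)) (fun l _ => nx_nonneg _) (mem_univ l)) zero_le_two
  have hn0 := nx_nonneg x0
  -- product estimates
  have PE : ∀ {N : ℕ} (hN : N ≠ 0) (i : Fin N) (X : ρ → Sp N) (s : Finset ι),
      |∏ l ∈ s, Vm q i (xs l) X| ≤ c ^ s.card * TT q X ^ s.card ∧ |∏ l ∈ s, VV q (xs l) X - ∏ l ∈ s, Vm q i (xs l) X| ≤ s.card * c ^ s.card * TT q X ^ (s.card + 1)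
    ∧ |∏ l ∈ s, VV q (xs l) X - ∏ l ∈ s, Vm q i (xs l) X - ∑ l ∈ s, (psi (xs l) (fun a => X a i) / N) * ∏ m ∈ s.erase l, Vm q i (xs m) X|
       ≤ (s.card : ℝ) ^ 2 * c ^ s.card * TT q X ^ (s.card + 2) := by
    intro N hN i X s
    have hT := TT_nonneg q X
    have hD : ∀ l, |psi (xs l) (fun a => X a i) / N| ≤ nx (xs l) * (1 / N) := fun l => by
      rw [abs_div, Nat.abs_cast, div_eq_mul_one_div]
      exact mulR (abs_psi _ _) (by positivity)
    have hA : ∀ l, |VV q (xs l) X| ≤ nx (xs l) * TT q X := fun l => abs_VV q (hxs l) X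
    refine prod_est _ _ _ hc0 hT (fun l => ?_) (fun l => ?_) (fun l => ?_) (fun l => by rw [Vm]; ring) s
    · refine (hA l).trans (mulR ?_ hT)
      linarith [nx_nonneg (xs l), hnx l]
    · rw [Vm]
      refine (abs_sub _ _).trans ((add_le_add (hA l) ((hD l).trans (mulL (invN_le' hN q X) (nx_nonneg _)))).trans ?_)
      rw [← two_mul, ← mul_assoc]
      exact mulR (hnx l) hT
    · refine (hD l).trans (mul_le_mul ?_ (invN_le q X) (by positivity) hc0)
      linarith [nx_nonneg (xs l), hnx l]
  obtain ⟨K1, hK1, b1⟩ := B1' h ρ (k + 2)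
  obtain ⟨K3, hK3, b3⟩ := B3 h ρ k
  obtain ⟨K4, hK4, b4⟩ := SW h ρ (k - 1)
  obtain ⟨K5, hK5, b5⟩ := SW h (ρ × Fin 3) (k + 1)
  obtain ⟨K6, hK6, b6⟩ := B1 h (ρ × Fin 3) (k + 2)
  set E4 : ℝ := (nx x0 * 2 * c) * (k * c ^ (k - 1)) * K4 with hE4
  set E5 : ℝ := (nx x0 * 2) * (2 * (c ^ k + k * c ^ k)) * K5 + (nx x0 * 2 * c ^ k) * K6 with hE5
  refine ⟨(nx x0 * 2 * (k ^ 2 * c ^ k)) * K1 + k * E4 + (nx x0 * 2 * c ^ k) * K3 + β ^ 2 / 2 * (6 * (card ρ : ℝ) ^ 2 * E5), by positivity, ?_⟩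
  intro N hN i
  have hphi : ∀ η : ρ → Bool, |phi q x0 η| ≤ nx x0 * 2 := abs_phi h.hq0.le h.hq1.le x0
  set M := MM N β μ v q (k + 2) with hM
  have hM0 : 0 ≤ M := MM_nonneg _ _ _ _ _ _
  have cu : (univ : Finset ι).card = k := rfl
  set Wm : (ρ → Sp N) → ℝ := fun X => ∏ l, Vm q i (xs l) X with hWm
  set W : (ρ → Sp N) → ℝ := fun X => ∏ l, VV q (xs l) X with hW
  -- step 1
  have s1 : |nuSK β μ v q (fun X : ρ → Sp N => phi q x0 (fun a => X a i) * W X)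
      - nuSK β μ v q (fun X : ρ → Sp N => phi q x0 (fun a => X a i) * Wm X)
      - ∑ l, 1 / N * nuSK β μ v q (fun X : ρ → Sp N => (phi q x0 (fun a => X a i) * psi (xs l) (fun a => X a i)) * ∏ m ∈ univ.erase l, Vm q i (xs m) X)|
      ≤ (nx x0 * 2 * (k ^ 2 * c ^ k)) * K1 * M := by
    have := b1 hN (fun X : ρ → Sp N => phi q x0 (fun a => X a i) * (W X - Wm X - ∑ l, (psi (xs l) (fun a => X a i) / N) * ∏ m ∈ univ.erase l, Vm q i (xs m) X))
      (nx x0 * 2 * (k ^ 2 * c ^ k)) (by positivity) (fun X => by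
        rw [abs_mul, mul_assoc (nx x0 * 2)]
        exact mul_le_mul (hphi _) ((PE hN i X univ).2.2) (abs_nonneg _) (by positivity))
    refine le_trans (le_of_eq ?_) this
    congr 1
    simp only [← nuSK_smul]
    rw [← nuSK_sub, ← nuSK_sum, ← nuSK_sub]
    congr 1; ext X
    rw [mul_sub, mul_sub, mul_sum]
    congr 1
    refine sum_congr rfl fun l _ => ?_
    ring
  -- step 2
  have s2 : ∀ l, |1 / N * nuSK β μ v q (fun X : ρ → Sp N => (phi q x0 (fun a => X a i) * psi (xs l) (fun a => X a i)) * ∏ m ∈ univ.erase l, Vm q i (xs m) X)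
      - 1 / N * (kap' β μ v q x0 (xs l) * nuSK β μ v q (fun X : ρ → Sp N => ∏ m ∈ univ.erase l, VV q (xs m) X))| ≤ E4 * M := by
    intro l
    have ce : (univ.erase l).card = k - 1 := by have := card_erase' l; omega
    have ck : (1:ℝ) ≤ k := by exact_mod_cast Fintype.card_pos_iff.2 ⟨l⟩
    have hck : c ^ (k - 1) ≤ k * c ^ (k - 1) := le_mul_of_one_le_left (by positivity) ck
    have := b4 hN i (fun η => phi q x0 η * psi (xs l) η) (nx x0 * 2 * c) (fun η => by
        rw [abs_mul]
        refine mul_le_mul (hphi _) ((abs_psi _ _).trans ?_) (abs_nonneg _) (by positivity)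
        linarith [nx_nonneg (xs l), hnx l])
      (fun X => ∏ m ∈ univ.erase l, Vm q i (xs m) X) (fun X => ∏ m ∈ univ.erase l, VV q (xs m) X) (k * c ^ (k - 1)) (by positivity)
      (fun X => by
        have := (PE hN i X (univ.erase l)).1
        rw [ce] at this
        exact this.trans (mulR hck (pow_nonneg (TT_nonneg q X) _)))
      (fun X => by
        have := (PE hN i X (univ.erase l)).2.1
        rw [ce] at this
        rw [abs_sub_comm]
        refine this.trans (mulR (mulR ?_ (by positivity)) (pow_nonneg (TT_nonneg q X) _))
        exact_mod_cast Nat.sub_le k 1)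
      (fun X η => by simp only [Vm_inv]) 1 zero_le_one le_rfl
    rw [nuS_one] at this
    have e : k - 1 + 1 = k := by have := card_erase' l; omega
    rw [e] at this
    rw [← mul_sub, abs_mul, abs_of_nonneg (by positivity)]
    refine (mulL this (by positivity)).trans ?_
    have m2 := mulL (MM_dl N β μ v q k) (by positivity : 0 ≤ E4)
    refine le_trans (le_of_eq ?_) m2
    rw [hE4]; ring
  -- step 3
  have s3 : |nuSK β μ v q (fun X : ρ → Sp N => phi q x0 (fun a => X a i) * Wm X)
      - nuS β μ v q i 0 (fun X : ρ × Fin 3 → Sp N => (phi q x0 (fun a => X (a, 0) i) * Wm (fun a => X (a, 0))) * (β ^ 2 / 2 * ker q i X))|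
      ≤ (nx x0 * 2 * c ^ k) * K3 * M := by
    have := b3 hN i (fun X : ρ → Sp N => phi q x0 (fun a => X a i) * Wm X) (nx x0 * 2 * c ^ k) (by positivity) (fun X => by
      rw [abs_mul, mul_assoc (nx x0 * 2)]
      exact mul_le_mul (hphi _) ((PE hN i X univ).1) (abs_nonneg _) (by positivity))
    rw [nuS_fact β μ v q i (phi q x0) Wm (fun X η => by simp only [hWm, Vm_inv]), site_phi h hx0, zero_mul, sub_zero] at this
    exact this
  -- step 4
  have s4 : |nuS β μ v q i 0 (fun X : ρ × Fin 3 → Sp N => (phi q x0 (fun a => X (a, 0) i) * Wm (fun a => X (a, 0))) * (β ^ 2 / 2 * ker q i X))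
      - β ^ 2 / 2 * KS (fun c d => kap β μ v q x0 c d * nuSK β μ v q (fun X : ρ × Fin 3 → Sp N => W (fun a => X (a, 0)) * (R (X c) (X d) - q)))|
      ≤ β ^ 2 / 2 * (6 * (card ρ : ℝ) ^ 2 * (E5 * M)) := by
    have e1 : (fun X : ρ × Fin 3 → Sp N => (phi q x0 (fun a => X (a, 0) i) * Wm (fun a => X (a, 0))) * (β ^ 2 / 2 * ker q i X))
       = fun X => β ^ 2 / 2 * KS (fun c d => (phi q x0 (fun a => X (a, 0) i) * Wm (fun a => X (a, 0))) * (ee i (X c) (X d) * (R (X c) (X d) - q))) := by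
      ext X
      rw [← KS_smul, ker_KS]
      exact mul_left_comm _ _ _
    rw [e1, nuS_smul, ← mul_sub, abs_mul, abs_of_nonneg (by positivity : (0:ℝ) ≤ β ^ 2 / 2)]
    refine mulL ?_ (by positivity)
    rw [KS_nu]
    refine KS_sub_le (fun cc dd hcd => ?_) (by positivity)
    have hTi : ∀ X : ρ × Fin 3 → Sp N, TT q (fun a => X (a, 0)) ≤ TT q X := fun X => TT_inj q X (fun a : ρ => (a, (0 : Fin 3))) (fun a b h => by simpa using h)
    have hWmB : ∀ X : ρ × Fin 3 → Sp N, |Wm (fun a => X (a, 0))| ≤ c ^ k * TT q X ^ k := fun X =>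
      ((PE hN i (fun a => X (a, 0)) univ).1).trans (mulL (pow_le_pow_left₀ (TT_nonneg q _) (hTi X) _) (by positivity))
    have hWWm : ∀ X : ρ × Fin 3 → Sp N, |W (fun a => X (a, 0)) - Wm (fun a => X (a, 0))| ≤ k * c ^ k * TT q X ^ (k + 1) := fun X =>
      ((PE hN i (fun a => X (a, 0)) univ).2.1).trans (mulL (pow_le_pow_left₀ (TT_nonneg q _) (hTi X) _) (by positivity))
    have hee : ∀ X : ρ × Fin 3 → Sp N, |ee i (X cc) (X dd) / N| = 1 / N := fun X => by rw [abs_div, abs_ee, Nat.abs_cast]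
    have hU := fun X : ρ × Fin 3 → Sp N => U_le q X hcd
    have t1 := b5 hN i (fun η => phi q x0 (fun a => η (a, 0)) * (sp (η cc) * sp (η dd))) (nx x0 * 2) (fun η => by
        rw [abs_mul, abs_sp2, mul_one]; exact hphi _)
      (fun X => Wm (fun a => X (a, 0)) * (R (X cc) (X dd) - ee i (X cc) (X dd) / N - q)) (fun X => W (fun a => X (a, 0)) * (R (X cc) (X dd) - q))
      (2 * (c ^ k + k * c ^ k)) (by positivity)
      (fun X => by
        rw [abs_mul]
        have hT := TT_nonneg q X
        have : |R (X cc) (X dd) - ee i (X cc) (X dd) / N - q| ≤ 2 * TT q X := by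
          rw [show R (X cc) (X dd) - ee i (X cc) (X dd) / N - q = (R (X cc) (X dd) - q) - ee i (X cc) (X dd) / N by ring]
          refine (abs_sub _ _).trans ?_
          rw [hee]; linarith [hU X, invN_le' hN q X]
        refine (mul_le_mul (hWmB X) this (abs_nonneg _) (by positivity)).trans ?_
        have : 0 ≤ k * c ^ k * TT q X ^ (k + 1) := by positivity
        rw [show c ^ k * TT q X ^ k * (2 * TT q X) = 2 * (c ^ k * TT q X ^ (k + 1)) by ring]
        linarith)
      (fun X => by
        have hT := TT_nonneg q X
        rw [show Wm (fun a => X (a, 0)) * (R (X cc) (X dd) - ee i (X cc) (X dd) / N - q) - W (fun a => X (a, 0)) * (R (X cc) (X dd) - q)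
          = -((W (fun a => X (a, 0)) - Wm (fun a => X (a, 0))) * (R (X cc) (X dd) - q)) - Wm (fun a => X (a, 0)) * (ee i (X cc) (X dd) / N) by ring]
        refine (abs_sub _ _).trans ?_
        rw [abs_neg, abs_mul, abs_mul, hee]
        refine (add_le_add (mul_le_mul (hWWm X) (hU X) (abs_nonneg _) (by positivity)) (mul_le_mul (hWmB X) (invN_le q X) (by positivity) (by positivity))).trans ?_
        have : 0 ≤ k * c ^ k * TT q X ^ (k + 2) := by positivity
        have : 0 ≤ c ^ k * TT q X ^ (k + 2) := by positivity
        rw [show k * c ^ k * TT q X ^ (k + 1) * TT q X + c ^ k * TT q X ^ k * TT q X ^ 2 = k * c ^ k * TT q X ^ (k + 2) + c ^ k * TT q X ^ (k + 2) by ring]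
        linarith)
      (fun X η => by
        have e1 := R_sub_inv i (X cc) (X dd) (η cc) (η dd)
        have e2 : Wm (fun a => updS i X η (a, 0)) = Wm (fun a => X (a, 0)) := by
          have : (fun a => updS i X η (a, 0)) = updS i (fun a => X (a, 0)) (fun a => η (a, 0)) := rfl
          rw [this]; simp only [hWm, Vm_inv]
        simp only [e2, ← e1]
        simp [updS, ee])
      0 le_rfl zero_le_one
    have t2 := b6 hN i (fun X => phi q x0 (fun a => X (a, 0) i) * Wm (fun a => X (a, 0)) * (1 / N)) (nx x0 * 2 * c ^ k) (by positivity)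
      (fun X => by
        have hT := TT_nonneg q X
        rw [abs_mul, abs_mul, abs_of_nonneg (by positivity : (0:ℝ) ≤ 1 / N)]
        refine (mul_le_mul (mul_le_mul (hphi _) (hWmB X) (abs_nonneg _) (by positivity)) (invN_le q X) (by positivity) (by positivity)).trans (le_of_eq ?_)
        ring) 0 le_rfl zero_le_one
    have e2 : nuS β μ v q i 0 (fun X : ρ × Fin 3 → Sp N => (phi q x0 (fun a => X (a, 0) i) * Wm (fun a => X (a, 0))) * (ee i (X cc) (X dd) * (R (X cc) (X dd) - q)))
       = nuS β μ v q i 0 (fun X : ρ × Fin 3 → Sp N => phi q x0 (fun a => X (a, 0) i) * (sp (X cc i) * sp (X dd i)) * (Wm (fun a => X (a, 0)) * (R (X cc) (X dd) - ee i (X cc) (X dd) / N - q)))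
         + nuS β μ v q i 0 (fun X : ρ × Fin 3 → Sp N => phi q x0 (fun a => X (a, 0) i) * Wm (fun a => X (a, 0)) * (1 / N)) := by
      refine Eq.trans ?_ (GS.nu_add _ _ _ _)
      rw [nuS]
      congr 1; ext X
      have := ee_sq i (X cc) (X dd)
      have e3 : sp (X cc i) * sp (X dd i) = ee i (X cc) (X dd) := rfl
      rw [e3]
      linear_combination (phi q x0 (fun a => X (a, 0) i) * Wm (fun a => X (a, 0)) / N) * this
    rw [e2]
    rw [show ∀ A B C : ℝ, A + B - C = (A - C) + B by intros; ring]
    refine (abs_add_le _ _).trans ((add_le_add t1 t2).trans (le_of_eq ?_))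
    rw [hE5, hM]; ring
  have s2' := (abs_sum_le_sum_abs (fun l => 1 / (N:ℝ) * nuSK β μ v q (fun X : ρ → Sp N => (phi q x0 (fun a => X a i) * psi (xs l) (fun a => X a i)) * ∏ m ∈ univ.erase l, Vm q i (xs m) X)
      - 1 / N * (kap' β μ v q x0 (xs l) * nuSK β μ v q (fun X : ρ → Sp N => ∏ m ∈ univ.erase l, VV q (xs m) X))) univ).trans (sum_le_sum fun l _ => s2 l)
  rw [sum_sub_distrib, sum_const, cu, nsmul_eq_mul, ← mul_sum univ (fun l => kap' β μ v q x0 (xs l) * nuSK β μ v q (fun X : ρ → Sp N => ∏ m ∈ univ.erase l, VV q (xs m) X)) (1 / (N:ℝ))] at s2'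
  rw [abs_le] at s1 s2' s3 s4 ⊢
  constructor <;> linarith [s1.1, s1.2, s2'.1, s2'.2, s3.1, s3.2, s4.1, s4.2]

/-- the cavity expansion -/
lemma CE2 (h : HYP β μ v q) {ρ : Type} [Fintype ρ] [DecidableEq ρ] [Nonempty ρ] {ι : Type} [Fintype ι] [DecidableEq ι]
    (x0 : ρ → ρ → ℝ) (hx0 : ∀ a, x0 a a = 0) (xs : ι → ρ → ρ → ℝ) (hxs : ∀ l a, xs l a a = 0) :
    ∃ C, 0 ≤ C ∧ ∀ {N : ℕ} (_ : N ≠ 0),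
      |nuSK β μ v q (fun X : ρ → Sp N => VV q x0 X * ∏ l, VV q (xs l) X)
        - 1 / N * ∑ l, kap' β μ v q x0 (xs l) * nuSK β μ v q (fun X : ρ → Sp N => ∏ m ∈ univ.erase l, VV q (xs m) X)
        - β ^ 2 / 2 * KS (fun c d => kap β μ v q x0 c d * nuSK β μ v q (fun X : ρ × Fin 3 → Sp N => (∏ l, VV q (xs l) (fun a => X (a, 0))) * (R (X c) (X d) - q)))|
      ≤ C * MM N β μ v q (card ι + 2) := by
  obtain ⟨C, hC, hb⟩ := CE1 h x0 hx0 xs hxs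
  refine ⟨C, hC, fun {N} hN => ?_⟩
  have hN' : (N:ℝ) ≠ 0 := by positivity
  set S1 := 1 / (N:ℝ) * ∑ l, kap' β μ v q x0 (xs l) * nuSK β μ v q (fun X : ρ → Sp N => ∏ m ∈ univ.erase l, VV q (xs m) X) with hS1
  set S2 := β ^ 2 / 2 * KS (fun c d => kap β μ v q x0 c d * nuSK β μ v q (fun X : ρ × Fin 3 → Sp N => (∏ l, VV q (xs l) (fun a => X (a, 0))) * (R (X c) (X d) - q))) with hS2
  have e : nuSK β μ v q (fun X : ρ → Sp N => VV q x0 X * ∏ l, VV q (xs l) X) - S1 - S2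
      = 1 / N * ∑ i, (nuSK β μ v q (fun X : ρ → Sp N => phi q x0 (fun a => X a i) * ∏ l, VV q (xs l) X) - S1 - S2) := by
    rw [sum_sub_distrib, sum_sub_distrib, ← nuSK_sum, mul_sub, mul_sub, ← nuSK_smul]
    simp only [sum_const, card_univ, Fintype.card_fin, nsmul_eq_mul]
    have : (fun X : ρ → Sp N => VV q x0 X * ∏ l, VV q (xs l) X) = fun X => 1 / (N:ℝ) * ∑ i, phi q x0 (fun a => X a i) * ∏ l, VV q (xs l) X := by
      ext X; rw [VV_site hN q x0, ← sum_mul]; ring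
    rw [this]
    field_simp
  rw [e, abs_mul, abs_of_nonneg (by positivity : (0:ℝ) ≤ 1 / N)]
  have := (abs_sum_le_sum_abs (fun i => nuSK β μ v q (fun X : ρ → Sp N => phi q x0 (fun a => X a i) * ∏ l, VV q (xs l) X) - S1 - S2) univ).trans (sum_le_sum fun i _ => hb hN i)
  refine (mulL this (by positivity)).trans (le_of_eq ?_)
  simp only [sum_const, card_univ, Fintype.card_fin, nsmul_eq_mul]
  field_simp

end
end

section
section
variable {ρ : Type} [Fintype ρ] [DecidableEq ρ] {ρ' : Type} [Fintype ρ'] [DecidableEq ρ']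

def de (a b : ρ) : ℝ := if a = b then 1 else 0
def ss (β μ v q : ℝ) : ℝ := 1 - 2 * q + qh β μ v q
def Pq (β μ v q : ℝ) (a b c d : ρ) : ℝ := (qh β μ v q - q ^ 2) + (q - qh β μ v q) * (de a c + de a d + (de b c + de b d))
  + ss β μ v q * (de a c * de b d + de a d * de b c)

lemma ss_eq (h : HYP β μ v q) : ss β μ v q = sech4i β μ v q := by
  have e : (fun w => (1 - tanh (μ + √(v + β ^ 2 * q) * w) ^ 2) ^ 2) = fun w => 1 - 2 * tq (μ + √(v + β ^ 2 * q) * w) + tf (μ + √(v + β ^ 2 * q) * w) := by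
    ext w; unfold tq tf; ring
  have i1 : Integrable (fun w => tq (μ + √(v + β ^ 2 * q) * w)) g1 :=
    Integrable.of_bound (by fun_prop) 1 (Eventually.of_forall fun w => abs_tq _)
  have i2 : Integrable (fun w => tf (μ + √(v + β ^ 2 * q) * w)) g1 :=
    Integrable.of_bound (by fun_prop) 1 (Eventually.of_forall fun w => abs_tf _)
  have i3 : Integrable (fun w => 1 - 2 * tq (μ + √(v + β ^ 2 * q) * w)) g1 := (integrable_const _).sub (i1.const_mul _)
  rw [sech4i, e, integral_add i3 i2, integral_sub (integrable_const _) (i1.const_mul _), integral_const_mul, ← h.hq]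
  simp [ss, qh]

lemma qh_le (h : HYP β μ v q) : qh β μ v q ≤ q := by
  conv_rhs => rw [h.hq]
  refine integral_mono (Integrable.of_bound (by fun_prop) 1 (Eventually.of_forall fun w => abs_tf _))
    (Integrable.of_bound (by fun_prop) 1 (Eventually.of_forall fun w => abs_tq _)) fun w => ?_
  have h1 := tanh_sq_le (μ + √(v + β ^ 2 * q) * w)
  simp only [tq, tf]
  nlinarith [sq_nonneg (tanh (μ + √(v + β ^ 2 * q) * w))]

lemma al_lt (h : HYP β μ v q) : β ^ 2 * ss β μ v q < 1 := by rw [ss_eq h]; exact h.hAT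

lemma al_lt' (h : HYP β μ v q) : β ^ 2 * (1 - 4 * q + 3 * qh β μ v q) < 1 := by
  refine lt_of_le_of_lt (mulL ?_ (sq_nonneg β)) (al_lt h)
  have := qh_le h
  rw [ss]; linarith

lemma site_e (h : HYP β μ v q) {e : ρ → ρ'} (he : Function.Injective e) {x : ρ → ρ → ℝ} (hx : ∀ a, x a a = 0) {c d : ρ'} (hcd : c ≠ d) :
    site β μ v q (fun η : ρ' → Bool => phi q x (fun a => η (e a)) * (sp (η c) * sp (η d))) = ∑ a, ∑ b, x a b * Pq β μ v q (e a) (e b) c d := by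
  simp only [phi, sum_mul]
  rw [site_sum]
  refine sum_congr rfl fun a _ => ?_
  rw [site_sum]
  refine sum_congr rfl fun b _ => ?_
  simp only [mul_assoc (x a b)]
  rw [site_smul]
  by_cases hab : a = b
  · rw [hab, hx, zero_mul, zero_mul]
  congr 1
  have hab' : e a ≠ e b := fun h => hab (he h)
  simp only [sub_mul]
  rw [site_sub, site_smul, site2 h hcd, site4v h hab' hcd]
  unfold Pq ss de
  generalize e a = a' at *
  generalize e b = b' at *
  by_cases h1 : a' = c
  · subst h1
    by_cases h2 : b' = d
    · subst h2; simp [hab', Ne.symm hab']; ring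
    · simp [h2, hcd, hab', Ne.symm hab']; ring
  by_cases h2 : a' = d
  · subst h2
    by_cases h3 : b' = c
    · subst h3; simp [hab', Ne.symm hab']; ring
    · simp [h1, h3, hab', Ne.symm hab']; ring
  by_cases h3 : b' = c
  · subst h3; simp [h1, h2, hcd]; ring
  by_cases h4 : b' = d
  · subst h4; simp [h1, h2, h3]; ring
  simp [h1, h2, h3, h4]; ring

lemma kap_eq (h : HYP β μ v q) {x : ρ → ρ → ℝ} (hx : ∀ a, x a a = 0) {c d : ρ × Fin 3} (hcd : c ≠ d) :
    kap β μ v q x c d = ∑ a, ∑ b, x a b * Pq β μ v q (a, (0:Fin 3)) (b, 0) c d :=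
  site_e h (e := fun a : ρ => (a, (0 : Fin 3))) (fun a b h => by simpa using h) hx hcd

lemma prod_sum (β μ v q : ℝ) (e : ρ → ρ') (f g : ρ → ℝ) (c d : ρ') :
    ∑ a, ∑ b, (f a * g b) * Pq β μ v q (e a) (e b) c d = (qh β μ v q - q ^ 2) * ((∑ a, f a) * ∑ b, g b)
     + (q - qh β μ v q) * ((∑ a, f a * de (e a) c + ∑ a, f a * de (e a) d) * (∑ b, g b) + (∑ a, f a) * (∑ b, g b * de (e b) c + ∑ b, g b * de (e b) d))
     + ss β μ v q * ((∑ a, f a * de (e a) c) * (∑ b, g b * de (e b) d) + (∑ a, f a * de (e a) d) * (∑ b, g b * de (e b) c)) := by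
  simp only [← sum_add_distrib, ← mul_add]
  simp only [sum_mul_sum]
  simp only [mul_sum, ← sum_add_distrib]
  refine sum_congr rfl fun a _ => sum_congr rfl fun b _ => ?_
  rw [Pq]; ring

def lv (f : ρ → ℝ) (c : ρ × Fin 3) : ℝ := if c.2 = 0 then f c.1 else 0

lemma kap_prod (h : HYP β μ v q) {f g : ρ → ℝ} (hfg : ∀ a, f a * g a = 0) {c d : ρ × Fin 3} (hcd : c ≠ d) :
    kap β μ v q (fun a b => f a * g b) c d = (qh β μ v q - q ^ 2) * ((∑ a, f a) * ∑ b, g b)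
      + (q - qh β μ v q) * ((lv f c + lv f d) * (∑ b, g b) + (∑ a, f a) * (lv g c + lv g d)) + ss β μ v q * (lv f c * lv g d + lv f d * lv g c) := by
  have : ∀ (f : ρ → ℝ) (c : ρ × Fin 3), ∑ a, f a * de (a, (0:Fin 3)) c = lv f c := by
    intro f c
    obtain ⟨c1, c2⟩ := c
    by_cases h2 : c2 = 0
    · subst h2; simp [de, lv]
    · simp [de, lv, h2, Ne.symm h2]
  rw [kap_eq h hfg hcd, prod_sum β μ v q (fun a : ρ => (a, (0:Fin 3)))]
  simp only [this]

lemma KS_pure (h : HYP β μ v q) {f g : ρ → ℝ} (hf : ∑ a, f a = 0) (hg : ∑ a, g a = 0) (hfg : ∀ a, f a * g a = 0)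
    (u : ρ × Fin 3 → ρ × Fin 3 → ℝ) (hu : ∀ c d, u c d = u d c) :
    KS (fun c d => kap β μ v q (fun a b => f a * g b) c d * u c d) = 2 * ss β μ v q * ∑ a, ∑ b, f a * g b * u (a, 0) (b, 0) := by
  have kv : ∀ (c d : ρ × Fin 3), c ≠ d → kap β μ v q (fun a b => f a * g b) c d = ss β μ v q * (lv f c * lv g d + lv f d * lv g c) := by
    intro c d hcd
    rw [kap_prod h hfg hcd, hf, hg]; ring
  rw [KS]
  have e1 : ∀ a b : ρ, ((if a = b then 0 else kap β μ v q (fun a b => f a * g b) (a, 0) (b, 0) * u (a, 0) (b, 0))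
    - 2 * (kap β μ v q (fun a b => f a * g b) (a, 0) (b, 1) * u (a, 0) (b, 1)) - (if a = b then 0 else kap β μ v q (fun a b => f a * g b) (a, 1) (b, 1) * u (a, 1) (b, 1))
    + 2 * (kap β μ v q (fun a b => f a * g b) (a, 1) (b, 2) * u (a, 1) (b, 2)))
     = ss β μ v q * (f a * g b * u (a, 0) (b, 0)) + ss β μ v q * (f b * g a * u (b, 0) (a, 0)) := by
    intro a b
    rw [kv (a, 0) (b, 1) (by simp), kv (a, 1) (b, 2) (by simp)]
    by_cases hab : a = b
    · subst hab
      have := hfg a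
      simp [this, lv]
    · rw [if_neg hab, if_neg hab, kv (a, 0) (b, 0) (by simp [hab]), kv (a, 1) (b, 1) (by simp [hab]), hu (b, 0) (a, 0)]
      simp [lv]; ring
  simp only [e1, sum_add_distrib]
  rw [sum_comm (f := fun a b => ss β μ v q * (f b * g a * u (b, 0) (a, 0)))]
  simp only [← mul_sum]
  ring

/-! moment classes -/
def GD (β μ v q : ℝ) (r : ℕ) (D : ∀ N : ℕ, (ρ → Sp N) → ℝ) : Prop :=
  ∃ C, 0 ≤ C ∧ ∀ N : ℕ, N ≠ 0 → nuSK β μ v q (fun X : ρ → Sp N => D N X ^ (2 * r)) ≤ C * (dl N ^ (2 * r) + MM N β μ v q (2 * r + 1))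

variable {β μ v q : ℝ} {r : ℕ}

lemma GD_add {D E : ∀ N : ℕ, (ρ → Sp N) → ℝ} (hD : GD β μ v q r D) (hE : GD β μ v q r E) : GD β μ v q r (fun N X => D N X + E N X) := by
  obtain ⟨C, hC, hb⟩ := hD
  obtain ⟨C', hC', hb'⟩ := hE
  refine ⟨2 ^ (2 * r - 1) * (C + C'), by positivity, fun N hN => ?_⟩
  refine (nuSK_mono β μ v q (fun X => (even_two_mul r).add_pow_le (a := D N X) (b := E N X))).trans ?_
  rw [nuSK_smul, nuSK_add, mul_assoc, add_mul]
  exact mulL (add_le_add (hb N hN) (hb' N hN)) (by positivity)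

lemma GD_smul (c : ℝ) {D : ∀ N : ℕ, (ρ → Sp N) → ℝ} (hD : GD β μ v q r D) : GD β μ v q r (fun N X => c * D N X) := by
  obtain ⟨C, hC, hb⟩ := hD
  have hc : 0 ≤ c ^ (2 * r) := (even_two_mul r).pow_nonneg c
  refine ⟨c ^ (2 * r) * C, by positivity, fun N hN => ?_⟩
  simp only [mul_pow]
  rw [nuSK_smul, mul_assoc]
  exact mulL (hb N hN) hc

lemma GD_zero (hr : r ≠ 0) : GD β μ v q r (fun N (X : ρ → Sp N) => 0) := by
  refine ⟨0, le_rfl, fun N hN => ?_⟩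
  simp only [zero_pow (mul_ne_zero two_ne_zero hr), zero_mul]
  exact (GS.nu_const _ _ _).le

lemma GD_sum (hr : r ≠ 0) {ι : Type*} (s : Finset ι) {D : ι → ∀ N : ℕ, (ρ → Sp N) → ℝ} (hD : ∀ l ∈ s, GD β μ v q r (D l)) :
    GD β μ v q r (fun N X => ∑ l ∈ s, D l N X) := by
  classical
  induction s using Finset.induction_on with
  | empty => simpa using GD_zero hr
  | insert a s ha ih =>
    simp only [sum_insert ha]
    exact GD_add (hD _ (by simp)) (ih fun l hl => hD _ (by simp [hl]))

lemma GD_inj {e : ρ' → ρ} (he : Function.Injective e) {D : ∀ N : ℕ, (ρ' → Sp N) → ℝ} (hD : GD β μ v q r D) :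
    GD β μ v q r (fun N (X : ρ → Sp N) => D N (fun a => X (e a))) := by
  obtain ⟨C, hC, hb⟩ := hD
  refine ⟨C, hC, fun N hN => ?_⟩
  rw [nuSK_inj e he β μ v q (fun X => D N X ^ (2 * r))]
  exact hb N hN

lemma young {n : ℕ} {η : ℝ} (hη : 0 < η) (x y : ℝ) : x ^ (2 * n + 1) * y ≤ η * x ^ (2 * n + 2) + η⁻¹ ^ (2 * n + 1) * y ^ (2 * n + 2) := by
  have hx : 0 ≤ x ^ (2 * n + 2) := Even.pow_nonneg (by simp [parity_simps]) x
  have hy : 0 ≤ y ^ (2 * n + 2) := Even.pow_nonneg (by simp [parity_simps]) y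
  have ex : |x| ^ (2 * n + 2) = x ^ (2 * n + 2) := Even.pow_abs (by simp [parity_simps]) x
  have ey : |y| ^ (2 * n + 2) = y ^ (2 * n + 2) := Even.pow_abs (by simp [parity_simps]) y
  refine (le_abs_self _).trans ?_
  rw [abs_mul, abs_pow, ← ex, ← ey]
  rcases le_total |y| (η * |x|) with h | h
  · have : |x| ^ (2 * n + 1) * |y| ≤ |x| ^ (2 * n + 1) * (η * |x|) := mulL h (by positivity)
    have h2 : 0 ≤ η⁻¹ ^ (2 * n + 1) * |y| ^ (2 * n + 2) := by positivity
    calc _ ≤ _ := this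
      _ = η * |x| ^ (2 * n + 2) := by ring
      _ ≤ _ := by linarith
  · have h1 : |x| ≤ η⁻¹ * |y| := by rw [inv_mul_eq_div, le_div_iff₀ hη]; linarith
    have h2 : 0 ≤ η * |x| ^ (2 * n + 2) := by positivity
    calc _ ≤ (η⁻¹ * |y|) ^ (2 * n + 1) * |y| := mulR (pow_le_pow_left₀ (abs_nonneg _) h1 _) (abs_nonneg _)
      _ = η⁻¹ ^ (2 * n + 1) * |y| ^ (2 * n + 2) := by ring
      _ ≤ _ := by linarith

lemma nuSK_KS (hN : N ≠ 0) (β μ v q : ℝ) (u : ρ × Fin 3 → ρ × Fin 3 → (ρ × Fin 3 → Sp N) → ℝ) :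
    nuSK β μ v q (fun x => KS (fun c d => u c d x)) = KS (fun c d => nuSK β μ v q (u c d)) := by
  have i : Fin N := ⟨0, Nat.pos_of_ne_zero hN⟩
  have := KS_nu β μ v q i 1 u
  simpa only [nuS_one] using this

lemma KS_fact (hN : N ≠ 0) (β μ v q : ℝ) (W : (ρ × Fin 3 → Sp N) → ℝ) (k : ρ × Fin 3 → ρ × Fin 3 → ℝ) :
    β ^ 2 / 2 * KS (fun c d => k c d * nuSK β μ v q (fun X => W X * (R (X c) (X d) - q)))
      = nuSK β μ v q (fun X => W X * (β ^ 2 / 2 * KS (fun c d => k c d * (R (X c) (X d) - q)))) := by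
  simp only [← nuSK_smul]
  rw [← nuSK_KS hN, ← nuSK_smul]
  congr 1; ext X
  rw [mul_left_comm, KS_smul (W X)]
  congr 2; ext c d; ring

lemma mom (h : HYP β μ v q) [Nonempty ρ] {m : ℕ} (IH : ∃ C, 0 ≤ C ∧ ∀ N : ℕ, N ≠ 0 → MM N β μ v q (2 * m) ≤ C * dl N ^ (2 * m))
    {x : ρ → ρ → ℝ} (hx : ∀ a, x a a = 0) {c : ℝ} (hc : c < 1) {D : ∀ N : ℕ, (ρ × Fin 3 → Sp N) → ℝ} (hD : GD β μ v q (m + 1) D)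
    (hid : ∀ N (X : ρ × Fin 3 → Sp N), β ^ 2 / 2 * KS (fun c d => kap β μ v q x c d * (R (X c) (X d) - q)) = c * VV q x (fun a => X (a, 0)) + D N X) :
    GD β μ v q (m + 1) (fun N (X : ρ → Sp N) => VV q x X) := by
  obtain ⟨C1, hC1, b1⟩ := CE2 h x hx (fun _ : Fin (2 * m + 1) => x) (fun _ => hx)
  obtain ⟨C2, hC2, b2⟩ := IH
  obtain ⟨C3, hC3, b3⟩ := hD
  obtain ⟨K, hK, b4⟩ := B1' h ρ (2 * m)
  set η := (1 - c) / 2 with hη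
  have hη0 : 0 < η := by rw [hη]; linarith
  set k := |kap' β μ v q x x| with hk
  have hn := nx_nonneg x
  refine ⟨η⁻¹ * ((2 * m + 1) * (k * (nx x ^ (2 * m) * K * C2)) + η⁻¹ ^ (2 * m + 1) * C3 + C1), by positivity, fun N hN => ?_⟩
  have t1 := b1 hN
  simp only [prod_const, card_univ, Fintype.card_fin, card_erase_of_mem (mem_univ _), sum_const, nsmul_eq_mul] at t1
  rw [KS_fact hN] at t1
  simp only [hid, add_tsub_cancel_right, ← pow_succ'] at t1
  have e1 : nuSK β μ v q (fun X : ρ × Fin 3 → Sp N => VV q x (fun a => X (a, 0)) ^ (2 * m + 1) * (c * VV q x (fun a => X (a, 0)) + D N X))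
      = c * nuSK β μ v q (fun X : ρ → Sp N => VV q x X ^ (2 * m + 2)) + nuSK β μ v q (fun X : ρ × Fin 3 → Sp N => VV q x (fun a => X (a, 0)) ^ (2 * m + 1) * D N X) := by
    rw [← nuSK_inj (fun a : ρ => (a, (0:Fin 3))) (fun a b h => by simpa using h) β μ v q (fun X : ρ → Sp N => VV q x X ^ (2 * m + 2)), ← nuSK_smul, ← nuSK_add]
    congr 1; ext X; ring
  have e2 : nuSK β μ v q (fun X : ρ × Fin 3 → Sp N => VV q x (fun a => X (a, 0)) ^ (2 * m + 1) * D N X)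
      ≤ η * nuSK β μ v q (fun X : ρ → Sp N => VV q x X ^ (2 * m + 2)) + η⁻¹ ^ (2 * m + 1) * nuSK β μ v q (fun X : ρ × Fin 3 → Sp N => D N X ^ (2 * m + 2)) := by
    rw [← nuSK_inj (fun a : ρ => (a, (0:Fin 3))) (fun a b h => by simpa using h) β μ v q (fun X : ρ → Sp N => VV q x X ^ (2 * m + 2)), ← nuSK_smul, ← nuSK_smul, ← nuSK_add]
    exact nuSK_mono _ _ _ _ fun X => young hη0 _ _
  have e3 := b3 N hN
  have e4 : |nuSK β μ v q (fun X : ρ → Sp N => VV q x X ^ (2 * m))| ≤ nx x ^ (2 * m) * K * (C2 * dl N ^ (2 * m)) := by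
    refine (b4 hN _ (nx x ^ (2 * m)) (by positivity) fun X => ?_).trans (mulL (b2 N hN) (by positivity))
    rw [abs_pow, ← mul_pow]
    exact pow_le_pow_left₀ (abs_nonneg _) (abs_VV q hx X) _
  have e5 : 1 / (N:ℝ) * ((2 * m + 1 : ℕ) * (kap' β μ v q x x * nuSK β μ v q (fun X : ρ → Sp N => VV q x X ^ (2 * m))))
      ≤ ((2 * m + 1) * (k * (nx x ^ (2 * m) * K * C2))) * dl N ^ (2 * (m + 1)) := by
    refine (le_abs_self _).trans ?_
    rw [abs_mul, abs_mul, abs_mul, ← dl_sq, abs_of_nonneg (sq_nonneg (dl N)), Nat.abs_cast]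
    refine (mulL (mulL (mulL e4 (abs_nonneg _)) (by positivity)) (by positivity)).trans (le_of_eq ?_)
    push_cast; rw [← hk]; ring
  have hM := MM_nonneg N β μ v q (2 * (m + 1) + 1)
  have hd : 0 ≤ dl N ^ (2 * (m + 1)) := pow_nonneg (dl_nonneg N) _
  rw [e1] at t1
  have t2 := (abs_le.1 t1).2
  change nuSK β μ v q (fun X : ρ → Sp N => VV q x X ^ (2 * m + 2)) ≤ _
  change nuSK β μ v q (fun X : ρ × Fin 3 → Sp N => D N X ^ (2 * m + 2)) ≤ _ at e3
  change _ ≤ C1 * MM N β μ v q (2 * (m + 1) + 1) at t2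
  have e6 := mulL e3 (by positivity : 0 ≤ η⁻¹ ^ (2 * m + 1))
  have e7 : η * nuSK β μ v q (fun X : ρ → Sp N => VV q x X ^ (2 * m + 2)) ≤ ((2 * m + 1) * (k * (nx x ^ (2 * m) * K * C2)) + η⁻¹ ^ (2 * m + 1) * C3 + C1) * (dl N ^ (2 * (m + 1)) + MM N β μ v q (2 * (m + 1) + 1)) := by
    have p1 : 0 ≤ ((2 * m + 1) * (k * (nx x ^ (2 * m) * K * C2))) * MM N β μ v q (2 * (m + 1) + 1) := by positivity
    have p2 : 0 ≤ C1 * dl N ^ (2 * (m + 1)) := by positivity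
    generalize nuSK β μ v q (fun X : ρ → Sp N => VV q x X ^ (2 * m + 2)) = A at *
    have hη' : η * A = A - c * A - η * A := by rw [hη]; ring
    rw [hη', add_mul, add_mul, mul_add C1, mul_add (_ * (k * _)), mul_assoc (η⁻¹ ^ _) C3]
    linarith
  rw [mul_assoc, ← div_eq_inv_mul, le_div_iff₀ hη0, mul_comm]
  exact e7

end
end

section
section
variable {ρ : Type} [Fintype ρ] [DecidableEq ρ] {β μ v q : ℝ} {m : ℕ}

abbrev IHm (β μ v q : ℝ) (m : ℕ) : Prop := ∃ C, 0 ≤ C ∧ ∀ N : ℕ, N ≠ 0 → MM N β μ v q (2 * m) ≤ C * dl N ^ (2 * m)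

lemma st1 (h : HYP β μ v q) (IH : IHm β μ v q m) {a b c d : ρ} (hab : a ≠ b) (hac : a ≠ c) (had : a ≠ d) (hbc : b ≠ c) (hbd : b ≠ d) (hcd : c ≠ d) :
    GD β μ v q (m + 1) (fun N (X : ρ → Sp N) => R (X a) (X c) - R (X a) (X d) - R (X b) (X c) + R (X b) (X d)) := by
  have he : Function.Injective ![a, b, c, d] := by
    intro x y; fin_cases x <;> fin_cases y <;> simp [hab, hac, had, hbc, hbd, hcd, Ne.symm hab, Ne.symm hac, Ne.symm had, Ne.symm hbc, Ne.symm hbd, Ne.symm hcd]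
  have hfg : ∀ i : Fin 4, (![1, -1, 0, 0] : Fin 4 → ℝ) i * (![0, 0, 1, -1] : Fin 4 → ℝ) i = 0 := by intro i; fin_cases i <;> simp
  have h1 := mom h IH (x := fun i j : Fin 4 => (![1, -1, 0, 0] : Fin 4 → ℝ) i * (![0, 0, 1, -1] : Fin 4 → ℝ) j) hfg (al_lt h)
    (D := fun N X => 0) (GD_zero (Nat.succ_ne_zero m)) (fun N X => by
      rw [KS_pure h (by simp [Fin.sum_univ_four]) (by simp [Fin.sum_univ_four]) hfg (fun c d => R (X c) (X d) - q) (fun c d => by rw [R_comm]), VV]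
      ring)
  have h2 := GD_inj he h1
  convert h2 using 3 with N X
  simp [VV, Fin.sum_univ_four]
  ring

lemma st2 (h : HYP β μ v q) (IH : IHm β μ v q m) {a b c : ρ} (hab : a ≠ b) (hac : a ≠ c) (hbc : b ≠ c) :
    GD β μ v q (m + 1) (fun N (X : ρ → Sp N) => R (X a) (X c) - R (X b) (X c)) := by
  have he : Function.Injective ![a, b, c] := by
    intro x y; fin_cases x <;> fin_cases y <;> simp [hab, hac, hbc, Ne.symm hab, Ne.symm hac, Ne.symm hbc]
  have hfg : ∀ i : Fin 3, (![1, -1, 0] : Fin 3 → ℝ) i * (![0, 0, 1] : Fin 3 → ℝ) i = 0 := by intro i; fin_cases i <;> simp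
  have hD := GD_smul (-(β ^ 2 * (q - qh β μ v q))) (GD_sum (Nat.succ_ne_zero m) (univ : Finset (Fin 3))
    (D := fun j N (X : Fin 3 × Fin 3 → Sp N) => R (X (0, 0)) (X (j, 1)) - R (X (0, 0)) (X (2, 0)) - R (X (1, 0)) (X (j, 1)) + R (X (1, 0)) (X (2, 0)))
    (fun j _ => st1 h IH (by simp) (by simp) (by simp) (by simp) (by simp) (by simp)))
  have h1 := mom h IH (x := fun i j : Fin 3 => (![1, -1, 0] : Fin 3 → ℝ) i * (![0, 0, 1] : Fin 3 → ℝ) j) hfg (al_lt' h) hD (fun N X => by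
      simp only [KS, Fin.sum_univ_three]
      simp [kap_prod h hfg, Fin.sum_univ_three, lv, VV, ss, R_comm (X (2, 0))]
      ring)
  have h2 := GD_inj he h1
  convert h2 using 3 with N X
  simp [VV, Fin.sum_univ_three]

lemma st2' (h : HYP β μ v q) (IH : IHm β μ v q m) {a b c d : ρ} (hab : a ≠ b) (hcd : c ≠ d) :
    GD β μ v q (m + 1) (fun N (X : ρ → Sp N) => R (X a) (X b) - R (X c) (X d)) := by
  have key : ∀ {a b c : ρ}, a ≠ c → b ≠ c → GD β μ v q (m + 1) (fun N (X : ρ → Sp N) => R (X a) (X c) - R (X b) (X c)) := by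
    intro a b c hac hbc
    by_cases h1 : a = b
    · subst h1; simpa using GD_zero (Nat.succ_ne_zero m)
    · exact st2 h IH h1 hac hbc
  by_cases h1 : c = b
  · subst h1
    have := key (a := a) (b := d) (c := c) hab (Ne.symm hcd)
    simpa only [R_comm (_ : Sp _)] using this
  · have := GD_add (key (a := a) (b := c) (c := b) hab h1) (key (a := b) (b := d) (c := c) (Ne.symm h1) (Ne.symm hcd))
    convert this using 3 with N X
    rw [R_comm (X c) (X d), R_comm (X b) (X c)]; ring

lemma GD_KS (hr : m ≠ 0) {u : ρ × Fin 3 → ρ × Fin 3 → ∀ N : ℕ, (ρ × Fin 3 → Sp N) → ℝ} (hu : ∀ c d, c ≠ d → GD β μ v q m (u c d)) :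
    GD β μ v q m (fun N X => KS (fun c d => u c d N X)) := by
  refine GD_sum hr _ fun a _ => GD_sum hr _ fun b _ => ?_
  have h1 := GD_smul (-2) (hu (a, 0) (b, 1) (by simp))
  have h2 := GD_smul 2 (hu (a, 1) (b, 2) (by simp))
  by_cases hab : a = b
  · convert GD_add h1 h2 using 3 with N X
    rw [if_pos hab, if_pos hab]; ring
  · convert GD_add (GD_add (GD_add (hu (a, 0) (b, 0) (by simp [hab])) h1) (GD_smul (-1) (hu (a, 1) (b, 1) (by simp [hab])))) h2 using 3 with N X
    rw [if_neg hab, if_neg hab]; ring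

lemma st3 (h : HYP β μ v q) (IH : IHm β μ v q m) : GD β μ v q (m + 1) (fun N (X : Fin 2 → Sp N) => R (X 0) (X 1) - q) := by
  have hfg : ∀ i : Fin 2, (![1, 0] : Fin 2 → ℝ) i * (![0, 1] : Fin 2 → ℝ) i = 0 := by intro i; fin_cases i <;> simp
  have hD := GD_smul (β ^ 2 / 2) (GD_KS (Nat.succ_ne_zero m) (u := fun c d N (X : Fin 2 × Fin 3 → Sp N) =>
    kap β μ v q (fun i j : Fin 2 => (![1, 0] : Fin 2 → ℝ) i * (![0, 1] : Fin 2 → ℝ) j) c d * (R (X c) (X d) - R (X (0, 0)) (X (1, 0))))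
    (fun c d hcd => GD_smul _ (st2' h IH hcd (by simp))))
  have h1 := mom h IH (x := fun i j : Fin 2 => (![1, 0] : Fin 2 → ℝ) i * (![0, 1] : Fin 2 → ℝ) j) hfg (al_lt' h) hD (fun N X => by
      simp only [KS, Fin.sum_univ_two]
      simp [kap_prod h hfg, Fin.sum_univ_two, lv, VV, ss]
      ring)
  convert h1 using 3 with N X
  simp [VV, Fin.sum_univ_two]

lemma MM_step (h : HYP β μ v q) (IH : IHm β μ v q m) : IHm β μ v q (m + 1) := by
  obtain ⟨C, hC, hb⟩ := st3 h IH
  set r := m + 1 with hr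
  -- first bound
  set C1 : ℝ := 2 ^ (2 * r) * (C + 1) with hC1
  have hC1p : 0 < C1 := by positivity
  have b1 : ∀ N : ℕ, N ≠ 0 → MM N β μ v q (2 * r) ≤ C1 * (dl N ^ (2 * r) + MM N β μ v q (2 * r + 1)) := by
    intro N hN
    have hM := MM_nonneg N β μ v q (2 * r + 1)
    have p1 : MM N β μ v q (2 * r) ≤ 2 ^ (2 * r) * (nuSK β μ v q (fun X : Fin 2 → Sp N => (R (X 0) (X 1) - q) ^ (2 * r)) + dl N ^ (2 * r)) := by
      have : nuSK (N := N) β μ v q (fun X : Fin 2 → Sp N => dl N ^ (2 * r)) = dl N ^ (2 * r) := GS.nu_const _ _ _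
      rw [MM, ← this, ← nuSK_add, ← nuSK_smul]
      refine nuSK_mono _ _ _ _ fun X => ?_
      have := (even_two_mul r).add_pow_le (a := |R (X 0) (X 1) - q|) (b := dl N)
      rw [(even_two_mul r).pow_abs] at this
      refine this.trans (mulR (pow_le_pow_right₀ one_le_two (Nat.sub_le _ _)) ?_)
      exact add_nonneg ((even_two_mul r).pow_nonneg _) (pow_nonneg (dl_nonneg N) _)
    refine p1.trans ?_
    rw [hC1, mul_assoc]
    refine mulL ?_ (by positivity)
    have := hb N hN
    rw [add_mul, one_mul]
    linarith
  set ε : ℝ := (4 * C1)⁻¹ with hε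
  have hε0 : 0 < ε := by positivity
  obtain ⟨Ct, hCt, bt⟩ := overlap_tail h ε hε0 r
  have t3 : ∀ {N : ℕ} (hN : N ≠ 0) (X : Fin 2 → Sp N), |R (X 0) (X 1) - q| + dl N ≤ 3 := by
    intro N hN X
    have h1 := abs_le.1 (abs_R (X 0) (X 1))
    have h2 : |R (X 0) (X 1) - q| ≤ 2 := abs_le.2 ⟨by linarith [h.hq1], by linarith [h.hq0]⟩
    linarith [dl_le_one hN]
  have t0 : ∀ {N : ℕ} (X : Fin 2 → Sp N), 0 ≤ |R (X 0) (X 1) - q| + dl N := fun X => add_nonneg (abs_nonneg _) (dl_nonneg _)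
  refine ⟨2 * C1 * (1 + 3 ^ (2 * r + 1) * Ct) + 3 ^ (2 * r) * (ε⁻¹) ^ (2 * r), by positivity, fun N hN => ?_⟩
  have hd := dl_nonneg N
  have hdp : 0 ≤ dl N ^ (2 * r) := pow_nonneg hd _
  rcases le_total (dl N) ε with hs | hs
  · have p2 : MM N β μ v q (2 * r + 1) ≤ (ε + dl N) * MM N β μ v q (2 * r) + 3 ^ (2 * r + 1) * (Ct * dl N ^ (2 * r)) := by
      have bt' : nuSK β μ v q (fun x : Fin 2 → Sp N => if ε ≤ |R (x 0) (x 1) - q| then (1:ℝ) else 0) ≤ Ct * dl N ^ (2 * r) := by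
        have := bt N hN
        rw [pow_mul, dl_sq, one_div, inv_pow, ← div_eq_mul_inv, le_div_iff₀ (by positivity), mul_comm]
        exact this
      refine le_trans ?_ (add_le_add le_rfl (mulL bt' (by positivity)))
      rw [MM, MM, ← nuSK_smul, ← nuSK_smul, ← nuSK_add]
      refine nuSK_mono _ _ _ _ fun X => ?_
      have h0 := t0 X
      by_cases hc : ε ≤ |R (X 0) (X 1) - q|
      · rw [if_pos hc, mul_one]
        have := pow_le_pow_left₀ h0 (t3 hN X) (2 * r + 1)
        have h3 : 0 ≤ (ε + dl N) * (|R (X 0) (X 1) - q| + dl N) ^ (2 * r) := by positivity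
        linarith
      · rw [if_neg hc, mul_zero, add_zero, pow_succ']
        refine mulR ?_ (by positivity)
        linarith [not_le.1 hc]
    have p3 := b1 N hN
    have hM := MM_nonneg N β μ v q (2 * r)
    have p4 : C1 * ((ε + dl N) * MM N β μ v q (2 * r)) ≤ MM N β μ v q (2 * r) / 2 := by
      have : C1 * (ε + dl N) ≤ 1 / 2 := by
        calc C1 * (ε + dl N) ≤ C1 * (ε + ε) := mulL (by linarith) hC1p.le
          _ = 1 / 2 := by rw [hε]; field_simp; norm_num
      rw [← mul_assoc]
      linarith [mulR this hM]
    have p5 := mulL p2 hC1p.le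
    have p6 : 0 ≤ 3 ^ (2 * r) * (ε⁻¹) ^ (2 * r) * dl N ^ (2 * r) := by positivity
    rw [mul_add C1] at p5 p3
    rw [add_mul, mul_add (2 * C1), mul_one, add_mul (2 * C1)]
    rw [show 2 * C1 * (3 ^ (2 * r + 1) * Ct) * dl N ^ (2 * r) = 2 * (C1 * (3 ^ (2 * r + 1) * (Ct * dl N ^ (2 * r)))) by ring, mul_assoc 2 C1]
    linarith
  · have p1 : MM N β μ v q (2 * r) ≤ 3 ^ (2 * r) := by
      have : nuSK (N := N) β μ v q (fun X : Fin 2 → Sp N => (3:ℝ) ^ (2 * r)) = 3 ^ (2 * r) := GS.nu_const _ _ _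
      rw [MM, ← this]
      exact nuSK_mono _ _ _ _ fun X => pow_le_pow_left₀ (t0 X) (t3 hN X) _
    have p2 : 1 ≤ (ε⁻¹) ^ (2 * r) * dl N ^ (2 * r) := by
      rw [← mul_pow]
      refine one_le_pow₀ ?_
      rw [inv_mul_eq_div, le_div_iff₀ hε0]; linarith
    have p3 := mulL p2 (by positivity : (0:ℝ) ≤ 3 ^ (2 * r))
    have p4 : 0 ≤ 2 * C1 * (1 + 3 ^ (2 * r + 1) * Ct) * dl N ^ (2 * r) := by positivity
    rw [add_mul, mul_assoc (3 ^ (2 * r))]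
    linarith

lemma MM_even (h : HYP β μ v q) (m : ℕ) : IHm β μ v q m := by
  induction m with
  | zero =>
    refine ⟨1, zero_le_one, fun N hN => ?_⟩
    simp only [mul_zero, MM, pow_zero, mul_one]
    exact (GS.nu_const _ _ _).le
  | succ m ih => exact MM_step h ih

lemma MMb (h : HYP β μ v q) (j : ℕ) : ∃ C, 0 ≤ C ∧ ∀ N : ℕ, N ≠ 0 → MM N β μ v q j ≤ C * dl N ^ j := by
  obtain ⟨m, rfl | rfl⟩ := Nat.even_or_odd' j
  · exact MM_even h m
  obtain ⟨C, hC, hb⟩ := MM_even h m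
  obtain ⟨C', hC', hb'⟩ := MM_even h (m + 1)
  refine ⟨(C + C') / 2, by positivity, fun N hN => ?_⟩
  have hd : 0 < dl N := by unfold dl; positivity
  have h1 : 2 * dl N * MM N β μ v q (2 * m + 1) ≤ dl N ^ 2 * MM N β μ v q (2 * m) + MM N β μ v q (2 * (m + 1)) := by
    rw [MM, MM, MM, ← nuSK_smul, ← nuSK_smul, ← nuSK_add]
    refine nuSK_mono _ _ _ _ fun X => ?_
    have h0 : 0 ≤ (|R (X 0) (X 1) - q| + dl N) := add_nonneg (abs_nonneg _) hd.le
    generalize |R (X 0) (X 1) - q| + dl N = T at h0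
    have : 0 ≤ T ^ (2 * m) * (T - dl N) ^ 2 := by positivity
    rw [show T ^ (2 * m + 1) = T ^ (2 * m) * T by ring, show T ^ (2 * (m + 1)) = T ^ (2 * m) * T ^ 2 by ring]
    linarith [show T ^ (2 * m) * (T - dl N) ^ 2 = dl N ^ 2 * T ^ (2 * m) + T ^ (2 * m) * T ^ 2 - 2 * dl N * (T ^ (2 * m) * T) by ring]
  have h2 := mulL (hb N hN) (by positivity : 0 ≤ dl N ^ 2)
  have h3 := hb' N hN
  refine le_of_mul_le_mul_left ?_ (by positivity : 0 < 2 * dl N)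
  calc _ ≤ _ := h1
    _ ≤ dl N ^ 2 * (C * dl N ^ (2 * m)) + C' * dl N ^ (2 * (m + 1)) := add_le_add h2 h3
    _ = _ := by ring

end
end

section
section
variable {K S : Type} [Fintype K] [Fintype S] [Nonempty S] {ρ : Type} [Fintype ρ] [DecidableEq ρ]

lemma av_ind7 (H : GS K S) (θ : K → ℝ) (a : ρ) (f : (ρ → S) → ℝ) (g : S → ℝ) (hf : ∀ X s, f (update X a s) = f X) :
    (H.rep ρ).av θ (fun X => f X * g (X a)) = (H.rep ρ).av θ f * H.av θ g := by
  have h1 := H.prod_av θ (fun i : Fin 2 => ![f, fun X : ρ → S => g (X a)] i)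
  have h0 : (H.rep ρ).av θ (fun X => g (X a)) = H.av θ g := by
    refine (H.av_inj (fun _ : Fin 1 => a) (Function.injective_of_subsingleton _) θ (fun X => g (X 0))).trans ?_
    simp only [GS.av, GS.rep_p, univ_unique, Finset.prod_singleton]
    exact sum_equiv (Equiv.funUnique (Fin 1) S) _ _ fun X => rfl
  rw [Fin.prod_univ_two] at h1
  simp only [Matrix.cons_val_zero, Matrix.cons_val_one, Fin.prod_univ_two] at h1
  rw [h0] at h1
  rw [h1, ← H.av_inj (fun b : ρ => if b = a then (b, (1 : Fin 2)) else (b, 0)) (fun b c hbc => ?_)]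
  · congr 1; ext X
    simp only [if_pos]
    congr 1
    refine (congrArg f (funext fun b => ?_)).trans (hf (fun b => X (b, 0)) (X (a, 1)))
    by_cases hb : b = a
    · subst hb; simp
    · simp [hb]
  · by_cases hb : b = a <;> by_cases hc : c = a <;> simp_all
end

def dd : ℕ → ℕ → ℝ
  | 0, a => if a = 0 then 1 / 2 else if a = 1 then -1 / 2 else 0
  | r + 1, a => if a < r + 1 then 1 else if a = r + 1 then -((r + 1 : ℕ) : ℝ) else 0

lemma dd_zero {r a : ℕ} (h : r < a) (h2 : 2 ≤ a) : dd r a = 0 := by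
  cases r with
  | zero => simp only [dd]; rw [if_neg (by omega), if_neg (by omega)]
  | succ r => simp only [dd]; rw [if_neg (by omega), if_neg (by omega)]
lemma dd_one {r a : ℕ} (h : a < r) : dd r a = 1 := by
  cases r with
  | zero => omega
  | succ r => simp only [dd]; rw [if_pos (by omega)]
lemma dd_sum {M r : ℕ} (h : r < M) (hM : 2 ≤ M) : ∑ a : Fin M, dd r a = 0 := by
  rw [Fin.sum_univ_eq_sum_range (dd r) M]
  have h1 : ∀ m, max 1 r + 1 ≤ m → ∑ a ∈ Finset.range m, dd r a = 0 := by
    intro m hm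
    induction m, hm using Nat.le_induction with
    | base =>
      cases r with
      | zero => simp [sum_range_succ, dd]; norm_num
      | succ r =>
        rw [sum_range_succ, max_eq_right (by omega), sum_congr rfl (fun a ha => dd_one (Finset.mem_range.1 ha))]
        simp [dd]
    | succ m hm ih => rw [sum_range_succ, ih, dd_zero (by omega) (by omega), add_zero]
  exact h1 M (by omega)
/-- orthogonality of the replica directions -/
lemma dd_orth {M r s : ℕ} (h : r < s) (h2 : 2 ≤ s) (hs : s < M) : ∑ a : Fin M, dd r a * dd s a = 0 := by
  rw [← dd_sum (show r < M by omega) (by omega)]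
  refine sum_congr rfl fun a _ => ?_
  by_cases ha : (a:ℕ) < s
  · rw [dd_one ha, mul_one]
  · rw [dd_zero (r := r) (by omega) (by omega), zero_mul]

variable {N M : ℕ}
def Dr (r : ℕ) (X : Fin M → Sp N) (i : Fin N) : ℝ := ∑ a : Fin M, dd r a * sp (X a i)
def cum (o : ℕ) : List (Fin N) → (Fin M → Sp N) → ℝ
  | [], _ => 1
  | i :: l, X => Dr (o + l.length) X i * cum o l X

lemma Dr_upd {r : ℕ} {X : Fin M → Sp N} {a : Fin M} {s : Sp N} (i : Fin N) (h : dd r a = 0) : Dr r (update X a s) i = Dr r X i := by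
  refine sum_congr rfl fun b _ => ?_
  by_cases hb : b = a
  · subst hb; rw [h, zero_mul, zero_mul]
  · rw [update_of_ne hb]
lemma cum_upd (o : ℕ) (l : List (Fin N)) {X : Fin M → Sp N} {a : Fin M} {s : Sp N} (h : o + l.length ≤ a) (h2 : 2 ≤ (a:ℕ)) :
    cum o l (update X a s) = cum o l X := by
  induction l with
  | nil => rfl
  | cons i l ih =>
    rw [List.length_cons] at h
    rw [cum, cum, ih (by omega), Dr_upd i (dd_zero (by omega) h2)]

lemma dstep (r : ℕ) (hr : r + 1 < M) (f : (Fin M → Sp N) → ℝ) (hf : ∀ X (a : Fin M) s, r + 1 ≤ (a:ℕ) → f (update X a s) = f X)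
    (θ : PI' N ⊕ Fin N → ℝ) (i : Fin N) :
    HasDerivAt (fun t => ((SKs N 0).rep (Fin M)).av (update θ (inr i) t) f)
      (((SKs N 0).rep (Fin M)).av θ (fun X => Dr (r + 1) X i * f X)) (θ (inr i)) := by
  refine (GS.hasDerivAt_av_update _ f (inr i) θ).congr_deriv ?_
  set H := (SKs N 0).rep (Fin M)
  set m := (SKs N 0).av θ (fun σ => sp (σ i))
  have hA : H.A (inr i) = fun X => ∑ a, sp (X a i) := rfl
  have e1 : ∀ a, H.av θ (fun X => sp (X a i)) = m := fun a => by
    have := av_ind7 (SKs N 0) θ a (fun _ => 1) (fun σ => sp (σ i)) (fun _ _ => rfl)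
    rw [GS.av_const, one_mul] at this
    simpa only [one_mul] using this
  have e2 : ∀ a : Fin M, (1 - dd (r + 1) a) * H.av θ (fun X => f X * sp (X a i)) = (1 - dd (r + 1) a) * (H.av θ f * m) := fun a => by
    by_cases ha : (a:ℕ) < r + 1
    · rw [dd_one ha, sub_self, zero_mul, zero_mul]
    · rw [av_ind7 (SKs N 0) θ a f (fun σ => sp (σ i)) (fun X s => hf X a s (by omega))]
  have e3 := sum_congr rfl fun a (_ : a ∈ univ) => e2 a
  rw [← sum_mul, sum_sub_distrib, dd_sum hr (by omega)] at e3
  simp only [sub_mul, one_mul, sum_sub_distrib] at e3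
  rw [GS.d1, hA]
  have e4 : (fun X : Fin M → Sp N => f X * ∑ a, sp (X a i)) = fun X => ∑ a, f X * sp (X a i) := by ext X; rw [mul_sum]
  have e5 : (fun X : Fin M → Sp N => Dr (r + 1) X i * f X) = fun X => ∑ a : Fin M, dd (r + 1) a * (f X * sp (X a i)) := by
    ext X; rw [Dr, sum_mul]; exact sum_congr rfl fun a _ => by ring
  rw [e4, e5, GS.av_sum, GS.av_sum, GS.av_sum, sum_congr rfl fun a _ => e1 a]
  simp only [GS.av_smul, sum_const, nsmul_eq_mul] at e3 ⊢
  linarith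

lemma cum_two (l : List (Fin N)) (hl : 2 + l.length ≤ M) (θ : PI' N ⊕ Fin N → ℝ) :
    ((SKs N 0).rep (Fin M)).av θ (cum 2 l) = if l = [] then 1 else 0 := by
  induction l generalizing θ with
  | nil => exact GS.av_const _ _ _
  | cons i l ih =>
    rw [List.length_cons] at hl
    have h1 := dstep (1 + l.length) (by omega) (cum (M := M) 2 l) (fun X a s ha => cum_upd 2 l (by omega) (by omega)) θ i
    simp only [ih (by omega)] at h1
    have h2 := h1.unique (hasDerivAt_const _ _)
    rw [show 1 + l.length + 1 = 2 + l.length by omega] at h2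
    rw [if_neg (by simp)]
    exact h2

def th (β : ℝ) (g : Fin N → Fin N → ℝ) (hv : Fin N → ℝ) : PI' N ⊕ Fin N → ℝ := Sum.elim (fun p => β * g p.1.1 p.1.2) hv

lemma part_eq (β : ℝ) (g : Fin N → Fin N → ℝ) (hv : Fin N → ℝ) : partitionZ N β g hv = (SKs N 0).Z (th β g hv) := by
  refine sum_congr rfl fun σ _ => ?_
  simp only [hamiltonian, GS.ew, SKs, th, sum_sum_type, elim_inl, elim_inr, zero_mul, sum_const_zero, zero_add]
  congr 2
  rw [← sum_prod_type' (f := fun i j => if i < j then g i j * spin (σ i) * spin (σ j) else 0), ← sum_filter, mul_sum]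
  refine (sum_subtype _ (by simp) _).trans (sum_congr rfl fun p _ => ?_)
  rw [mul_assoc, mul_assoc]
  rfl

lemma pd_eq (β : ℝ) (g : Fin N → Fin N → ℝ) (hv : Fin N → ℝ) (i : Fin N) (F : (PI' N ⊕ Fin N → ℝ) → ℝ) {F' : ℝ}
    (h : HasDerivAt (fun t => F (update (th β g hv) (inr i) t)) F' (hv i)) :
    partialD N i (fun hv => F (th β g hv)) hv = F' := by
  simp only [partialD]
  rw [← h.deriv]
  congr 1; ext t
  simp only [th, Sum.update_elim_inr]

lemma it_eq (β : ℝ) (g : Fin N → Fin N → ℝ) (l : List (Fin N)) (h2 : 2 ≤ l.length) (hl : l.length ≤ M) :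
    iterPartialD N l (fun hv' => Real.log (partitionZ N β g hv')) = fun hv => ((SKs N 0).rep (Fin M)).av (th β g hv) (cum 0 l) := by
  induction l with
  | nil => simp at h2
  | cons i l ih =>
    rw [List.length_cons] at h2 hl
    rw [iterPartialD]
    obtain ⟨j, rfl⟩ | hl2 : (∃ j, l = [j]) ∨ 2 ≤ l.length := by
      rcases l with _ | ⟨j, _ | ⟨j', l⟩⟩
      · simp at h2
      · exact Or.inl ⟨j, rfl⟩
      · exact Or.inr (by simp)
    · simp only [List.length_singleton] at hl
      let a0 : Fin M := ⟨0, by omega⟩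
      let a1 : Fin M := ⟨1, by omega⟩
      have hne : a0 ≠ a1 := by simp [a0, a1]
      have b1 : iterPartialD N [j] (fun hv' => Real.log (partitionZ N β g hv')) = fun hv => ((SKs N 0).rep (Fin M)).av (th β g hv) (fun X => sp (X a0 j)) := by
        ext hv
        simp only [iterPartialD, part_eq]
        refine pd_eq β g hv j (fun θ => log ((SKs N 0).Z θ)) ((hasDerivAt_update_of_dif ((SKs N 0).hasFDerivAt_logZ) (inr j) (th β g hv)).congr_deriv ?_)
        have := av_ind7 (SKs N 0) (th β g hv) a0 (fun _ => 1) (fun σ => sp (σ j)) (fun _ _ => rfl)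
        rw [GS.av_const, one_mul] at this
        simp only [one_mul] at this
        exact this.symm
      have dv : ∀ (X : Fin M → Sp N) i, Dr 1 X i = sp (X a0 i) - sp (X a1 i) := by
        intro X i
        rw [Dr, ← sum_subset (subset_univ {a0, a1}), sum_pair hne]
        · simp [dd, a0, a1]; ring
        · intro a _ ha
          simp only [mem_insert, mem_singleton, not_or, a0, a1, Fin.ext_iff] at ha
          rw [dd_zero (by omega) (by omega), zero_mul]
      have dv0 : ∀ (X : Fin M → Sp N) i, Dr 0 X i = 1 / 2 * (sp (X a0 i) - sp (X a1 i)) := by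
        intro X i
        rw [Dr, ← sum_subset (subset_univ {a0, a1}), sum_pair hne]
        · simp [dd, a0, a1]; ring
        · intro a _ ha
          simp only [mem_insert, mem_singleton, not_or, a0, a1, Fin.ext_iff] at ha
          rw [dd_zero (by omega) (by omega), zero_mul]
      rw [b1]
      ext hv
      rw [pd_eq β g hv i (fun θ => ((SKs N 0).rep (Fin M)).av θ (fun X => sp (X a0 j))) (dstep 0 (by omega) (fun X => sp (X a0 j))
        (fun X a s ha => by
          have : a0 ≠ a := by intro h; rw [← h] at ha; simp [a0] at ha
          rw [update_of_ne this]) _ i)]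
      have sw := (SKs N 0).av_reindex (Equiv.swap a0 a1) (th β g hv) (fun X : Fin M → Sp N => Dr 1 X i * sp (X a0 j))
      have e : (fun X : Fin M → Sp N => cum 0 [i, j] X) = fun X => 1 / 2 * (Dr 1 X i * sp (X a0 j)) + 1 / 2 * (Dr 1 (fun a => X (Equiv.swap a0 a1 a)) i * sp (X (Equiv.swap a0 a1 a0) j)) := by
        ext X
        simp only [cum, List.length_singleton, List.length_nil, zero_add, dv0, dv, Equiv.swap_apply_left, Equiv.swap_apply_right]
        ring
      refine Eq.trans ?_ (congrArg (((SKs N 0).rep (Fin M)).av (th β g hv)) e).symm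
      rw [GS.av_add, GS.av_smul, GS.av_smul, sw]
      simp only [zero_add]
      ring
    · rw [ih hl2 (by omega)]
      ext hv
      obtain ⟨r, hr⟩ : ∃ r, l.length = r + 1 := ⟨l.length - 1, by omega⟩
      rw [pd_eq β g hv i (fun θ => ((SKs N 0).rep (Fin M)).av θ (cum 0 l)) (dstep r (by omega) (cum 0 l)
        (fun X a s ha => cum_upd 0 l (by omega) (by omega)) _ i)]
      congr 1; ext X
      rw [cum, zero_add, hr]
end

section
variable {N M : ℕ}

def Ev (M r : ℕ) (c : Fin 2) (a : Fin M × Fin 2) : ℝ := if a.2 = c then dd r a.1 else 0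
def slot {ρ : Type} [DecidableEq ρ] (f g : ρ → ℝ) (a b : ρ) : ℝ := if a = b then 0 else f a * g b

lemma Ev_sum' (r : ℕ) (c : Fin 2) (f : Fin M × Fin 2 → ℝ) : ∑ a, Ev M r c a * f a = ∑ a : Fin M, dd r a * f (a, c) := by
  rw [sum_prod_type]
  refine sum_congr rfl fun a _ => ?_
  simp [Ev]
lemma Ev_sum {r : ℕ} (h : r < M) (hM : 2 ≤ M) (c : Fin 2) : ∑ a, Ev M r c a = 0 := by
  have := Ev_sum' (M := M) r c (fun _ => 1)
  simp only [mul_one] at this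
  rw [this, dd_sum h hM]
lemma Ev_ne (r s : ℕ) {c d : Fin 2} (h : c ≠ d) (a : Fin M × Fin 2) : Ev M r c a * Ev M s d a = 0 := by
  simp only [Ev]
  split_ifs with h1 h2
  · exact absurd (h1.symm.trans h2) h
  all_goals simp
lemma Ev_orth {r s : ℕ} (h : r < s) (h2 : 2 ≤ s) (hs : s < M) (c d : Fin 2) : ∑ a, Ev M r c a * Ev M s d a = 0 := by
  by_cases hcd : c = d
  · subst hcd
    rw [Ev_sum', ← dd_orth h h2 hs]
    simp [Ev]
  · simp [Ev_ne r s hcd]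

lemma VV_slot (hN : N ≠ 0) (q : ℝ) {f g : ρ → ℝ} (hf : ∑ a, f a = 0) (hfg : ∑ a, f a * g a = 0) (X : ρ → Sp N) :
    VV q (slot f g) X = (N:ℝ)⁻¹ * ∑ i, (∑ a, f a * sp (X a i)) * ∑ b, g b * sp (X b i) := by
  have e1 : VV q (slot f g) X = ∑ a, ∑ b, f a * g b * (R (X a) (X b) - q) := by
    have : ∀ a b, slot f g a b * (R (X a) (X b) - q) = f a * g b * (R (X a) (X b) - q) - if a = b then f a * g a * (1 - q) else 0 := by
      intro a b
      by_cases h : a = b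
      · subst h; rw [slot, if_pos rfl, if_pos rfl, R_self hN]; ring
      · rw [slot, if_neg h, if_neg h, sub_zero]
    simp only [VV, this, sum_sub_distrib]
    rw [sub_eq_self]
    simp [← sum_mul, hfg]
  rw [e1]
  simp only [mul_sub, sum_sub_distrib]
  have e2 : ∑ a, ∑ b, f a * g b * q = 0 := by
    simp only [← sum_mul, ← mul_sum, hf, zero_mul]
  rw [e2, sub_zero]
  have e3 : ∀ a b, f a * g b * R (X a) (X b) = ∑ i, (N:ℝ)⁻¹ * (f a * sp (X a i) * (g b * sp (X b i))) := by
    intro a b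
    rw [R, div_eq_inv_mul, mul_sum, mul_sum]
    exact sum_congr rfl fun i _ => by ring
  simp only [e3, sum_mul_sum]
  simp only [mul_sum]
  rw [sum_comm (s := (univ : Finset (Fin N)))]
  exact sum_congr rfl fun a _ => sum_comm

/-- the list of field indices -/
def Li {k p : ℕ} (it : Fin k → Fin N) (j : Fin p → Fin N) : List (Fin N) := ((List.ofFn it).flatMap fun a => [a, a]) ++ List.ofFn j

lemma Li_length {k p : ℕ} (it : Fin k → Fin N) (j : Fin p → Fin N) : (Li it j).length = 2 * k + p := by
  induction k with
  | zero => simp [Li]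
  | succ k ih =>
    have := ih fun s => it s.succ
    simp only [Li, List.ofFn_succ, List.flatMap_cons, List.length_append, List.length_cons, List.length_nil] at this ⊢
    omega

lemma cum_ofFn (o p : ℕ) (j : Fin p → Fin N) (X : Fin M → Sp N) : cum o (List.ofFn j) X = ∏ r : Fin p, Dr (o + (p - 1 - r)) X (j r) := by
  induction p with
  | zero => simp [cum]
  | succ p ih =>
    rw [List.ofFn_succ, cum, ih, Fin.prod_univ_succ, List.length_ofFn]
    congr 1
    refine prod_congr rfl fun r _ => ?_
    rw [Fin.val_succ, show p + 1 - 1 - (r + 1) = p - 1 - (r:ℕ) by omega]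

lemma cum_Li (o p k : ℕ) (it : Fin k → Fin N) (j : Fin p → Fin N) (X : Fin M → Sp N) :
    cum o (Li it j) X = (∏ s : Fin k, Dr (o + p + 2 * (k - 1 - s)) X (it s) * Dr (o + p + 2 * (k - 1 - s) + 1) X (it s)) * cum o (List.ofFn j) X := by
  induction k with
  | zero => simp [Li]
  | succ k ih =>
    have e : Li it j = it 0 :: it 0 :: Li (fun s => it s.succ) j := by simp [Li, List.ofFn_succ]
    rw [e, cum, cum, ih, Fin.prod_univ_succ, List.length_cons, Li_length]
    simp only [Fin.val_succ, Fin.val_zero]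
    have e2 : ∀ r : ℕ, k + 1 - 1 - (r + 1) = k - 1 - r := fun r => by omega
    simp only [e2]
    rw [show o + p + 2 * (k + 1 - 1 - 0) = o + (2 * k + p) by omega, show o + (2 * k + p + 1) = o + (2 * k + p) + 1 by omega]
    ring

lemma rev_prod (p : ℕ) (f : ℕ → ℝ) : ∏ r : Fin p, f (p - 1 - r) = ∏ r : Fin p, f r := by
  rw [← prod_range fun r => f (p - 1 - r), Finset.prod_range_reflect, prod_range]

def cross (M r : ℕ) : Fin M × Fin 2 → Fin M × Fin 2 → ℝ := slot (Ev M r 0) (Ev M r 1)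
def pair (M r : ℕ) (c : Fin 2) : Fin M × Fin 2 → Fin M × Fin 2 → ℝ := slot (Ev M r c) (Ev M (r + 1) c)

lemma tr1 (hN : N ≠ 0) (q : ℝ) {o p k : ℕ} (hM : 2 ≤ M) (hM' : o + p + 2 * k ≤ M) (hp : 1 ≤ o + p) (X : Fin M × Fin 2 → Sp N) :
    ((N:ℝ) ^ p)⁻¹ * ∑ j : Fin p → Fin N, ∏ c : Fin 2, (((N:ℝ) ^ k)⁻¹ * ∑ it : Fin k → Fin N, cum o (Li it j) (fun a => X (a, c)))
      = (∏ r : Fin p, VV q (cross M (o + r)) X) * ∏ z : Fin k × Fin 2, VV q (pair M (o + p + 2 * z.1) z.2) X := by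
  have hD : ∀ r c i, Dr r (fun a => X (a, c)) i = ∑ a, Ev M r c a * sp (X a i) := fun r c i => (Ev_sum' r c fun a => sp (X a i)).symm
  have h1 : ∀ (j : Fin p → Fin N) (c : Fin 2), ((N:ℝ) ^ k)⁻¹ * ∑ it : Fin k → Fin N, cum o (Li it j) (fun a => X (a, c))
      = (∏ s : Fin k, VV q (pair M (o + p + 2 * s) c) X) * ∏ r : Fin p, Dr (o + (p - 1 - r)) (fun a => X (a, c)) (j r) := by
    intro j c
    simp only [cum_Li, cum_ofFn]
    rw [← sum_mul, GS.sum_prod_eq (fun (s : Fin k) i => Dr (o + p + 2 * (k - 1 - s)) (fun a => X (a, c)) i * Dr (o + p + 2 * (k - 1 - s) + 1) (fun a => X (a, c)) i),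
      ← mul_assoc, ← rev_prod k fun s => VV q (pair M (o + p + 2 * s) c) X]
    congr 1
    rw [← inv_pow, ← Fin.prod_const, ← prod_mul_distrib]
    refine prod_congr rfl fun s _ => ?_
    have := s.2
    rw [pair, VV_slot hN q (Ev_sum (by omega) hM c) (Ev_orth (by omega) (by omega) (by omega) c c)]
    simp only [hD]
  simp only [h1]
  simp only [prod_mul_distrib, ← mul_sum]
  rw [Finset.prod_comm (s := (univ : Finset (Fin 2)))]
  rw [Fintype.prod_prod_type]
  have h2 : ∀ j : Fin p → Fin N, ∏ c : Fin 2, ∏ r : Fin p, Dr (o + (p - 1 - r)) (fun a => X (a, c)) (j r) = ∏ r : Fin p, ∏ c : Fin 2, Dr (o + (p - 1 - r)) (fun a => X (a, c)) (j r) :=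
    fun j => Finset.prod_comm
  simp only [h2]
  rw [GS.sum_prod_eq (fun (r : Fin p) i => ∏ c : Fin 2, Dr (o + (p - 1 - r)) (fun a => X (a, c)) i), mul_left_comm, mul_comm]
  congr 1
  rw [← rev_prod p fun s => VV q (cross M (o + s)) X, ← inv_pow, ← Fin.prod_const, ← prod_mul_distrib]
  refine prod_congr rfl fun s _ => ?_
  have := s.2
  rw [cross, VV_slot hN q (Ev_sum (by omega) hM 0) (by simp [Ev_ne _ _ (show (0:Fin 2) ≠ 1 by decide)])]
  simp only [hD, Fin.prod_univ_two]
end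

section
variable {N M : ℕ}

def shf (μ : ℝ) (θ : PI' N ⊕ Fin N → ℝ) (k : PI' N ⊕ Fin N) : ℝ := Sum.elim (fun _ => 0) (fun _ => μ) k + θ k

lemma av_shf (μ : ℝ) (θ : PI' N ⊕ Fin N → ℝ) (f : (ρ → Sp N) → ℝ) :
    ((SKs N μ).rep ρ).av θ f = ((SKs N 0).rep ρ).av (shf μ θ) f := by
  have h1 : (SKs N μ).ew θ = (SKs N 0).ew (shf μ θ) := by
    ext σ
    simp only [GS.ew, SKs, shf, sum_sum_type, elim_inl, elim_inr, add_mul, zero_mul, zero_add, sum_add_distrib, sum_const_zero]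
  have h2 : (SKs N μ).p θ = (SKs N 0).p (shf μ θ) := by
    ext σ; simp only [GS.p, GS.Z, h1]
  simp only [GS.av, GS.rep_p, h2]

lemma tr2 (hN : N ≠ 0) (β μ v q : ℝ) {o p k : ℕ} (hM : 2 ≤ M) (hM' : o + p + 2 * k ≤ M) (hp : 1 ≤ o + p) :
    nuSK β μ v q (fun X : Fin M × Fin 2 → Sp N => (∏ r : Fin p, VV q (cross M (o + r)) X) * ∏ z : Fin k × Fin 2, VV q (pair M (o + p + 2 * z.1) z.2) X)
      = ((N:ℝ) ^ p)⁻¹ * ∑ j : Fin p → Fin N, ∫ w, (((N:ℝ) ^ k)⁻¹ * ∑ it : Fin k → Fin N,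
          ((SKs N 0).rep (Fin M)).av (shf μ fun i => √(va β v q 1 i) * w i) (cum o (Li it j))) ^ 2 ∂(gam (PI' N ⊕ Fin N)) := by
  simp only [← tr1 hN q hM hM' hp]
  rw [nuSK_smul, nuSK_sum]
  congr 1
  refine sum_congr rfl fun j _ => ?_
  rw [nuSK, GS.nu]
  congr 1; ext w
  rw [av_shf]
  have := (SKs N 0).prod_av (ρ := Fin M) (ι := Fin 2) (shf μ fun i => √(va β v q 1 i) * w i) (fun _ X => ((N:ℝ) ^ k)⁻¹ * ∑ it : Fin k → Fin N, cum o (Li it j) X)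
  rw [← this, Fin.prod_const, GS.av_smul, GS.av_sum]

lemma tr_zero (hN : N ≠ 0) (β μ v q : ℝ) {p k : ℕ} (hM : 2 + p + 2 * k ≤ M) (hp : 1 ≤ p + 2 * k) :
    nuSK β μ v q (fun X : Fin M × Fin 2 → Sp N => (∏ r : Fin p, VV q (cross M (2 + r)) X) * ∏ z : Fin k × Fin 2, VV q (pair M (2 + p + 2 * z.1) z.2) X) = 0 := by
  rw [tr2 hN β μ v q (by omega) hM (by omega)]
  have : ∀ (it : Fin k → Fin N) (j : Fin p → Fin N) θ, ((SKs N 0).rep (Fin M)).av θ (cum 2 (Li it j)) = 0 := by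
    intro it j θ
    have hl := Li_length it j
    rw [cum_two _ (by omega), if_neg]
    intro h0; rw [h0] at hl; simp at hl; omega
  simp [this]

lemma kap'_eq (h : HYP β μ v q) {ρ : Type} [Fintype ρ] [DecidableEq ρ] {f g : ρ → ℝ} (hf : ∑ a, f a = 0) (hg : ∑ a, g a = 0) (hfg : ∀ a, f a * g a = 0)
    {y : ρ → ρ → ℝ} (hy : ∀ a, y a a = 0) :
    kap' β μ v q (slot f g) y = ∑ c, ∑ d, y c d * (ss β μ v q * (f c * g d + f d * g c)) := by
  have hs : slot f g = fun a b => f a * g b := by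
    ext a b; rw [slot]; split_ifs with hab
    · rw [← hab, hfg]
    · rfl
  have hde : ∀ (f : ρ → ℝ) c, ∑ a, f a * de a c = f c := fun f c => by simp [de]
  have e : ∀ η : ρ → Bool, phi q (slot f g) η * psi y η = ∑ c, ∑ d, y c d * (phi q (slot f g) η * (sp (η c) * sp (η d))) := by
    intro η
    rw [psi, mul_sum]
    refine sum_congr rfl fun c _ => ?_
    rw [mul_sum]
    exact sum_congr rfl fun d _ => by ring
  rw [kap', funext e, site_sum]
  refine sum_congr rfl fun c _ => ?_
  rw [site_sum]
  refine sum_congr rfl fun d _ => ?_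
  rw [site_smul]
  by_cases hcd : c = d
  · rw [← hcd, hy, zero_mul, zero_mul]
  · have h1 := site_e h (e := id) Function.injective_id (x := slot f g) (fun a => by simp [slot]) hcd
    simp only [id] at h1
    rw [h1, hs, prod_sum β μ v q (fun a => a) f g c d, hf, hg]
    simp only [hde]
    ring

lemma slot_self {ρ : Type} [DecidableEq ρ] (f g : ρ → ℝ) (a : ρ) : slot f g a a = 0 := if_pos rfl

lemma kap'_zero (h : HYP β μ v q) {f g f' g' : Fin M × Fin 2 → ℝ} (hf : ∑ a, f a = 0) (hg : ∑ a, g a = 0) (hfg : ∀ a, f a * g a = 0)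
    (h1 : (∑ a, f a * f' a) * (∑ a, g a * g' a) = 0) (h2 : (∑ a, f a * g' a) * (∑ a, g a * f' a) = 0)
    (h3 : ∀ a, f a * g a = 0) :
    kap' β μ v q (slot f g) (slot f' g') = 0 := by
  rw [kap'_eq h hf hg hfg (slot_self f' g')]
  have e : ∀ c d, slot f' g' c d * (ss β μ v q * (f c * g d + f d * g c)) = ss β μ v q * ((f c * f' c) * (g d * g' d)) + ss β μ v q * ((g c * f' c) * (f d * g' d)) := by
    intro c d
    rw [slot]; split_ifs with hcd
    · rw [← hcd]
      linear_combination -(2 * ss β μ v q * f' c * g' c) * hfg c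
    · ring
  simp only [e, sum_add_distrib, ← mul_sum, ← sum_mul]
  rw [h1, mul_comm (∑ a, g a * f' a), h2]; ring

lemma Xb (h : HYP β μ v q) (p k : ℕ) (hpk : 1 ≤ p + 2 * k) :
    ∃ C, 0 ≤ C ∧ ∀ N : ℕ, N ≠ 0 → nuSK β μ v q (fun X : Fin (p + 1 + 2 * k) × Fin 2 → Sp N =>
      (∏ r : Fin (p + 1), VV q (cross _ (0 + r)) X) * ∏ z : Fin k × Fin 2, VV q (pair _ (0 + (p + 1) + 2 * z.1) z.2) X)
      ≤ C * dl N ^ (if p + 2 * k = 1 then 2 else p + 2 * k + 2) := by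
  set M := p + 1 + 2 * k with hM
  have : NeZero M := ⟨by omega⟩
  set f := Ev M 0 0 with hf
  set g := Ev M 0 1 with hg
  have hf0 : ∑ a, f a = 0 := Ev_sum (by omega) (by omega) 0
  have hg0 : ∑ a, g a = 0 := Ev_sum (by omega) (by omega) 1
  have hfg : ∀ a, f a * g a = 0 := Ev_ne 0 0 (by decide)
  have hs : cross M 0 = fun a b => f a * g b := by
    ext a b; rw [cross, slot]; split_ifs with hab
    · rw [← hab, hfg]
    · rfl
  set xs : Fin p ⊕ (Fin k × Fin 2) → Fin M × Fin 2 → Fin M × Fin 2 → ℝ :=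
    Sum.elim (fun r => cross M (r + 1)) (fun z => pair M (p + 1 + 2 * z.1) z.2) with hxs
  have hxs0 : ∀ l a, xs l a a = 0 := by
    rintro (l | l) a
    · exact slot_self _ _ a
    · exact slot_self _ _ a
  have hcard : card (Fin p ⊕ (Fin k × Fin 2)) = p + 2 * k := by simp [mul_comm]
  have eX : ∀ (N : ℕ) (X : Fin M × Fin 2 → Sp N), (∏ r : Fin (p + 1), VV q (cross M (0 + r)) X) * ∏ z : Fin k × Fin 2, VV q (pair M (0 + (p + 1) + 2 * z.1) z.2) X
      = VV q (cross M 0) X * ∏ l, VV q (xs l) X := by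
    intro N X
    rw [Fin.prod_univ_succ, Fintype.prod_sum_type, mul_assoc]
    simp [hxs]
  simp only [eX]
  by_cases h2 : p + 2 * k = 1
  · obtain ⟨K, hK, hb⟩ := B1' h (Fin M × Fin 2) 2
    obtain ⟨C, hC, hc⟩ := MMb h 2
    have hc0 : 0 ≤ nx (cross M 0) * ∏ l, nx (xs l) := mul_nonneg (nx_nonneg _) (prod_nonneg fun l _ => nx_nonneg _)
    refine ⟨(nx (cross M 0) * ∏ l, nx (xs l)) * K * C, mul_nonneg (mul_nonneg hc0 hK) hC, fun N hN => ?_⟩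
    rw [if_pos h2]
    refine (le_abs_self _).trans ((hb hN _ _ hc0 fun X => ?_).trans ?_)
    · rw [abs_mul, Finset.abs_prod, pow_succ', pow_one, mul_mul_mul_comm]
      refine mul_le_mul (abs_VV q (slot_self _ _) X) ?_ (prod_nonneg fun l _ => abs_nonneg _) (mul_nonneg (nx_nonneg _) (TT_nonneg _ _))
      refine (prod_le_prod (fun l _ => abs_nonneg _) fun l _ => abs_VV q (hxs0 l) X).trans ?_
      rw [prod_mul_distrib, prod_const, card_univ, hcard, h2, pow_one]
    · have := mulL (hc N hN) (mul_nonneg hc0 hK)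
      linarith
  · obtain ⟨C1, hC1, b1⟩ := CE2 h (cross M 0) (slot_self _ _) xs hxs0
    obtain ⟨C2, hC2, b2⟩ := MMb h (p + 2 * k + 2)
    have hal := al_lt h
    refine ⟨C1 * C2 / (1 - β ^ 2 * ss β μ v q), div_nonneg (by positivity) (by linarith), fun N hN => ?_⟩
    rw [if_neg h2]
    have b3 := b1 hN
    set Y := nuSK β μ v q (fun X : Fin M × Fin 2 → Sp N => VV q (cross M 0) X * ∏ l, VV q (xs l) X) with hY
    have z1 : ∀ l, kap' β μ v q (cross M 0) (xs l) * nuSK β μ v q (fun X : Fin M × Fin 2 → Sp N => ∏ m ∈ univ.erase l, VV q (xs m) X) = 0 := by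
      rintro (l | ⟨s, c⟩)
      · obtain ⟨l, hl⟩ := l
        rcases l with _ | l
        · obtain ⟨p', rfl⟩ : ∃ p', p = p' + 1 := ⟨p - 1, by omega⟩
          rw [mul_eq_zero]; right
          rw [← tr_zero hN β μ v q (p := p') (k := k) (M := M) (by omega) (by omega)]
          congr 1; ext X
          have e : ∀ m ∈ univ.erase (inl (⟨0, hl⟩ : Fin (p' + 1)) : Fin (p' + 1) ⊕ (Fin k × Fin 2)), VV q (xs m) X
              = if m = inl ⟨0, hl⟩ then 1 else VV q (xs m) X := fun m hm => by rw [if_neg (ne_of_mem_erase hm)]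
          rw [prod_congr rfl e, Finset.prod_erase _ (by simp), Fintype.prod_sum_type, Fin.prod_univ_succ]
          have e3 : ∀ r : ℕ, r + 1 + 1 = 2 + r := fun r => by omega
          have e4 : ∀ r : ℕ, p' + 1 + 1 + r = 2 + p' + r := fun r => by omega
          simp [hxs, Fin.ext_iff, e3]
        · rw [mul_eq_zero]; left
          refine kap'_zero h hf0 hg0 hfg ?_ ?_ hfg
          · rw [Ev_orth (by simp) (by simp) (by simp; omega), zero_mul]
          · simp [hf, Ev_ne _ _ (show (0:Fin 2) ≠ 1 by decide)]
      · rw [mul_eq_zero]; left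
        refine kap'_zero h hf0 hg0 hfg ?_ ?_ hfg
        all_goals
          obtain rfl | rfl : c = 0 ∨ c = 1 := by omega
          · simp [hg, Ev_ne _ _ (show (1:Fin 2) ≠ 0 by decide)]
          · simp [hf, Ev_ne _ _ (show (0:Fin 2) ≠ 1 by decide)]
    have z2 : β ^ 2 / 2 * KS (fun c d => kap β μ v q (cross M 0) c d * nuSK β μ v q (fun X : (Fin M × Fin 2) × Fin 3 → Sp N => (∏ l, VV q (xs l) (fun a => X (a, 0))) * (R (X c) (X d) - q)))
        = β ^ 2 * ss β μ v q * Y := by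
      rw [hs, KS_pure h hf0 hg0 hfg _ (fun c d => by simp only [R_comm])]
      have hY2 := nuSK_inj (fun a : Fin M × Fin 2 => (a, (0:Fin 3))) (fun a b hab => (Prod.ext_iff.1 hab).1) β μ v q
        (fun X : Fin M × Fin 2 → Sp N => VV q (cross M 0) X * ∏ l, VV q (xs l) X)
      rw [hY, ← hY2]
      have e : (fun X : (Fin M × Fin 2) × Fin 3 → Sp N => VV q (cross M 0) (fun a => X (a, 0)) * ∏ l, VV q (xs l) (fun a => X (a, 0)))
          = fun X => ∑ a, ∑ b, f a * g b * ((∏ l, VV q (xs l) (fun a => X (a, 0))) * (R (X (a, 0)) (X (b, 0)) - q)) := by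
        ext X
        rw [hs, VV, sum_mul]
        refine sum_congr rfl fun a _ => ?_
        rw [sum_mul]
        exact sum_congr rfl fun b _ => by ring
      rw [e]
      simp only [nuSK_sum, nuSK_smul]
      ring
    rw [sum_eq_zero fun l _ => z1 l, z2, mul_zero, sub_zero, hcard] at b3
    have b4 := (le_abs_self _).trans (b3.trans (mulL (b2 N hN) hC1))
    rw [div_mul_eq_mul_div, le_div_iff₀ (by linarith)]
    linarith
end

section
lemma gmap (m s : ℝ) (v : NNReal) (hs : s ^ 2 = v) : g1.map (fun x => m + s * x) = gaussianReal m v := by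
  have e : (fun x : ℝ => m + s * x) = (m + ·) ∘ (s * ·) := rfl
  rw [e, ← Measure.map_map (by fun_prop) (by fun_prop), gaussianReal_map_const_mul, gaussianReal_map_const_add]
  congr 1
  · ring
  · ext; simp [hs]

lemma trf {Ω : Type} [MeasurableSpace Ω] (P : Measure Ω) [IsProbabilityMeasure P] {G : Ω → Fin N → Fin N → ℝ} {hf : Ω → Fin N → ℝ}
    {μ : ℝ} {v : NNReal} (h : IsSKGaussField N P G hf μ v) {β : ℝ} (hβ : 0 < β) (q : ℝ) {F : (PI' N ⊕ Fin N → ℝ) → ℝ} (hF : Continuous F) :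
    ∫ ω, F (th β (G ω) (hf ω)) ∂P = ∫ w, F (shf μ fun i => √(va β v q 1 i) * w i) ∂(gam (PI' N ⊕ Fin N)) := by
  obtain ⟨-, -, hi, hG, hh⟩ := h
  set Y : PI' N ⊕ Fin N → Ω → ℝ := Sum.elim (fun p ω => G ω p.1.1 p.1.2) (fun i ω => hf ω i) with hY
  set s : PI' N ⊕ Fin N → ℝ := Sum.elim (fun _ => √((N:ℝ)⁻¹)) (fun _ => √(v:ℝ)) with hs
  set m : PI' N ⊕ Fin N → ℝ := Sum.elim (fun _ => 0) (fun _ => μ) with hm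
  have hL : ∀ k, P.map (Y k) = g1.map (fun x => m k + s k * x) := by
    rintro (p | i)
    · exact (hG p).trans (gmap _ _ _ (by simp [hs])).symm
    · exact (hh i).trans (gmap _ _ _ (by simp [hs])).symm
  have hA : ∀ k, AEMeasurable (Y k) P := by
    intro k
    by_contra hc
    have h1 := hL k
    rw [Measure.map_of_not_aemeasurable hc] at h1
    have h2 : IsProbabilityMeasure (g1.map (fun x => m k + s k * x)) := Measure.isProbabilityMeasure_map (by fun_prop)
    rw [← h1] at h2
    exact h2.ne_zero _ rfl
  have h1 := (iIndepFun_iff_map_fun_eq_pi_map hA).1 hi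
  have h3 : ∀ k, IsProbabilityMeasure (g1.map (fun x => m k + s k * x)) := fun k => Measure.isProbabilityMeasure_map (by fun_prop)
  simp only [hL] at h1
  rw [← Measure.pi_map_pi (μ := fun _ => g1) (f := fun k x => m k + s k * x) (fun k => by fun_prop)] at h1
  set T : (PI' N ⊕ Fin N → ℝ) → PI' N ⊕ Fin N → ℝ := fun y => Sum.elim (fun p => β * y (inl p)) (fun i => y (inr i)) with hT
  have hTc : Continuous T := continuous_pi fun k => by rcases k with p | i <;> simp only [hT, elim_inl, elim_inr] <;> fun_prop
  have e1 : ∀ ω, th β (G ω) (hf ω) = T fun k => Y k ω := by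
    intro ω; ext (p | i) <;> simp [th, hT, hY]
  have e2 : ∀ w : PI' N ⊕ Fin N → ℝ, (shf μ fun i => √(va β v q 1 i) * w i) = T fun k => m k + s k * w k := by
    intro w; ext (p | i)
    · have : √(β ^ 2 / N) = β * √((N:ℝ)⁻¹) := by rw [div_eq_mul_inv, sqrt_mul (sq_nonneg β), sqrt_sq hβ.le]
      simp only [shf, va, vr, hT, hm, hs, elim_inl, one_mul, zero_add, this]; ring
    · simp [shf, va, vr, hT, hm, hs]
  have hFT : Continuous fun y => F (T y) := hF.comp hTc
  simp only [e1, e2]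
  have i1 := integral_map (μ := P) (φ := fun ω k => Y k ω) (f := fun y => F (T y)) (aemeasurable_pi_lambda _ hA) hFT.aestronglyMeasurable
  have i2 := integral_map (μ := gam (PI' N ⊕ Fin N)) (φ := fun w k => m k + s k * w k) (f := fun y => F (T y))
    (measurable_pi_lambda _ fun k => by fun_prop).aemeasurable hFT.aestronglyMeasurable
  rw [← i1, ← i2, h1]

lemma dl_rpow (hN : N ≠ 0) (e : ℕ) : dl N ^ e = (N:ℝ) ^ (-((e:ℝ) / 2)) := by
  have hp : (0:ℝ) < N := by positivity
  rw [dl, inv_pow, sqrt_eq_rpow, ← rpow_natCast, ← rpow_mul hp.le, rpow_neg hp.le]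
  congr 2; ring

theorem main_aux
    (β μ : ℝ) (v : NNReal) (hmem : memRSminus β μ v)
    (Ω : ℕ → Type) [∀ N, MeasurableSpace (Ω N)] (P : ∀ N, Measure (Ω N))
    (hP : ∀ N, IsProbabilityMeasure (P N))
    (G : ∀ N, Ω N → Fin N → Fin N → ℝ) (hf : ∀ N, Ω N → Fin N → ℝ)
    (hsetup : ∀ N, IsSKGaussField N (P N) (G N) (hf N) μ v) (k p : ℕ) (hp : 1 ≤ p) (hpk : 2 ≤ 2 * k + p) :
      ∃ C : ℝ, 0 < C ∧ ∀ N : ℕ,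
        ((N : ℝ) ^ p)⁻¹ * ∑ j : Fin p → Fin N,
            ∫ ω, (kpPoint N β (G N ω) k p j (hf N ω)) ^ 2 ∂(P N)
          ≤ C * (N : ℝ) ^ (-Aexp (2 * k + p)) := by
  obtain ⟨q, h⟩ := HYP_of_mem β μ v hmem
  obtain ⟨p, rfl⟩ : ∃ p', p = p' + 1 := ⟨p - 1, by omega⟩
  obtain ⟨C, hC, hb⟩ := Xb h p k (by omega)
  refine ⟨C + 1, by positivity, fun N => ?_⟩
  have hr : (0:ℝ) ≤ (N : ℝ) ^ (-Aexp (2 * k + (p + 1))) := rpow_nonneg (by positivity) _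
  by_cases hN : N = 0
  · subst hN
    simp only [Finset.univ_eq_empty, Finset.sum_empty, mul_zero]
    exact mul_nonneg (by positivity) hr
  have b := hb N hN
  rw [tr2 hN β μ v q (by omega) (by omega) (by omega), dl_rpow hN] at b
  have he : -(((if p + 2 * k = 1 then 2 else p + 2 * k + 2 : ℕ) : ℝ) / 2) = -Aexp (2 * k + (p + 1)) := by
    rw [Aexp]
    by_cases h1 : p + 2 * k = 1
    · rw [if_pos h1, if_pos (by omega), show 2 * k + (p + 1) = 2 by omega]
    · rw [if_neg h1, if_neg (by omega)]; push_cast; ring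
  rw [he] at b
  refine le_trans (le_of_eq ?_) (b.trans (mulR (by linarith) hr))
  congr 1
  refine sum_congr rfl fun j _ => ?_
  have := hP N
  rw [← trf (P N) (hsetup N) h.hβ q (F := fun θ => (((N:ℝ) ^ k)⁻¹ * ∑ it : Fin k → Fin N,
          ((SKs N 0).rep (Fin (p + 1 + 2 * k))).av θ (cum 0 (Li it j))) ^ 2) (by fun_prop)]
  refine integral_congr_ae (ae_of_all _ fun ω => ?_)
  simp only [kpPoint, kPoint]
  congr 2
  refine sum_congr rfl fun it _ => ?_
  have hl := Li_length it j
  exact congrFun (it_eq (M := p + 1 + 2 * k) β (G N ω) (Li it j) (by omega) (by omega)) (hf N ω)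
end

end

/-- Assume `(β, μ_h, σ_h²) ∈ 𝒜_{RS⁻}` (and `E h² > 0`). Then for every
`k ≥ 0` and `p ≥ 1` with `2k + p ≥ 2` there is a constant `C = C_{β,h} > 0` such that
`N⁻ᵖ ∑_{j₁,…,j_p} 𝔼 m_{j₁…j_p;k}² ≤ C N^{-A_{2k+p}}`. -/
theorem kp_point_correlation_bound
    (β μ : ℝ) (v : NNReal) (hE : 0 < μ ^ 2 + (v : ℝ)) (hmem : memRSminus β μ v)
    (Ω : ℕ → Type) [∀ N, MeasurableSpace (Ω N)] (P : ∀ N, Measure (Ω N))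
    (hP : ∀ N, IsProbabilityMeasure (P N))
    (G : ∀ N, Ω N → Fin N → Fin N → ℝ) (hf : ∀ N, Ω N → Fin N → ℝ)
    (hsetup : ∀ N, IsSKGaussField N (P N) (G N) (hf N) μ v) :
    ∀ k p : ℕ, 1 ≤ p → 2 ≤ 2 * k + p →
      ∃ C : ℝ, 0 < C ∧ ∀ N : ℕ,
        ((N : ℝ) ^ p)⁻¹ * ∑ j : Fin p → Fin N,
            ∫ ω, (kpPoint N β (G N ω) k p j (hf N ω)) ^ 2 ∂(P N)
          ≤ C * (N : ℝ) ^ (-Aexp (2 * k + p)) := by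
  intro k p hp hpk
  exact main_aux β μ v hmem Ω P hP G hf hsetup k p hp hpk

end SK
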